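/- Let Q be an affine quiver with n + 1 vertices and let δ be the minimal positive imaginary root. For every finite field F_q and every integer m ≥ 1, the number of isomorphism classes of absolutely indecomposable representations of Q over F_q with dimension vector mδ is exactly q + n. In particular a_{mδ}(q) = a_δ(q) = q + dim g_{mδ}, confirming Kac's conjecture in dimension mδ. -/

import Mathlib

open scoped BigOperators

/-- A finite quiver: finite sets of vertices and arrows with source and target maps. -/
structure FinQuiver where
  V : Type
  A : Type
  [fintypeV : Fintype V]
  [fintypeA : Fintype A]
  [decEqV : DecidableEq V]
  src : A → V
  tgt : A → V

attribute [instance] FinQuiver.fintypeV FinQuiver.fintypeA FinQuiver.decEqV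

namespace FinQuiver

variable (Q : FinQuiver)

/-- The Euler form of a finite quiver. -/
def eulerForm (x y : Q.V → ℤ) : ℤ :=
  (∑ i : Q.V, x i * y i) - ∑ a : Q.A, x (Q.src a) * y (Q.tgt a)

/-- The Tits form of a finite quiver. -/
def titsForm (x : Q.V → ℤ) : ℤ := Q.eulerForm x x

/-- The quiver has no loops. -/
def NoLoops : Prop := ∀ a : Q.A, Q.src a ≠ Q.tgt a

/-- The underlying (simple) graph of a quiver without loops. -/
def graph : SimpleGraph Q.V where
  Adj i j := i ≠ j ∧ ∃ a : Q.A, (Q.src a = i ∧ Q.tgt a = j) ∨ (Q.src a = j ∧ Q.tgt a = i)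
  symm := by
    refine ⟨?_⟩
    rintro i j ⟨hij, a, h⟩
    exact ⟨hij.symm, a, h.symm⟩
  loopless := by
    refine ⟨?_⟩
    rintro i ⟨hii, -⟩
    exact hii rfl

/-- The quiver has no oriented cycles. -/
def Acyclic : Prop :=
  ¬ ∃ (n : ℕ) (g : Fin (n + 1) → Q.A), ∀ k, Q.tgt (g k) = Q.src (g (k + 1))

/-- The double quiver: for each arrow `a : i → j` add a reverse arrow `a* : j → i`. -/
def double : FinQuiver where
  V := Q.V
  A := Q.A ⊕ Q.A
  src := Sum.elim Q.src Q.tgt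
  tgt := Sum.elim Q.tgt Q.src

/-- Positive roots: nonzero, nonnegative integer vectors with Tits form at most 1. -/
def PosRoot (x : Q.V → ℤ) : Prop := (∀ i, 0 ≤ x i) ∧ x ≠ 0 ∧ Q.titsForm x ≤ 1

end FinQuiver

/-- An affine quiver: connected, no loops, no oriented cycles, Tits form positive
semidefinite but not positive definite; `δ` is the minimal positive imaginary root,
generating the radical of the symmetrized Euler form. -/
structure AffineQuiver extends FinQuiver where
  noLoops : toFinQuiver.NoLoops
  connected : toFinQuiver.graph.Connected
  acyclic : toFinQuiver.Acyclic
  posSemidef : ∀ x : V → ℤ, 0 ≤ toFinQuiver.titsForm x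
  notPosDef : ∃ x : V → ℤ, x ≠ 0 ∧ toFinQuiver.titsForm x = 0
  δ : V → ℤ
  delta_pos : ∀ i, 0 < δ i
  radical_iff : ∀ x : V → ℤ,
    (∀ y : V → ℤ, toFinQuiver.eulerForm x y + toFinQuiver.eulerForm y x = 0) ↔
      ∃ m : ℤ, x = m • δ

/-- The defect `∂(x) = e(δ, x)`. -/
def AffineQuiver.defect (Q : AffineQuiver) (x : Q.V → ℤ) : ℤ :=
  Q.eulerForm Q.δ x


section MatrixRep

variable (Q : FinQuiver) (k : Type) [Field k]

/-- The space of representations of `Q` on the fixed vector spaces `k^{d i}`,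
in matrix form. -/
def MRep (d : Q.V → ℕ) : Type :=
  ∀ a : Q.A, Matrix (Fin (d (Q.tgt a))) (Fin (d (Q.src a))) k

variable {Q k}

/-- A family of subspaces is a subrepresentation of `x` if it is stable under all the
arrow maps of `x`. -/
def MSub {d : Q.V → ℕ} (x : MRep Q k d) (U : ∀ i, Submodule k (Fin (d i) → k)) : Prop :=
  ∀ a : Q.A, ∀ v ∈ U (Q.src a), (x a).mulVec v ∈ U (Q.tgt a)

/-- A representation is indecomposable if it is nonzero and is not the internal direct
sum of two nonzero subrepresentations. -/
def MIndec {d : Q.V → ℕ} (x : MRep Q k d) : Prop :=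
  (∃ i, 0 < d i) ∧
    ∀ U W : ∀ i, Submodule k (Fin (d i) → k), MSub x U → MSub x W →
      (∀ i, IsCompl (U i) (W i)) →
        (∀ i, U i = ⊥) ∨ (∀ i, W i = ⊥)

/-- Isomorphism of representations: simultaneous conjugation by a family of invertible
matrices. -/
def MIso {d : Q.V → ℕ} (x y : MRep Q k d) : Prop :=
  ∃ g : ∀ i, GL (Fin (d i)) k,
    ∀ a : Q.A, y a = ((g (Q.tgt a) : Matrix (Fin (d (Q.tgt a))) (Fin (d (Q.tgt a))) k) * x a) *
      (((g (Q.src a))⁻¹ : GL (Fin (d (Q.src a))) k) : Matrix (Fin (d (Q.src a))) (Fin (d (Q.src a))) k)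

/-- Extension of scalars along a field extension: apply the field embedding to all
matrix entries. -/
def mapRep {d : Q.V → ℕ} (K : Type) [Field K] [Algebra k K] (x : MRep Q k d) :
    MRep Q K d :=
  fun a => (x a).map (algebraMap k K)

/-- A representation over `k` is absolutely indecomposable if it remains indecomposable
after extension of scalars to an algebraic closure of `k`. -/
def MAbsIndec {d : Q.V → ℕ} (x : MRep Q k d) : Prop :=
  MIndec x ∧ MIndec (mapRep (AlgebraicClosure k) x)

end MatrixRep



namespace KacAff

noncomputable section

open Module

/-- Relations defining the path algebra. -/
inductive PRel {V A : Type} [Fintype V] [DecidableEq V] (s t : A → V) (k : Type) [Field k] :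
    FreeAlgebra k (V ⊕ A) → FreeAlgebra k (V ⊕ A) → Prop
  | idem (i : V) : PRel s t k (FreeAlgebra.ι k (Sum.inl i) * FreeAlgebra.ι k (Sum.inl i))
      (FreeAlgebra.ι k (Sum.inl i))
  | orth (i j : V) (h : i ≠ j) :
      PRel s t k (FreeAlgebra.ι k (Sum.inl i) * FreeAlgebra.ι k (Sum.inl j)) 0
  | one : PRel s t k (∑ i : V, FreeAlgebra.ι k (Sum.inl i)) 1
  | src (a : A) : PRel s t k (FreeAlgebra.ι k (Sum.inr a) * FreeAlgebra.ι k (Sum.inl (s a)))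
      (FreeAlgebra.ι k (Sum.inr a))
  | tgt (a : A) : PRel s t k (FreeAlgebra.ι k (Sum.inl (t a)) * FreeAlgebra.ι k (Sum.inr a))
      (FreeAlgebra.ι k (Sum.inr a))

/-- The path algebra. -/
def PA {V A : Type} [Fintype V] [DecidableEq V] (s t : A → V) (k : Type) [Field k] : Type :=
  RingQuot (PRel s t k)

section basics

variable {V A : Type} [Fintype V] [DecidableEq V] {s t : A → V} {k : Type} [Field k]

instance : Ring (PA s t k) := inferInstanceAs (Ring (RingQuot (PRel s t k)))
instance : Algebra k (PA s t k) :=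
  inferInstanceAs (Algebra k (RingQuot (PRel s t k)))

/-- quotient map from the free algebra -/
def pmk (s t : A → V) (k : Type) [Field k] :
    FreeAlgebra k (V ⊕ A) →ₐ[k] PA s t k := RingQuot.mkAlgHom k (PRel s t k)

theorem pmk_surj : Function.Surjective (pmk s t k) := RingQuot.mkAlgHom_surjective k (PRel s t k)

theorem pmk_rel {x y} (h : PRel s t k x y) : pmk s t k x = pmk s t k y :=
  RingQuot.mkAlgHom_rel k h

/-- vertex idempotents -/
def pe (s t : A → V) (k : Type) [Field k] (i : V) : PA s t k :=
  pmk s t k (FreeAlgebra.ι k (Sum.inl i))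
/-- arrows -/
def px (s t : A → V) (k : Type) [Field k] (a : A) : PA s t k :=
  pmk s t k (FreeAlgebra.ι k (Sum.inr a))

theorem pe_mul_self (i : V) : pe s t k i * pe s t k i = pe s t k i := by
  simpa [pe] using pmk_rel (PRel.idem (s := s) (t := t) (k := k) i)
theorem pe_mul_ne {i j : V} (h : i ≠ j) : pe s t k i * pe s t k j = 0 := by
  simpa [pe] using pmk_rel (PRel.orth (s := s) (t := t) (k := k) i j h)
theorem pe_sum : ∑ i, pe s t k i = 1 := by
  simpa [pe] using pmk_rel (PRel.one (s := s) (t := t) (k := k))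
theorem px_mul_pe (a : A) : px s t k a * pe s t k (s a) = px s t k a := by
  simpa [pe, px] using pmk_rel (PRel.src (s := s) (t := t) (k := k) a)
theorem pe_mul_px (a : A) : pe s t k (t a) * px s t k a = px s t k a := by
  simpa [pe, px] using pmk_rel (PRel.tgt (s := s) (t := t) (k := k) a)

theorem PA_induction {C : PA s t k → Prop} (h0 : ∀ r : k, C (algebraMap k _ r))
    (he : ∀ i, C (pe s t k i)) (hx : ∀ a, C (px s t k a))
    (hm : ∀ a b, C a → C b → C (a * b)) (ha : ∀ a b, C a → C b → C (a + b)) (z : PA s t k) :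
    C z := by
  obtain ⟨y, rfl⟩ := pmk_surj z
  induction y using FreeAlgebra.induction with
  | grade0 r => rw [AlgHom.commutes]; exact h0 r
  | grade1 v => rcases v with i | a
                · exact he i
                · exact hx a
  | mul a b iha ihb => rw [map_mul]; exact hm _ _ iha ihb
  | add a b iha ihb => rw [map_add]; exact ha _ _ iha ihb

end basics

/-- finite-dimensional modules over the path algebra, i.e. representations -/
structure Obj {V A : Type} [Fintype V] [DecidableEq V] (s t : A → V) (k : Type) [Field k] where
  carrier : Type
  [acg : AddCommGroup carrier]
  [modk : Module k carrier]
  [modp : Module (PA s t k) carrier]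
  [tower : IsScalarTower k (PA s t k) carrier]
  [fd : FiniteDimensional k carrier]

attribute [instance] Obj.acg Obj.modk Obj.modp Obj.tower Obj.fd

instance {V A : Type} [Fintype V] [DecidableEq V] (s t : A → V) (k : Type) [Field k] :
    CoeSort (Obj s t k) Type := ⟨Obj.carrier⟩

section objs

variable {V A : Type} [Fintype V] [DecidableEq V] {s t : A → V} {k : Type} [Field k]
variable (M N : Obj s t k)

/-- subobject -/
abbrev Obj.sub (U : Submodule (PA s t k) M) : Obj s t k :=
  { carrier := U
    fd := inferInstanceAs (FiniteDimensional k (U.restrictScalars k)) }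

/-- quotient object -/
abbrev Obj.quot (U : Submodule (PA s t k) M) : Obj s t k :=
  { carrier := M ⧸ U
    tower := ⟨by
      intro x y z
      induction z using Submodule.Quotient.induction_on with | _ z
      rw [← Submodule.Quotient.mk_smul, ← Submodule.Quotient.mk_smul,
        ← Submodule.Quotient.mk_smul, smul_assoc]⟩
    fd := by
      exact Module.Finite.of_surjective ((U.mkQ).restrictScalars k) (Submodule.mkQ_surjective U) }

/-- product object -/
abbrev Obj.prod : Obj s t k := { carrier := M × N }

variable {M N}

/-- build a PA-linear map from a k-linear one -/
def mkHom (f : M →ₗ[k] N) (he : ∀ i m, f (pe s t k i • m) = pe s t k i • f m)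
    (hx : ∀ a m, f (px s t k a • m) = px s t k a • f m) : M →ₗ[PA s t k] N :=
  { toFun := f
    map_add' := f.map_add
    map_smul' := by
      intro z m
      simp only [RingHom.id_apply]
      induction z using PA_induction generalizing m with
      | h0 r => rw [algebraMap_smul, algebraMap_smul, f.map_smul]
      | he i => exact he i m
      | hx a => exact hx a m
      | hm a b ha hb => rw [mul_smul, ha, hb, mul_smul]
      | ha a b ha hb => rw [add_smul, map_add, ha, hb, add_smul] }

@[simp] theorem mkHom_apply (f : M →ₗ[k] N) (he hx) (m : M) :
    mkHom (s := s) (t := t) f he hx m = f m := rfl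

/-- build a PA-submodule from a k-submodule -/
def mkSub (U : Submodule k M) (he : ∀ i, ∀ m ∈ U, pe s t k i • m ∈ U)
    (hx : ∀ a, ∀ m ∈ U, px s t k a • m ∈ U) : Submodule (PA s t k) M :=
  { carrier := U
    add_mem' := U.add_mem
    zero_mem' := U.zero_mem
    smul_mem' := by
      intro z m hm
      induction z using PA_induction generalizing m with
      | h0 r => rw [algebraMap_smul]; exact U.smul_mem r hm
      | he i => exact he i m hm
      | hx a => exact hx a m hm
      | hm a b ha hb => rw [mul_smul]; exact ha (hb hm)
      | ha a b ha hb => rw [add_smul]; exact U.add_mem (ha hm) (hb hm) }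

@[simp] theorem mem_mkSub (U : Submodule k M) (he hx) (m : M) :
    m ∈ mkSub (s := s) (t := t) U he hx ↔ m ∈ U := Iff.rfl

/-- data for building a module -/
structure ModData (s t : A → V) (k W : Type) [Field k] [AddCommGroup W] [Module k W] where
  E : V → Module.End k W
  X : A → Module.End k W
  idem : ∀ i, E i * E i = E i
  orth : ∀ i j, i ≠ j → E i * E j = 0
  one : ∑ i, E i = 1
  src : ∀ a, X a * E (s a) = X a
  tgt : ∀ a, E (t a) * X a = X a

variable {W : Type} [AddCommGroup W] [Module k W]

/-- the algebra hom -/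
def ModData.hom (D : ModData s t k W) : PA s t k →ₐ[k] Module.End k W :=
  RingQuot.liftAlgHom k ⟨FreeAlgebra.lift k (Sum.elim D.E D.X), by
    intro x y h
    cases h with
    | idem i => simpa using D.idem i
    | orth i j h => simpa using D.orth i j h
    | one => simpa using D.one
    | src a => simpa using D.src a
    | tgt a => simpa using D.tgt a⟩

theorem ModData.hom_pe (D : ModData s t k W) (i : V) : D.hom (pe s t k i) = D.E i := by
  exact (RingQuot.liftAlgHom_mkAlgHom_apply ..).trans (by simp)
theorem ModData.hom_px (D : ModData s t k W) (a : A) : D.hom (px s t k a) = D.X a := by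
  exact (RingQuot.liftAlgHom_mkAlgHom_apply ..).trans (by simp)

/-- the object -/
def mkObj [FiniteDimensional k W] (D : ModData s t k W) : Obj s t k :=
  { carrier := W
    modp := Module.compHom W (D.hom : PA s t k →+* Module.End k W)
    tower := by
      let _ := Module.compHom W (D.hom : PA s t k →+* Module.End k W)
      refine ⟨fun x y z => ?_⟩
      change D.hom (x • y) z = x • D.hom y z
      simp }

/-- underlying identification -/
def mkEqv [FiniteDimensional k W] (D : ModData s t k W) : W ≃ₗ[k] mkObj D :=
  { toFun := fun w => w
    invFun := fun w => w
    map_add' := fun _ _ => rfl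
    map_smul' := fun _ _ => rfl
    left_inv := fun _ => rfl
    right_inv := fun _ => rfl }

theorem pe_mkEqv [FiniteDimensional k W] (D : ModData s t k W) (i : V) (w : W) :
    pe s t k i • mkEqv D w = mkEqv D (D.E i w) := by
  change D.hom (pe s t k i) w = _
  rw [D.hom_pe]; rfl
theorem px_mkEqv [FiniteDimensional k W] (D : ModData s t k W) (a : A) (w : W) :
    px s t k a • mkEqv D w = mkEqv D (D.X a w) := by
  change D.hom (px s t k a) w = _
  rw [D.hom_px]; rfl

attribute [irreducible] mkObj mkEqv

end objs

end

end KacAff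


namespace KacAff

noncomputable section

open Module

set_option linter.all false

section comps

variable {V A : Type} [Fintype V] [DecidableEq V] {s t : A → V} {k : Type} [Field k]
variable (M N : Obj s t k)

theorem pa_smul {V A : Type} [Fintype V] [DecidableEq V] {s t : A → V} {M : Obj s t k}
    (z : PA s t k) (c : k) (m : M) : z • c • m = c • z • m := smul_comm z c m

/-- action of an element as a k-linear map -/
def act (z : PA s t k) : M →ₗ[k] M where
  toFun m := z • m
  map_add' := smul_add z
  map_smul' c m := pa_smul z c m

@[simp] theorem act_apply (z : PA s t k) (m : M) : act M z m = z • m := rfl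

/-- component at a vertex -/
def cmp (i : V) : Submodule k M := LinearMap.range (act M (pe s t k i))

variable {M N}

theorem pe_pe (i : V) (m : M) : pe s t k i • pe s t k i • m = pe s t k i • m := by
  rw [← mul_smul, pe_mul_self]
theorem pe_pe_ne {i j : V} (h : i ≠ j) (m : M) : pe s t k i • pe s t k j • m = 0 := by
  rw [← mul_smul, pe_mul_ne h, zero_smul]
theorem px_pe (a : A) (m : M) : px s t k a • pe s t k (s a) • m = px s t k a • m := by
  rw [← mul_smul, px_mul_pe]
theorem pe_px (a : A) (m : M) : pe s t k (t a) • px s t k a • m = px s t k a • m := by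
  rw [← mul_smul, pe_mul_px]
theorem pe_px_ne {a : A} {i : V} (h : i ≠ t a) (m : M) : pe s t k i • px s t k a • m = 0 := by
  rw [← pe_px, pe_pe_ne h]
theorem px_pe_ne {a : A} {i : V} (h : i ≠ s a) (m : M) : px s t k a • pe s t k i • m = 0 := by
  rw [← px_pe, pe_pe_ne h.symm, smul_zero]
theorem sum_pe (m : M) : ∑ i, pe s t k i • m = m := by
  rw [← Finset.sum_smul, pe_sum, one_smul]

theorem mem_cmp {i : V} {m : M} : m ∈ cmp M i ↔ pe s t k i • m = m := by
  constructor
  · rintro ⟨n, rfl⟩; exact pe_pe i n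
  · intro h; exact ⟨m, h⟩

theorem pe_mem_cmp (i : V) (m : M) : pe s t k i • m ∈ cmp M i := ⟨m, rfl⟩
theorem px_mem_cmp (a : A) (m : M) : px s t k a • m ∈ cmp M (t a) := mem_cmp.2 (pe_px a m)

theorem ext_pe {m n : M} (h : ∀ i, pe s t k i • m = pe s t k i • n) : m = n := by
  rw [← sum_pe m, ← sum_pe n]; exact Finset.sum_congr rfl fun i _ => h i

variable (M N)
/-- dimension vector -/
def dim (i : V) : ℤ := (finrank k (cmp M i) : ℤ)

theorem dim_nonneg (i : V) : 0 ≤ dim M i := Int.natCast_nonneg _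

variable {M N}
/-- induced map on components -/
def cmap (f : M →ₗ[PA s t k] N) (i : V) : cmp M i →ₗ[k] cmp N i :=
  ((f.restrictScalars k).restrict (p := cmp M i) (q := cmp N i) (by
    intro m hm
    rw [mem_cmp] at *
    rw [LinearMap.restrictScalars_apply, ← map_smul, hm]))

@[simp] theorem cmap_coe (f : M →ₗ[PA s t k] N) (i : V) (m : cmp M i) :
    (cmap f i m : N) = f m := rfl

theorem cmap_inj {f : M →ₗ[PA s t k] N} (hf : Function.Injective f) (i : V) :
    Function.Injective (cmap f i) := by
  intro x y h
  exact Subtype.ext (hf (congrArg Subtype.val h))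

theorem cmap_surj {f : M →ₗ[PA s t k] N} (hf : Function.Surjective f) (i : V) :
    Function.Surjective (cmap f i) := by
  rintro ⟨y, hy⟩
  obtain ⟨x, rfl⟩ := hf y
  refine ⟨⟨pe s t k i • x, pe_mem_cmp i x⟩, Subtype.ext ?_⟩
  simpa using mem_cmp.1 hy

theorem dim_exact {L : Obj s t k} {f : L →ₗ[PA s t k] M} {g : M →ₗ[PA s t k] N}
    (hf : Function.Injective f) (hg : Function.Surjective g) (h : Function.Exact f g) :
    dim M = dim L + dim N := by
  funext i
  have h1 := LinearMap.finrank_range_add_finrank_ker (cmap g i)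
  rw [LinearMap.range_eq_top.2 (cmap_surj hg i), finrank_top] at h1
  have h2 : LinearMap.ker (cmap g i) = LinearMap.range (cmap f i) := by
    ext ⟨m, hm⟩
    constructor
    · intro hk
      have : g m = 0 := congrArg Subtype.val (LinearMap.mem_ker.1 hk)
      obtain ⟨l, rfl⟩ := (h m).1 this
      refine ⟨⟨pe s t k i • l, pe_mem_cmp i l⟩, Subtype.ext ?_⟩
      simpa using mem_cmp.1 hm
    · rintro ⟨l, hl⟩
      rw [LinearMap.mem_ker]
      apply Subtype.ext
      have : m = f l := (congrArg Subtype.val hl).symm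
      simp only [cmap_coe]
      rw [this]
      exact (h _).2 ⟨_, rfl⟩
  rw [h2, LinearMap.finrank_range_of_inj (cmap_inj hf i)] at h1
  simp only [dim, Pi.add_apply]
  omega

theorem dim_eqv (f : M ≃ₗ[PA s t k] N) : dim M = dim N := by
  funext i
  have h1 := LinearMap.finrank_le_finrank_of_injective (cmap_inj (f := f.toLinearMap) f.injective i)
  have h2 := LinearMap.finrank_le_finrank_of_injective
    (cmap_inj (f := f.symm.toLinearMap) f.symm.injective i)
  simp only [dim]; omega

theorem dim_sub_quot (M : Obj s t k) (U : Submodule (PA s t k) M) :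
    dim M = dim (M.sub U) + dim (M.quot U) :=
  dim_exact (L := M.sub U) (N := M.quot U) (f := U.subtype) (g := U.mkQ)
    (Submodule.injective_subtype U) (Submodule.mkQ_surjective U)
    (by intro x; simp)

theorem dim_prod (M N : Obj s t k) : dim (M.prod N) = dim M + dim N :=
  dim_exact (L := M) (M := M.prod N) (N := N) (f := LinearMap.inl _ _ _) (g := LinearMap.snd _ _ _)
    LinearMap.inl_injective LinearMap.snd_surjective
    Function.Exact.inl_snd

theorem dim_ker_range (f : M →ₗ[PA s t k] N) :
    dim M = dim (M.sub (LinearMap.ker f)) + dim (N.sub (LinearMap.range f)) :=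
  dim_exact (L := M.sub (LinearMap.ker f)) (N := N.sub (LinearMap.range f))
    (f := (LinearMap.ker f).subtype) (g := f.rangeRestrict)
    (Submodule.injective_subtype _) (LinearMap.surjective_rangeRestrict f)
    (by intro x; simp [Subtype.ext_iff])

/-- M is the direct sum of its components -/
def cmpEqv (M : Obj s t k) : M ≃ₗ[k] (Π i, cmp M i) where
  toFun m i := ⟨pe s t k i • m, pe_mem_cmp i m⟩
  map_add' m n := by funext i; apply Subtype.ext; simp
  map_smul' c m := by funext i; apply Subtype.ext; simp [pa_smul]
  invFun f := ∑ i, (f i : M)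
  left_inv m := sum_pe m
  right_inv f := by
    funext i
    apply Subtype.ext
    simp only [Finset.smul_sum]
    rw [Finset.sum_eq_single i]
    · exact mem_cmp.1 (f i).2
    · intro j _ hj
      rw [← mem_cmp.1 (f j).2, pe_pe_ne hj.symm]
    · simp

theorem finrank_eq_sum (M : Obj s t k) : (finrank k M : ℤ) = ∑ i, dim M i := by
  rw [(cmpEqv M).finrank_eq, finrank_pi_fintype]
  simp [dim]

theorem dim_eq_zero_iff (M : Obj s t k) : dim M = 0 ↔ Subsingleton M := by
  rw [← Module.finrank_zero_iff (R := k)]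
  have := finrank_eq_sum M
  constructor
  · intro h; rw [h] at this; simpa using this
  · intro h; rw [h] at this
    have h2 := (Finset.sum_eq_zero_iff_of_nonneg (fun i _ => dim_nonneg M i)).1 this.symm
    funext i; exact h2 i (Finset.mem_univ i)

end comps

section complex

variable {V A : Type} [Fintype V] [DecidableEq V] [Fintype A] {s t : A → V} {k : Type} [Field k]
variable (M N : Obj s t k)

/-- degree zero cochains -/
def C0 : Submodule k (M →ₗ[k] N) where
  carrier := {f | ∀ i m, f (pe s t k i • m) = pe s t k i • f m}
  add_mem' := by intro f g hf hg i m; simp [hf i m, hg i m]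
  zero_mem' := by intro i m; simp
  smul_mem' := by intro c f hf i m; simp [hf i m, pa_smul]

/-- degree one cochains -/
def C1 : Submodule k (A → M →ₗ[k] N) where
  carrier := {f | ∀ a m, pe s t k (t a) • f a (pe s t k (s a) • m) = f a m}
  add_mem' := by intro f g hf hg a m; simp [hf a m, hg a m]
  zero_mem' := by intro i m; simp
  smul_mem' := by intro c f hf a m; simp [hf a m, pa_smul]

variable {M N}

theorem C1_src {f : A → M →ₗ[k] N} (hf : f ∈ C1 M N) (a : A) (m : M) :
    f a (pe s t k (s a) • m) = f a m := by
  rw [← hf a (pe s t k (s a) • m), pe_pe, hf a m]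
theorem C1_tgt {f : A → M →ₗ[k] N} (hf : f ∈ C1 M N) (a : A) (m : M) :
    pe s t k (t a) • f a m = f a m := by
  rw [← hf a m, pe_pe]

variable (M N)
/-- differential -/
def dd : C0 M N →ₗ[k] C1 M N where
  toFun f := ⟨fun a => act N (px s t k a) ∘ₗ f.1 - f.1 ∘ₗ act M (px s t k a), by
    intro a m
    simp only [LinearMap.sub_apply, LinearMap.comp_apply, act_apply, smul_sub]
    rw [px_pe, ← f.2, pe_px, f.2, px_pe, pe_px]⟩
  map_add' f g := by
    apply Subtype.ext; funext a; ext m; simp; abel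
  map_smul' c f := by
    apply Subtype.ext; funext a; ext m
    simp [smul_sub, pa_smul]

theorem dd_apply (f : C0 M N) (a : A) (m : M) :
    (dd M N f).1 a m = px s t k a • f.1 m - f.1 (px s t k a • m) := rfl

/-- Ext group -/
abbrev Ext : Type := C1 M N ⧸ LinearMap.range (dd M N)

/-- Hom is the kernel -/
def homEqv : (M →ₗ[PA s t k] N) ≃ₗ[k] LinearMap.ker (dd M N) where
  toFun f := ⟨⟨f.restrictScalars k, fun i m => by simp⟩, by
    rw [LinearMap.mem_ker]; apply Subtype.ext; funext a; ext m; simp [dd_apply]⟩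
  map_add' f g := rfl
  map_smul' c f := rfl
  invFun f := mkHom f.1.1 f.1.2 (by
    intro a m
    have := LinearMap.mem_ker.1 f.2
    have h2 := dd_apply M N f.1 a m
    rw [this] at h2
    exact (sub_eq_zero.1 h2.symm).symm)
  left_inv f := rfl
  right_inv f := rfl

instance : FiniteDimensional k (M →ₗ[PA s t k] N) :=
  Module.Finite.equiv (homEqv M N).symm

/-- dimension of Hom -/
def hom : ℤ := finrank k (M →ₗ[PA s t k] N)
/-- dimension of Ext -/
def ext : ℤ := finrank k (Ext M N)

/-- Euler form -/
def eu (s t : A → V) (x y : V → ℤ) : ℤ := (∑ i, x i * y i) - ∑ a, x (s a) * y (t a)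

/-- blocks -/
def blk (i j : V) : Submodule k (M →ₗ[k] N) where
  carrier := {f | ∀ m, pe s t k j • f (pe s t k i • m) = f m}
  add_mem' := by intro f g hf hg m; simp [hf m, hg m]
  zero_mem' := by intro m; simp
  smul_mem' := by intro c f hf m; simp [hf m, pa_smul]

/-- block equivalence -/
def blkEqv (i j : V) : blk M N i j ≃ₗ[k] (cmp M i →ₗ[k] cmp N j) where
  toFun f := (f.1.restrict (p := cmp M i) (q := cmp N j) (by
    intro m hm
    rw [mem_cmp, ← f.2 m, pe_pe]))
  map_add' f g := rfl
  map_smul' c f := rfl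
  invFun g := ⟨(cmp N j).subtype ∘ₗ g ∘ₗ (act M (pe s t k i)).rangeRestrict, by
    intro m
    have : (act M (pe s t k i)).rangeRestrict (pe s t k i • m) =
      (act M (pe s t k i)).rangeRestrict m := Subtype.ext (pe_pe i m)
    change pe s t k j • ((g ((act M (pe s t k i)).rangeRestrict (pe s t k i • m)) : cmp N j) : N)
      = (g ((act M (pe s t k i)).rangeRestrict m) : cmp N j)
    rw [this]
    exact mem_cmp.1 (g _).2⟩
  left_inv f := by
    apply Subtype.ext; ext m
    have h1 : f.1 (pe s t k i • m) = f.1 m := by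
      rw [← f.2 (pe s t k i • m), pe_pe, f.2 m]
    exact h1
  right_inv g := by
    ext m
    have : (act M (pe s t k i)).rangeRestrict m = m := Subtype.ext (mem_cmp.1 m.2)
    exact congrArg (fun x => ((g x : cmp N j) : N)) this

/-- C1 as product -/
def C1Eqv : C1 M N ≃ₗ[k] (Π a : A, blk M N (s a) (t a)) where
  toFun f a := ⟨f.1 a, f.2 a⟩
  map_add' f g := rfl
  map_smul' c f := rfl
  invFun g := ⟨fun a => (g a).1, fun a => (g a).2⟩
  left_inv f := rfl
  right_inv f := rfl

/-- C0 as product -/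
def C0Eqv : C0 M N ≃ₗ[k] (Π i : V, blk M N i i) where
  toFun f i := ⟨f.1 ∘ₗ act M (pe s t k i), by
    intro m; simp only [LinearMap.comp_apply, act_apply]; rw [← f.2, pe_pe, pe_pe]⟩
  map_add' f g := rfl
  map_smul' c f := rfl
  invFun g := ⟨∑ i, (g i).1, by
    intro i m
    simp only [LinearMap.sum_apply, Finset.smul_sum]
    refine Finset.sum_congr rfl fun j _ => ?_
    by_cases h : i = j
    · subst h
      rw [← (g i).2 (pe s t k i • m), pe_pe, ← (g i).2 m, pe_pe]
    · rw [← (g j).2 m, ← (g j).2 (pe s t k i • m), pe_pe_ne (Ne.symm h), pe_pe_ne h]; simp⟩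
  left_inv f := by
    apply Subtype.ext; ext m
    simp only [LinearMap.sum_apply, LinearMap.comp_apply, act_apply]
    rw [← map_sum, sum_pe]
  right_inv g := by
    funext i; apply Subtype.ext; ext m
    simp only [LinearMap.comp_apply, act_apply, LinearMap.sum_apply]
    rw [Finset.sum_eq_single i]
    · rw [← (g i).2 (pe s t k i • m), pe_pe, (g i).2 m]
    · intro j _ hj
      rw [← (g j).2 (pe s t k i • m), pe_pe_ne hj]; simp
    · simp

theorem euler : hom M N - ext M N = eu s t (dim M) (dim N) := by
  have h1 := LinearMap.finrank_range_add_finrank_ker (dd M N)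
  have h2 := Submodule.finrank_quotient_add_finrank (LinearMap.range (dd M N))
  have h3 : finrank k (C0 M N) = ∑ i, finrank k (cmp M i) * finrank k (cmp N i) := by
    rw [(C0Eqv M N).finrank_eq, finrank_pi_fintype]
    exact Finset.sum_congr rfl fun i _ => by
      rw [(blkEqv M N i i).finrank_eq, finrank_linearMap]
  have h4 : finrank k (C1 M N) = ∑ a, finrank k (cmp M (s a)) * finrank k (cmp N (t a)) := by
    rw [(C1Eqv M N).finrank_eq, finrank_pi_fintype]
    exact Finset.sum_congr rfl fun i _ => by
      rw [(blkEqv M N _ _).finrank_eq, finrank_linearMap]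
  have h5 := (homEqv M N).finrank_eq
  simp only [hom, ext, eu, dim, Ext]
  have h3' := congrArg (Nat.cast : ℕ → ℤ) h3
  have h4' := congrArg (Nat.cast : ℕ → ℤ) h4
  push_cast at h3' h4'
  rw [← h3', ← h4', h5]
  omega

theorem hom_nonneg : 0 ≤ hom M N := Int.natCast_nonneg _
theorem ext_nonneg : 0 ≤ ext M N := Int.natCast_nonneg _

end complex

end

end KacAff


namespace KacAff

noncomputable section

open Module

set_option linter.all false

theorem lin_lift {k M N N' : Type} [Field k] [AddCommGroup M] [Module k M] [AddCommGroup N]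
    [Module k N] [AddCommGroup N'] [Module k N'] (f : N →ₗ[k] N') (ξ : M →ₗ[k] N')
    (h : ∀ m, ξ m ∈ LinearMap.range f) : ∃ η : M →ₗ[k] N, ∀ m, f (η m) = ξ m := by
  obtain ⟨g, hg⟩ := f.rangeRestrict.exists_rightInverse_of_surjective f.range_rangeRestrict
  refine ⟨g ∘ₗ ξ.codRestrict _ h, fun m => ?_⟩
  have := congrArg Subtype.val (LinearMap.congr_fun hg (ξ.codRestrict _ h m))
  exact this

theorem lin_ext {k M M' N : Type} [Field k] [AddCommGroup M] [Module k M] [AddCommGroup N]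
    [Module k N] [AddCommGroup M'] [Module k M'] (f : M' →ₗ[k] M) (hf : Function.Injective f)
    (ξ : M' →ₗ[k] N) : ∃ η : M →ₗ[k] N, ∀ m, η (f m) = ξ m := by
  obtain ⟨g, hg⟩ := f.exists_leftInverse_of_injective (LinearMap.ker_eq_bot.2 hf)
  refine ⟨ξ ∘ₗ g, fun m => ?_⟩
  have := LinearMap.congr_fun hg m
  simp only [LinearMap.comp_apply, LinearMap.id_apply] at this
  simp [this]

section ext

variable {V A : Type} [Fintype V] [DecidableEq V] [Fintype A] {s t : A → V} {k : Type} [Field k]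
variable {M M' M'' N N' N'' : Obj s t k}

/-- averaging to a degree zero cochain -/
def av0 (f : M →ₗ[k] N) : C0 M N :=
  ⟨∑ i, act N (pe s t k i) ∘ₗ f ∘ₗ act M (pe s t k i), by
    intro j m
    simp only [LinearMap.sum_apply, LinearMap.comp_apply, act_apply, Finset.smul_sum]
    refine Finset.sum_congr rfl fun i _ => ?_
    by_cases h : i = j
    · subst h; rw [pe_pe, pe_pe]
    · rw [pe_pe_ne h, pe_pe_ne (Ne.symm h)]; simp⟩

theorem av0_apply (f : M →ₗ[k] N) (m : M) :
    (av0 f).1 m = ∑ i, pe s t k i • f (pe s t k i • m) := by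
  simp [av0, LinearMap.sum_apply]

/-- averaging to a degree one cochain -/
def av1 (f : A → M →ₗ[k] N) : C1 M N :=
  ⟨fun a => act N (pe s t k (t a)) ∘ₗ f a ∘ₗ act M (pe s t k (s a)), by
    intro a m
    simp only [LinearMap.comp_apply, act_apply, pe_pe]⟩

theorem av1_apply (f : A → M →ₗ[k] N) (a : A) (m : M) :
    (av1 f).1 a m = pe s t k (t a) • f a (pe s t k (s a) • m) := rfl

/-- pushforward of cochains -/
def push1 (M : Obj s t k) (h : N →ₗ[PA s t k] N') : C1 M N →ₗ[k] C1 M N' where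
  toFun ξ := ⟨fun a => h.restrictScalars k ∘ₗ ξ.1 a, by
    intro a m
    simp only [LinearMap.comp_apply, LinearMap.restrictScalars_apply]
    rw [← map_smul, ξ.2]⟩
  map_add' ξ η := by apply Subtype.ext; funext a; ext m; simp
  map_smul' c ξ := by apply Subtype.ext; funext a; ext m; simp

/-- pullback of cochains -/
def pull1 (h : M' →ₗ[PA s t k] M) (N : Obj s t k) : C1 M N →ₗ[k] C1 M' N where
  toFun ξ := ⟨fun a => ξ.1 a ∘ₗ h.restrictScalars k, by
    intro a m
    simp only [LinearMap.comp_apply, LinearMap.restrictScalars_apply]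
    rw [map_smul, ξ.2]⟩
  map_add' ξ η := by apply Subtype.ext; funext a; ext m; simp
  map_smul' c ξ := by apply Subtype.ext; funext a; ext m; simp

theorem push1_apply (h : N →ₗ[PA s t k] N') (ξ : C1 M N) (a : A) (m : M) :
    (push1 M h ξ).1 a m = h (ξ.1 a m) := rfl
theorem pull1_apply (h : M' →ₗ[PA s t k] M) (ξ : C1 M N) (a : A) (m : M') :
    (pull1 h N ξ).1 a m = ξ.1 a (h m) := rfl

/-- post composition on C0 -/
def post0 (h : N →ₗ[PA s t k] N') (f : C0 M N) : C0 M N' :=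
  ⟨h.restrictScalars k ∘ₗ f.1, fun i m => by
    simp only [LinearMap.comp_apply, LinearMap.restrictScalars_apply]; rw [f.2, map_smul]⟩
/-- pre composition on C0 -/
def pre0 (h : M' →ₗ[PA s t k] M) (f : C0 M N) : C0 M' N :=
  ⟨f.1 ∘ₗ h.restrictScalars k, fun i m => by
    simp only [LinearMap.comp_apply, LinearMap.restrictScalars_apply]; rw [map_smul, f.2]⟩

/-- identity cochain -/
def idC0 (N : Obj s t k) : C0 N N := ⟨LinearMap.id, fun i m => rfl⟩

theorem C0_pe (f : C0 M N) (i : V) (m : M) : f.1 (pe s t k i • m) = pe s t k i • f.1 m := f.2 i m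

theorem C1_ext {ξ η : C1 M N} (h : ∀ a m, ξ.1 a m = η.1 a m) : ξ = η := by
  apply Subtype.ext; funext a; ext m; exact h a m

theorem dd_post0 (h : N →ₗ[PA s t k] N') (f : C0 M N) :
    dd M N' (post0 h f) = push1 M h (dd M N f) := by
  apply C1_ext; intro a m
  rw [push1_apply, dd_apply, dd_apply, map_sub, map_smul h]; rfl
theorem dd_pre0 (h : M' →ₗ[PA s t k] M) (f : C0 M N) :
    dd M' N (pre0 h f) = pull1 h N (dd M N f) := by
  apply C1_ext; intro a m
  rw [pull1_apply, dd_apply, dd_apply, ← map_smul h]; rfl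

/-- pushforward on Ext -/
def push (M : Obj s t k) (h : N →ₗ[PA s t k] N') : Ext M N →ₗ[k] Ext M N' :=
  Submodule.mapQ _ _ (push1 M h) (by
    rintro _ ⟨f, rfl⟩
    exact ⟨post0 h f, dd_post0 h f⟩)
/-- pullback on Ext -/
def pull (h : M' →ₗ[PA s t k] M) (N : Obj s t k) : Ext M N →ₗ[k] Ext M' N :=
  Submodule.mapQ _ _ (pull1 h N) (by
    rintro _ ⟨f, rfl⟩
    exact ⟨pre0 h f, dd_pre0 h f⟩)

/-- class of a cochain -/
def cls : C1 M N →ₗ[k] Ext M N := Submodule.mkQ _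

theorem cls_surj (ξ : Ext M N) : ∃ x, cls x = ξ := Submodule.mkQ_surjective _ ξ
theorem push_cls (h : N →ₗ[PA s t k] N') (ξ : C1 M N) : push M h (cls ξ) = cls (push1 M h ξ) := rfl
theorem pull_cls (h : M' →ₗ[PA s t k] M) (ξ : C1 M N) : pull h N (cls ξ) = cls (pull1 h N ξ) := rfl
theorem cls_eq_zero {ξ : C1 M N} : cls ξ = 0 ↔ ∃ f, dd M N f = ξ := by
  rw [cls, Submodule.mkQ_apply, Submodule.Quotient.mk_eq_zero, LinearMap.mem_range]
theorem cls_dd (f : C0 M N) : cls (dd M N f) = 0 := cls_eq_zero.2 ⟨f, rfl⟩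

theorem push_comp (h : N →ₗ[PA s t k] N') (h' : N' →ₗ[PA s t k] N'') (ξ : Ext M N) :
    push M (h' ∘ₗ h) ξ = push M h' (push M h ξ) := by
  obtain ⟨x, rfl⟩ := cls_surj ξ; rfl
theorem pull_comp (h : M' →ₗ[PA s t k] M) (h' : M'' →ₗ[PA s t k] M') (ξ : Ext M N) :
    pull (h ∘ₗ h') N ξ = pull h' N (pull h N ξ) := by
  obtain ⟨x, rfl⟩ := cls_surj ξ; rfl
theorem push_pull (h : N →ₗ[PA s t k] N') (g : M' →ₗ[PA s t k] M) (ξ : Ext M N) :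
    push M' h (pull g N ξ) = pull g N' (push M h ξ) := by
  obtain ⟨x, rfl⟩ := cls_surj ξ; rfl
theorem push_id (ξ : Ext M N) : push M (LinearMap.id) ξ = ξ := by
  obtain ⟨x, rfl⟩ := cls_surj ξ; rfl
theorem pull_id (ξ : Ext M N) : pull (LinearMap.id) N ξ = ξ := by
  obtain ⟨x, rfl⟩ := cls_surj ξ; rfl
theorem push_add (h h' : N →ₗ[PA s t k] N') (ξ : Ext M N) :
    push M (h + h') ξ = push M h ξ + push M h' ξ := by
  obtain ⟨x, rfl⟩ := cls_surj ξ
  rw [push_cls, push_cls, push_cls, ← map_add]; rfl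
theorem pull_add (h h' : M' →ₗ[PA s t k] M) (ξ : Ext M N) :
    pull (h + h') N ξ = pull h N ξ + pull h' N ξ := by
  obtain ⟨x, rfl⟩ := cls_surj ξ
  rw [pull_cls, pull_cls, pull_cls, ← map_add]
  congr 1; apply C1_ext; intro a m; exact map_add (x.1 a) _ _
theorem push_smul (c : k) (h : N →ₗ[PA s t k] N') (ξ : Ext M N) :
    push M (c • h) ξ = c • push M h ξ := by
  obtain ⟨x, rfl⟩ := cls_surj ξ
  rw [push_cls, push_cls, ← map_smul]; rfl
theorem pull_smul (c : k) (h : M' →ₗ[PA s t k] M) (ξ : Ext M N) :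
    pull (c • h) N ξ = c • pull h N ξ := by
  obtain ⟨x, rfl⟩ := cls_surj ξ
  rw [pull_cls, pull_cls, ← map_smul]
  congr 1; apply C1_ext; intro a m; exact map_smul (x.1 a) c _
theorem push_zero (ξ : Ext M N) : push M (0 : N →ₗ[PA s t k] N') ξ = 0 := by
  have := push_smul (0 : k) (0 : N →ₗ[PA s t k] N') ξ
  rwa [zero_smul, zero_smul] at this
theorem pull_zero (ξ : Ext M N) : pull (0 : M' →ₗ[PA s t k] M) N ξ = 0 := by
  have := pull_smul (0 : k) (0 : M' →ₗ[PA s t k] M) ξ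
  rwa [zero_smul, zero_smul] at this

/-! lifting of cochains -/

theorem lift0 (g : N →ₗ[PA s t k] N') (f : C0 M N') (h : ∀ m, ∃ n, g n = f.1 m) :
    ∃ f' : C0 M N, ∀ m, g (f'.1 m) = f.1 m := by
  obtain ⟨η, hη⟩ := lin_lift (g.restrictScalars k) f.1 h
  refine ⟨av0 η, fun m => ?_⟩
  rw [av0_apply, map_sum]
  have : ∀ i, g (pe s t k i • η (pe s t k i • m)) = pe s t k i • f.1 m := by
    intro i
    have := hη (pe s t k i • m)
    rw [LinearMap.restrictScalars_apply] at this
    rw [map_smul, this, f.2, pe_pe]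
  rw [Finset.sum_congr rfl fun i _ => this i, sum_pe]

theorem lift1 (g : N →ₗ[PA s t k] N') (f : C1 M N') (h : ∀ a m, ∃ n, g n = f.1 a m) :
    ∃ f' : C1 M N, push1 M g f' = f := by
  choose η hη using fun a => lin_lift (g.restrictScalars k) (f.1 a) (h a)
  refine ⟨av1 η, C1_ext fun a m => ?_⟩
  have := hη a (pe s t k (s a) • m)
  rw [LinearMap.restrictScalars_apply] at this
  rw [push1_apply, av1_apply, map_smul, this, f.2]

theorem ext0 (g : M' →ₗ[PA s t k] M) (hg : Function.Injective g) (f : C0 M' N) :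
    ∃ f' : C0 M N, pre0 g f' = f := by
  obtain ⟨η, hη⟩ := lin_ext (g.restrictScalars k) hg f.1
  refine ⟨av0 η, Subtype.ext (LinearMap.ext fun m => ?_)⟩
  change (av0 η).1 (g m) = _
  rw [av0_apply]
  have : ∀ i, pe s t k i • η (pe s t k i • g m) = pe s t k i • f.1 m := by
    intro i
    have := hη (pe s t k i • m)
    rw [LinearMap.restrictScalars_apply, map_smul] at this
    rw [this, f.2, pe_pe]
  rw [Finset.sum_congr rfl fun i _ => this i, sum_pe]

theorem ext1 (g : M' →ₗ[PA s t k] M) (hg : Function.Injective g) (f : C1 M' N) :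
    ∃ f' : C1 M N, pull1 g N f' = f := by
  choose η hη using fun a => lin_ext (g.restrictScalars k) hg (f.1 a)
  refine ⟨av1 η, C1_ext fun a m => ?_⟩
  have := hη a (pe s t k (s a) • m)
  rw [LinearMap.restrictScalars_apply, map_smul] at this
  rw [pull1_apply, av1_apply, this, f.2]

theorem push_surj (M : Obj s t k) {g : N →ₗ[PA s t k] N'} (hg : Function.Surjective g) :
    Function.Surjective (push M g) := by
  intro ξ
  obtain ⟨x, rfl⟩ := cls_surj ξ
  obtain ⟨y, rfl⟩ := lift1 g x (fun a m => hg _)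
  exact ⟨cls y, rfl⟩

theorem pull_surj (N : Obj s t k) {g : M' →ₗ[PA s t k] M} (hg : Function.Injective g) :
    Function.Surjective (pull g N) := by
  intro ξ
  obtain ⟨x, rfl⟩ := cls_surj ξ
  obtain ⟨y, rfl⟩ := ext1 g hg x
  exact ⟨cls y, rfl⟩

theorem push_exact {f : N' →ₗ[PA s t k] N} {g : N →ₗ[PA s t k] N''} (h : Function.Exact f g)
    (hg : Function.Surjective g) (ξ : Ext M N) (hξ : push M g ξ = 0) : ∃ η, push M f η = ξ := by
  obtain ⟨x, rfl⟩ := cls_surj ξ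
  rw [push_cls, cls_eq_zero] at hξ
  obtain ⟨φ, hφ⟩ := hξ
  obtain ⟨ψ, hψ⟩ := lift0 g φ (fun m => hg _)
  have hψ' : post0 g ψ = φ := Subtype.ext (LinearMap.ext hψ)
  obtain ⟨y, hy⟩ := lift1 f (x - dd M N ψ) (by
    intro a m
    apply (h _).1
    have : push1 M g (x - dd M N ψ) = 0 := by
      rw [map_sub, ← dd_post0, hψ', hφ, sub_self]
    exact LinearMap.congr_fun (congrFun (congrArg Subtype.val this) a) m)
  exact ⟨cls y, by rw [push_cls, hy, map_sub, cls_dd, sub_zero]⟩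

theorem pull_exact {f : M' →ₗ[PA s t k] M} {g : M →ₗ[PA s t k] M''} (h : Function.Exact f g)
    (hf : Function.Injective f) (hg : Function.Surjective g)
    (ξ : Ext M N) (hξ : pull f N ξ = 0) : ∃ η, pull g N η = ξ := by
  obtain ⟨x, rfl⟩ := cls_surj ξ
  rw [pull_cls, cls_eq_zero] at hξ
  obtain ⟨φ, hφ⟩ := hξ
  obtain ⟨ψ, hψ⟩ := ext0 f hf φ
  have hz : pull1 f N (x - dd M N ψ) = 0 := by
    rw [map_sub, ← dd_pre0, hψ, hφ, sub_self]
  obtain ⟨σ, hσ⟩ := (g.restrictScalars k).exists_rightInverse_of_surjective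
    (LinearMap.range_eq_top.2 hg)
  have hker : ∀ a m, g m = 0 → (x - dd M N ψ).1 a m = 0 := by
    intro a m hm
    obtain ⟨l, rfl⟩ := (h m).1 hm
    exact LinearMap.congr_fun (congrFun (congrArg Subtype.val hz) a) l
  have key : ∀ a m, (x - dd M N ψ).1 a (σ (g m)) = (x - dd M N ψ).1 a m := by
    intro a m
    rw [← sub_eq_zero, ← map_sub]
    apply hker
    rw [map_sub, sub_eq_zero]
    exact LinearMap.congr_fun hσ (g m)
  refine ⟨cls (av1 fun a => (x - dd M N ψ).1 a ∘ₗ σ), ?_⟩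
  have : pull1 g N (av1 fun a => (x - dd M N ψ).1 a ∘ₗ σ) = x - dd M N ψ := by
    apply C1_ext; intro a m
    rw [pull1_apply, av1_apply, LinearMap.comp_apply, ← map_smul g, key]
    exact (x - dd M N ψ).2 a m
  rw [pull_cls, this, map_sub, cls_dd, sub_zero]

theorem ext_eq_zero_iff (M N : Obj s t k) : ext M N = 0 ↔ ∀ ξ : Ext M N, ξ = 0 := by
  rw [ext, Nat.cast_eq_zero, Module.finrank_zero_iff, subsingleton_iff_forall_eq 0]

theorem hom_eq_zero_iff (M N : Obj s t k) : hom M N = 0 ↔ ∀ f : M →ₗ[PA s t k] N, f = 0 := by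
  rw [hom, Nat.cast_eq_zero, Module.finrank_zero_iff, subsingleton_iff_forall_eq 0]

theorem push_surj_of_coker (M : Obj s t k) (f : N →ₗ[PA s t k] N')
    (h : ext M (N'.quot (LinearMap.range f)) = 0) : Function.Surjective (push M f) := by
  intro ξ
  refine push_exact (N'' := N'.quot (LinearMap.range f)) (g := (LinearMap.range f).mkQ) ?_
    (Submodule.mkQ_surjective _) ξ ((ext_eq_zero_iff _ _).1 h _)
  intro x; simp

theorem ext_le_of_inj (N : Obj s t k) {g : M' →ₗ[PA s t k] M} (hg : Function.Injective g) :
    ext M' N ≤ ext M N := by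
  have := LinearMap.finrank_le_finrank_of_surjective (pull_surj N hg)
  simp only [ext]; exact_mod_cast this

theorem ext_le_of_surj (M : Obj s t k) {g : N →ₗ[PA s t k] N'} (hg : Function.Surjective g) :
    ext M N' ≤ ext M N := by
  have := LinearMap.finrank_le_finrank_of_surjective (push_surj M hg)
  simp only [ext]; exact_mod_cast this

theorem finrank_le_of_exact {k X Y Z : Type} [Field k] [AddCommGroup X] [Module k X]
    [AddCommGroup Y] [Module k Y] [AddCommGroup Z] [Module k Z] [FiniteDimensional k X]
    [FiniteDimensional k Y] [FiniteDimensional k Z] (f : X →ₗ[k] Y) (g : Y →ₗ[k] Z)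
    (h : ∀ y, g y = 0 → ∃ x, f x = y) : finrank k Y ≤ finrank k X + finrank k Z := by
  have h1 := LinearMap.finrank_range_add_finrank_ker g
  have h2 : finrank k (LinearMap.ker g) ≤ finrank k (LinearMap.range f) :=
    Submodule.finrank_mono (fun y hy => h y hy)
  have h3 := LinearMap.finrank_range_le f
  have h4 := Submodule.finrank_le (LinearMap.range g)
  omega

theorem ext_sub_right (M : Obj s t k) {f : N' →ₗ[PA s t k] N} {g : N →ₗ[PA s t k] N''}
    (h : Function.Exact f g) (hg : Function.Surjective g) :
    ext M N ≤ ext M N' + ext M N'' := by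
  have := finrank_le_of_exact (push M f) (push M g) (push_exact h hg)
  simp only [ext]; exact_mod_cast this

theorem ext_sub_left (N : Obj s t k) {f : M' →ₗ[PA s t k] M} {g : M →ₗ[PA s t k] M''}
    (h : Function.Exact f g) (hf : Function.Injective f) (hg : Function.Surjective g) :
    ext M N ≤ ext M'' N + ext M' N := by
  have := finrank_le_of_exact (pull g N) (pull f N) (pull_exact h hf hg)
  simp only [ext]; exact_mod_cast this

/-- post composition as a k-linear map on Hom -/
def postH (M : Obj s t k) (h : N →ₗ[PA s t k] N') :
    (M →ₗ[PA s t k] N) →ₗ[k] (M →ₗ[PA s t k] N') where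
  toFun f := h ∘ₗ f
  map_add' f g := by ext; simp
  map_smul' c f := by
    ext m; simp only [LinearMap.comp_apply, LinearMap.smul_apply, RingHom.id_apply]
    exact (h.restrictScalars k).map_smul c _
/-- pre composition as a k-linear map on Hom -/
def preH (h : M' →ₗ[PA s t k] M) (N : Obj s t k) :
    (M →ₗ[PA s t k] N) →ₗ[k] (M' →ₗ[PA s t k] N) where
  toFun f := f ∘ₗ h
  map_add' f g := by ext; simp
  map_smul' c f := by ext m; simp

@[simp] theorem postH_apply (h : N →ₗ[PA s t k] N') (f : M →ₗ[PA s t k] N) :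
    postH M h f = h ∘ₗ f := rfl
@[simp] theorem preH_apply (h : M' →ₗ[PA s t k] M) (f : M →ₗ[PA s t k] N) :
    preH h N f = f ∘ₗ h := rfl

theorem exact_lift {X : Obj s t k} {f : N' →ₗ[PA s t k] N} {g : N →ₗ[PA s t k] N''}
    (h : Function.Exact f g) (hf : Function.Injective f) (u : X →ₗ[PA s t k] N)
    (hu : g ∘ₗ u = 0) : ∃ v : X →ₗ[PA s t k] N', f ∘ₗ v = u := by
  have hr : ∀ x, u x ∈ LinearMap.range f := fun x => (h _).1 (LinearMap.congr_fun hu x)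
  refine ⟨(LinearEquiv.ofInjective f hf).symm.toLinearMap ∘ₗ u.codRestrict _ hr, ?_⟩
  ext x
  have := (LinearEquiv.ofInjective f hf).apply_symm_apply (u.codRestrict _ hr x)
  exact congrArg Subtype.val this

theorem exact_desc {Y : Obj s t k} {f : N' →ₗ[PA s t k] N} {g : N →ₗ[PA s t k] N''}
    (h : Function.Exact f g) (hg : Function.Surjective g) (u : N →ₗ[PA s t k] Y)
    (hu : u ∘ₗ f = 0) : ∃ v : N'' →ₗ[PA s t k] Y, v ∘ₗ g = u := by
  have hk : LinearMap.ker g ≤ LinearMap.ker u := by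
    intro x hx
    obtain ⟨y, rfl⟩ := (h x).1 hx
    exact LinearMap.congr_fun hu y
  refine ⟨(LinearMap.ker g).liftQ u hk ∘ₗ (g.quotKerEquivOfSurjective hg).symm.toLinearMap, ?_⟩
  ext x
  simp only [LinearMap.comp_apply, LinearEquiv.coe_coe]
  have : (g.quotKerEquivOfSurjective hg).symm (g x) = Submodule.Quotient.mk x := by
    rw [LinearEquiv.symm_apply_eq]; rfl
  rw [this]; rfl

theorem hom_sub_left (Y : Obj s t k) {f : N' →ₗ[PA s t k] N} {g : N →ₗ[PA s t k] N''}
    (h : Function.Exact f g) (hg : Function.Surjective g) : hom N Y ≤ hom N'' Y + hom N' Y := by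
  have := finrank_le_of_exact (preH g Y) (preH f Y) (fun u hu => exact_desc h hg u hu)
  simp only [hom]; exact_mod_cast this
theorem hom_sub_right (X : Obj s t k) {f : N' →ₗ[PA s t k] N} {g : N →ₗ[PA s t k] N''}
    (h : Function.Exact f g) (hf : Function.Injective f) : hom X N ≤ hom X N' + hom X N'' := by
  have := finrank_le_of_exact (postH X f) (postH X g) (fun u hu => exact_lift h hf u hu)
  simp only [hom]; exact_mod_cast this

theorem hom_le_of_surj (Y : Obj s t k) {g : N →ₗ[PA s t k] N''}
    (hg : Function.Surjective g) : hom N'' Y ≤ hom N Y := by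
  have : Function.Injective (preH g Y) := by
    intro u v huv
    ext x; obtain ⟨y, rfl⟩ := hg x
    exact LinearMap.congr_fun huv y
  have := LinearMap.finrank_le_finrank_of_injective this
  simp only [hom]; exact_mod_cast this
theorem hom_le_of_inj (X : Obj s t k) {g : N →ₗ[PA s t k] N''}
    (hg : Function.Injective g) : hom X N ≤ hom X N'' := by
  have : Function.Injective (postH X g) := by
    intro u v huv
    ext x
    exact hg (LinearMap.congr_fun huv x)
  have := LinearMap.finrank_le_finrank_of_injective this
  simp only [hom]; exact_mod_cast this

theorem hom_congr {M₁ N₁ : Obj s t k} (e : M ≃ₗ[PA s t k] M₁) (e' : N ≃ₗ[PA s t k] N₁) :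
    hom M N = hom M₁ N₁ := by
  apply le_antisymm
  · exact (hom_le_of_surj N (g := e.symm.toLinearMap) e.symm.surjective).trans
      (hom_le_of_inj M₁ (g := e'.toLinearMap) e'.injective)
  · exact (hom_le_of_surj N₁ (g := e.toLinearMap) e.surjective).trans
      (hom_le_of_inj M (g := e'.symm.toLinearMap) e'.symm.injective)
theorem ext_congr {M₁ N₁ : Obj s t k} (e : M ≃ₗ[PA s t k] M₁) (e' : N ≃ₗ[PA s t k] N₁) :
    ext M N = ext M₁ N₁ := by
  have h1 := euler M N
  have h2 := euler M₁ N₁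
  rw [dim_eqv e, dim_eqv e', ← h2, hom_congr e e'] at h1
  omega

/-- a short exact sequence with its class -/
structure IsClass (f : N' →ₗ[PA s t k] N) (g : N →ₗ[PA s t k] N'') (ξ : Ext N'' N') : Prop where
  inj : Function.Injective f
  surj : Function.Surjective g
  exact : Function.Exact f g
  ext_iff : ∀ (Y : Obj s t k) (h : N' →ₗ[PA s t k] Y), push N'' h ξ = 0 ↔
    ∃ H : N →ₗ[PA s t k] Y, H ∘ₗ f = h
  lift_iff : ∀ (X : Obj s t k) (h : X →ₗ[PA s t k] N''), pull h N' ξ = 0 ↔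
    ∃ H : X →ₗ[PA s t k] N, g ∘ₗ H = h

theorem class_of {f : N' →ₗ[PA s t k] N} {g : N →ₗ[PA s t k] N''} (hf : Function.Injective f)
    (hg : Function.Surjective g) (h : Function.Exact f g) (σ : C0 N'' N)
    (hσ : ∀ x, g (σ.1 x) = x) (ξ : C1 N'' N') (hξ : push1 N'' f ξ = dd N'' N σ) :
    IsClass f g (cls ξ) := by
  have hξ' : ∀ a m, f (ξ.1 a m) = px s t k a • σ.1 m - σ.1 (px s t k a • m) := by
    intro a m
    exact LinearMap.congr_fun (congrFun (congrArg Subtype.val hξ) a) m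
  refine ⟨hf, hg, h, ?_, ?_⟩
  · intro Y u
    rw [push_cls, cls_eq_zero]
    constructor
    · rintro ⟨φ, hφ⟩
      obtain ⟨ρ, hρ⟩ := lin_lift (f.restrictScalars k)
        (LinearMap.id - σ.1 ∘ₗ g.restrictScalars k) (by
          intro n
          apply (h _).1
          simp [hσ])
      have hρ' : ∀ n, f (ρ n) = n - σ.1 (g n) := hρ
      have hφ' : ∀ a m, u (ξ.1 a m) = px s t k a • φ.1 m - φ.1 (px s t k a • m) := by
        intro a m
        exact (LinearMap.congr_fun (congrFun (congrArg Subtype.val hφ) a) m).symm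
      refine ⟨mkHom (u.restrictScalars k ∘ₗ ρ + φ.1 ∘ₗ g.restrictScalars k) ?_ ?_, ?_⟩
      · intro i m
        have : ρ (pe s t k i • m) = pe s t k i • ρ m := by
          apply hf; rw [hρ', map_smul g, map_smul f, hρ', smul_sub, σ.2]
        simp only [LinearMap.add_apply, LinearMap.comp_apply, LinearMap.restrictScalars_apply,
          this, map_smul u, map_smul g, smul_add, C0_pe]
      · intro a m
        have : ρ (px s t k a • m) = px s t k a • ρ m + ξ.1 a (g m) := by
          apply hf; rw [hρ', map_add, map_smul g, map_smul f, hρ', smul_sub, hξ']; abel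
        simp only [LinearMap.add_apply, LinearMap.comp_apply, LinearMap.restrictScalars_apply,
          this, map_smul u, map_smul g, smul_add, map_add, hφ']
        abel
      · ext n
        have h1 : ρ (f n) = n := by
          apply hf; rw [hρ', (h _).2 ⟨n, rfl⟩, map_zero, sub_zero]
        simp [h1, (h (f n)).2 ⟨n, rfl⟩]
    · rintro ⟨H, rfl⟩
      refine ⟨post0 H σ, ?_⟩
      rw [dd_post0, ← hξ]; rfl
  · intro X u
    rw [pull_cls, cls_eq_zero]
    constructor
    · rintro ⟨φ, hφ⟩
      have hφ' : ∀ a m, ξ.1 a (u m) = px s t k a • φ.1 m - φ.1 (px s t k a • m) := by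
        intro a m
        exact (LinearMap.congr_fun (congrFun (congrArg Subtype.val hφ) a) m).symm
      refine ⟨mkHom (σ.1 ∘ₗ u.restrictScalars k - f.restrictScalars k ∘ₗ φ.1) ?_ ?_, ?_⟩
      · intro i m
        simp only [LinearMap.sub_apply, LinearMap.comp_apply, LinearMap.restrictScalars_apply,
          map_smul f, map_smul u, smul_sub, C0_pe]
      · intro a m
        have h1 := hξ' a (u m)
        rw [hφ', map_sub, map_smul f] at h1
        simp only [LinearMap.sub_apply, LinearMap.comp_apply, LinearMap.restrictScalars_apply,
          map_smul u, smul_sub]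
        rw [sub_eq_sub_iff_add_eq_add] at h1 ⊢
        rw [add_comm, ← h1, add_comm]
      · ext m
        simp [hσ, (h (f (φ.1 m))).2 ⟨_, rfl⟩]
    · rintro ⟨H, rfl⟩
      obtain ⟨φ, hφ⟩ := lift0 f (pre0 g σ - idC0 N) (by
        intro n
        apply (h _).1
        change g (σ.1 (g n) - n) = 0
        rw [map_sub, hσ, sub_self])
      have hφ' : ∀ n, f (φ.1 n) = σ.1 (g n) - n := hφ
      refine ⟨pre0 H φ, ?_⟩
      apply C1_ext
      intro a m
      rw [dd_pre0, pull1_apply, dd_apply, pull1_apply]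
      apply hf
      rw [map_sub, map_smul f, hφ', hφ', hξ', LinearMap.comp_apply, smul_sub, map_smul g]
      abel

theorem exists_class {f : N' →ₗ[PA s t k] N} {g : N →ₗ[PA s t k] N''} (hf : Function.Injective f)
    (hg : Function.Surjective g) (h : Function.Exact f g) : ∃ ξ, IsClass f g ξ := by
  obtain ⟨σ, hσ⟩ := lift0 g (idC0 N'') (fun m => hg _)
  obtain ⟨ξ, hξ⟩ := lift1 f (dd N'' N σ) (by
    intro a m
    apply (h _).1
    have h1 : ∀ x, g (σ.1 x) = x := hσ
    rw [dd_apply, map_sub, map_smul g, h1, h1, sub_self])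
  exact ⟨cls ξ, class_of hf hg h σ hσ ξ hξ⟩

/-- realization data -/
def extData (M N : Obj s t k) (ξ : C1 M N) : ModData s t k (N × M) where
  E i := (act N (pe s t k i)).prodMap (act M (pe s t k i))
  X a := (act N (px s t k a)).prodMap (act M (px s t k a)) +
    LinearMap.inl k N M ∘ₗ ξ.1 a ∘ₗ LinearMap.snd k N M
  idem i := by ext x <;> simp [pe_pe]
  orth i j h := by ext x <;> simp [pe_pe_ne h]
  one := by
    refine LinearMap.ext fun x => ?_
    rw [LinearMap.sum_apply]
    apply Prod.ext
    · rw [Prod.fst_sum]; simpa using sum_pe x.1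
    · rw [Prod.snd_sum]; simpa using sum_pe x.2
  src a := by ext x <;> simp [px_pe, C1_src ξ.2]
  tgt a := by ext x <;> simp [pe_px, C1_tgt ξ.2]

theorem exists_real (M N : Obj s t k) (ξ : Ext M N) :
    ∃ (E : Obj s t k) (f : N →ₗ[PA s t k] E) (g : E →ₗ[PA s t k] M), IsClass f g ξ := by
  obtain ⟨x, rfl⟩ := cls_surj ξ
  let D := extData M N x
  set ε := mkEqv D with hε
  have hsur : ∀ y : mkObj D, ∃ w, ε w = y := fun y => ⟨ε.symm y, ε.apply_symm_apply y⟩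
  let f : N →ₗ[PA s t k] mkObj D := mkHom (ε.toLinearMap ∘ₗ LinearMap.inl k N M)
    (by
      intro i m
      change mkEqv D (pe s t k i • m, 0) = pe s t k i • mkEqv D (m, 0)
      rw [pe_mkEqv]
      congr 1
      simp [D, extData])
    (by
      intro i m
      change mkEqv D (px s t k i • m, 0) = px s t k i • mkEqv D (m, 0)
      rw [px_mkEqv]
      congr 1
      simp [D, extData])
  let g : mkObj D →ₗ[PA s t k] M := mkHom (LinearMap.snd k N M ∘ₗ ε.symm.toLinearMap)
    (by
      intro i m
      obtain ⟨w, rfl⟩ := hsur m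
      rw [pe_mkEqv]
      change (ε.symm (ε (D.E i w))).2 = pe s t k i • (ε.symm (ε w)).2
      rw [ε.symm_apply_apply, ε.symm_apply_apply]
      simp [D, extData])
    (by
      intro i m
      obtain ⟨w, rfl⟩ := hsur m
      rw [px_mkEqv]
      change (ε.symm (ε (D.X i w))).2 = px s t k i • (ε.symm (ε w)).2
      rw [ε.symm_apply_apply, ε.symm_apply_apply]
      simp [D, extData])
  have hf : ∀ n, f n = ε (n, 0) := fun n => rfl
  have hg : ∀ w, g (ε w) = w.2 := by intro w; simp [g]
  refine ⟨mkObj D, f, g, ?_⟩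
  let σ : C0 M (mkObj D) := ⟨ε.toLinearMap ∘ₗ LinearMap.inr k N M, by
    intro i m
    change mkEqv D (0, pe s t k i • m) = pe s t k i • mkEqv D (0, m)
    rw [pe_mkEqv]
    congr 1
    simp [D, extData]⟩
  refine class_of (σ := σ) ?_ ?_ ?_ ?_ x ?_
  · intro a b hab
    rw [hf, hf] at hab
    exact congrArg Prod.fst (ε.injective hab)
  · intro m; exact ⟨ε (0, m), hg _⟩
  · intro y
    obtain ⟨w, rfl⟩ := hsur y
    rw [hg]
    constructor
    · intro h; exact ⟨w.1, by rw [hf]; congr 1; exact Prod.ext rfl h.symm⟩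
    · rintro ⟨n, hn⟩
      rw [hf] at hn
      exact (congrArg Prod.snd (ε.injective hn)).symm
  · intro m; exact hg _
  · apply C1_ext
    intro a m
    rw [push1_apply, dd_apply, hf]
    change _ = px s t k a • mkEqv D (0, m) - mkEqv D (0, px s t k a • m)
    rw [px_mkEqv, ← map_sub]
    congr 1
    simp [D, extData]

theorem IsClass.dim {f : N' →ₗ[PA s t k] N} {g : N →ₗ[PA s t k] N''} {ξ : Ext N'' N'}
    (h : IsClass f g ξ) : KacAff.dim N = KacAff.dim N' + KacAff.dim N'' :=
  dim_exact h.inj h.surj h.exact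

end ext

end

end KacAff


namespace KacAff

noncomputable section

open Module

set_option linter.all false

section numerics

variable {V A : Type} [Fintype V] [DecidableEq V] [Fintype A] {s t : A → V}

theorem eu_add_left (x y z : V → ℤ) : eu s t (x + y) z = eu s t x z + eu s t y z := by
  simp [eu, add_mul, Finset.sum_add_distrib]; ring
theorem eu_add_right (x y z : V → ℤ) : eu s t x (y + z) = eu s t x y + eu s t x z := by
  simp [eu, mul_add, Finset.sum_add_distrib]; ring
theorem eu_smul_left (c : ℤ) (x z : V → ℤ) : eu s t (c • x) z = c * eu s t x z := by
  simp [eu, mul_assoc, Finset.mul_sum, mul_sub]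
theorem eu_smul_right (c : ℤ) (x z : V → ℤ) : eu s t x (c • z) = c * eu s t x z := by
  simp [eu, Finset.mul_sum, mul_sub, mul_left_comm]
theorem eu_neg_left (x z : V → ℤ) : eu s t (-x) z = - eu s t x z := by
  rw [← neg_one_smul ℤ x, eu_smul_left]; ring
theorem eu_neg_right (x z : V → ℤ) : eu s t x (-z) = - eu s t x z := by
  rw [← neg_one_smul ℤ z, eu_smul_right]; ring
theorem eu_sub_left (x y z : V → ℤ) : eu s t (x - y) z = eu s t x z - eu s t y z := by
  rw [sub_eq_add_neg, eu_add_left, eu_neg_left]; ring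
theorem eu_sub_right (x y z : V → ℤ) : eu s t x (y - z) = eu s t x y - eu s t x z := by
  rw [sub_eq_add_neg, eu_add_right, eu_neg_right]; ring
@[simp] theorem eu_zero_left (z : V → ℤ) : eu s t 0 z = 0 := by simp [eu]
@[simp] theorem eu_zero_right (z : V → ℤ) : eu s t z 0 = 0 := by simp [eu]
theorem eu_sum_left {ι : Type*} (S : Finset ι) (f : ι → V → ℤ) (z : V → ℤ) :
    eu s t (∑ i ∈ S, f i) z = ∑ i ∈ S, eu s t (f i) z := by
  classical
  induction S using Finset.induction_on with
  | empty => simp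
  | insert a S ha ih => rw [Finset.sum_insert ha, Finset.sum_insert ha, eu_add_left, ih]
theorem eu_sum_right {ι : Type*} (S : Finset ι) (f : ι → V → ℤ) (z : V → ℤ) :
    eu s t z (∑ i ∈ S, f i) = ∑ i ∈ S, eu s t z (f i) := by
  classical
  induction S using Finset.induction_on with
  | empty => simp
  | insert a S ha ih => rw [Finset.sum_insert ha, Finset.sum_insert ha, eu_add_right, ih]

/-- symmetrized form -/
def bl (s t : A → V) (x y : V → ℤ) : ℤ := eu s t x y + eu s t y x

theorem bl_comm (x y : V → ℤ) : bl s t x y = bl s t y x := by simp [bl, add_comm]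

theorem eu_self_add (x y : V → ℤ) :
    eu s t (x + y) (x + y) = eu s t x x + eu s t y y + bl s t x y := by
  simp only [eu_add_left, eu_add_right, bl]; ring
theorem eu_self_smul (c : ℤ) (x : V → ℤ) : eu s t (c • x) (c • x) = c ^ 2 * eu s t x x := by
  rw [eu_smul_left, eu_smul_right]; ring
theorem bl_smul_left (c : ℤ) (x y : V → ℤ) : bl s t (c • x) y = c * bl s t x y := by
  simp only [bl, eu_smul_left, eu_smul_right]; ring
theorem bl_smul_right (c : ℤ) (x y : V → ℤ) : bl s t x (c • y) = c * bl s t x y := by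
  simp only [bl, eu_smul_left, eu_smul_right]; ring
theorem bl_add_right (x y z : V → ℤ) : bl s t x (y + z) = bl s t x y + bl s t x z := by
  simp only [bl, eu_add_left, eu_add_right]; ring

/-- simple root -/
def al (i : V) : V → ℤ := Pi.single i 1

theorem sum_al (x : V → ℤ) : x = ∑ i, x i • al i := by
  funext j
  simp [al, Finset.sum_apply, Pi.single_apply]

theorem bl_expand (x y : V → ℤ) : bl s t x y = ∑ j, y j * bl s t x (al j) := by
  conv_lhs => rw [sum_al y]
  rw [bl, eu_sum_right, eu_sum_left, ← Finset.sum_add_distrib]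
  refine Finset.sum_congr rfl fun j _ => ?_
  rw [eu_smul_left, eu_smul_right, bl]; ring

/-- affine data -/
structure Aff (s t : A → V) (δ : V → ℤ) : Prop where
  ne : Nonempty V
  pos : ∀ i, 0 < δ i
  psd : ∀ x, 0 ≤ eu s t x x
  rad : ∀ x, (∀ y, bl s t x y = 0) ↔ ∃ m : ℤ, x = m • δ
  idx : ∃ f : V ≃ Fin (Fintype.card V), ∀ a, f (s a) < f (t a)

variable {δ : V → ℤ}

theorem Aff.noloop (h : Aff s t δ) (a : A) : s a ≠ t a := by
  obtain ⟨f, hf⟩ := h.idx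
  intro he
  have := hf a
  rw [he] at this; exact lt_irrefl _ this

theorem Aff.eu_al (h : Aff s t δ) (i : V) : eu s t (al i) (al i) = 1 := by
  have : ∀ a, (al i : V → ℤ) (s a) * (al i : V → ℤ) (t a) = 0 := by
    intro a
    simp only [al, Pi.single_apply]
    have := h.noloop a
    split_ifs with h1 h2 <;> simp
    exact this (h1.trans h2.symm)
  simp [eu, this]
  simp [al, Pi.single_apply]

theorem Aff.bl_delta (h : Aff s t δ) (y : V → ℤ) : bl s t δ y = 0 :=
  (h.rad δ).2 ⟨1, by simp⟩ y

theorem Aff.eu_delta_right (h : Aff s t δ) (x : V → ℤ) : eu s t x δ = - eu s t δ x := by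
  have := h.bl_delta x
  simp only [bl] at this; omega

theorem Aff.eu_delta (h : Aff s t δ) : eu s t δ δ = 0 := by
  have := h.eu_delta_right δ; omega

theorem Aff.isotropic (h : Aff s t δ) {x : V → ℤ} (hx : eu s t x x = 0) :
    ∃ m : ℤ, x = m • δ := by
  rw [← h.rad]
  intro y
  by_contra hne
  have h1 := h.psd ((-(bl s t x y) * (eu s t y y + 1)) • x + y)
  rw [eu_self_add, eu_self_smul, hx, bl_smul_left] at h1
  have h2 := h.psd y
  have h3 : 1 ≤ bl s t x y * bl s t x y := by
    have : 0 < bl s t x y * bl s t x y := mul_self_pos.2 hne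
    omega
  nlinarith

/-- clearing denominators -/
theorem clear_denoms (w : V → ℚ) : ∃ (N : ℕ) (z : V → ℤ), 0 < N ∧ ∀ i, (z i : ℚ) = N * w i := by
  refine ⟨∏ i, (w i).den, fun i => (w i).num * ∏ j ∈ Finset.univ.erase i, ((w j).den : ℤ), ?_, ?_⟩
  · exact Finset.prod_pos fun i _ => (w i).den_pos
  · intro i
    rw [← Finset.mul_prod_erase _ _ (Finset.mem_univ i)]
    push_cast
    have : ((w i).num : ℚ) = w i * (w i).den := (Rat.mul_den_eq_num (w i)).symm
    rw [this]; ring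

theorem Aff.fredholm (h : Aff s t δ) (c : V → ℤ) (hc : ∑ i, c i * δ i = 0) :
    ∃ (N : ℤ) (w : V → ℤ), 0 < N ∧ ∀ u, N * ∑ i, c i * u i = bl s t w u := by
  -- the matrix of the form
  let G : V → V → ℤ := fun i j => bl s t (al i) (al j)
  have hG : ∀ x j, bl s t x (al j) = ∑ i, x i * G i j := by
    intro x j
    rw [bl_comm, bl_expand]
    exact Finset.sum_congr rfl fun i _ => by rw [bl_comm]
  let B : (V → ℚ) →ₗ[ℚ] (V → ℚ) :=
    { toFun := fun x j => ∑ i, x i * (G i j : ℚ)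
      map_add' := by intro x y; funext j; simp [add_mul, Finset.sum_add_distrib]
      map_smul' := by intro r x; funext j; simp [Finset.mul_sum, mul_assoc] }
  have hBa : ∀ x j, B x j = ∑ i, x i * (G i j : ℚ) := fun x j => rfl
  have key : (fun i => (c i : ℚ)) ∈ LinearMap.range B := by
    by_contra hn
    obtain ⟨f, hf1, hf2⟩ := Submodule.exists_le_ker_of_notMem hn
    obtain ⟨D, z, hD, hz⟩ := clear_denoms (fun i => f (Pi.single i 1))
    have hfe : ∀ v : V → ℚ, f v = ∑ i, v i * f (Pi.single i 1) := by
      intro v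
      conv_lhs => rw [← Finset.univ_sum_single v]
      rw [map_sum]
      refine Finset.sum_congr rfl fun i _ => ?_
      have : (Pi.single i (v i) : V → ℚ) = v i • Pi.single i 1 := by
        funext j; simp [Pi.single_apply]
      rw [this, map_smul, smul_eq_mul]
    have hzr : ∀ y, bl s t z y = 0 := by
      intro y
      rw [bl_expand]
      refine Finset.sum_eq_zero fun j _ => ?_
      have h1 : f (B (Pi.single j 1)) = 0 := hf2 ⟨_, rfl⟩
      rw [hfe] at h1
      have h2 : ∀ i, B (Pi.single j 1) i = (G j i : ℚ) := by
        intro i; rw [hBa]; simp [Pi.single_apply]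
      simp only [h2] at h1
      have h3 : (bl s t z (al j) : ℚ) = 0 := by
        rw [hG]; push_cast
        simp only [hz]
        have : ∀ i, (D : ℚ) * f (Pi.single i 1) * (G i j : ℚ) =
            D * ((G j i : ℚ) * f (Pi.single i 1)) := by
          intro i
          have : G i j = G j i := bl_comm _ _
          rw [this]; ring
        rw [Finset.sum_congr rfl fun i _ => this i, ← Finset.mul_sum, h1, mul_zero]
      have h4 : bl s t z (al j) = 0 := by exact_mod_cast h3
      rw [h4, mul_zero]
    obtain ⟨m, hm⟩ := (h.rad z).1 hzr
    apply hf1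
    rw [hfe]
    have : (D : ℚ) * ∑ i, (c i : ℚ) * f (Pi.single i 1) = 0 := by
      rw [Finset.mul_sum]
      have h5 : ∀ i, (D : ℚ) * ((c i : ℚ) * f (Pi.single i 1)) = ((m * (c i * δ i) : ℤ) : ℚ) := by
        intro i
        have h6 := hz i
        rw [hm] at h6
        simp only [Pi.smul_apply, smul_eq_mul] at h6
        rw [mul_left_comm, ← h6]; push_cast; ring
      rw [Finset.sum_congr rfl fun i _ => h5 i, ← Int.cast_sum, ← Finset.mul_sum, hc]; simp
    rcases mul_eq_zero.1 this with h7 | h7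
    · exact absurd h7 (by positivity)
    · exact h7
  obtain ⟨w, hw⟩ := key
  obtain ⟨D, z, hD, hz⟩ := clear_denoms w
  refine ⟨D, z, by exact_mod_cast hD, fun u => ?_⟩
  rw [bl_expand, Finset.mul_sum]
  refine Finset.sum_congr rfl fun j _ => ?_
  have h1 : (bl s t z (al j) : ℚ) = D * c j := by
    rw [hG]; push_cast
    simp only [hz]
    rw [← congrFun hw j, hBa, Finset.mul_sum]
    exact Finset.sum_congr rfl fun i _ => by ring
  have h2 : bl s t z (al j) = D * c j := by exact_mod_cast h1
  rw [h2]; ring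

theorem Aff.bounded (h : Aff s t δ) (H : ℤ) (hH : 0 < H) (c : V → ℤ)
    (hc : ∑ i, c i * δ i = 0) : ∃ C : ℤ, ∀ u, -C ≤ H * eu s t u u + ∑ i, c i * u i := by
  obtain ⟨N, w, hN, hw⟩ := h.fredholm c hc
  refine ⟨eu s t w w, fun u => ?_⟩
  have h1 := h.psd ((H * N) • u + w)
  rw [eu_self_add, eu_self_smul, bl_smul_left, bl_comm, ← hw] at h1
  have h2 := h.psd w
  have h3 : 1 ≤ H * N * N := by
    have : 0 < H * N * N := by positivity
    omega
  set X := H * eu s t u u + ∑ i, c i * u i with hX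
  have h4 : 0 ≤ H * N * N * X + eu s t w w := by
    rw [hX]; nlinarith
  by_contra hlt
  push Not at hlt
  nlinarith

theorem Aff.primitive (h : Aff s t δ) : ∃ f : V → ℤ, ∑ i, f i * δ i = 1 := by
  have hp := IsPrincipalIdealRing.principal (Ideal.span (Set.range δ))
  obtain ⟨g, hg⟩ := hp
  have h1 : ∀ i, g ∣ δ i := by
    intro i
    have : δ i ∈ Ideal.span (Set.range δ) := Ideal.subset_span ⟨i, rfl⟩
    rw [hg] at this
    exact Ideal.mem_span_singleton.1 this
  choose δ' hδ' using h1
  have hδ : δ = g • δ' := by funext i; simpa using hδ' i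
  obtain ⟨i0⟩ := h.ne
  have hg0 : g ≠ 0 := by
    rintro rfl
    have := h.pos i0
    rw [hδ' i0] at this; simp at this
  have h2 : ∃ m : ℤ, δ' = m • δ := by
    rw [← h.rad]
    intro y
    have := h.bl_delta y
    rw [hδ, bl_smul_left] at this
    exact (mul_eq_zero.1 this).resolve_left hg0
  obtain ⟨m, hm⟩ := h2
  have h3 : g * m = 1 := by
    have h4 := hδ' i0
    rw [hm] at h4
    simp only [Pi.smul_apply, smul_eq_mul] at h4
    have := h.pos i0
    have : δ i0 * (g * m - 1) = 0 := by linear_combination -h4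
    rcases mul_eq_zero.1 this with h5 | h5 <;> omega
  have h4 : (1 : ℤ) ∈ Ideal.span (Set.range δ) := by
    rw [hg]; exact Ideal.mem_span_singleton.2 ⟨m, h3.symm⟩
  exact (Ideal.mem_span_range_iff_exists_fun.1 h4)

theorem Aff.exists_one (h : Aff s t δ) : ∃ i, δ i = 1 := by
  obtain ⟨f, hf⟩ := h.primitive
  obtain ⟨i0⟩ := h.ne
  set H := ∑ i, δ i with hH
  have hHp : 0 < H := Finset.sum_pos (fun i _ => h.pos i) ⟨i0, Finset.mem_univ _⟩
  let c : V → ℤ := fun i => H * f i - 1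
  obtain ⟨C, hC⟩ := h.bounded H hHp c (by
    simp only [c, sub_mul, one_mul, Finset.sum_sub_distrib, mul_assoc]
    rw [← Finset.mul_sum, hf, ← hH]; ring)
  let Ψ : (V → ℤ) → ℤ := fun u => H * eu s t u u + ∑ i, c i * u i
  obtain ⟨u, -, hu⟩ := (measure fun u => (Ψ u + C).toNat).wf.has_min Set.univ ⟨0, trivial⟩
  have hmin : ∀ v, Ψ u ≤ Ψ v := by
    intro v
    have h1 := hu v trivial
    have h2 := hC u
    have h3 := hC v
    change ¬ (Ψ v + C).toNat < (Ψ u + C).toNat at h1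
    change -C ≤ Ψ u at h2
    change -C ≤ Ψ v at h3
    omega
  let fu : V → ℤ := fun i => f i + bl s t u (al i)
  have hfu : ∀ i, 0 ≤ fu i := by
    intro i
    have h1 := hmin (u + (-fu i) • al i)
    have h2 : Ψ (u + (-fu i) • al i) = Ψ u + fu i := by
      simp only [Ψ]
      rw [eu_self_add, eu_self_smul, h.eu_al, bl_smul_right]
      have : ∑ j, c j * (u + (-fu i) • al i) j = ∑ j, c j * u j - fu i * c i := by
        simp [mul_add, Finset.sum_add_distrib, al, Pi.single_apply]; ring
      rw [this]
      simp only [c]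
      have hb : bl s t u (al i) = fu i - f i := by simp [fu]
      rw [hb]; ring
    omega
  have hsum : ∑ i, fu i * δ i = 1 := by
    simp only [fu, add_mul, Finset.sum_add_distrib]
    rw [hf]
    have : ∑ x, bl s t u (al x) * δ x = bl s t u δ := by
      rw [bl_expand]; exact Finset.sum_congr rfl fun i _ => mul_comm _ _
    rw [this, bl_comm, h.bl_delta, add_zero]
  by_contra hne
  push Not at hne
  have h2 : ∀ i, fu i = 0 := by
    intro i
    have h3 : fu i * δ i ≤ 1 := by
      rw [← hsum]
      exact Finset.single_le_sum (f := fun i => fu i * δ i)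
        (fun j _ => mul_nonneg (hfu j) (h.pos j).le) (Finset.mem_univ i)
    have h4 := hfu i
    have h5 := h.pos i
    have h6 := hne i
    by_contra h7
    have : 1 ≤ fu i := by omega
    have : 2 ≤ δ i := by omega
    nlinarith
  simp [h2] at hsum

end numerics

end

end KacAff


namespace KacAff

noncomputable section

open Module

set_option linter.all false

section refl

variable {V A : Type} [Fintype V] [DecidableEq V] {s t : A → V} {k : Type} [Field k]

/-- reflected source -/
def rs (s t : A → V) (i : V) (a : A) : V := if s a = i then t a else s a
/-- reflected target -/
def rt (s t : A → V) (i : V) (a : A) : V := if s a = i then i else t a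

/-- relations submodule -/
def rR (M : Obj s t k) (i : V) : Submodule k (M × (A → M)) where
  carrier := {z | (∀ j, j ≠ i → pe s t k j • z.1 = 0) ∧
    ∃ m : M, ∀ a, s a = i → pe s t k (t a) • z.2 a = px s t k a • m}
  add_mem' := by
    rintro z w ⟨h1, m, h2⟩ ⟨h3, n, h4⟩
    refine ⟨fun j hj => by simp [h1 j hj, h3 j hj], m + n, fun a ha => ?_⟩
    simp [h2 a ha, h4 a ha]
  zero_mem' := ⟨by simp, 0, by simp⟩
  smul_mem' := by
    rintro c z ⟨h1, m, h2⟩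
    refine ⟨fun j hj => ?_, c • m, fun a ha => ?_⟩
    · simp [pa_smul, h1 j hj]
    · simp [pa_smul, h2 a ha]

/-- vertex maps -/
def rE0 (M : Obj s t k) (i j : V) : (M × (A → M)) →ₗ[k] (M × (A → M)) :=
  if j = i then LinearMap.inr k _ _ ∘ₗ LinearMap.snd k _ _
  else LinearMap.inl k _ _ ∘ₗ act M (pe s t k j) ∘ₗ LinearMap.fst k _ _

open Classical in
/-- arrow maps -/
def rX0 (M : Obj s t k) (i : V) (a : A) : (M × (A → M)) →ₗ[k] (M × (A → M)) :=
  if s a = i then LinearMap.inr k _ _ ∘ₗ LinearMap.single k (fun _ : A => M.carrier) a ∘ₗ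
    act M (pe s t k (t a)) ∘ₗ LinearMap.fst k _ _
  else LinearMap.inl k _ _ ∘ₗ act M (px s t k a) ∘ₗ LinearMap.fst k _ _

theorem rE0_same (M : Obj s t k) (i : V) (z : M × (A → M)) : rE0 M i i z = (0, z.2) := by
  simp [rE0]
theorem rE0_ne (M : Obj s t k) {i j : V} (h : j ≠ i) (z : M × (A → M)) :
    rE0 M i j z = (pe s t k j • z.1, 0) := by
  simp [rE0, h]
open Classical in
theorem rX0_same (M : Obj s t k) {i : V} {a : A} (h : s a = i) (z : M × (A → M)) :
    rX0 M i a z = (0, Pi.single a (pe s t k (t a) • z.1)) := by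
  simp only [rX0, h, if_true]; rfl
theorem rX0_ne (M : Obj s t k) {i : V} {a : A} (h : s a ≠ i) (z : M × (A → M)) :
    rX0 M i a z = (px s t k a • z.1, 0) := by
  simp [rX0, h]

theorem rE0_mem (M : Obj s t k) (i j : V) : rR M i ≤ (rR M i).comap (rE0 M i j) := by
  rintro z ⟨h1, m, h2⟩
  rw [Submodule.mem_comap]
  by_cases h : j = i
  · subst h; rw [rE0_same]; exact ⟨by simp, m, h2⟩
  · rw [rE0_ne M h, h1 j h]; exact (rR M i).zero_mem

theorem rX0_mem (M : Obj s t k) (i : V) (hi : ∀ a, t a ≠ i) (a : A) :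
    rR M i ≤ (rR M i).comap (rX0 M i a) := by
  rintro z ⟨h1, m, h2⟩
  rw [Submodule.mem_comap]
  by_cases h : s a = i
  · classical
    rw [rX0_same M h, h1 _ (hi a), Pi.single_zero]; exact (rR M i).zero_mem
  · rw [rX0_ne M h, ← px_pe, h1 _ h, smul_zero]; exact (rR M i).zero_mem

/-- reflected module data -/
def rData (M : Obj s t k) (i : V) (hi : ∀ a, t a ≠ i) :
    ModData (rs s t i) (rt s t i) k ((M × (A → M)) ⧸ rR M i) where
  E j := (rR M i).mapQ (rR M i) (rE0 M i j) (rE0_mem M i j)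
  X a := (rR M i).mapQ (rR M i) (rX0 M i a) (rX0_mem M i hi a)
  idem j := by
    refine Submodule.linearMap_qext _ (LinearMap.ext fun z => ?_)
    change Submodule.Quotient.mk (rE0 M i j (rE0 M i j z)) = Submodule.Quotient.mk (rE0 M i j z)
    by_cases h : j = i
    · subst h; simp [rE0_same]
    · simp [rE0_ne M h, pe_pe]
  orth j l hjl := by
    refine Submodule.linearMap_qext _ (LinearMap.ext fun z => ?_)
    change Submodule.Quotient.mk (rE0 M i j (rE0 M i l z)) = 0
    have : rE0 M i j (rE0 M i l z) = 0 := by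
      by_cases h : j = i
      · subst h
        simp [rE0_same, rE0_ne M (Ne.symm hjl)]
      · by_cases h' : l = i
        · subst h'; simp [rE0_same, rE0_ne M h]
        · simp [rE0_ne M h, rE0_ne M h', pe_pe_ne hjl]
    rw [this]; rfl
  one := by
    refine Submodule.linearMap_qext _ (LinearMap.ext fun z => ?_)
    have : (∑ j, (rR M i).mapQ (rR M i) (rE0 M i j) (rE0_mem M i j)) ∘ₗ (rR M i).mkQ =
        (rR M i).mkQ ∘ₗ ∑ j, rE0 M i j := by
      refine LinearMap.ext fun z => ?_
      simp [LinearMap.sum_apply]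
    rw [this]
    change Submodule.Quotient.mk ((∑ j, rE0 M i j) z) = Submodule.Quotient.mk z
    rw [Submodule.Quotient.eq]
    have h2 : (∑ j, rE0 M i j) z = (z.1 - pe s t k i • z.1, z.2) := by
      rw [LinearMap.sum_apply, ← Finset.add_sum_erase _ _ (Finset.mem_univ i), rE0_same]
      have : ∀ j ∈ Finset.univ.erase i, rE0 M i j z = (pe s t k j • z.1, 0) := fun j hj =>
        rE0_ne M (Finset.ne_of_mem_erase hj) z
      rw [Finset.sum_congr rfl this]
      have h3 : ∑ j ∈ Finset.univ.erase i, pe s t k j • z.1 = z.1 - pe s t k i • z.1 := by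
        rw [eq_sub_iff_add_eq, add_comm, Finset.add_sum_erase _ (fun j => pe s t k j • z.1)
          (Finset.mem_univ i), sum_pe]
      apply Prod.ext
      · simp [Prod.fst_sum, h3]; exact sum_pe z.1
      · simp [Prod.snd_sum]
    rw [h2]
    refine ⟨fun j hj => ?_, 0, fun a ha => ?_⟩
    · simp [pe_pe_ne hj]
    · simp
  src a := by
    refine Submodule.linearMap_qext _ (LinearMap.ext fun z => ?_)
    change Submodule.Quotient.mk (rX0 M i a (rE0 M i (rs s t i a) z)) =
      Submodule.Quotient.mk (rX0 M i a z)
    congr 1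
    by_cases h : s a = i
    · simp [rs, h, rX0_same, rE0_ne M (hi a), pe_pe]
    · simp [rs, h, rX0_ne, rE0_ne M h, px_pe]
  tgt a := by
    refine Submodule.linearMap_qext _ (LinearMap.ext fun z => ?_)
    change Submodule.Quotient.mk (rE0 M i (rt s t i a) (rX0 M i a z)) =
      Submodule.Quotient.mk (rX0 M i a z)
    congr 1
    by_cases h : s a = i
    · simp [rt, h, rX0_same, rE0_same]
    · simp [rt, h, rX0_ne, rE0_ne M (hi a), pe_px]

variable [Fintype A]

/-- reflected object -/
def rF (M : Obj s t k) (i : V) (hi : ∀ a, t a ≠ i) : Obj (rs s t i) (rt s t i) k :=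
  mkObj (rData M i hi)

/-- projection -/
def rπ (M : Obj s t k) (i : V) (hi : ∀ a, t a ≠ i) : (M × (A → M)) →ₗ[k] rF M i hi :=
  (mkEqv (rData M i hi)).toLinearMap ∘ₗ (rR M i).mkQ

theorem rπ_surj (M : Obj s t k) (i : V) (hi : ∀ a, t a ≠ i) (z : rF M i hi) :
    ∃ w, rπ M i hi w = z := by
  obtain ⟨w, hw⟩ := Submodule.mkQ_surjective _ ((mkEqv (rData M i hi)).symm z)
  exact ⟨w, by
    change (mkEqv (rData M i hi)) ((rR M i).mkQ w) = z
    rw [hw]; exact (mkEqv (rData M i hi)).apply_symm_apply z⟩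

theorem rπ_zero (M : Obj s t k) (i : V) (hi : ∀ a, t a ≠ i) (z) :
    rπ M i hi z = 0 ↔ z ∈ rR M i := by
  change (mkEqv (rData M i hi)) ((rR M i).mkQ z) = 0 ↔ _
  rw [LinearEquiv.map_eq_zero_iff, Submodule.mkQ_apply, Submodule.Quotient.mk_eq_zero]

theorem rπ_E (M : Obj s t k) (i : V) (hi : ∀ a, t a ≠ i) (j : V) (z) :
    pe (rs s t i) (rt s t i) k j • rπ M i hi z = rπ M i hi (rE0 M i j z) := by
  exact pe_mkEqv (rData M i hi) j _
theorem rπ_X (M : Obj s t k) (i : V) (hi : ∀ a, t a ≠ i) (a : A) (z) :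
    px (rs s t i) (rt s t i) k a • rπ M i hi z = rπ M i hi (rX0 M i a z) := by
  exact px_mkEqv (rData M i hi) a _

/-- the basic map -/
def rκ (M : Obj s t k) (i : V) (hi : ∀ a, t a ≠ i) : M →ₗ[k] rF M i hi :=
  rπ M i hi ∘ₗ LinearMap.inl k _ _

theorem rκ_def (M : Obj s t k) (i : V) (hi : ∀ a, t a ≠ i) (m : M) :
    rκ M i hi m = rπ M i hi (m, 0) := rfl

theorem rκ_zero (M : Obj s t k) (i : V) (hi : ∀ a, t a ≠ i) (m : M) :
    rκ M i hi m = 0 ↔ pe s t k i • m = m := by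
  rw [rκ_def, rπ_zero]
  constructor
  · rintro ⟨h1, -⟩
    conv_rhs => rw [← sum_pe m]
    rw [Finset.sum_eq_single i (fun j _ hj => h1 j hj) (by simp)]
  · intro h
    refine ⟨fun j hj => ?_, 0, by simp⟩
    rw [← h, pe_pe_ne hj]

theorem rκ_pe_same (M : Obj s t k) (i : V) (hi : ∀ a, t a ≠ i) (m : M) :
    pe (rs s t i) (rt s t i) k i • rκ M i hi m = 0 := by
  rw [rκ_def, rπ_E, rE0_same]; exact map_zero _
theorem rκ_pe_ne (M : Obj s t k) (i : V) (hi : ∀ a, t a ≠ i) {j : V} (h : j ≠ i) (m : M) :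
    pe (rs s t i) (rt s t i) k j • rκ M i hi m = rκ M i hi (pe s t k j • m) := by
  rw [rκ_def, rπ_E, rE0_ne M h]; rfl
theorem rκ_px_ne (M : Obj s t k) (i : V) (hi : ∀ a, t a ≠ i) {a : A} (h : s a ≠ i) (m : M) :
    px (rs s t i) (rt s t i) k a • rκ M i hi m = rκ M i hi (px s t k a • m) := by
  rw [rκ_def, rπ_X, rX0_ne M h]; rfl
theorem rκ_pei (M : Obj s t k) (i : V) (hi : ∀ a, t a ≠ i) (m : M) :
    rκ M i hi (pe s t k i • m) = 0 := (rκ_zero M i hi _).2 (pe_pe i m)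

open Classical in
theorem rX_sum (M : Obj s t k) (i : V) (hi : ∀ a, t a ≠ i) (w : A → M) :
    ∑ a with s a = i, px (rs s t i) (rt s t i) k a • rκ M i hi (w a) = rπ M i hi (0, w) := by
  have h1 : ∀ a ∈ Finset.univ.filter (fun a => s a = i),
      px (rs s t i) (rt s t i) k a • rκ M i hi (w a) =
      rπ M i hi (0, Pi.single a (pe s t k (t a) • w a)) := by
    intro a ha
    rw [rκ_def, rπ_X, rX0_same M (Finset.mem_filter.1 ha).2]
  rw [Finset.sum_congr rfl h1, ← map_sum, ← sub_eq_zero, ← map_sub, rπ_zero]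
  refine ⟨fun j hj => by simp [Prod.fst_sum], 0, fun b hb => ?_⟩
  simp only [Prod.snd_sub, Pi.sub_apply, Prod.snd_sum, Finset.sum_apply, smul_zero]
  rw [Finset.sum_eq_single b]
  · simp [smul_sub, pe_pe]
  · intro a _ ha
    simp [Pi.single_apply, ha.symm]
  · simp [hb]

open Classical in
theorem rX_span (M : Obj s t k) (i : V) (hi : ∀ a, t a ≠ i) (z : rF M i hi) :
    ∃ (m : M) (w : A → M), z = rκ M i hi m +
      ∑ a with s a = i, px (rs s t i) (rt s t i) k a • rκ M i hi (w a) := by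
  obtain ⟨⟨m, w⟩, rfl⟩ := rπ_surj M i hi z
  refine ⟨m, w, ?_⟩
  rw [rX_sum, rκ_def, ← map_add]; simp

open Classical in
theorem rX_zero (M : Obj s t k) (i : V) (hi : ∀ a, t a ≠ i) (w : A → M) :
    ∑ a with s a = i, px (rs s t i) (rt s t i) k a • rκ M i hi (w a) = 0 ↔
      ∃ m : M, ∀ a, s a = i → pe s t k (t a) • w a = px s t k a • m := by
  rw [rX_sum, rπ_zero]
  constructor
  · rintro ⟨-, h⟩; exact h
  · intro h; exact ⟨by simp, h⟩

/-- functoriality -/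
def rMap {M N : Obj s t k} (i : V) (hi : ∀ a, t a ≠ i) (f : M →ₗ[PA s t k] N) :
    (M × (A → M)) ⧸ rR M i →ₗ[k] (N × (A → N)) ⧸ rR N i :=
  (rR M i).mapQ (rR N i)
    ((f.restrictScalars k).prodMap ((f.restrictScalars k).compLeft A)) (by
      rintro z ⟨h1, m, h2⟩
      refine ⟨fun j hj => ?_, f m, fun a ha => ?_⟩
      · change pe s t k j • f z.1 = 0
        rw [← map_smul, h1 j hj, map_zero]
      · change pe s t k (t a) • f (z.2 a) = _
        rw [← map_smul, h2 a ha, map_smul])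

/-- functoriality, k-linear version on objects -/
def rMapk {M N : Obj s t k} (i : V) (hi : ∀ a, t a ≠ i) (f : M →ₗ[PA s t k] N) :
    rF M i hi →ₗ[k] rF N i hi :=
  (mkEqv (rData N i hi)).toLinearMap ∘ₗ rMap i hi f ∘ₗ (mkEqv (rData M i hi)).symm.toLinearMap

theorem rMapk_π {M N : Obj s t k} (i : V) (hi : ∀ a, t a ≠ i) (f : M →ₗ[PA s t k] N) (z) :
    rMapk i hi f (rπ M i hi z) = rπ N i hi (f z.1, fun a => f (z.2 a)) := by
  change (mkEqv (rData N i hi)) (rMap i hi f ((mkEqv (rData M i hi)).symm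
    (mkEqv (rData M i hi) ((rR M i).mkQ z)))) = _
  rw [LinearEquiv.symm_apply_apply]; rfl

/-- functor on maps -/
def rFmap {M N : Obj s t k} (i : V) (hi : ∀ a, t a ≠ i) (f : M →ₗ[PA s t k] N) :
    rF M i hi →ₗ[PA (rs s t i) (rt s t i) k] rF N i hi :=
  mkHom (rMapk i hi f)
    (by
      intro j z
      obtain ⟨w, rfl⟩ := rπ_surj M i hi z
      rw [rπ_E, rMapk_π, rMapk_π, rπ_E]
      congr 1
      by_cases h : j = i
      · subst h; simp [rE0_same]
      · simp [rE0_ne _ h]; rfl)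
    (by
      intro a z
      obtain ⟨w, rfl⟩ := rπ_surj M i hi z
      rw [rπ_X, rMapk_π, rMapk_π, rπ_X]
      congr 1
      by_cases h : s a = i
      · simp [rX0_same _ h]
        funext b
        by_cases hb : b = a
        · subst hb; simp
        · simp [hb]
      · simp [rX0_ne _ h]; rfl)

theorem rFmap_κ {M N : Obj s t k} (i : V) (hi : ∀ a, t a ≠ i) (f : M →ₗ[PA s t k] N) (m : M) :
    rFmap i hi f (rκ M i hi m) = rκ N i hi (f m) := by
  change rMapk i hi f (rπ M i hi (m, 0)) = _
  rw [rMapk_π, rκ_def]; congr 1; simp; rfl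

/-- the source map is injective at i -/
def SInj (M : Obj s t k) (i : V) : Prop :=
  ∀ m : M, pe s t k i • m = m → (∀ a, s a = i → px s t k a • m = 0) → m = 0

theorem rF_hom_le {M N : Obj s t k} (i : V) (hi : ∀ a, t a ≠ i) (hN : SInj N i) :
    hom M N ≤ hom (rF M i hi) (rF N i hi) := by
  let F : (M →ₗ[PA s t k] N) →ₗ[k] (rF M i hi →ₗ[PA (rs s t i) (rt s t i) k] rF N i hi) :=
    { toFun := rFmap i hi
      map_add' := by
        intro f g; ext z
        obtain ⟨w, rfl⟩ := rπ_surj M i hi z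
        change rMapk i hi (f + g) _ = rMapk i hi f _ + rMapk i hi g _
        rw [rMapk_π, rMapk_π, rMapk_π, ← map_add]; rfl
      map_smul' := by
        intro c f; ext z
        obtain ⟨w, rfl⟩ := rπ_surj M i hi z
        change rMapk i hi (c • f) _ = c • rMapk i hi f _
        rw [rMapk_π, rMapk_π, ← map_smul]; rfl }
  have hF : Function.Injective F := by
    rw [injective_iff_map_eq_zero]
    intro f hf
    have h1 : ∀ m, pe s t k i • f m = f m := by
      intro m
      rw [← rκ_zero N i hi, ← rFmap_κ]
      exact LinearMap.congr_fun hf _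
    ext m
    refine hN _ (h1 m) ?_
    intro a ha
    rw [← map_smul, ← h1, map_smul, pe_px_ne (hi a).symm]
  have := LinearMap.finrank_le_finrank_of_injective hF
  simp only [hom]; exact_mod_cast this

/-- indecomposability -/
def Indec (M : Obj s t k) : Prop :=
  Nontrivial M ∧ ∀ U W : Submodule (PA s t k) M, IsCompl U W → U = ⊥ ∨ W = ⊥

end refl

end

end KacAff


namespace KacAff

noncomputable section

open Module

set_option linter.all false

section refl

variable {V A : Type} [Fintype V] [DecidableEq V] {s t : A → V} {k : Type} [Field k] [Fintype A]

theorem rF_lift (M : Obj s t k) (i : V) (hi : ∀ a, t a ≠ i) {j : V} (hj : j ≠ i) (z : rF M i hi) :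
    ∃ m : M, pe s t k j • m = m ∧ pe (rs s t i) (rt s t i) k j • z = rκ M i hi m := by
  classical
  obtain ⟨m, w, rfl⟩ := rX_span M i hi z
  refine ⟨pe s t k j • m, pe_pe j m, ?_⟩
  rw [smul_add, rκ_pe_ne M i hi hj, Finset.smul_sum, Finset.sum_eq_zero, add_zero]
  intro a ha
  apply pe_px_ne
  simp only [rt, (Finset.mem_filter.1 ha).2, if_true]; exact hj

theorem rκ_inj (M : Obj s t k) (i : V) (hi : ∀ a, t a ≠ i) {j : V} (hj : j ≠ i) {m : M}
    (hm : pe s t k j • m = m) (h : rκ M i hi m = 0) : m = 0 := by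
  rw [rκ_zero] at h
  rw [← h, ← hm, pe_pe_ne hj.symm]

theorem rκ_all (M : Obj s t k) (i : V) (hi : ∀ a, t a ≠ i)
    (U : Submodule (PA (rs s t i) (rt s t i) k) (rF M i hi)) (h : ∀ m, rκ M i hi m ∈ U) : U = ⊤ := by
  classical
  rw [eq_top_iff]
  rintro z -
  obtain ⟨m, w, rfl⟩ := rX_span M i hi z
  exact U.add_mem (h m) (U.sum_mem fun a _ => U.smul_mem _ (h _))

/-- pullback submodule -/
def rU (M : Obj s t k) (i : V) (hi : ∀ a, t a ≠ i)
    (U : Submodule (PA (rs s t i) (rt s t i) k) (rF M i hi)) : Submodule (PA s t k) M :=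
  mkSub (M := M) (
    { carrier := {m | rκ M i hi m ∈ U ∧ ∀ a, s a = i → rκ M i hi (px s t k a • m) ∈ U}
      add_mem' := by
        rintro x y ⟨h1, h2⟩ ⟨h3, h4⟩
        refine ⟨?_, fun a ha => ?_⟩
        · rw [map_add]; exact U.add_mem h1 h3
        · rw [smul_add, map_add]; exact U.add_mem (h2 a ha) (h4 a ha)
      zero_mem' := by simp
      smul_mem' := by
        rintro c x ⟨h1, h2⟩
        refine ⟨?_, fun a ha => ?_⟩
        · rw [map_smul]; exact (U.restrictScalars k).smul_mem c h1
        · rw [pa_smul, map_smul]; exact (U.restrictScalars k).smul_mem c (h2 a ha) } : Submodule k M)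
    (by
      rintro j m ⟨h1, h2⟩
      by_cases h : j = i
      · subst h
        refine ⟨by rw [rκ_pei]; exact U.zero_mem, fun a ha => ?_⟩
        subst ha; rw [px_pe]; exact h2 a rfl
      · refine ⟨by rw [← rκ_pe_ne M i hi h]; exact U.smul_mem _ h1, fun a ha => ?_⟩
        rw [px_pe_ne (by rw [ha]; exact h), map_zero]; exact U.zero_mem)
    (by
      rintro b m ⟨h1, h2⟩
      refine ⟨?_, fun a ha => ?_⟩
      · by_cases h : s b = i
        · exact h2 b h
        · rw [← rκ_px_ne M i hi h]; exact U.smul_mem _ h1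
      · rw [← px_pe, ha, pe_px_ne (hi b).symm, smul_zero, map_zero]; exact U.zero_mem)

theorem mem_rU (M : Obj s t k) (i : V) (hi : ∀ a, t a ≠ i) (U) (m : M) :
    m ∈ rU M i hi U ↔ rκ M i hi m ∈ U ∧ ∀ a, s a = i → rκ M i hi (px s t k a • m) ∈ U := by
  exact Iff.rfl

theorem rsplit (M : Obj s t k) (i : V) (hi : ∀ a, t a ≠ i)
    {U W : Submodule (PA (rs s t i) (rt s t i) k) (rF M i hi)} (h : IsCompl U W)
    {j : V} (hj : j ≠ i) {m : M} (hm : pe s t k j • m = m) :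
    ∃ p q : M, pe s t k j • p = p ∧ pe s t k j • q = q ∧ rκ M i hi p ∈ U ∧ rκ M i hi q ∈ W ∧
      m = p + q := by
  have h1 : rκ M i hi m ∈ U ⊔ W := by rw [h.sup_eq_top]; trivial
  obtain ⟨u, hu, w, hw, huw⟩ := Submodule.mem_sup.1 h1
  obtain ⟨p, hp, hp'⟩ := rF_lift M i hi hj u
  obtain ⟨q, hq, hq'⟩ := rF_lift M i hi hj w
  refine ⟨p, q, hp, hq, ?_, ?_, ?_⟩
  · rw [← hp']; exact U.smul_mem _ hu
  · rw [← hq']; exact W.smul_mem _ hw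
  · rw [← sub_eq_zero]
    apply rκ_inj M i hi hj
    · rw [smul_sub, smul_add, hm, hp, hq]
    · rw [map_sub, map_add, ← hp', ← hq', ← smul_add, huw, rκ_pe_ne M i hi hj, hm, sub_self]

theorem rU_compl (M : Obj s t k) (i : V) (hi : ∀ a, t a ≠ i) (hM : SInj M i)
    {U W : Submodule (PA (rs s t i) (rt s t i) k) (rF M i hi)} (h : IsCompl U W) :
    IsCompl (rU M i hi U) (rU M i hi W) := by
  classical
  constructor
  · rw [Submodule.disjoint_def]
    rintro m ⟨h1, h2⟩ ⟨h3, h4⟩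
    have h0 := Submodule.disjoint_def.1 h.disjoint
    have h5 := (rκ_zero M i hi m).1 (h0 _ h1 h3)
    refine hM m h5 fun a ha => ?_
    have h6 := (rκ_zero M i hi _).1 (h0 _ (h2 a ha) (h4 a ha))
    rw [← h6, pe_px_ne (hi a).symm]
  · rw [codisjoint_iff, eq_top_iff]
    rintro m -
    rw [← sum_pe m]
    refine Submodule.sum_mem _ fun j _ => ?_
    by_cases hj : j = i
    · subst hj
      have hx : ∀ a, s a = j → ∃ p q : M, pe s t k (t a) • p = p ∧ pe s t k (t a) • q = q ∧
          rκ M j hi p ∈ U ∧ rκ M j hi q ∈ W ∧ px s t k a • m = p + q := fun a ha =>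
        rsplit M j hi h (hi a) (pe_px a m)
      choose! p q hp hq hpU hqW hpq using hx
      have e1 : ∑ a with s a = j, px (rs s t j) (rt s t j) k a • rκ M j hi (p a) +
          ∑ a with s a = j, px (rs s t j) (rt s t j) k a • rκ M j hi (q a) = 0 := by
        rw [← (rX_zero M j hi (fun a => px s t k a • m)).2 ⟨m, fun a ha => pe_px a m⟩,
          ← Finset.sum_add_distrib]
        refine Finset.sum_congr rfl fun a ha => ?_
        rw [hpq a (Finset.mem_filter.1 ha).2, map_add, smul_add]
      have e2 : ∑ a with s a = j, px (rs s t j) (rt s t j) k a • rκ M j hi (p a) ∈ U :=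
        U.sum_mem fun a ha => U.smul_mem _ (hpU a (Finset.mem_filter.1 ha).2)
      have e3 : ∑ a with s a = j, px (rs s t j) (rt s t j) k a • rκ M j hi (q a) ∈ W :=
        W.sum_mem fun a ha => W.smul_mem _ (hqW a (Finset.mem_filter.1 ha).2)
      have e4 : ∑ a with s a = j, px (rs s t j) (rt s t j) k a • rκ M j hi (p a) = 0 := by
        refine Submodule.disjoint_def.1 h.disjoint _ e2 ?_
        rw [eq_neg_of_add_eq_zero_left e1]; exact W.neg_mem e3
      have e5 : ∑ a with s a = j, px (rs s t j) (rt s t j) k a • rκ M j hi (q a) = 0 := by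
        rw [e4, zero_add] at e1; exact e1
      obtain ⟨mu, hmu⟩ := (rX_zero M j hi p).1 e4
      obtain ⟨mw, hmw⟩ := (rX_zero M j hi q).1 e5
      have e6 : pe s t k j • m = pe s t k j • mu + pe s t k j • mw := by
        rw [← sub_eq_zero]
        refine hM _ ?_ ?_
        · simp only [smul_sub, smul_add, pe_pe]
        · intro a ha
          subst ha
          simp only [smul_sub, smul_add, px_pe]
          rw [← hmu a rfl, ← hmw a rfl, hp a rfl, hq a rfl, hpq a rfl, sub_self]
      rw [e6]
      refine Submodule.add_mem_sup ?_ ?_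
      · rw [mem_rU]
        refine ⟨by rw [rκ_pei]; exact U.zero_mem, fun a ha => ?_⟩
        subst ha; rw [px_pe, ← hmu a rfl, hp a rfl]; exact hpU a rfl
      · rw [mem_rU]
        refine ⟨by rw [rκ_pei]; exact W.zero_mem, fun a ha => ?_⟩
        subst ha; rw [px_pe, ← hmw a rfl, hq a rfl]; exact hqW a rfl
    · obtain ⟨p, q, hp, hq, hpU, hqW, e⟩ := rsplit M i hi h hj (pe_pe j m)
      rw [e]
      refine Submodule.add_mem_sup ?_ ?_
      · rw [mem_rU]
        refine ⟨hpU, fun a ha => ?_⟩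
        rw [← hp, px_pe_ne (by rw [ha]; exact hj), map_zero]; exact U.zero_mem
      · rw [mem_rU]
        refine ⟨hqW, fun a ha => ?_⟩
        rw [← hq, px_pe_ne (by rw [ha]; exact hj), map_zero]; exact W.zero_mem

theorem rF_indec (M : Obj s t k) (i : V) (hi : ∀ a, t a ≠ i) (hM : SInj M i) (h : Indec M) :
    Indec (rF M i hi) := by
  obtain ⟨h0, h⟩ := h
  have key : ∀ U W : Submodule (PA (rs s t i) (rt s t i) k) (rF M i hi), IsCompl U W →
      rU M i hi U = ⊥ → U = ⊥ := by
    intro U W hc hU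
    have h2 := rU_compl M i hi hM hc
    have h3 : rU M i hi W = ⊤ := by rw [hU] at h2; exact eq_top_of_bot_isCompl h2
    have h4 : W = ⊤ := rκ_all M i hi W fun m => by
      have : m ∈ rU M i hi W := by rw [h3]; trivial
      exact this.1
    rw [h4] at hc; exact eq_bot_of_isCompl_top hc
  refine ⟨?_, fun U W hc => ?_⟩
  · by_contra hn
    rw [not_nontrivial_iff_subsingleton] at hn
    obtain ⟨m, hm⟩ := exists_ne (0 : M)
    refine hm (hM m ((rκ_zero M i hi m).1 (Subsingleton.elim _ _)) fun a ha => ?_)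
    rw [← (rκ_zero M i hi (px s t k a • m)).1 (Subsingleton.elim _ _), pe_px_ne (hi a).symm]
  · rcases h _ _ (rU_compl M i hi hM hc) with h1 | h1
    · exact Or.inl (key U W hc h1)
    · exact Or.inr (key W U hc.symm h1)

open Classical in
/-- reflected dimension vector -/
def rr (s t : A → V) (i : V) (x : V → ℤ) : V → ℤ :=
  Function.update x i ((∑ a with s a = i, x (t a)) - x i)

theorem rr_ne {i j : V} (h : j ≠ i) (x : V → ℤ) : rr s t i x j = x j := by
  simp [rr, h]
open Classical in
theorem rr_same {i : V} (x : V → ℤ) : rr s t i x i = (∑ a with s a = i, x (t a)) - x i := by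
  simp [rr]

theorem rr_rr {i : V} (hi : ∀ a, t a ≠ i) (x : V → ℤ) : rr s t i (rr s t i x) = x := by
  classical
  funext j
  by_cases h : j = i
  · subst h
    rw [rr_same, rr_same]
    simp [rr_ne (hi _)]
  · rw [rr_ne h, rr_ne h]

theorem rr_eu {i : V} (hi : ∀ a, t a ≠ i) (x y : V → ℤ) :
    eu (rs s t i) (rt s t i) (rr s t i x) (rr s t i y) = eu s t x y := by
  classical
  simp only [eu]
  rw [← Finset.add_sum_erase _ (fun j => rr s t i x j * rr s t i y j) (Finset.mem_univ i),
    ← Finset.add_sum_erase _ (fun j => x j * y j) (Finset.mem_univ i)]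
  have h1 : ∑ j ∈ Finset.univ.erase i, rr s t i x j * rr s t i y j =
      ∑ j ∈ Finset.univ.erase i, x j * y j := Finset.sum_congr rfl fun j hj => by
    rw [rr_ne (Finset.ne_of_mem_erase hj), rr_ne (Finset.ne_of_mem_erase hj)]
  rw [h1, ← Finset.sum_filter_add_sum_filter_not Finset.univ (fun a => s a = i)
    (fun a => rr s t i x (rs s t i a) * rr s t i y (rt s t i a)),
    ← Finset.sum_filter_add_sum_filter_not Finset.univ (fun a => s a = i)
    (fun a => x (s a) * y (t a))]
  have h2 : ∑ a with s a = i, rr s t i x (rs s t i a) * rr s t i y (rt s t i a) =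
      (∑ a with s a = i, x (t a)) * rr s t i y i := by
    rw [Finset.sum_mul]
    refine Finset.sum_congr rfl fun a ha => ?_
    have := (Finset.mem_filter.1 ha).2
    simp only [rs, rt, this, if_true]; rw [rr_ne (hi a)]
  have h3 : ∑ a with ¬ s a = i, rr s t i x (rs s t i a) * rr s t i y (rt s t i a) =
      ∑ a with ¬ s a = i, x (s a) * y (t a) := by
    refine Finset.sum_congr rfl fun a ha => ?_
    have := (Finset.mem_filter.1 ha).2
    simp only [rs, rt, this, if_false]; rw [rr_ne (hi a), rr_ne this]
  have h4 : ∑ a with s a = i, x (s a) * y (t a) = x i * ∑ a with s a = i, y (t a) := by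
    rw [Finset.mul_sum]
    refine Finset.sum_congr rfl fun a ha => ?_
    rw [(Finset.mem_filter.1 ha).2]
  rw [h2, h3, h4, rr_same, rr_same]
  ring

theorem eu_right_al {i : V} (hi : ∀ a, t a ≠ i) (x : V → ℤ) : eu s t x (al i) = x i := by
  simp [eu, al, Pi.single_apply, hi]

theorem eu_left_al {i : V} (y : V → ℤ) [DecidablePred fun a => s a = i] :
    eu s t (al i) y = y i - ∑ a with s a = i, y (t a) := by
  simp [eu, al, Pi.single_apply, Finset.sum_filter]

theorem rr_eq {i : V} (hi : ∀ a, t a ≠ i) (x : V → ℤ) :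
    rr s t i x = x - bl s t x (al i) • al i := by
  classical
  funext j
  by_cases h : j = i
  · subst h
    rw [rr_same]
    rw [Pi.sub_apply, Pi.smul_apply, bl, eu_right_al hi, eu_left_al]
    simp [al]
  · simp [rr_ne h, al, h]

theorem rr_delta {δ : V → ℤ} {i : V} (hi : ∀ a, t a ≠ i) (h : ∀ y, bl s t δ y = 0) :
    rr s t i δ = δ := by
  rw [rr_eq hi, h]; simp

theorem rr_bl_delta {δ : V → ℤ} {i : V} (hi : ∀ a, t a ≠ i) (h : ∀ y, bl s t δ y = 0) (y : V → ℤ) :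
    bl (rs s t i) (rt s t i) δ y = 0 := by
  rw [← rr_delta hi h, ← rr_rr hi y, bl, rr_eu hi, rr_eu hi]
  exact h _

theorem rr_df {δ : V → ℤ} {i : V} (hi : ∀ a, t a ≠ i) (h : ∀ y, bl s t δ y = 0) (y : V → ℤ) :
    eu (rs s t i) (rt s t i) δ (rr s t i y) = eu s t δ y := by
  conv_lhs => rw [← rr_delta hi h]
  rw [rr_eu hi]

theorem rF_dim_ne (M : Obj s t k) (i : V) (hi : ∀ a, t a ≠ i) {j : V} (hj : j ≠ i) :
    dim (rF M i hi) j = dim M j := by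
  simp only [dim]
  congr 1
  symm
  let f : cmp M j →ₗ[k] cmp (rF M i hi) j :=
    (rκ M i hi).restrict (by
      intro m hm
      rw [mem_cmp] at hm ⊢
      rw [rκ_pe_ne M i hi hj, hm])
  refine (LinearEquiv.ofBijective f ⟨?_, ?_⟩).finrank_eq
  · rw [injective_iff_map_eq_zero]
    rintro ⟨m, hm⟩ h
    apply Subtype.ext
    exact rκ_inj M i hi hj (mem_cmp.1 hm) (congrArg Subtype.val h)
  · rintro ⟨z, hz⟩
    obtain ⟨m, hm, h⟩ := rF_lift M i hi hj z
    refine ⟨⟨m, mem_cmp.2 hm⟩, Subtype.ext ?_⟩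
    change rκ M i hi m = z
    rw [← h, mem_cmp.1 hz]

theorem rF_dim_same (M : Obj s t k) (i : V) (hi : ∀ a, t a ≠ i) (hM : SInj M i) :
    dim (rF M i hi) i = rr s t i (dim M) i := by
  classical
  rw [rr_same]
  let f : cmp M i →ₗ[k] (Π a : {a // s a = i}, cmp M (t a.1)) :=
    LinearMap.pi fun a => (act M (px s t k a.1)).restrict (fun m _ => px_mem_cmp a.1 m)
  let W := Π a : {a // s a = i}, cmp M (t a.1)
  let ex : W →ₗ[k] (A → M) := LinearMap.pi fun a =>
    if h : s a = i then (cmp M (t a)).subtype ∘ₗ LinearMap.proj (⟨a, h⟩ : {a // s a = i}) else 0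
  have ex_apply : ∀ (w : W) a (h : s a = i), ex w a = w ⟨a, h⟩ := by
    intro w a h; simp [ex, h]; rfl
  let g : W →ₗ[k] cmp (rF M i hi) i :=
    (rπ M i hi ∘ₗ LinearMap.inr k _ _ ∘ₗ ex).codRestrict _ (by
      intro w
      rw [mem_cmp]
      change _ • rπ M i hi (0, ex w) = rπ M i hi (0, ex w)
      rw [rπ_E, rE0_same])
  have hf : Function.Injective f := by
    rw [injective_iff_map_eq_zero]
    rintro ⟨m, hm⟩ h
    apply Subtype.ext
    refine hM m (mem_cmp.1 hm) fun a ha => ?_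
    exact congrArg Subtype.val (congrFun h ⟨a, ha⟩)
  have hg : Function.Surjective g := by
    rintro ⟨z, hz⟩
    obtain ⟨m, w, rfl⟩ := rX_span M i hi z
    refine ⟨fun a => ⟨pe s t k (t a.1) • w a.1, pe_mem_cmp _ _⟩, Subtype.ext ?_⟩
    change rπ M i hi (0, ex _) = rκ M i hi m + _
    rw [← mem_cmp.1 hz, smul_add, rκ_pe_same, zero_add]
    change rπ M i hi (0, ex _) = _
    rw [← rX_sum, Finset.smul_sum]
    refine Finset.sum_congr rfl fun a ha => ?_
    have ha' := (Finset.mem_filter.1 ha).2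
    rw [ex_apply _ a ha', ← rκ_pe_ne M i hi (hi a)]
    have h1 : pe (rs s t i) (rt s t i) k i • px (rs s t i) (rt s t i) k a • rκ M i hi (w a) =
        px (rs s t i) (rt s t i) k a • rκ M i hi (w a) := by
      have : rt s t i a = i := by simp [rt, ha']
      have h0 : ∀ j, j = rt s t i a → pe (rs s t i) (rt s t i) k j •
          px (rs s t i) (rt s t i) k a • rκ M i hi (w a) =
          px (rs s t i) (rt s t i) k a • rκ M i hi (w a) := by
        rintro _ rfl; exact pe_px _ _
      exact h0 i this.symm
    rw [h1]
    have : rs s t i a = t a := by simp [rs, ha']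
    rw [← this, px_pe]
  have hker : LinearMap.ker g = LinearMap.range f := by
    ext w
    rw [LinearMap.mem_ker, LinearMap.mem_range]
    have e : g w = 0 ↔ rπ M i hi (0, ex w) = 0 := by
      constructor
      · intro h; exact congrArg Subtype.val h
      · intro h; exact Subtype.ext h
    rw [e, ← rX_sum, rX_zero]
    constructor
    · rintro ⟨m, hm⟩
      refine ⟨⟨pe s t k i • m, pe_mem_cmp _ _⟩, ?_⟩
      funext a
      apply Subtype.ext
      change px s t k a.1 • pe s t k i • m = _
      obtain ⟨a, rfl⟩ := a
      rw [px_pe, ← hm a rfl, ex_apply w a rfl]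
      exact mem_cmp.1 (w ⟨a, rfl⟩).2
    · rintro ⟨⟨m, hm⟩, rfl⟩
      refine ⟨m, fun a ha => ?_⟩
      rw [ex_apply _ a ha]
      exact pe_px a m
  have h1 := LinearMap.finrank_range_add_finrank_ker g
  rw [LinearMap.range_eq_top.2 hg, finrank_top, hker, LinearMap.finrank_range_of_inj hf,
    finrank_pi_fintype] at h1
  have h2 : (∑ a with s a = i, dim M (t a)) = ∑ a : {a // s a = i}, dim M (t a.1) :=
    Finset.sum_subtype _ (by simp) _
  rw [h2]
  simp only [dim]
  rw [← Nat.cast_sum, ← h1]; push_cast; ring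

theorem rF_dim (M : Obj s t k) (i : V) (hi : ∀ a, t a ≠ i) (hM : SInj M i) :
    dim (rF M i hi) = rr s t i (dim M) := by
  funext j
  by_cases h : j = i
  · subst h; exact rF_dim_same M j hi hM
  · rw [rr_ne h, rF_dim_ne M i hi h]

theorem dim_of_not_SInj (M : Obj s t k) (i : V) (hi : ∀ a, t a ≠ i) (hI : Indec M)
    (hM : ¬ SInj M i) : dim M = al i := by
  simp only [SInj] at hM
  push Not at hM
  obtain ⟨n, hn, hx, hn0⟩ := hM
  obtain ⟨ψ, hψ⟩ : ∃ ψ : M →ₗ[k] k, ψ n = 1 := by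
    obtain ⟨f, hf⟩ : ∃ f : Module.Dual k M, f n ≠ 0 := by
      by_contra hcon
      push Not at hcon
      exact hn0 ((Module.forall_dual_apply_eq_zero_iff k n).1 hcon)
    exact ⟨(f n)⁻¹ • f, by simp [hf]⟩
  let U : Submodule (PA s t k) M := mkSub (M := M) (Submodule.span k {n})
    (by
      intro j m hm
      obtain ⟨c, rfl⟩ := Submodule.mem_span_singleton.1 hm
      rw [pa_smul]
      by_cases h : j = i
      · subst h; rw [hn]; exact hm
      · rw [← hn, pe_pe_ne h, smul_zero]; exact Submodule.zero_mem _)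
    (by
      intro a m hm
      obtain ⟨c, rfl⟩ := Submodule.mem_span_singleton.1 hm
      rw [pa_smul]
      by_cases h : s a = i
      · rw [hx a h, smul_zero]; exact Submodule.zero_mem _
      · rw [← hn, px_pe_ne (Ne.symm h), smul_zero]; exact Submodule.zero_mem _)
  let W : Submodule (PA s t k) M := mkSub (M := M) (LinearMap.ker (ψ ∘ₗ act M (pe s t k i)))
    (by
      intro j m hm
      change ψ (pe s t k i • pe s t k j • m) = 0
      by_cases h : j = i
      · subst h; rw [pe_pe]; exact hm
      · rw [pe_pe_ne (Ne.symm h), map_zero])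
    (by
      intro a m hm
      change ψ (pe s t k i • px s t k a • m) = 0
      rw [pe_px_ne (hi a).symm, map_zero])
  have hc : IsCompl U W := by
    constructor
    · rw [Submodule.disjoint_def]
      intro m hm hm'
      obtain ⟨c, rfl⟩ := Submodule.mem_span_singleton.1 (show m ∈ Submodule.span k {n} from hm)
      have h3 : ψ (pe s t k i • c • n) = 0 := hm'
      rw [pa_smul, hn, map_smul, hψ] at h3
      simp at h3; simp [h3]
    · rw [codisjoint_iff, eq_top_iff]
      rintro m -
      rw [show m = ψ (pe s t k i • m) • n + (m - ψ (pe s t k i • m) • n) by abel]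
      refine Submodule.add_mem_sup ?_ ?_
      · exact Submodule.smul_mem (Submodule.span k {n}) _ (Submodule.mem_span_singleton_self n)
      · change ψ (pe s t k i • (m - _)) = 0
        rw [smul_sub, pa_smul, hn, map_sub, LinearMap.map_smul ψ, hψ]; simp
  have hW : W = ⊥ := by
    refine (hI.2 U W hc).resolve_left fun h => hn0 ?_
    have : n ∈ U := Submodule.mem_span_singleton_self n
    rw [h] at this; exact this
  have hU : ∀ m : M, m ∈ Submodule.span k {n} := by
    intro m
    have : U = ⊤ := by rw [hW] at hc; exact eq_top_of_isCompl_bot hc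
    have h2 : m ∈ U := by rw [this]; trivial
    exact h2
  funext j
  by_cases h : j = i
  · subst h
    have : cmp M j = Submodule.span k {n} := by
      apply le_antisymm
      · intro m _; exact hU m
      · rw [Submodule.span_singleton_le_iff_mem, mem_cmp]; exact hn
    change (finrank k (cmp M j) : ℤ) = _
    rw [this, finrank_span_singleton hn0]; simp [al]
  · have : cmp M j = ⊥ := by
      rw [eq_bot_iff]
      rintro m hm
      obtain ⟨c, rfl⟩ := Submodule.mem_span_singleton.1 (hU m)
      rw [mem_cmp] at hm
      rw [Submodule.mem_bot, ← hm, pa_smul, ← hn, pe_pe_ne h, smul_zero]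
    simp [dim, this, al, h]

end refl

end

end KacAff


namespace KacAff

noncomputable section

open Module

set_option linter.all false

section claim

variable {V A : Type} [Fintype V] [DecidableEq V] {s t : A → V} {k : Type} [Field k] [Fintype A]
variable {δ : V → ℤ}

/-- the vanishing claim for indecomposables of dimension β -/
def Cl (s t : A → V) (k : Type) [Field k] (δ β : V → ℤ) : Prop :=
  ∀ U : Obj s t k, Indec U → dim U = β → 0 < eu s t δ β →
    eu s t β β = 1 ∧ ∀ Y : Obj s t k, Indec Y → eu s t δ (dim Y) ≤ 0 → hom U Y = 0 ∧ ext Y U = 0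

theorem Cl_step {i : V} {β : V → ℤ} (hi : ∀ a, t a ≠ i) (hδ : ∀ y, bl s t δ y = 0)
    (hpos : ∀ j, 0 < δ j) (h : Cl (rs s t i) (rt s t i) k δ (rr s t i β)) : Cl s t k δ β := by
  intro U hU hdim hdf
  have hY : ∀ Y : Obj s t k, Indec Y → eu s t δ (dim Y) ≤ 0 → SInj Y i := by
    intro Y hY hd
    by_contra hn
    rw [dim_of_not_SInj Y i hi hY hn, eu_right_al hi] at hd
    exact absurd (hpos i) (not_lt.2 hd)
  by_cases hS : SInj U i
  · obtain ⟨h1, h2⟩ := h (rF U i hi) (rF_indec U i hi hS hU) (by rw [rF_dim U i hi hS, hdim])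
      (by rw [rr_df hi hδ]; exact hdf)
    rw [rr_eu hi] at h1
    refine ⟨h1, fun Y hIY hd => ?_⟩
    have hSY := hY Y hIY hd
    obtain ⟨h3, h4⟩ := h2 (rF Y i hi) (rF_indec Y i hi hSY hIY)
      (by rw [rF_dim Y i hi hSY, rr_df hi hδ]; exact hd)
    have h5 := rF_hom_le (M := U) i hi hSY
    have h6 := rF_hom_le (M := Y) i hi hS
    have h7 := hom_nonneg U Y
    have h8 := ext_nonneg Y U
    have h9 := euler Y U
    have h10 := euler (rF Y i hi) (rF U i hi)
    rw [rF_dim U i hi hS, rF_dim Y i hi hSY, rr_eu hi] at h10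
    constructor <;> omega
  · have hd := dim_of_not_SInj U i hi hU hS
    have hβ : β = al i := by rw [← hdim, hd]
    have h0 : ∀ j, j ≠ i → ∀ u : U, pe s t k j • u = 0 := by
      intro j hj u
      have h1 : dim U j = 0 := by rw [hd]; simp [al, hj]
      have h2 : finrank k (cmp U j) = 0 := by simp only [dim] at h1; exact_mod_cast h1
      rw [Submodule.finrank_eq_zero] at h2
      have := pe_mem_cmp j u
      rw [h2] at this; exact this
    have h1 : ∀ u : U, pe s t k i • u = u := by
      intro u
      conv_rhs => rw [← sum_pe u]
      rw [Finset.sum_eq_single i (fun j _ hj => h0 j hj u) (by simp)]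
    refine ⟨by rw [hβ, eu_right_al hi]; simp [al], fun Y hIY hdY => ⟨?_, ?_⟩⟩
    · rw [hom_eq_zero_iff]
      intro f
      ext u
      refine hY Y hIY hdY _ (by rw [← map_smul, h1]) fun a ha => ?_
      rw [← map_smul, ← pe_px, h0 _ (hi a), map_zero]
    · rw [ext_eq_zero_iff]
      intro ξ
      obtain ⟨c, rfl⟩ := cls_surj ξ
      have : c = 0 := by
        apply Subtype.ext
        funext a
        ext m
        rw [← C1_tgt c.2, h0 _ (hi a)]; rfl
      rw [this, map_zero]

/-- intermediate sources -/
def stS (s t : A → V) {N : ℕ} (f : V ≃ Fin N) (r : ℕ) (a : A) : V :=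
  if (f (s a) : ℕ) < r ∧ r ≤ (f (t a) : ℕ) then t a else s a
/-- intermediate targets -/
def stT (s t : A → V) {N : ℕ} (f : V ≃ Fin N) (r : ℕ) (a : A) : V :=
  if (f (s a) : ℕ) < r ∧ r ≤ (f (t a) : ℕ) then s a else t a

/-- intermediate vectors -/
def be (s t : A → V) {N : ℕ} (f : V ≃ Fin N) (β : V → ℤ) : ℕ → V → ℤ
  | 0 => β
  | r + 1 => if h : r < N then rr (stS s t f r) (stT s t f r) (f.symm ⟨r, h⟩) (be s t f β r)
      else be s t f β r

variable {N : ℕ} {f : V ≃ Fin N}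


theorem st_src (hf : ∀ a, f (s a) < f (t a)) {r : ℕ} (h : r < N) (a : A) : stT s t f r a ≠ f.symm ⟨r, h⟩ := by
  have h1 : (f (s a) : ℕ) < f (t a) := hf a
  intro he
  have h2 : (f (stT s t f r a) : ℕ) = r := by rw [he]; simp
  simp only [stT] at h2
  split_ifs at h2 with h3
  · omega
  · push Not at h3; omega

theorem st_eq (hf : ∀ a, f (s a) < f (t a)) {r : ℕ} (h : r < N) (a : A) :
    stS s t f r a = f.symm ⟨r, h⟩ ↔ (f (s a) : ℕ) = r ∨ (f (t a) : ℕ) = r := by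
  have h1 : (f (s a) : ℕ) < f (t a) := hf a
  rw [Equiv.eq_symm_apply, Fin.ext_iff]
  simp only [stS]
  split_ifs with h3
  · constructor
    · intro h; exact Or.inr h
    · rintro h4; omega
  · push Not at h3
    constructor
    · intro h; exact Or.inl h
    · intro h4; by_contra; have := h3 (by omega); omega

theorem st_rs (hf : ∀ a, f (s a) < f (t a)) {r : ℕ} (h : r < N) :
    rs (stS s t f r) (stT s t f r) (f.symm ⟨r, h⟩) = stS s t f (r + 1) := by
  funext a
  have h1 : (f (s a) : ℕ) < f (t a) := hf a
  simp only [rs, st_eq hf h]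
  simp only [stS, stT]
  split_ifs <;> first | rfl | (exfalso; omega)

theorem st_rt (hf : ∀ a, f (s a) < f (t a)) {r : ℕ} (h : r < N) :
    rt (stS s t f r) (stT s t f r) (f.symm ⟨r, h⟩) = stT s t f (r + 1) := by
  funext a
  have h1 : (f (s a) : ℕ) < f (t a) := hf a
  simp only [rt, st_eq hf h]
  simp only [stT]
  split_ifs with h2 h3 <;> first | rfl | (exfalso; omega) | skip
  · rw [Equiv.symm_apply_eq, Fin.ext_iff]; simp; omega
  · rw [Equiv.symm_apply_eq, Fin.ext_iff]; simp; omega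

theorem st_delta (hf : ∀ a, f (s a) < f (t a)) (hδ : ∀ y, bl s t δ y = 0) (r : ℕ) (hr : r ≤ N) :
    ∀ y, bl (stS s t f r) (stT s t f r) δ y = 0 := by
  induction r with
  | zero =>
    have h1 : stS s t f 0 = s := by funext a; simp [stS]
    have h2 : stT s t f 0 = t := by funext a; simp [stT]
    rw [h1, h2]; exact hδ
  | succ r ih =>
    have h : r < N := hr
    intro y
    rw [← st_rs hf h, ← st_rt hf h]
    exact rr_bl_delta (st_src hf h) (ih h.le) y

theorem Cl_round (hf : ∀ a, f (s a) < f (t a)) {β : V → ℤ} (hδ : ∀ y, bl s t δ y = 0) (hpos : ∀ j, 0 < δ j)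
    (h : Cl s t k δ (be s t f β N)) : Cl s t k δ β := by
  have key : ∀ r, r ≤ N → Cl (stS s t f r) (stT s t f r) k δ (be s t f β r) → Cl s t k δ β := by
    intro r
    induction r with
    | zero =>
      intro _
      have h1 : stS s t f 0 = s := by funext a; simp [stS]
      have h2 : stT s t f 0 = t := by funext a; simp [stT]
      rw [h1, h2]; exact id
    | succ r ih =>
      intro hr hc
      have h : r < N := hr
      refine ih h.le (Cl_step (i := f.symm ⟨r, h⟩) (st_src hf h) (st_delta hf hδ r h.le) hpos ?_)
      rw [st_rs hf h, st_rt hf h]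
      simpa [be, h] using hc
  refine key N le_rfl ?_
  have h1 : stS s t f N = s := by funext a; simp [stS]
  have h2 : stT s t f N = t := by funext a; simp [stT]
  rw [h1, h2]; exact h

theorem be_low (hf : ∀ a, f (s a) < f (t a)) (β : V → ℤ) {r : ℕ} {j : V} (hj : r ≤ (f j : ℕ)) : be s t f β r j = β j := by
  induction r with
  | zero => rfl
  | succ r ih =>
    rw [be]
    split_ifs with h
    · rw [rr_ne, ih (by omega)]
      rintro rfl; simp at hj
    · exact ih (by omega)

theorem be_high (hf : ∀ a, f (s a) < f (t a)) (β : V → ℤ) {r : ℕ} {j : V} (hj : (f j : ℕ) < r) (d : ℕ) :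
    be s t f β (r + d) j = be s t f β r j := by
  induction d with
  | zero => rfl
  | succ d ih =>
    rw [← add_assoc, be]
    split_ifs with h
    · rw [rr_ne, ih]
      rintro rfl; simp at hj
    · exact ih

theorem be_rec (hf : ∀ a, f (s a) < f (t a)) (β : V → ℤ) (i : V) :
    eu s t (be s t f β N) (al i) = - eu s t (al i) β := by
  classical
  set r : ℕ := (f i : ℕ) with hr
  have hrN : r < N := (f i).2
  have hi : f.symm ⟨r, hrN⟩ = i := by rw [Equiv.symm_apply_eq]
  have hhigh : ∀ j r', (f j : ℕ) < r' → r' ≤ N → be s t f β N j = be s t f β r' j := by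
    intro j r' h h'
    obtain ⟨d, rfl⟩ := Nat.exists_eq_add_of_le h'
    exact be_high hf β h d
  have h1 : be s t f β N i = (∑ a with s a = i, β (t a)) +
      (∑ a with t a = i, be s t f β N (s a)) - β i := by
    rw [hhigh i (r + 1) (by omega) hrN, be, dif_pos hrN, hi, rr_same, be_low hf β (le_refl _)]
    congr 1
    have h2 : Finset.univ.filter (fun a => stS s t f r a = i) =
        Finset.univ.filter (fun a => s a = i) ∪ Finset.univ.filter (fun a => t a = i) := by
      ext a
      simp only [Finset.mem_filter, Finset.mem_univ, true_and, Finset.mem_union]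
      rw [← hi, st_eq hf hrN, Equiv.eq_symm_apply, Equiv.eq_symm_apply, Fin.ext_iff, Fin.ext_iff]
    have h3 : Disjoint (Finset.univ.filter (fun a => s a = i))
        (Finset.univ.filter (fun a => t a = i)) := by
      rw [Finset.disjoint_filter]
      intro a _ h4 h5
      have := hf a
      rw [h4, h5] at this; exact lt_irrefl _ this
    have h2' : (∑ a with stS s t f r a = i, be s t f β r (stT s t f r a)) =
      ∑ a ∈ Finset.univ.filter (fun a => s a = i) ∪ Finset.univ.filter (fun a => t a = i),
        be s t f β r (stT s t f r a) := by rw [← h2]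
    rw [h2', Finset.sum_union h3]
    congr 1
    · refine Finset.sum_congr rfl fun a ha => ?_
      have ha' := (Finset.mem_filter.1 ha).2
      have h5 : (f (s a) : ℕ) < f (t a) := hf a
      rw [ha'] at h5
      have : stT s t f r a = t a := by
        simp only [stT]; rw [if_neg]; rw [ha']; omega
      rw [this, be_low hf β (by omega)]
    · refine Finset.sum_congr rfl fun a ha => ?_
      have ha' := (Finset.mem_filter.1 ha).2
      have h5 : (f (s a) : ℕ) < f (t a) := hf a
      rw [ha'] at h5
      have : stT s t f r a = s a := by
        simp only [stT]; rw [if_pos]; rw [ha']; omega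
      rw [this, hhigh (s a) r (by omega) hrN.le]
  rw [eu_left_al]
  have h2 : eu s t (be s t f β N) (al i) = be s t f β N i - ∑ a with t a = i, be s t f β N (s a) := by
    simp [eu, al, Pi.single_apply, Finset.sum_filter]
  rw [h2, h1]; ring

theorem be_cox (hf : ∀ a, f (s a) < f (t a)) (β y : V → ℤ) : eu s t (be s t f β N) y = - eu s t y β := by
  conv_lhs => rw [sum_al y]
  conv_rhs => rw [sum_al y]
  rw [eu_sum_right, eu_sum_left, ← Finset.sum_neg_distrib]
  refine Finset.sum_congr rfl fun i _ => ?_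
  rw [eu_smul_right, eu_smul_left, be_rec hf]; ring


theorem cox_exit (h : Aff s t δ) (g : (V → ℤ) → V → ℤ)
    (hg : ∀ β y, eu s t (g β) y = - eu s t y β) (β : V → ℤ) (hβ : 0 < eu s t δ β) :
    ∃ n : ℕ, ∃ j, (g^[n] β) j < 0 := by
  by_contra hcon
  push Not at hcon
  have hs : ∀ n, g^[n+1] β = g (g^[n] β) := fun n => Function.iterate_succ_apply' g n β
  have hdf : ∀ n, eu s t δ (g^[n] β) = eu s t δ β := by
    intro n
    induction n with
    | zero => rfl
    | succ n ih =>
      rw [hs, ← ih]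
      have h1 := h.eu_delta_right (g (g^[n] β))
      rw [hg] at h1; omega
  have hq : ∀ n, eu s t (g^[n] β) (g^[n] β) = eu s t β β := by
    intro n
    induction n with
    | zero => rfl
    | succ n ih =>
      rw [hs, hg, hg, ih]
      ring
  obtain ⟨o⟩ := h.ne
  -- boundedness
  have hb : ∀ j, ∃ C : ℤ, ∀ n, -C ≤ δ o * (g^[n] β) j - δ j * (g^[n] β) o ∧
      δ o * (g^[n] β) j - δ j * (g^[n] β) o ≤ C := by
    intro j
    have e : ∀ u : V → ℤ, ∑ i, (δ o * (al j : V → ℤ) i - δ j * (al o : V → ℤ) i) * u i =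
        δ o * u j - δ j * u o := by
      intro u
      simp [sub_mul, Finset.sum_sub_distrib, al, Pi.single_apply, mul_assoc]
    have e' : ∀ u : V → ℤ, ∑ i, (-(δ o * (al j : V → ℤ) i - δ j * (al o : V → ℤ) i)) * u i =
        -(δ o * u j - δ j * u o) := by
      intro u
      rw [← e u, ← Finset.sum_neg_distrib]; exact Finset.sum_congr rfl fun i _ => by ring
    obtain ⟨C1, h1⟩ := h.bounded 1 one_pos (fun i => δ o * (al j : V → ℤ) i - δ j * (al o : V → ℤ) i)
      (by rw [e]; ring)
    obtain ⟨C2, h2⟩ := h.bounded 1 one_pos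
      (fun i => -(δ o * (al j : V → ℤ) i - δ j * (al o : V → ℤ) i)) (by rw [e']; ring)
    refine ⟨|C1| + |C2| + |eu s t β β|, fun n => ?_⟩
    have h3 := h1 (g^[n] β)
    have h4 := h2 (g^[n] β)
    rw [e, hq] at h3
    rw [e', hq] at h4
    have := le_abs_self C1
    have := le_abs_self C2
    have := le_abs_self (eu s t β β)
    have := abs_nonneg C1
    have := abs_nonneg C2
    constructor <;> linarith
  choose C hC using hb
  let F : ℕ → (Π j : V, Finset.Icc (-C j) (C j)) := fun n j =>
    ⟨δ o * (g^[n] β) j - δ j * (g^[n] β) o, Finset.mem_Icc.2 (hC j n)⟩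
  obtain ⟨y, hy⟩ := Finite.exists_infinite_fiber F
  have key : ∀ n p, 0 < p → F n = F (n + p) → (g^[n+p] β) o < (g^[n] β) o := by
    intro n p hp hF
    have h1 : ∀ j, δ o * (g^[n] β) j - δ j * (g^[n] β) o =
        δ o * (g^[n+p] β) j - δ j * (g^[n+p] β) o := fun j =>
      congrArg Subtype.val (congrFun hF j)
    obtain ⟨l, hl⟩ : ∃ l : ℤ, g^[n+p] β - g^[n] β = l • δ := by
      rw [← h.rad]
      intro y
      have h2 : δ o • (g^[n+p] β - g^[n] β) = ((g^[n+p] β - g^[n] β) o) • δ := by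
        funext j; simp; linarith [h1 j]
      have h3 := bl_smul_left (s := s) (t := t) (δ o) (g^[n+p] β - g^[n] β) y
      rw [h2, bl_smul_left, h.bl_delta, mul_zero] at h3
      exact (mul_eq_zero.1 h3.symm).resolve_left (h.pos o).ne'
    let Y : V → ℤ := ∑ j ∈ Finset.range p, g^[n+j] β
    have hY : eu s t (∑ j ∈ Finset.range p, g^[n+j+1] β) Y = - eu s t Y Y := by
      rw [eu_sum_left]
      conv_rhs => rw [show eu s t Y Y = ∑ j ∈ Finset.range p, eu s t Y (g^[n+j] β) from
        eu_sum_right _ _ _]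
      rw [← Finset.sum_neg_distrib]
      refine Finset.sum_congr rfl fun j _ => ?_
      rw [hs, hg]
    have hsum : ∑ j ∈ Finset.range p, g^[n+j+1] β = Y + l • δ := by
      rw [← hl]
      have h4 := Finset.sum_range_succ (fun j => g^[n+j] β) p
      rw [Finset.sum_range_succ'] at h4
      simp only [add_zero] at h4
      have : ∑ j ∈ Finset.range p, g^[n+j+1] β = ∑ j ∈ Finset.range p, g^[n+(j+1)] β := rfl
      rw [this, eq_sub_of_add_eq h4]
      abel
    rw [hsum, eu_add_left, eu_smul_left] at hY
    have hdY : eu s t δ Y = p * eu s t δ β := by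
      rw [eu_sum_right, Finset.sum_congr rfl fun j _ => hdf (n + j)]; simp
    have hpos : 0 < eu s t δ Y := by rw [hdY]; positivity
    have hneg : l < 0 := by
      by_contra hl0
      push Not at hl0
      have hq0 := h.psd Y
      have : eu s t Y Y = 0 := by nlinarith
      obtain ⟨m, hm⟩ := h.isotropic this
      rw [hm, eu_smul_right, h.eu_delta] at hpos
      simp at hpos
    have h5 := congrFun hl o
    simp at h5
    nlinarith [h.pos o]
  have h1 : Set.InjOn (fun n => (g^[n] β) o) (F ⁻¹' {y}) := by
    intro n hn m hm hnm
    have hn' : F n = y := hn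
    have hm' : F m = y := hm
    simp only at hnm
    rcases lt_trichotomy n m with h2 | h2 | h2
    · obtain ⟨p, rfl⟩ := Nat.exists_eq_add_of_lt h2
      have := key n (p + 1) (by omega) (by rw [hn', ← hm']; rfl)
      rw [← add_assoc] at this; omega
    · exact h2
    · obtain ⟨p, rfl⟩ := Nat.exists_eq_add_of_lt h2
      have := key m (p + 1) (by omega) (by rw [hm', ← hn']; rfl)
      rw [← add_assoc] at this; omega
  have hinf : (F ⁻¹' {y}).Infinite := Set.infinite_coe_iff.1 hy
  obtain ⟨n0, hn0⟩ := hinf.nonempty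
  have hn0' : F n0 = y := hn0
  have h2 : (F ⁻¹' {y} \ Set.Iio n0).Infinite := hinf.sdiff (Set.finite_Iio n0)
  refine h2 (Set.Finite.of_finite_image
    (Set.Finite.subset (Set.finite_Icc (0 : ℤ) ((g^[n0] β) o)) ?_) (h1.mono Set.diff_subset))
  rintro _ ⟨n, ⟨hn, hn2⟩, rfl⟩
  refine ⟨hcon n o, ?_⟩
  have hn' : F n = y := hn
  simp at hn2
  rcases hn2.eq_or_lt with h3 | h3
  · simp [h3]
  · obtain ⟨p, rfl⟩ := Nat.exists_eq_add_of_lt h3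
    exact (key n0 (p + 1) (by omega) (by rw [hn0', ← hn']; rfl)).le

theorem Aff.Cl (h : Aff s t δ) (k : Type) [Field k] (β : V → ℤ) : Cl s t k δ β := by
  obtain ⟨f, hf⟩ := h.idx
  by_cases hβ : 0 < eu s t δ β
  · obtain ⟨n, j, hj⟩ := cox_exit h (fun x => be s t f x (Fintype.card V)) (be_cox hf) β hβ
    have h1 : KacAff.Cl s t k δ ((fun x => be s t f x (Fintype.card V))^[n] β) := by
      intro U _ hd _
      rw [← hd] at hj
      exact absurd (dim_nonneg U j) (not_le.2 hj)
    clear hj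
    induction n with
    | zero => exact h1
    | succ n ih =>
      rw [Function.iterate_succ_apply'] at h1
      exact ih (Cl_round hf h.bl_delta h.pos h1)
  · intro U _ _ h2; exact absurd h2 hβ

end claim

end

end KacAff


namespace KacAff

noncomputable section

open Module

set_option linter.all false

section decomp

variable {V A : Type} [Fintype V] [DecidableEq V] {s t : A → V} {k : Type} [Field k] [Fintype A]
variable {δ : V → ℤ}

/-- defect of an object -/
def df (δ : V → ℤ) (M : Obj s t k) : ℤ := eu s t δ (dim M)

theorem df_eqv {M N : Obj s t k} (e : M ≃ₗ[PA s t k] N) : df δ M = df δ N := by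
  rw [df, df, dim_eqv e]
theorem df_prod (M N : Obj s t k) : df δ (M.prod N) = df δ M + df δ N := by
  rw [df, dim_prod, eu_add_right]; rfl
theorem df_sub_quot (M : Obj s t k) (U : Submodule (PA s t k) M) :
    df δ M = df δ (M.sub U) + df δ (M.quot U) := by
  rw [df, dim_sub_quot M U, eu_add_right]; rfl
theorem df_exact {L M N : Obj s t k} {f : L →ₗ[PA s t k] M} {g : M →ₗ[PA s t k] N}
    (hf : Function.Injective f) (hg : Function.Surjective g) (h : Function.Exact f g) :
    df δ M = df δ L + df δ N := by
  rw [df, dim_exact hf hg h, eu_add_right]; rfl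
theorem df_zero {M : Obj s t k} (h : Subsingleton M) : df δ M = 0 := by
  rw [df, (dim_eq_zero_iff M).2 h, eu_zero_right]

theorem finrank_prod' (M N : Obj s t k) :
    finrank k (M.prod N) = finrank k M + finrank k N := Module.finrank_prod

theorem finrank_eqv {M N : Obj s t k} (e : M ≃ₗ[PA s t k] N) : finrank k M = finrank k N :=
  (e.restrictScalars k).finrank_eq

theorem decomp_ind {P : Obj s t k → Prop} (h0 : ∀ M : Obj s t k, Subsingleton M → P M)
    (h1 : ∀ M, Indec M → P M)
    (h2 : ∀ (M X W : Obj s t k), (M ≃ₗ[PA s t k] X.prod W) → P X → P W → P M) (M) : P M := by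
  induction hn : finrank k M using Nat.strong_induction_on generalizing M with
  | _ n ih =>
  by_cases hs : Subsingleton M
  · exact h0 M hs
  by_cases hI : Indec M
  · exact h1 M hI
  rw [not_subsingleton_iff_nontrivial] at hs
  have : ∃ U W : Submodule (PA s t k) M, IsCompl U W ∧ U ≠ ⊥ ∧ W ≠ ⊥ := by
    by_contra hcon
    push Not at hcon
    refine hI ⟨hs, fun U W hc => ?_⟩
    by_cases hU : U = ⊥
    · exact Or.inl hU
    · exact Or.inr (hcon U W hc hU)
  obtain ⟨U, W, hc, hU, hW⟩ := this
  have e : (M.sub U).prod (M.sub W) ≃ₗ[PA s t k] M := Submodule.prodEquivOfIsCompl U W hc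
  have h3 := finrank_eqv e
  rw [finrank_prod'] at h3
  have pos : ∀ U : Submodule (PA s t k) M, U ≠ ⊥ → 0 < finrank k (M.sub U) := by
    intro U hU
    have : Nontrivial (M.sub U) := Submodule.nontrivial_iff_ne_bot.2 hU
    haveI := (M.sub U).fd
    exact Module.finrank_pos (R := k)
  have := pos U hU
  have := pos W hW
  exact h2 M (M.sub U) (M.sub W) e.symm (ih _ (by omega) _ rfl) (ih _ (by omega) _ rfl)

/-- retracts -/
def Ret (X M : Obj s t k) : Prop :=
  ∃ (i : X →ₗ[PA s t k] M) (p : M →ₗ[PA s t k] X), ∀ x, p (i x) = x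

theorem Ret.refl (X : Obj s t k) : Ret X X := ⟨LinearMap.id, LinearMap.id, fun _ => rfl⟩
theorem Ret.trans {X Y Z : Obj s t k} (h : Ret X Y) (h' : Ret Y Z) : Ret X Z := by
  obtain ⟨i, p, h⟩ := h
  obtain ⟨i', p', h'⟩ := h'
  exact ⟨i' ∘ₗ i, p ∘ₗ p', fun x => by simp [h', h]⟩
theorem Ret.left {X W M : Obj s t k} (e : M ≃ₗ[PA s t k] X.prod W) : Ret X M :=
  ⟨e.symm.toLinearMap ∘ₗ LinearMap.inl _ _ _, LinearMap.fst _ _ _ ∘ₗ e.toLinearMap,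
    fun x => by simp⟩
theorem Ret.right {X W M : Obj s t k} (e : M ≃ₗ[PA s t k] X.prod W) : Ret W M :=
  ⟨e.symm.toLinearMap ∘ₗ LinearMap.inr _ _ _, LinearMap.snd _ _ _ ∘ₗ e.toLinearMap,
    fun x => by simp⟩

theorem Ret.compl {X M : Obj s t k} (h : Ret X M) :
    ∃ W : Obj s t k, Nonempty (M ≃ₗ[PA s t k] X.prod W) := by
  obtain ⟨i, p, h⟩ := h
  refine ⟨M.sub (LinearMap.ker p), ⟨LinearEquiv.ofBijective
    (p.prod ((LinearMap.id - i ∘ₗ p).codRestrict (LinearMap.ker p) (by intro x; simp [h])))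
    ⟨?_, ?_⟩⟩⟩
  · rw [injective_iff_map_eq_zero]
    intro m hm
    have h1 : p m = 0 := congrArg Prod.fst hm
    have h2 : m - i (p m) = 0 := congrArg Subtype.val (congrArg Prod.snd hm)
    rw [h1, map_zero, sub_zero] at h2; exact h2
  · rintro ⟨x, ⟨w, hw⟩⟩
    rw [LinearMap.mem_ker] at hw
    refine ⟨i x + w, Prod.ext ?_ (Subtype.ext ?_)⟩
    · change p (i x + w) = x
      rw [map_add, h, hw, add_zero]
    · change (i x + w) - i (p (i x + w)) = w
      rw [map_add, h, hw, add_zero]; abel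

theorem Indec.ret {X M : Obj s t k} (hM : Indec M) (hX : Nontrivial X) (h : Ret X M) :
    Nonempty (X ≃ₗ[PA s t k] M) := by
  obtain ⟨i, p, h⟩ := h
  have hi : Function.Injective i := Function.LeftInverse.injective h
  have hc : IsCompl (LinearMap.range i) (LinearMap.ker p) := by
    constructor
    · rw [Submodule.disjoint_def]
      rintro _ ⟨x, rfl⟩ hx
      rw [LinearMap.mem_ker, h] at hx; rw [hx, map_zero]
    · rw [codisjoint_iff, eq_top_iff]
      rintro m -
      rw [show m = i (p m) + (m - i (p m)) by abel]
      exact Submodule.add_mem_sup ⟨_, rfl⟩ (by simp [h])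
  have : LinearMap.range i = ⊤ := by
    rcases hM.2 _ _ hc with h1 | h1
    · rw [LinearMap.range_eq_bot] at h1
      obtain ⟨x, hx⟩ := exists_ne (0 : X)
      exact absurd (hi (by rw [h1]; rfl : i x = i 0)) hx
    · rw [h1] at hc; exact eq_top_of_isCompl_bot hc
  exact ⟨LinearEquiv.ofBijective i ⟨hi, LinearMap.range_eq_top.1 this⟩⟩

theorem Indec.congr {X M : Obj s t k} (e : X ≃ₗ[PA s t k] M) (hX : Indec X) : Indec M := by
  refine ⟨e.symm.toEquiv.nontrivial_congr.2 hX.1, fun U W hc => ?_⟩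
  have := hX.2 (U.comap e.toLinearMap) (W.comap e.toLinearMap) (by
    have := (OrderIso.isCompl_iff (Submodule.orderIsoMapComap e.symm)).1 hc
    simpa [Submodule.map_equiv_eq_comap_symm] using this)
  have key : ∀ U : Submodule (PA s t k) M, U.comap e.toLinearMap = ⊥ → U = ⊥ := by
    intro U hU
    rw [eq_bot_iff]
    intro x hx
    have : e.symm x ∈ U.comap e.toLinearMap := by simpa using hx
    rw [hU] at this
    simpa using this
  exact this.imp (key U) (key W)

theorem exists_pos (M : Obj s t k) : 0 < df δ M → ∃ X, Indec X ∧ 0 < df δ X ∧ Ret X M := by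
  induction M using decomp_ind with
  | h0 M h => intro h1; rw [df_zero h] at h1; exact absurd h1 (lt_irrefl _)
  | h1 M h => intro h1; exact ⟨M, h, h1, Ret.refl M⟩
  | h2 M X W e hX hW =>
    intro h1
    rw [df_eqv e, df_prod] at h1
    by_cases h2 : 0 < df δ X
    · obtain ⟨Z, h3, h4, h5⟩ := hX h2
      exact ⟨Z, h3, h4, h5.trans (Ret.left e)⟩
    · obtain ⟨Z, h3, h4, h5⟩ := hW (by omega)
      exact ⟨Z, h3, h4, h5.trans (Ret.right e)⟩

theorem hom_prod_right (B X W : Obj s t k) : hom B (X.prod W) = hom B X + hom B W := by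
  have := (LinearMap.prodEquiv (R := PA s t k) (M := B) (M₂ := X) (M₃ := W) k).finrank_eq
  rw [Module.finrank_prod] at this
  simp only [hom]; rw [← Nat.cast_add, this]
theorem hom_prod_left (B X W : Obj s t k) : hom (X.prod W) B = hom X B + hom W B := by
  have := (LinearMap.coprodEquiv (R := PA s t k) (M := X) (M₂ := W) (M₃ := B) k).finrank_eq
  rw [Module.finrank_prod] at this
  simp only [hom]; rw [← Nat.cast_add, this]
theorem ext_prod_right (B X W : Obj s t k) : ext B (X.prod W) = ext B X + ext B W := by
  have h1 := euler B (X.prod W)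
  rw [dim_prod, eu_add_right, ← euler, ← euler, hom_prod_right] at h1; omega
theorem ext_prod_left (B X W : Obj s t k) : ext (X.prod W) B = ext X B + ext W B := by
  have h1 := euler (X.prod W) B
  rw [dim_prod, eu_add_left, ← euler, ← euler, hom_prod_left] at h1; omega

theorem hom_zero_left {M N : Obj s t k} (h : Subsingleton M) : hom M N = 0 := by
  rw [hom_eq_zero_iff]; intro f; ext x; rw [Subsingleton.elim x 0]; simp
theorem hom_zero_right {M N : Obj s t k} (h : Subsingleton N) : hom M N = 0 := by
  rw [hom_eq_zero_iff]; intro f; ext x; exact Subsingleton.elim _ _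
theorem ext_zero_left {M N : Obj s t k} (h : Subsingleton M) : ext M N = 0 := by
  have := euler M N
  rw [hom_zero_left h, (dim_eq_zero_iff M).2 h, eu_zero_left] at this; omega
theorem ext_zero_right {M N : Obj s t k} (h : Subsingleton N) : ext M N = 0 := by
  have := euler M N
  rw [hom_zero_right h, (dim_eq_zero_iff N).2 h, eu_zero_right] at this; omega

/-- all indecomposable summands have defect ≤ 0 -/
def NP (δ : V → ℤ) (M : Obj s t k) : Prop := ∀ X, Indec X → Ret X M → df δ X ≤ 0

theorem Aff.hom_zero (h : Aff s t δ) {B : Obj s t k} (hB : Indec B) (hB' : 0 < df δ B)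
    (M : Obj s t k) : NP δ M → hom B M = 0 := by
  induction M using decomp_ind with
  | h0 M hM => intro _; exact hom_zero_right hM
  | h1 M hM => intro h1; exact ((h.Cl k _ B hB rfl hB').2 M hM (h1 M hM (Ret.refl M))).1
  | h2 M X W e hX hW =>
    intro h1
    rw [hom_congr (LinearEquiv.refl _ _) e, hom_prod_right,
      hX fun Z hZ hr => h1 Z hZ (hr.trans (Ret.left e)),
      hW fun Z hZ hr => h1 Z hZ (hr.trans (Ret.right e)), add_zero]

theorem Aff.ext_zero (h : Aff s t δ) {Y : Obj s t k} (hY : Indec Y) (hY' : df δ Y ≤ 0)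
    (M : Obj s t k) : (∀ X, Indec X → Ret X M → 0 < df δ X) → ext Y M = 0 := by
  induction M using decomp_ind with
  | h0 M hM => intro _; exact ext_zero_right hM
  | h1 M hM => intro h1; exact ((h.Cl k _ M hM rfl (h1 M hM (Ret.refl M))).2 Y hY hY').2
  | h2 M X W e hX hW =>
    intro h1
    rw [ext_congr (LinearEquiv.refl _ _) e, ext_prod_right,
      hX fun Z hZ hr => h1 Z hZ (hr.trans (Ret.left e)),
      hW fun Z hZ hr => h1 Z hZ (hr.trans (Ret.right e)), add_zero]

theorem Aff.NP_le (h : Aff s t δ) {M B : Obj s t k} (hM : NP δ M) {f : B →ₗ[PA s t k] M}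
    (hf : Function.Injective f) : df δ B ≤ 0 := by
  by_contra hn
  push Not at hn
  obtain ⟨X, hX, hd, i, p, hip⟩ := exists_pos B hn
  have h1 := (hom_eq_zero_iff _ _).1 (h.hom_zero hX hd M hM) (f ∘ₗ i)
  obtain ⟨x, hx⟩ := @exists_ne _ hX.1 (0 : X)
  apply hx
  have h2 : f (i x) = f (i 0) := by rw [map_zero, map_zero]; exact LinearMap.congr_fun h1 x
  exact (Function.LeftInverse.injective hip) (hf h2)

/-- semistable of defect zero (regular) -/
def Reg (δ : V → ℤ) (M : Obj s t k) : Prop :=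
  df δ M = 0 ∧ ∀ U : Submodule (PA s t k) M, df δ (M.sub U) ≤ 0

theorem Aff.indec_reg (h : Aff s t δ) {M : Obj s t k} (hM : Indec M) (hd : df δ M = 0) : Reg δ M := by
  refine ⟨hd, fun U => h.NP_le (M := M) (f := U.subtype) ?_ U.subtype_injective⟩
  intro X hX hr
  obtain ⟨e⟩ := hM.ret hX.1 hr
  rw [df_eqv e, hd]

/-! generic modules -/

/-- zero-arrow module data -/
def zData (s t : A → V) (k : Type) [Field k] (d : V → ℕ) : ModData s t k (Π i, Fin (d i) → k) where
  E i := LinearMap.single k (fun i => Fin (d i) → k) i ∘ₗ LinearMap.proj i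
  X a := 0
  idem i := by
    refine LinearMap.ext fun x => ?_
    simp only [Module.End.mul_apply, LinearMap.comp_apply, LinearMap.proj_apply, LinearMap.coe_single]
    rw [Pi.single_eq_same]
  orth i j h := by
    refine LinearMap.ext fun x => ?_
    simp only [Module.End.mul_apply, LinearMap.comp_apply, LinearMap.proj_apply,
      LinearMap.coe_single, LinearMap.zero_apply]
    rw [Pi.single_eq_of_ne h, Pi.single_zero]
  one := by
    refine LinearMap.ext fun x => ?_
    simp only [LinearMap.sum_apply, LinearMap.comp_apply, LinearMap.proj_apply,
      LinearMap.coe_single, Module.End.one_apply]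
    exact Finset.univ_sum_single x
  src a := by simp
  tgt a := by simp

theorem exists_dim (d : V → ℤ) (hd : ∀ i, 0 ≤ d i) : ∃ M : Obj s t k, dim M = d := by
  let D := zData s t k (fun i => (d i).toNat)
  refine ⟨mkObj D, funext fun i => ?_⟩
  have e : (Fin (d i).toNat → k) ≃ₗ[k] cmp (mkObj D) i := by
    refine LinearEquiv.ofBijective
      ((((mkEqv D).toLinearMap ∘ₗ LinearMap.single k (fun i => Fin (d i).toNat → k) i)).codRestrict
      _ ?_) ⟨?_, ?_⟩
    · intro x
      rw [mem_cmp]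
      change pe s t k i • mkEqv D (Pi.single i x) = mkEqv D (Pi.single i x)
      rw [pe_mkEqv]
      congr 1
      change (Pi.single i ((Pi.single i x : Π i, Fin (d i).toNat → k) i) : Π i, Fin (d i).toNat → k) = _
      rw [Pi.single_eq_same]
    · intro x y hxy
      have := congrArg Subtype.val hxy
      have h2 := (mkEqv D).injective this
      exact Pi.single_injective i h2
    · rintro ⟨z, hz⟩
      obtain ⟨w, rfl⟩ := (mkEqv D).surjective z
      refine ⟨w i, Subtype.ext ?_⟩
      change mkEqv D (Pi.single i (w i)) = mkEqv D w
      rw [← mem_cmp.1 hz, pe_mkEqv]; rfl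
  simp only [dim]
  rw [← e.finrank_eq]
  simp [hd i]

/-- generic: minimal endomorphism ring -/
def Gen (M : Obj s t k) : Prop := ∀ N : Obj s t k, dim N = dim M → hom M M ≤ hom N N

theorem exists_gen (d : V → ℤ) (hd : ∀ i, 0 ≤ d i) : ∃ M : Obj s t k, dim M = d ∧ Gen M := by
  obtain ⟨M0, h0⟩ := exists_dim (s := s) (t := t) (k := k) d hd
  have hex : ∃ n : ℕ, ∃ M : Obj s t k, dim M = d ∧ finrank k (M →ₗ[PA s t k] M) = n :=
    ⟨_, M0, h0, rfl⟩
  classical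
  obtain ⟨M, hM, hn⟩ := Nat.find_spec hex
  refine ⟨M, hM, fun N hN => ?_⟩
  have := Nat.find_min' hex ⟨N, hN.trans hM, rfl⟩
  simp only [hom]; rw [hn]; exact_mod_cast this

theorem Gen.ext {M X W : Obj s t k} (hM : Gen M) (e : M ≃ₗ[PA s t k] X.prod W) : ext X W = 0 := by
  rw [ext_eq_zero_iff]
  intro ξ
  by_contra hξ
  obtain ⟨E, f, g, hE⟩ := exists_real X W ξ
  have h1 := hM E (by rw [hE.dim, dim_eqv e, dim_prod, add_comm])
  rw [hom_congr e e, hom_prod_left, hom_prod_right, hom_prod_right] at h1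
  have h2 := hom_sub_right E hE.exact hE.inj
  have h3 := hom_sub_left X hE.exact hE.surj
  have h4 : hom E W < hom X W + hom W W := by
    have e1 := LinearMap.finrank_range_add_finrank_ker (preH f W)
    have e2 : finrank k (LinearMap.ker (preH f W)) ≤ finrank k (X →ₗ[PA s t k] W) := by
      have : LinearMap.ker (preH f W) ≤ LinearMap.range (preH g W) := by
        intro u hu
        obtain ⟨v, hv⟩ := exact_desc hE.exact hE.surj u hu
        exact ⟨v, hv⟩
      exact (Submodule.finrank_mono this).trans (LinearMap.finrank_range_le _)
    have e3 : finrank k (LinearMap.range (preH f W)) < finrank k (W →ₗ[PA s t k] W) := by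
      apply Submodule.finrank_lt
      intro htop
      have : (LinearMap.id : W →ₗ[PA s t k] W) ∈ LinearMap.range (preH f W) := by
        rw [htop]; trivial
      obtain ⟨u, hu⟩ := this
      have := (hE.ext_iff W LinearMap.id).2 ⟨u, hu⟩
      rw [push_id] at this
      exact hξ this
    simp only [hom]
    have e4 : finrank k (E →ₗ[PA s t k] W) < finrank k (X →ₗ[PA s t k] W) +
      finrank k (W →ₗ[PA s t k] W) := by omega
    exact_mod_cast e4
  omega

theorem Aff.gen_reg (h : Aff s t δ) {M : Obj s t k} (hM : Gen M) (hd : df δ M = 0)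
    (hx : ∀ x : V → ℤ, eu s t x x = 1 → 0 < eu s t δ x → eu s t x (dim M) ≤ 0) : Reg δ M := by
  refine ⟨hd, fun U => h.NP_le (M := M) (f := U.subtype) ?_ U.subtype_injective⟩
  intro X hX hr
  by_contra hn
  push Not at hn
  obtain ⟨W, ⟨e⟩⟩ := hr.compl
  have h1 := hM.ext e
  have h2 := (h.Cl k _ X hX rfl hn).1
  have h3 := hx _ h2 hn
  rw [dim_eqv e, dim_prod, eu_add_right, h2, ← euler, h1] at h3
  have := hom_nonneg X W
  omega

theorem Aff.exists_reg_delta (h : Aff s t δ) (k : Type) [Field k] :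
    ∃ M : Obj s t k, dim M = δ ∧ Reg δ M := by
  obtain ⟨M, hM, hG⟩ := exists_gen (s := s) (t := t) (k := k) δ (fun i => (h.pos i).le)
  refine ⟨M, hM, h.gen_reg hG (by rw [df, hM, h.eu_delta]) fun x _ hx => ?_⟩
  rw [hM, h.eu_delta_right]; omega

theorem Aff.exists_reg (h : Aff s t δ) (k : Type) [Field k] (x : V → ℤ) (hx : eu s t δ x = 0) :
    ∃ N0 : ℤ, ∀ N, N0 ≤ N → ∃ M : Obj s t k, dim M = x + N • δ ∧ Reg δ M := by
  have e : ∀ u, ∑ i, (- eu s t (al i) x) * u i = - eu s t u x := by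
    intro u
    conv_rhs => rw [sum_al u]
    rw [eu_sum_left, ← Finset.sum_neg_distrib]
    exact Finset.sum_congr rfl fun i _ => by rw [eu_smul_left]; ring
  obtain ⟨C, hC⟩ := h.bounded 1 one_pos (fun i => - eu s t (al i) x) (by rw [e, hx, neg_zero])
  refine ⟨|C| + 1 + ∑ i, |x i|, fun N hN => ?_⟩
  have h1 : ∀ i, |x i| ≤ ∑ i, |x i| := fun i =>
    Finset.single_le_sum (f := fun i => |x i|) (fun j _ => abs_nonneg _) (Finset.mem_univ i)
  have hC0 := abs_nonneg C
  have hC1 := le_abs_self C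
  obtain ⟨o⟩ := h.ne
  have h1' : 0 ≤ ∑ i, |x i| := (abs_nonneg _).trans (h1 o)
  obtain ⟨M, hM, hG⟩ := exists_gen (s := s) (t := t) (k := k) (x + N • δ) (fun i => by
    simp only [Pi.add_apply, Pi.smul_apply, smul_eq_mul]
    have := neg_abs_le (x i)
    have := h1 i
    have := h.pos i
    nlinarith)
  refine ⟨M, hM, h.gen_reg hG ?_ fun u hu hdu => ?_⟩
  · rw [df, hM, eu_add_right, hx, eu_smul_right, h.eu_delta]; simp
  · rw [hM, eu_add_right, eu_smul_right, h.eu_delta_right]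
    have h2 := hC u
    rw [e, hu] at h2
    nlinarith

end decomp

end

end KacAff


namespace KacAff

noncomputable section

open Module

set_option linter.all false

section regular

variable {V A : Type} [Fintype V] [DecidableEq V] {s t : A → V} {k : Type} [Field k] [Fintype A]
variable {δ : V → ℤ}

theorem df_ker_range {M N : Obj s t k} (f : M →ₗ[PA s t k] N) :
    df δ M = df δ (M.sub (LinearMap.ker f)) + df δ (N.sub (LinearMap.range f)) := by
  rw [df, dim_ker_range f, eu_add_right]; rfl

/-- iso onto the range -/
def rangeEqv {M N : Obj s t k} (f : M →ₗ[PA s t k] N) (hf : Function.Injective f) :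
    M ≃ₗ[PA s t k] N.sub (LinearMap.range f) := LinearEquiv.ofInjective f hf

theorem dim_surj {M B : Obj s t k} {f : M →ₗ[PA s t k] B} (hf : Function.Surjective f) :
    dim M = dim (M.sub (LinearMap.ker f)) + dim B :=
  dim_exact (L := M.sub (LinearMap.ker f)) (LinearMap.ker f).subtype_injective hf
    (LinearMap.exact_subtype_ker_map f)

theorem df_surj {M B : Obj s t k} {f : M →ₗ[PA s t k] B} (hf : Function.Surjective f) :
    df δ M = df δ (M.sub (LinearMap.ker f)) + df δ B := by
  rw [df, dim_surj hf, eu_add_right]; rfl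

theorem finrank_surj {M B : Obj s t k} {f : M →ₗ[PA s t k] B} (hf : Function.Surjective f) :
    finrank k M = finrank k (M.sub (LinearMap.ker f)) + finrank k B := by
  have h1 := finrank_eq_sum M
  rw [dim_surj hf] at h1
  simp only [Pi.add_apply, Finset.sum_add_distrib] at h1
  rw [← finrank_eq_sum, ← finrank_eq_sum] at h1
  exact_mod_cast h1

theorem finrank_pos' {M : Obj s t k} (h : Nontrivial M) : 0 < finrank k M :=
  Module.finrank_pos (R := k)

theorem Reg.le_of_inj {M B : Obj s t k} (hM : Reg δ M) {f : B →ₗ[PA s t k] M}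
    (hf : Function.Injective f) : df δ B ≤ 0 := by
  rw [df_eqv (rangeEqv f hf)]; exact hM.2 _

theorem Reg.of_inj {M B : Obj s t k} (hM : Reg δ M) {f : B →ₗ[PA s t k] M}
    (hf : Function.Injective f) (hd : df δ B = 0) : Reg δ B :=
  ⟨hd, fun U => hM.le_of_inj (f := f ∘ₗ U.subtype) (hf.comp U.subtype_injective)⟩

theorem Reg.congr {M B : Obj s t k} (e : M ≃ₗ[PA s t k] B) (hM : Reg δ M) : Reg δ B :=
  hM.of_inj (f := e.symm.toLinearMap) e.symm.injective (by rw [← df_eqv e, hM.1])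

theorem Reg.sub {M : Obj s t k} (hM : Reg δ M) {U : Submodule (PA s t k) M}
    (hU : df δ (M.sub U) = 0) : Reg δ (M.sub U) := hM.of_inj U.subtype_injective hU

theorem Reg.nonneg_of_surj {M B : Obj s t k} (hM : Reg δ M) {f : M →ₗ[PA s t k] B}
    (hf : Function.Surjective f) : 0 ≤ df δ B := by
  have h1 := df_surj (δ := δ) hf
  have h2 := hM.2 (LinearMap.ker f)
  rw [hM.1] at h1; omega

/-- comap along a surjection: short exact sequence -/
theorem df_comap {M B : Obj s t k} {f : M →ₗ[PA s t k] B} (hf : Function.Surjective f)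
    (W : Submodule (PA s t k) B) :
    df δ (M.sub (W.comap f)) = df δ (M.sub (LinearMap.ker f)) + df δ (B.sub W) := by
  have hle : LinearMap.ker f ≤ W.comap f := fun x hx => by
    rw [LinearMap.mem_ker] at hx
    rw [Submodule.mem_comap, hx]; exact W.zero_mem
  refine df_exact (L := M.sub (LinearMap.ker f)) (M := M.sub (W.comap f)) (N := B.sub W)
    (f := Submodule.inclusion hle)
    (g := f.restrict (fun x hx => hx)) (Submodule.inclusion_injective _) ?_ ?_
  · rintro ⟨w, hw⟩
    obtain ⟨m, rfl⟩ := hf w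
    exact ⟨⟨m, hw⟩, rfl⟩
  · rintro ⟨m, hm⟩
    constructor
    · intro h
      exact ⟨⟨m, congrArg Subtype.val h⟩, rfl⟩
    · rintro ⟨⟨x, hx⟩, h⟩
      have : x = m := congrArg Subtype.val h
      subst this
      exact Subtype.ext hx

theorem Reg.of_surj {M B : Obj s t k} (hM : Reg δ M) {f : M →ₗ[PA s t k] B}
    (hf : Function.Surjective f) (hd : df δ B = 0) : Reg δ B := by
  refine ⟨hd, fun W => ?_⟩
  have h1 := df_comap (δ := δ) hf W
  have h2 := df_surj (δ := δ) hf
  have h3 := hM.2 (W.comap f)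
  rw [hM.1, hd] at h2
  omega

theorem Reg.quot {M : Obj s t k} (hM : Reg δ M) {U : Submodule (PA s t k) M}
    (hU : df δ (M.sub U) = 0) : Reg δ (M.quot U) :=
  hM.of_surj (B := M.quot U) (f := U.mkQ) U.mkQ_surjective (by
    have := df_sub_quot (δ := δ) M U
    rw [hM.1, hU] at this; omega)

theorem Reg.exact {L M N : Obj s t k} {f : L →ₗ[PA s t k] M} {g : M →ₗ[PA s t k] N}
    (hf : Function.Injective f) (hg : Function.Surjective g) (h : Function.Exact f g)
    (hL : Reg δ L) (hN : Reg δ N) : Reg δ M := by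
  refine ⟨by rw [df_exact hf hg h, hL.1, hN.1, add_zero], fun U => ?_⟩
  have h1 := df_ker_range (δ := δ) (M := M.sub U) (g ∘ₗ U.subtype)
  have h2 := hN.2 (LinearMap.range (g ∘ₗ U.subtype))
  have h3 : df δ ((M.sub U).sub (LinearMap.ker (g ∘ₗ U.subtype))) ≤ 0 := by
    obtain ⟨v, hv⟩ := exact_lift (N' := L) (N := M) (N'' := N)
      (X := (M.sub U).sub (LinearMap.ker (g ∘ₗ U.subtype))) h hf
      (U.subtype ∘ₗ (LinearMap.ker (g ∘ₗ U.subtype)).subtype) (by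
        ext x; exact x.2)
    refine hL.le_of_inj (f := v) ?_
    have : Function.Injective (f ∘ₗ v) := by
      rw [hv]; exact U.subtype_injective.comp (Submodule.subtype_injective _)
    exact Function.Injective.of_comp this
  omega

theorem Reg.prod {M N : Obj s t k} (hM : Reg δ M) (hN : Reg δ N) : Reg δ (M.prod N) :=
  Reg.exact (M := M.prod N) (f := LinearMap.inl _ M N) (g := LinearMap.snd _ M N) LinearMap.inl_injective
    LinearMap.snd_surjective (by
      rintro ⟨x, y⟩
      constructor
      · intro h; exact ⟨x, Prod.ext rfl h.symm⟩
      · rintro ⟨z, h⟩; exact (congrArg Prod.snd h).symm) hM hN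

theorem Reg.ker {M N : Obj s t k} (hM : Reg δ M) (hN : Reg δ N) (f : M →ₗ[PA s t k] N) :
    df δ (M.sub (LinearMap.ker f)) = 0 := by
  have h1 := df_ker_range (δ := δ) f
  have h2 := hM.2 (LinearMap.ker f)
  have h3 := hN.2 (LinearMap.range f)
  rw [hM.1] at h1; omega

theorem Reg.range {M N : Obj s t k} (hM : Reg δ M) (hN : Reg δ N) (f : M →ₗ[PA s t k] N) :
    df δ (N.sub (LinearMap.range f)) = 0 := by
  have h1 := df_ker_range (δ := δ) f
  rw [hM.1, hM.ker hN] at h1; omega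

theorem df_bot (M : Obj s t k) : df δ (M.sub ⊥) = 0 :=
  df_zero (show Subsingleton (⊥ : Submodule (PA s t k) M) from inferInstance)
theorem df_top (M : Obj s t k) : df δ (M.sub ⊤) = df δ M :=
  df_eqv (M := M.sub ⊤) Submodule.topEquiv

/-- regular simple -/
def RSimple (δ : V → ℤ) (S : Obj s t k) : Prop :=
  Reg δ S ∧ Nontrivial S ∧ ∀ U : Submodule (PA s t k) S, df δ (S.sub U) = 0 → U = ⊥ ∨ U = ⊤

theorem RSimple.surj {M S : Obj s t k} (hS : RSimple δ S) (hM : Reg δ M) {f : M →ₗ[PA s t k] S}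
    (hf : f ≠ 0) : Function.Surjective f := by
  rw [← LinearMap.range_eq_top]
  refine (hS.2.2 _ (hM.range hS.1 f)).resolve_left fun h => hf ?_
  exact LinearMap.range_eq_bot.1 h

theorem RSimple.inj {M S : Obj s t k} (hS : RSimple δ S) (hM : Reg δ M) {f : S →ₗ[PA s t k] M}
    (hf : f ≠ 0) : Function.Injective f := by
  rw [← LinearMap.ker_eq_bot]
  refine (hS.2.2 _ (hS.1.ker hM f)).resolve_right fun h => hf ?_
  exact LinearMap.ker_eq_top.1 h

theorem RSimple.bij {S S' : Obj s t k} (hS : RSimple δ S) (hS' : RSimple δ S')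
    {f : S →ₗ[PA s t k] S'} (hf : f ≠ 0) : Function.Bijective f :=
  ⟨hS.inj hS'.1 hf, hS'.surj hS.1 hf⟩

theorem RSimple.congr {S S' : Obj s t k} (hS : RSimple δ S) (e : S ≃ₗ[PA s t k] S') :
    RSimple δ S' := by
  refine ⟨hS.1.congr e, e.symm.toEquiv.nontrivial_congr.2 hS.2.1, fun U hU => ?_⟩
  have h1 : df δ (S.sub (U.comap e.toLinearMap)) = 0 := by
    rw [df_comap e.surjective, hU, add_zero]
    have : LinearMap.ker (e : S →ₗ[PA s t k] S') = ⊥ := LinearEquiv.ker e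
    rw [this, df_bot]
  have h3 : U = (U.comap e.toLinearMap).map e.toLinearMap :=
    (Submodule.map_comap_eq_of_surjective e.surjective U).symm
  rcases hS.2.2 _ h1 with h2 | h2
  · left; rw [h3, h2, Submodule.map_bot]
  · right; rw [h3, h2, Submodule.map_top]; exact LinearEquiv.range e

/-- a nonzero regular has a regular simple subobject -/
theorem Reg.exists_simple_sub {M : Obj s t k} (hM : Reg δ M) (hn : Nontrivial M) :
    ∃ (S : Obj s t k) (f : S →ₗ[PA s t k] M), RSimple δ S ∧ Function.Injective f := by
  classical
  have hex : ∃ n : ℕ, ∃ (S : Obj s t k) (f : S →ₗ[PA s t k] M), Function.Injective f ∧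
      Nontrivial S ∧ df δ S = 0 ∧ finrank k S = n :=
    ⟨_, M, LinearMap.id, Function.injective_id, hn, hM.1, rfl⟩
  obtain ⟨S, f, hf, hS, hd, hr⟩ := Nat.find_spec hex
  refine ⟨S, f, ⟨hM.of_inj hf hd, hS, fun U hU => ?_⟩, hf⟩
  by_cases hb : U = ⊥
  · exact Or.inl hb
  right
  have h1 : Nat.find hex ≤ finrank k (S.sub U) := Nat.find_min' hex ⟨S.sub U, f ∘ₗ U.subtype,
    hf.comp U.subtype_injective, Submodule.nontrivial_iff_ne_bot.2 hb, hU, rfl⟩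
  rw [← hr] at h1
  have h2 : U.restrictScalars k = ⊤ := by
    apply Submodule.eq_top_of_finrank_eq
    exact le_antisymm (Submodule.finrank_le _) h1
  rw [eq_top_iff]
  intro x _
  have : x ∈ U.restrictScalars k := by rw [h2]; trivial
  exact this

/-- a nonzero regular has a regular simple quotient -/
theorem Reg.exists_simple_quot {M : Obj s t k} (hM : Reg δ M) (hn : Nontrivial M) :
    ∃ (S : Obj s t k) (f : M →ₗ[PA s t k] S), RSimple δ S ∧ Function.Surjective f := by
  classical
  have hex : ∃ n : ℕ, ∃ (S : Obj s t k) (f : M →ₗ[PA s t k] S), Function.Surjective f ∧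
      Nontrivial S ∧ df δ S = 0 ∧ finrank k S = n :=
    ⟨_, M, LinearMap.id, Function.surjective_id, hn, hM.1, rfl⟩
  obtain ⟨S, f, hf, hS, hd, hr⟩ := Nat.find_spec hex
  have hSr := hM.of_surj hf hd
  refine ⟨S, f, ⟨hSr, hS, fun U hU => ?_⟩, hf⟩
  by_cases hb : U = ⊤
  · exact Or.inr hb
  left
  have h1 : Nat.find hex ≤ finrank k (S.quot U) := Nat.find_min' hex ⟨S.quot U, U.mkQ ∘ₗ f,
    U.mkQ_surjective.comp hf, Submodule.Quotient.nontrivial_iff.2 hb, (hSr.quot hU).1, rfl⟩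
  rw [← hr] at h1
  have h2 := finrank_surj (M := S) (B := S.quot U) (f := U.mkQ) U.mkQ_surjective
  have h3 : finrank k (S.sub (LinearMap.ker U.mkQ)) = 0 := by omega
  rw [Submodule.ker_mkQ] at h3
  by_contra hb'
  have := finrank_pos' (M := S.sub U) (Submodule.nontrivial_iff_ne_bot.2 hb')
  omega

/-! iso classes of regular simples -/

/-- setoid of isomorphism -/
def rsSetoid (s t : A → V) (k : Type) [Field k] (δ : V → ℤ) :
    Setoid {S : Obj s t k // RSimple δ S} where
  r S S' := Nonempty (S.1 ≃ₗ[PA s t k] S'.1)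
  iseqv := ⟨fun S => ⟨LinearEquiv.refl _ _⟩, fun ⟨e⟩ => ⟨e.symm⟩, fun ⟨e⟩ ⟨e'⟩ => ⟨e.trans e'⟩⟩

/-- iso classes of regular simples -/
def RS (s t : A → V) (k : Type) [Field k] (δ : V → ℤ) := Quotient (rsSetoid s t k δ)

/-- representative -/
def RS.rep (c : RS s t k δ) : Obj s t k := (Quotient.out c).1

theorem RS.simple (c : RS s t k δ) : RSimple δ c.rep := (Quotient.out c).2

/-- class of a simple -/
def RS.mk {S : Obj s t k} (hS : RSimple δ S) : RS s t k δ := Quotient.mk (rsSetoid s t k δ) ⟨S, hS⟩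

theorem RS.mk_rep {S : Obj s t k} (hS : RSimple δ S) : Nonempty (S ≃ₗ[PA s t k] (RS.mk hS).rep) := by
  have := Quotient.mk_out (s := rsSetoid s t k δ) ⟨S, hS⟩
  exact (rsSetoid s t k δ).symm this

theorem RS.eq_of_iso {c c' : RS s t k δ} (e : c.rep ≃ₗ[PA s t k] c'.rep) : c = c' := by
  have h := Quotient.sound (s := rsSetoid s t k δ) (a := Quotient.out c) (b := Quotient.out c') ⟨e⟩
  exact ((Quotient.out_eq c).symm.trans h).trans (Quotient.out_eq c')

theorem RS.mk_eq_iff {S S' : Obj s t k} (hS : RSimple δ S) (hS' : RSimple δ S') :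
    RS.mk hS = RS.mk hS' ↔ Nonempty (S ≃ₗ[PA s t k] S') := by
  constructor
  · intro h; exact Quotient.exact h
  · intro h; exact Quotient.sound (s := rsSetoid s t k δ) h

theorem RS.eq_of_map {c c' : RS s t k δ} {f : c.rep →ₗ[PA s t k] c'.rep} (hf : f ≠ 0) : c = c' :=
  RS.eq_of_iso (LinearEquiv.ofBijective f (c.simple.bij c'.simple hf))

/-- dimension vector of a class -/
def RS.dv (c : RS s t k δ) : V → ℤ := dim c.rep

/-- endomorphism dimension -/
def RS.d (c : RS s t k δ) : ℤ := hom c.rep c.rep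

theorem RS.d_pos (c : RS s t k δ) : 0 < c.d := by
  rcases (hom_nonneg c.rep c.rep).lt_or_eq with h | h
  · exact h
  · have h1 := (hom_eq_zero_iff _ _).1 h.symm LinearMap.id
    have := c.simple.2.1
    obtain ⟨x, hx⟩ := exists_ne (0 : c.rep)
    exact absurd (LinearMap.congr_fun h1 x) hx

theorem RS.hom_self (c : RS s t k δ) : hom c.rep c.rep = c.d := rfl
theorem RS.hom_ne {c c' : RS s t k δ} (h : c ≠ c') : hom c.rep c'.rep = 0 := by
  rw [hom_eq_zero_iff]
  intro f
  by_contra hf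
  exact h (RS.eq_of_map hf)

theorem Reg.exists_top {M : Obj s t k} (hM : Reg δ M) (hn : Nontrivial M) :
    ∃ (c : RS s t k δ) (f : M →ₗ[PA s t k] c.rep), Function.Surjective f := by
  obtain ⟨S, f, hS, hf⟩ := hM.exists_simple_quot hn
  obtain ⟨e⟩ := RS.mk_rep hS
  exact ⟨_, e.toLinearMap ∘ₗ f, e.surjective.comp hf⟩

theorem Reg.exists_soc {M : Obj s t k} (hM : Reg δ M) (hn : Nontrivial M) :
    ∃ (c : RS s t k δ) (f : c.rep →ₗ[PA s t k] M), Function.Injective f := by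
  obtain ⟨S, f, hS, hf⟩ := hM.exists_simple_sub hn
  obtain ⟨e⟩ := RS.mk_rep hS
  exact ⟨_, f ∘ₗ e.symm.toLinearMap, hf.comp e.symm.injective⟩

theorem surj_ne_zero {M S : Obj s t k} (h : Nontrivial S) {f : M →ₗ[PA s t k] S}
    (hf : Function.Surjective f) : f ≠ 0 := by
  rintro rfl
  obtain ⟨x, hx⟩ := exists_ne (0 : S)
  obtain ⟨y, hy⟩ := hf x
  exact hx hy.symm
theorem inj_ne_zero {M S : Obj s t k} (h : Nontrivial S) {f : S →ₗ[PA s t k] M}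
    (hf : Function.Injective f) : f ≠ 0 := by
  rintro rfl
  obtain ⟨x, hx⟩ := exists_ne (0 : S)
  exact hx (hf rfl)

/-- composition factors -/
theorem Reg.factors {M : Obj s t k} (hM : Reg δ M) :
    ∃ m : RS s t k δ →₀ ℕ, dim M = m.sum (fun c n => (n : ℤ) • c.dv) ∧
      ∀ (c : RS s t k δ) (f : M →ₗ[PA s t k] c.rep), f ≠ 0 → m c ≠ 0 := by
  classical
  induction hn : finrank k M using Nat.strong_induction_on generalizing M with
  | _ n ih =>
  by_cases hs : Subsingleton M
  · refine ⟨0, by simpa using (dim_eq_zero_iff M).2 hs, fun c f hf => absurd ?_ hf⟩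
    ext x; rw [Subsingleton.elim x 0]; simp
  rw [not_subsingleton_iff_nontrivial] at hs
  obtain ⟨c, g, hg⟩ := hM.exists_top hs
  have h1 := finrank_surj hg
  have h2 := finrank_pos' c.simple.2.1
  obtain ⟨m, hm, hm'⟩ := ih _ (by omega) (hM.sub (hM.ker c.simple.1 g)) rfl
  refine ⟨m + Finsupp.single c 1, ?_, ?_⟩
  · rw [Finsupp.sum_add_index' (by simp) (by intros; push_cast; rw [add_smul]), ← hm, dim_surj hg]
    simp [Finsupp.sum_single_index, RS.dv]
  · intro c' f hf
    by_cases hc : c' = c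
    · subst hc; simp
    have := hm' c' (f ∘ₗ (LinearMap.ker g).subtype) ?_
    · simp [this]
    intro h0
    obtain ⟨u, hu⟩ := exact_desc (N' := M.sub (LinearMap.ker g)) (LinearMap.exact_subtype_ker_map g) hg f h0
    apply hc
    refine (RS.eq_of_map (f := u) ?_).symm
    rintro rfl
    apply hf; rw [← hu, LinearMap.zero_comp]

end regular

end

end KacAff


namespace KacAff

noncomputable section

open Module

set_option linter.all false

section sigma

variable {V A : Type} [Fintype V] [DecidableEq V] {s t : A → V} {k : Type} [Field k] [Fintype A]
variable {δ : V → ℤ}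

/-- push along varying maps -/
def pushL {M N N' : Obj s t k} (ξ : Ext M N) : (N →ₗ[PA s t k] N') →ₗ[k] Ext M N' where
  toFun h := push M h ξ
  map_add' h h' := push_add h h' ξ
  map_smul' c h := push_smul c h ξ
/-- pull along varying maps -/
def pullL {M M' N : Obj s t k} (ξ : Ext M N) : (M' →ₗ[PA s t k] M) →ₗ[k] Ext M' N where
  toFun h := pull h N ξ
  map_add' h h' := pull_add h h' ξ
  map_smul' c h := pull_smul c h ξ

theorem pushL_inj {M S : Obj s t k} (hS : RSimple δ S) (ξ : Ext M S) (hξ : ξ ≠ 0) :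
    Function.Injective (pushL (N' := S) ξ) := by
  rw [injective_iff_map_eq_zero]
  intro α hα
  by_contra h0
  let e := LinearEquiv.ofBijective α (hS.bij hS h0)
  apply hξ
  rw [← push_id ξ, show (LinearMap.id : S →ₗ[PA s t k] S) = e.symm.toLinearMap ∘ₗ α by
    ext x; exact (e.symm_apply_apply x).symm, push_comp]
  rw [show push M α ξ = 0 from hα, map_zero]

theorem pullL_inj {N S : Obj s t k} (hS : RSimple δ S) (ξ : Ext S N) (hξ : ξ ≠ 0) :
    Function.Injective (pullL (M' := S) ξ) := by
  rw [injective_iff_map_eq_zero]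
  intro α hα
  by_contra h0
  let e := LinearEquiv.ofBijective α (hS.bij hS h0)
  apply hξ
  rw [← pull_id ξ, show (LinearMap.id : S →ₗ[PA s t k] S) = α ∘ₗ e.symm.toLinearMap by
    ext x; exact (e.apply_symm_apply x).symm, pull_comp]
  rw [show pull α N ξ = 0 from hα, map_zero]

theorem RS.ext_ge_right {M : Obj s t k} {c : RS s t k δ} (h : ext M c.rep ≠ 0) :
    c.d ≤ ext M c.rep := by
  have : ∃ ξ : Ext M c.rep, ξ ≠ 0 := by
    by_contra hc; push Not at hc
    exact h ((ext_eq_zero_iff _ _).2 hc)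
  obtain ⟨ξ, hξ⟩ := this
  have := LinearMap.finrank_le_finrank_of_injective (pushL_inj c.simple ξ hξ)
  simp only [RS.d, hom, ext]; exact_mod_cast this

theorem RS.ext_ge_left {M : Obj s t k} {c : RS s t k δ} (h : ext c.rep M ≠ 0) :
    c.d ≤ ext c.rep M := by
  have : ∃ ξ : Ext c.rep M, ξ ≠ 0 := by
    by_contra hc; push Not at hc
    exact h ((ext_eq_zero_iff _ _).2 hc)
  obtain ⟨ξ, hξ⟩ := this
  have := LinearMap.finrank_le_finrank_of_injective (pullL_inj c.simple ξ hξ)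
  simp only [RS.d, hom, ext]; exact_mod_cast this

open Classical in
theorem RS.eu_dv (c c' : RS s t k δ) :
    eu s t c.dv c'.dv = (if c = c' then c.d else 0) - ext c.rep c'.rep := by
  rw [RS.dv, RS.dv, ← euler]
  split_ifs with h
  · subst h; rfl
  · rw [RS.hom_ne h]

theorem RS.df (c : RS s t k δ) : eu s t δ c.dv = 0 := c.simple.1.1

/-- combination of simples which is a multiple of δ -/
def Good (m : RS s t k δ →₀ ℕ) : Prop :=
  ∃ N : ℤ, ∑ c ∈ m.support, (m c : ℤ) • c.dv = N • δ

theorem Good.row (h : Aff s t δ) {m : RS s t k δ →₀ ℕ} (hm : Good m) (c : RS s t k δ) :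
    (m c : ℤ) * c.d = ∑ c' ∈ m.support, (m c' : ℤ) * ext c.rep c'.rep := by
  classical
  obtain ⟨N, hN⟩ := hm
  have h1 : eu s t c.dv (∑ c ∈ m.support, (m c : ℤ) • c.dv) = 0 := by
    rw [hN, eu_smul_right, h.eu_delta_right, c.df]; ring
  rw [eu_sum_right] at h1
  simp only [eu_smul_right, RS.eu_dv, mul_sub, Finset.sum_sub_distrib, mul_ite, mul_zero] at h1
  rw [Finset.sum_ite_eq] at h1
  rw [← sub_eq_zero, ← h1]
  congr 1
  split_ifs with h2
  · rfl
  · rw [Finsupp.notMem_support_iff.1 h2]; simp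

theorem Good.col (h : Aff s t δ) {m : RS s t k δ →₀ ℕ} (hm : Good m) (c : RS s t k δ) :
    (m c : ℤ) * c.d = ∑ c' ∈ m.support, (m c' : ℤ) * ext c'.rep c.rep := by
  classical
  obtain ⟨N, hN⟩ := hm
  have h1 : eu s t (∑ c ∈ m.support, (m c : ℤ) • c.dv) c.dv = 0 := by
    rw [hN, eu_smul_left, c.df]; ring
  rw [eu_sum_left] at h1
  simp only [eu_smul_left, RS.eu_dv, mul_sub, Finset.sum_sub_distrib, mul_ite, mul_zero] at h1
  rw [Finset.sum_ite_eq'] at h1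
  rw [← sub_eq_zero, ← h1]
  congr 1
  split_ifs with h2
  · rfl
  · rw [Finsupp.notMem_support_iff.1 h2]; simp

theorem Good.row_exists (h : Aff s t δ) {m : RS s t k δ →₀ ℕ} (hm : Good m) {c : RS s t k δ}
    (hc : c ∈ m.support) : ∃ c' ∈ m.support, ext c.rep c'.rep ≠ 0 := by
  by_contra hcon
  push Not at hcon
  have h1 := hm.row h c
  rw [Finset.sum_eq_zero (fun c' hc' => by rw [hcon c' hc', mul_zero])] at h1
  have := c.d_pos
  have h2 : (m c : ℤ) ≠ 0 := by exact_mod_cast Finsupp.mem_support_iff.1 hc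
  rcases mul_eq_zero.1 h1 with h3 | h3 <;> omega

theorem Good.col_exists (h : Aff s t δ) {m : RS s t k δ →₀ ℕ} (hm : Good m) {c : RS s t k δ}
    (hc : c ∈ m.support) : ∃ c' ∈ m.support, ext c'.rep c.rep ≠ 0 := by
  by_contra hcon
  push Not at hcon
  have h1 := hm.col h c
  rw [Finset.sum_eq_zero (fun c' hc' => by rw [hcon c' hc', mul_zero])] at h1
  have := c.d_pos
  have h2 : (m c : ℤ) ≠ 0 := by exact_mod_cast Finsupp.mem_support_iff.1 hc
  rcases mul_eq_zero.1 h1 with h3 | h3 <;> omega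

theorem Good.total (h : Aff s t δ) (m : RS s t k δ →₀ ℕ) :
    ∑ c ∈ m.support, ∑ c' ∈ m.support, ext c.rep c'.rep ≤ ∑ c ∈ m.support, c.d := by
  classical
  have h1 := h.psd (∑ c ∈ m.support, c.dv)
  rw [eu_sum_left] at h1
  simp only [eu_sum_right, RS.eu_dv, Finset.sum_sub_distrib, Finset.sum_ite_eq] at h1
  rw [Finset.sum_congr rfl (fun c hc => if_pos hc)] at h1
  exact sub_nonneg.1 h1

theorem Good.row_ge (h : Aff s t δ) {m : RS s t k δ →₀ ℕ} (hm : Good m) {c : RS s t k δ}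
    (hc : c ∈ m.support) : c.d ≤ ∑ c' ∈ m.support, ext c.rep c'.rep := by
  obtain ⟨c', hc', h1⟩ := hm.row_exists h hc
  exact (RS.ext_ge_left h1).trans
    (Finset.single_le_sum (f := fun c' : RS s t k δ => ext c.rep c'.rep)
      (fun i _ => ext_nonneg _ _) hc')

theorem Good.col_ge (h : Aff s t δ) {m : RS s t k δ →₀ ℕ} (hm : Good m) {c : RS s t k δ}
    (hc : c ∈ m.support) : c.d ≤ ∑ c' ∈ m.support, ext c'.rep c.rep := by
  obtain ⟨c', hc', h1⟩ := hm.col_exists h hc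
  exact (RS.ext_ge_right h1).trans
    (Finset.single_le_sum (f := fun c' : RS s t k δ => ext c'.rep c.rep)
      (fun i _ => ext_nonneg _ _) hc')

theorem sum_tight {ι : Type*} {S : Finset ι} {f g : ι → ℤ} (h : ∀ i ∈ S, f i ≤ g i)
    (ht : ∑ i ∈ S, g i ≤ ∑ i ∈ S, f i) : ∀ i ∈ S, g i = f i := by
  have := (Finset.sum_eq_sum_iff_of_le h).1 (le_antisymm (Finset.sum_le_sum h) ht)
  exact fun i hi => (this i hi).symm

theorem Good.row_eq (h : Aff s t δ) {m : RS s t k δ →₀ ℕ} (hm : Good m) {c : RS s t k δ}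
    (hc : c ∈ m.support) : ∑ c' ∈ m.support, ext c.rep c'.rep = c.d :=
  sum_tight (f := RS.d) (g := fun c => ∑ c' ∈ m.support, ext c.rep c'.rep)
    (fun c hc => hm.row_ge h hc) (Good.total h m) c hc

theorem Good.col_eq (h : Aff s t δ) {m : RS s t k δ →₀ ℕ} (hm : Good m) {c : RS s t k δ}
    (hc : c ∈ m.support) : ∑ c' ∈ m.support, ext c'.rep c.rep = c.d :=
  sum_tight (f := RS.d) (g := fun c => ∑ c' ∈ m.support, ext c'.rep c.rep)
    (fun c hc => hm.col_ge h hc) (by rw [Finset.sum_comm]; exact Good.total h m) c hc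

/-- a nonneg sum equal to `d` with a term ≥ d has only that term -/
theorem sum_one {ι : Type*} [DecidableEq ι] {S : Finset ι} {f : ι → ℤ} {d : ℤ} (h : ∀ i ∈ S, 0 ≤ f i)
    (hs : ∑ i ∈ S, f i = d) {i : ι} (hi : i ∈ S) (hd : d ≤ f i) :
    f i = d ∧ ∀ j ∈ S, j ≠ i → f j = 0 := by
  have h1 := Finset.add_sum_erase S f hi
  have h2 : 0 ≤ ∑ x ∈ S.erase i, f x :=
    Finset.sum_nonneg fun j hj => h j (Finset.mem_of_mem_erase hj)
  refine ⟨by omega, fun j hj hne => ?_⟩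
  have h3 : ∑ x ∈ S.erase i, f x = 0 := by omega
  exact (Finset.sum_eq_zero_iff_of_nonneg fun j hj => h j (Finset.mem_of_mem_erase hj)).1 h3 j
    (Finset.mem_erase.2 ⟨hne, hj⟩)

theorem Aff.exists_good (h : Aff s t δ) (F : Finset (RS s t k δ)) :
    ∃ m : RS s t k δ →₀ ℕ, Good m ∧ ∀ c ∈ F, c ∈ m.support := by
  classical
  obtain ⟨N0, hN0⟩ := h.exists_reg k (-∑ c ∈ F, c.dv) (by
    rw [eu_neg_right, eu_sum_right, Finset.sum_eq_zero (fun c _ => c.df), neg_zero])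
  obtain ⟨W, hW, hR⟩ := hN0 N0 le_rfl
  obtain ⟨m, hm, -⟩ := hR.factors
  refine ⟨m + ∑ c ∈ F, Finsupp.single c 1, ⟨N0, ?_⟩, ?_⟩
  · change (m + ∑ c ∈ F, Finsupp.single c 1).sum (fun c n => (n : ℤ) • c.dv) = _
    rw [Finsupp.sum_add_index' (by simp) (by intros; push_cast; rw [add_smul]), ← hm, hW,
      ← Finsupp.sum_finsetSum_index (by simp) (by intros; push_cast; rw [add_smul])]
    simp [Finsupp.sum_single_index]
  · intro c hc
    have : (∑ c ∈ F, Finsupp.single c 1 : RS s t k δ →₀ ℕ) c = 1 := by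
      rw [Finsupp.finset_sum_apply, Finset.sum_eq_single c]
      · simp
      · intro b _ hb; simp [hb]
      · intro hn; exact absurd hc hn
    rw [Finsupp.mem_support_iff, Finsupp.add_apply, this]; omega

theorem Aff.sg_exists (h : Aff s t δ) (c : RS s t k δ) : ∃ c' : RS s t k δ, ext c.rep c'.rep ≠ 0 := by
  obtain ⟨m, hm, hc⟩ := h.exists_good {c}
  obtain ⟨c', -, h'⟩ := hm.row_exists h (hc c (by simp))
  exact ⟨c', h'⟩

theorem Aff.sg_uniq (h : Aff s t δ) {c c' : RS s t k δ} (hc : ext c.rep c'.rep ≠ 0) :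
    ext c.rep c'.rep = c.d ∧ c.d = c'.d ∧ (∀ c'', ext c.rep (RS.rep c'') ≠ 0 → c'' = c') ∧
      (∀ c'', ext (RS.rep c'') c'.rep ≠ 0 → c'' = c) := by
  classical
  have e1 : ∀ c'' : RS s t k δ, ext c.rep c'.rep = c.d ∧ ext c.rep c'.rep = c'.d ∧
      (ext c.rep c''.rep ≠ 0 → c'' = c') ∧ (ext c''.rep c'.rep ≠ 0 → c'' = c) := by
    intro c''
    obtain ⟨m, hm, hF⟩ := h.exists_good {c, c', c''}
    have h1 := hF c (by simp)
    have h2 := hF c' (by simp)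
    have h3 := hF c'' (by simp)
    have r := sum_one (f := fun x : RS s t k δ => ext c.rep x.rep) (fun i _ => ext_nonneg _ _)
      (hm.row_eq h h1) h2 (RS.ext_ge_left hc)
    have q := sum_one (f := fun x : RS s t k δ => ext x.rep c'.rep) (fun i _ => ext_nonneg _ _)
      (hm.col_eq h h2) h1 (RS.ext_ge_right hc)
    refine ⟨r.1, q.1, fun hne => ?_, fun hne => ?_⟩
    · by_contra hx; exact hne (r.2 c'' h3 hx)
    · by_contra hx; exact hne (q.2 c'' h3 hx)
  exact ⟨(e1 c).1, by rw [← (e1 c).1, (e1 c).2.1], fun c'' => (e1 c'').2.2.1,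
    fun c'' => (e1 c'').2.2.2⟩

/-- the translate -/
def Aff.sg (h : Aff s t δ) (c : RS s t k δ) : RS s t k δ := Classical.choose (h.sg_exists c)

theorem Aff.sg_spec (h : Aff s t δ) (c : RS s t k δ) : ext c.rep (h.sg c).rep ≠ 0 :=
  Classical.choose_spec (h.sg_exists c)

open Classical in
theorem Aff.ext_rep (h : Aff s t δ) (c c' : RS s t k δ) :
    ext c.rep c'.rep = if h.sg c = c' then c.d else 0 := by
  have h1 := h.sg_uniq (h.sg_spec c)
  split_ifs with hc
  · rw [← hc]; exact h1.1
  · by_contra hne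
    exact hc (h1.2.2.1 c' hne).symm

theorem Aff.d_sg (h : Aff s t δ) (c : RS s t k δ) : (h.sg c).d = c.d :=
  (h.sg_uniq (h.sg_spec c)).2.1.symm

theorem Aff.sg_inj (h : Aff s t δ) : Function.Injective (h.sg (k := k)) := by
  intro c c' hcc
  have h1 := h.sg_uniq (h.sg_spec c')
  exact h1.2.2.2 c (by rw [← hcc]; exact h.sg_spec c)

theorem Good.sg_mem (h : Aff s t δ) {m : RS s t k δ →₀ ℕ} (hm : Good m) {c : RS s t k δ}
    (hc : c ∈ m.support) : h.sg c ∈ m.support := by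
  obtain ⟨c', hc', hne⟩ := hm.row_exists h hc
  rwa [← (h.sg_uniq (h.sg_spec c)).2.2.1 c' hne]

theorem Good.sg_mult (h : Aff s t δ) {m : RS s t k δ →₀ ℕ} (hm : Good m) (c : RS s t k δ) :
    m (h.sg c) = m c := by
  classical
  have h1 := hm.row h c
  simp only [h.ext_rep, mul_ite, mul_zero] at h1
  rw [Finset.sum_ite_eq] at h1
  have := c.d_pos
  split_ifs at h1 with h2
  · have h3 := mul_right_cancel₀ this.ne' h1
    exact_mod_cast h3.symm
  · rw [Finsupp.notMem_support_iff.1 h2]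
    rcases mul_eq_zero.1 h1 with h3 | h3
    · exact_mod_cast h3.symm
    · omega

theorem Aff.sg_periodic (h : Aff s t δ) (c : RS s t k δ) : ∃ r, 0 < r ∧ (h.sg)^[r] c = c := by
  obtain ⟨m, hm, hc⟩ := h.exists_good {c}
  have h1 : ∀ n, (h.sg)^[n] c ∈ m.support := by
    intro n
    induction n with
    | zero => exact hc c (by simp)
    | succ n ih => rw [Function.iterate_succ_apply']; exact hm.sg_mem h ih
  have h2 : ¬ Function.Injective (fun n : ℕ => (⟨(h.sg)^[n] c, h1 n⟩ : m.support)) :=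
    not_injective_infinite_finite _
  rw [Function.Injective] at h2
  push Not at h2
  obtain ⟨a, b, hab, hne⟩ := h2
  have hab : (h.sg)^[a] c = (h.sg)^[b] c := congrArg Subtype.val hab
  have key : ∀ a b : ℕ, a < b → (h.sg)^[a] c = (h.sg)^[b] c → (h.sg)^[b - a] c = c := by
    intro a b hlt he
    apply h.sg_inj.iterate a
    rw [← Function.iterate_add_apply, show a + (b - a) = b by omega, he]
  rcases lt_or_gt_of_ne hne with hlt | hlt
  · exact ⟨b - a, by omega, key a b hlt hab⟩
  · exact ⟨a - b, by omega, key b a hlt hab.symm⟩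

theorem Aff.sg_surj (h : Aff s t δ) : Function.Surjective (h.sg (k := k)) := by
  intro c
  obtain ⟨r, hr, hc⟩ := h.sg_periodic c
  obtain ⟨n, rfl⟩ : ∃ n, r = n + 1 := ⟨r - 1, by omega⟩
  rw [Function.iterate_succ_apply'] at hc
  exact ⟨_, hc⟩

theorem Aff.d_iter (h : Aff s t δ) (c : RS s t k δ) (n : ℕ) : ((h.sg)^[n] c).d = c.d := by
  induction n with
  | zero => rfl
  | succ n ih => rw [Function.iterate_succ_apply', h.d_sg, ih]

/-- partial tube sums -/
def Aff.ts (h : Aff s t δ) (c : RS s t k δ) (l : ℕ) : V → ℤ :=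
  ∑ n ∈ Finset.range l, ((h.sg)^[n] c).dv

theorem Aff.ts_zero (h : Aff s t δ) (c : RS s t k δ) : h.ts c 0 = 0 := by simp [Aff.ts]
theorem Aff.ts_succ (h : Aff s t δ) (c : RS s t k δ) (l : ℕ) :
    h.ts c (l + 1) = h.ts c l + ((h.sg)^[l] c).dv := by rw [Aff.ts, Finset.sum_range_succ]; rfl
theorem Aff.ts_succ' (h : Aff s t δ) (c : RS s t k δ) (l : ℕ) :
    h.ts c (l + 1) = h.ts (h.sg c) l + c.dv := by
  rw [Aff.ts, Finset.sum_range_succ']; rfl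

open Classical in
theorem Aff.eu_ts_left (h : Aff s t δ) (c c' : RS s t k δ) (l : ℕ) :
    eu s t (h.ts c l) c'.dv = c.d * ((if c = c' then 1 else 0) - if (h.sg)^[l] c = c' then 1 else 0) := by
  induction l with
  | zero =>
    rw [h.ts_zero, eu_zero_left]
    change 0 = c.d * ((if c = c' then 1 else 0) - if c = c' then 1 else 0)
    rw [sub_self, mul_zero]
  | succ l ih =>
    rw [h.ts_succ, eu_add_left, ih, RS.eu_dv, h.ext_rep, h.d_iter, Function.iterate_succ_apply']
    split_ifs <;> ring

open Classical in
theorem Aff.eu_ts_right (h : Aff s t δ) (c c' : RS s t k δ) (l : ℕ) :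
    eu s t c'.dv (h.ts c l) =
      c'.d * ((if h.sg c' = (h.sg)^[l] c then 1 else 0) - if h.sg c' = c then 1 else 0) := by
  induction l with
  | zero =>
    rw [h.ts_zero, eu_zero_right]
    change 0 = c'.d * ((if h.sg c' = c then 1 else 0) - if h.sg c' = c then 1 else 0)
    rw [sub_self, mul_zero]
  | succ l ih =>
    rw [h.ts_succ, eu_add_right, ih, RS.eu_dv, h.ext_rep, Function.iterate_succ_apply']
    have : (h.sg c' = h.sg ((h.sg)^[l] c)) ↔ c' = (h.sg)^[l] c := h.sg_inj.eq_iff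
    simp only [this]
    split_ifs <;> ring

theorem Aff.ts_period (h : Aff s t δ) {c : RS s t k δ} {r : ℕ} (hr : (h.sg)^[r] c = c) :
    ∃ m : ℤ, h.ts c r = m • δ := by
  classical
  apply h.isotropic
  conv_lhs => arg 4; rw [Aff.ts]
  rw [eu_sum_right]
  apply Finset.sum_eq_zero
  intro n _
  rw [h.eu_ts_left, hr]; ring

end sigma

end

end KacAff

namespace KacAff
noncomputable section
open Module
set_option linter.all false
variable {V A : Type} [Fintype V] [DecidableEq V] {s t : A → V} {k : Type} [Field k] [Fintype A]
variable {δ : V → ℤ}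

theorem Aff.ext_sg (h : Aff s t δ) (c : RS s t k δ) : ext c.rep (h.sg c).rep = c.d := by
  rw [h.ext_rep, if_pos rfl]
theorem Aff.ext_ne (h : Aff s t δ) {c c' : RS s t k δ} (hc : h.sg c ≠ c') : ext c.rep c'.rep = 0 := by
  rw [h.ext_rep, if_neg hc]

/-- `f` is the top of the local regular module `M` -/
structure LocF (c : RS s t k δ) (M : Obj s t k) (f : M →ₗ[PA s t k] c.rep) : Prop where
  reg : Reg δ M
  surj : Function.Surjective f
  loc : ∀ U : Submodule (PA s t k) M, df δ (M.sub U) = 0 → U = ⊤ ∨ U ≤ LinearMap.ker f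

theorem RS.nt (c : RS s t k δ) : Nontrivial c.rep := c.simple.2.1

theorem LocF.of_tops {c : RS s t k δ} {M : Obj s t k} {f : M →ₗ[PA s t k] c.rep} (hM : Reg δ M)
    (hf : Function.Surjective f)
    (H : ∀ (T : RS s t k δ) (g : M →ₗ[PA s t k] T.rep), g ≠ 0 → LinearMap.ker g ≤ LinearMap.ker f) :
    LocF c M f := by
  refine ⟨hM, hf, fun U hU => ?_⟩
  by_cases hU' : U = ⊤
  · exact Or.inl hU'
  right
  have hn : Nontrivial (M.quot U) := Submodule.Quotient.nontrivial_iff.2 hU'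
  obtain ⟨T, g, hg⟩ := (hM.quot hU).exists_top hn
  have hs : Function.Surjective (g ∘ₗ U.mkQ) := hg.comp U.mkQ_surjective
  refine le_trans ?_ (H T (g ∘ₗ U.mkQ) (surj_ne_zero T.nt hs))
  intro x hx
  rw [LinearMap.mem_ker, LinearMap.comp_apply, Submodule.mkQ_apply,
    (Submodule.Quotient.mk_eq_zero U).2 hx, map_zero]

theorem ker_ne_top {M N : Obj s t k} {f : M →ₗ[PA s t k] N} (hf : f ≠ 0) : LinearMap.ker f ≠ ⊤ :=
  fun h => hf (LinearMap.ker_eq_top.1 h)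

theorem LocF.ker_le {c : RS s t k δ} {M : Obj s t k} {f : M →ₗ[PA s t k] c.rep} (h : LocF c M f)
    {T : RS s t k δ} {g : M →ₗ[PA s t k] T.rep} (hg : g ≠ 0) : LinearMap.ker g ≤ LinearMap.ker f :=
  (h.loc _ (h.reg.ker T.simple.1 g)).resolve_left (ker_ne_top hg)

/-- factor through a surjection -/
theorem exists_factor {M N T : Obj s t k} {g : M →ₗ[PA s t k] N} (hg : Function.Surjective g)
    (f : M →ₗ[PA s t k] T) (h : LinearMap.ker g ≤ LinearMap.ker f) : ∃ v : N →ₗ[PA s t k] T, v ∘ₗ g = f := by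
  refine exact_desc (N' := M.sub (LinearMap.ker g)) (LinearMap.exact_subtype_ker_map g) hg f ?_
  ext x
  exact h x.2

theorem LocF.eq {c : RS s t k δ} {M : Obj s t k} {f : M →ₗ[PA s t k] c.rep} (h : LocF c M f)
    {T : RS s t k δ} {g : M →ₗ[PA s t k] T.rep} (hg : g ≠ 0) : T = c := by
  obtain ⟨v, hv⟩ := exists_factor (T.simple.surj h.reg hg) f (h.ker_le hg)
  refine RS.eq_of_map (f := v) ?_
  rintro rfl
  exact surj_ne_zero c.nt h.surj (by rw [← hv]; ext; rfl)

theorem LocF.exists_end {c : RS s t k δ} {M : Obj s t k} {f : M →ₗ[PA s t k] c.rep} (h : LocF c M f)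
    (g : M →ₗ[PA s t k] c.rep) : ∃ v : c.rep →ₗ[PA s t k] c.rep, v ∘ₗ f = g := by
  by_cases hg : g = 0
  · exact ⟨0, by rw [hg]; ext; rfl⟩
  · obtain ⟨v, hv⟩ := exists_factor (c.simple.surj h.reg hg) f (h.ker_le hg)
    have hv0 : v ≠ 0 := by
      rintro rfl
      exact surj_ne_zero c.nt h.surj (by rw [← hv]; ext; rfl)
    let e := LinearEquiv.ofBijective v (c.simple.bij c.simple hv0)
    refine ⟨e.symm.toLinearMap, ?_⟩
    ext x
    have : f x = e (g x) := by rw [← hv]; rfl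
    change e.symm (f x) = g x
    rw [this, e.symm_apply_apply]

theorem LocF.ker_eq {c : RS s t k δ} {M : Obj s t k} {f : M →ₗ[PA s t k] c.rep} (h : LocF c M f)
    {g : M →ₗ[PA s t k] c.rep} (hg : g ≠ 0) : LinearMap.ker g = LinearMap.ker f := by
  refine le_antisymm (h.ker_le hg) ?_
  obtain ⟨v, rfl⟩ := h.exists_end g
  intro x hx
  rw [LinearMap.mem_ker] at hx ⊢
  rw [LinearMap.comp_apply, hx, map_zero]

theorem LocF.change {c : RS s t k δ} {M : Obj s t k} {f : M →ₗ[PA s t k] c.rep} (h : LocF c M f)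
    {g : M →ₗ[PA s t k] c.rep} (hg : g ≠ 0) : LocF c M g :=
  ⟨h.reg, c.simple.surj h.reg hg, by rw [h.ker_eq hg]; exact h.loc⟩

theorem hom_le_linear {M N M' N' : Obj s t k} (φ : (M →ₗ[PA s t k] N) →ₗ[k] (M' →ₗ[PA s t k] N'))
    (h : Function.Surjective φ) : hom M' N' ≤ hom M N := by
  unfold hom
  exact_mod_cast LinearMap.finrank_le_finrank_of_surjective h

/-- local module, with some top -/
def Loc (c : RS s t k δ) (M : Obj s t k) : Prop := ∃ f, LocF c M f

theorem Loc.reg {c : RS s t k δ} {M : Obj s t k} (h : Loc c M) : Reg δ M := by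
  obtain ⟨f, hf⟩ := h; exact hf.reg

theorem Loc.nt {c : RS s t k δ} {M : Obj s t k} (h : Loc c M) : Nontrivial M := by
  obtain ⟨f, hf⟩ := h; have := c.nt; exact hf.surj.nontrivial

theorem Loc.hom_self {c : RS s t k δ} {M : Obj s t k} (h : Loc c M) : hom M c.rep = c.d := by
  obtain ⟨f, hf⟩ := h
  refine le_antisymm (hom_le_linear (preH f c.rep) fun g => ?_) (hom_le_of_surj c.rep hf.surj)
  exact hf.exists_end g

theorem Loc.hom_ne {c T : RS s t k δ} {M : Obj s t k} (h : Loc c M) (hT : T ≠ c) : hom M T.rep = 0 := by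
  obtain ⟨f, hf⟩ := h
  rw [hom_eq_zero_iff]
  intro g
  by_contra hg
  exact hT (hf.eq hg)

theorem LocF.of_hom {c : RS s t k δ} {M : Obj s t k} {f : M →ₗ[PA s t k] c.rep} (hM : Reg δ M)
    (hf : Function.Surjective f) (h1 : hom M c.rep ≤ c.d) (h2 : ∀ T : RS s t k δ, T ≠ c → hom M T.rep = 0) :
    LocF c M f := by
  refine LocF.of_tops hM hf fun T g hg => ?_
  have hT : T = c := by
    by_contra hT
    exact hg ((hom_eq_zero_iff _ _).1 (h2 T hT) g)
  subst hT
  have hi : Function.Injective (preH f T.rep) := by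
    intro u v huv
    ext x
    obtain ⟨y, rfl⟩ := hf x
    exact LinearMap.congr_fun huv y
  have hd : finrank k (T.rep →ₗ[PA s t k] T.rep) = finrank k (M →ₗ[PA s t k] T.rep) := by
    apply le_antisymm
    · exact LinearMap.finrank_le_finrank_of_injective hi
    · unfold hom RS.d hom at h1; exact_mod_cast h1
  obtain ⟨v, hv⟩ := ((LinearMap.injective_iff_surjective_of_finrank_eq_finrank hd).1 hi) g
  have hv : v ∘ₗ f = g := hv
  have hv0 : v ≠ 0 := by
    rintro rfl; exact hg (by rw [← hv]; ext; rfl)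
  intro x hx
  rw [← hv, LinearMap.mem_ker, LinearMap.comp_apply] at hx
  exact (T.simple.inj T.simple.1 hv0) (hx.trans (map_zero v).symm)

theorem Loc.top_ne {c : RS s t k δ} {M : Obj s t k} (h : Loc c M) {T : RS s t k δ} {g : M →ₗ[PA s t k] T.rep}
    (hg : g ≠ 0) : T = c := by obtain ⟨f, hf⟩ := h; exact hf.eq hg

theorem Loc.congr {c : RS s t k δ} {M N : Obj s t k} (h : Loc c M) (e : M ≃ₗ[PA s t k] N) : Loc c N := by
  obtain ⟨f, hf⟩ := h
  refine ⟨f ∘ₗ e.symm.toLinearMap, LocF.of_hom (hf.reg.congr e) (hf.surj.comp e.symm.surjective) ?_ ?_⟩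
  · rw [← hom_congr e (LinearEquiv.refl _ c.rep)]; exact (Loc.hom_self ⟨f, hf⟩).le
  · intro T hT
    rw [← hom_congr e (LinearEquiv.refl _ T.rep)]; exact (Loc.hom_ne ⟨f, hf⟩ hT)

theorem Loc.simple (c : RS s t k δ) : Loc c c.rep :=
  ⟨LinearMap.id, LocF.of_hom c.simple.1 Function.surjective_id le_rfl fun T hT => RS.hom_ne hT.symm⟩

theorem dim_zero {M : Obj s t k} (h : Subsingleton M) : dim M = 0 := by
  by_contra h'; exact absurd h (by rw [← dim_eq_zero_iff]; exact h')

/-- the radical of a local module is local -/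
theorem LocF.rad (h : Aff s t δ) {c : RS s t k δ} {M : Obj s t k} {f : M →ₗ[PA s t k] c.rep}
    (hf : LocF c M f) (hn : Nontrivial (M.sub (LinearMap.ker f))) :
    Loc (h.sg c) (M.sub (LinearMap.ker f)) := by
  have hR : Reg δ (M.sub (LinearMap.ker f)) := hf.reg.sub (hf.reg.ker c.simple.1 f)
  have key : ∀ T : RS s t k δ, hom (M.sub (LinearMap.ker f)) T.rep ≤ ext c.rep T.rep := by
    intro T
    have e1 := euler M T.rep
    have e2 := euler c.rep T.rep
    have e3 := euler (M.sub (LinearMap.ker f)) T.rep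
    rw [dim_surj hf.surj, eu_add_left] at e1
    have h1 : hom M T.rep = hom c.rep T.rep := by
      by_cases hT : T = c
      · subst hT; exact Loc.hom_self ⟨f, hf⟩
      · rw [Loc.hom_ne ⟨f, hf⟩ hT, RS.hom_ne (Ne.symm hT)]
    have h2 := ext_le_of_inj T.rep (M' := M.sub (LinearMap.ker f)) (M := M) (g := (LinearMap.ker f).subtype)
      (LinearMap.ker f).subtype_injective
    linarith
  have key2 : ∀ T : RS s t k δ, T ≠ h.sg c → hom (M.sub (LinearMap.ker f)) T.rep = 0 := fun T hT =>
    le_antisymm ((key T).trans (h.ext_ne (Ne.symm hT)).le) (hom_nonneg _ _)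
  obtain ⟨T, g, hg⟩ := hR.exists_top hn
  have hT : T = h.sg c := by
    by_contra hT
    exact surj_ne_zero T.nt hg ((hom_eq_zero_iff _ _).1 (key2 T hT) g)
  subst hT
  refine ⟨g, LocF.of_hom hR hg ?_ key2⟩
  refine (key _).trans ?_
  rw [h.ext_sg, h.d_sg]

theorem Loc.exists_len (h : Aff s t δ) {c : RS s t k δ} {M : Obj s t k} (hM : Loc c M) :
    ∃ l, dim M = h.ts c (l + 1) := by
  induction hn : finrank k M using Nat.strong_induction_on generalizing M c with
  | _ n ih =>
  obtain ⟨f, hf⟩ := hM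
  by_cases hs : Subsingleton (M.sub (LinearMap.ker f))
  · refine ⟨0, ?_⟩
    rw [dim_surj hf.surj, h.ts_succ, h.ts_zero, dim_zero hs]; rfl
  · have hs := not_subsingleton_iff_nontrivial.1 hs
    have h1 := finrank_surj hf.surj
    have h2 := finrank_pos' c.nt
    obtain ⟨l, hl⟩ := ih _ (by omega) (hf.rad h hs) rfl
    refine ⟨l + 1, ?_⟩
    rw [dim_surj hf.surj, hl, h.ts_succ' c]; rfl

/-- local module with given length -/
def LocL (h : Aff s t δ) (c : RS s t k δ) (l : ℕ) (M : Obj s t k) : Prop := Loc c M ∧ dim M = h.ts c l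

theorem finrank_of_dim {M N : Obj s t k} (h : dim M = dim N) : finrank k M = finrank k N := by
  have h1 := finrank_eq_sum M
  rw [h, ← finrank_eq_sum] at h1
  exact_mod_cast h1

theorem LocL.ext_left {h : Aff s t δ} {c : RS s t k δ} {l : ℕ} {M : Obj s t k} (hM : LocL h c l M) :
    ext M ((h.sg)^[l] c).rep = c.d ∧ ∀ T : RS s t k δ, (h.sg)^[l] c ≠ T → ext M T.rep = 0 := by
  classical
  have key : ∀ T : RS s t k δ, ext M T.rep = c.d * if (h.sg)^[l] c = T then 1 else 0 := by
    intro T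
    have e1 := euler M T.rep
    have e2 := h.eu_ts_left c T l
    rw [hM.2] at e1
    have e3 : eu s t (h.ts c l) T.dv = eu s t (h.ts c l) (dim T.rep) := rfl
    by_cases hT : T = c
    · subst hT
      rw [hM.1.hom_self] at e1
      simp only [if_true] at e2
      linarith
    · rw [hM.1.hom_ne hT] at e1
      rw [if_neg (Ne.symm hT)] at e2
      linarith
  refine ⟨by rw [key, if_pos rfl, mul_one], fun T hT => by rw [key, if_neg hT, mul_zero]⟩

theorem ts_sum_pos (h : Aff s t δ) (c : RS s t k δ) {M : Obj s t k} {l : ℕ} (hM : dim M = h.ts c (l + 1)) :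
    Nontrivial M := by
  rw [← not_subsingleton_iff_nontrivial, ← dim_eq_zero_iff, hM, h.ts_succ']
  intro h0
  have h1 : dim c.rep ≠ 0 := by
    rw [Ne, dim_eq_zero_iff, not_subsingleton_iff_nontrivial]; exact c.nt
  apply h1
  funext i
  have h2 := congrFun h0 i
  have h3 : 0 ≤ h.ts (h.sg c) l i := by
    rw [Aff.ts, Finset.sum_apply]
    exact Finset.sum_nonneg fun n _ => dim_nonneg _ _
  have h4 := dim_nonneg c.rep i
  change _ + dim c.rep i = 0 at h2
  change dim c.rep i = 0
  linarith

theorem LocL.rad {h : Aff s t δ} {c : RS s t k δ} {l : ℕ} {M : Obj s t k} {f : M →ₗ[PA s t k] c.rep}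
    (hM : dim M = h.ts c (l + 2)) (hf : LocF c M f) :
    LocL h (h.sg c) (l + 1) (M.sub (LinearMap.ker f)) := by
  have h1 : dim (M.sub (LinearMap.ker f)) = h.ts (h.sg c) (l + 1) := by
    have := dim_surj hf.surj
    rw [hM, h.ts_succ'] at this
    exact (add_right_cancel (b := c.dv) this).symm
  exact ⟨hf.rad h (ts_sum_pos h _ h1), h1⟩

theorem hom_le_inj_linear {M N M' N' : Obj s t k} (φ : (M →ₗ[PA s t k] N) →ₗ[k] (M' →ₗ[PA s t k] N'))
    (h : Function.Injective φ) : hom M N ≤ hom M' N' := by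
  unfold hom
  exact_mod_cast LinearMap.finrank_le_finrank_of_injective h

theorem LocL.len_one {h : Aff s t δ} {c : RS s t k δ} {M : Obj s t k} {f : M →ₗ[PA s t k] c.rep}
    (hM : dim M = h.ts c 1) (hf : Function.Surjective f) : Function.Bijective f := by
  refine ⟨?_, hf⟩
  have h1 := finrank_surj hf
  have h2 : finrank k M = finrank k c.rep := finrank_of_dim (by rw [hM, h.ts_succ, h.ts_zero, zero_add]; rfl)
  have h3 : finrank k (M.sub (LinearMap.ker f)) = 0 := by omega
  have : Subsingleton (M.sub (LinearMap.ker f)) := by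
    by_contra hns
    have := finrank_pos' (not_subsingleton_iff_nontrivial.1 hns)
    omega
  rw [← LinearMap.ker_eq_bot]
  exact Submodule.subsingleton_iff_eq_bot.1 this

theorem LocL.soc_in_rad {h : Aff s t δ} {c : RS s t k δ} {l : ℕ} {M : Obj s t k} {f : M →ₗ[PA s t k] c.rep}
    (hM : dim M = h.ts c (l + 2)) (hf : LocF c M f) {T : RS s t k δ} (u : T.rep →ₗ[PA s t k] M) :
    f ∘ₗ u = 0 := by
  by_contra hne
  have hTc := RS.eq_of_map hne
  subst hTc
  have hr : df δ (M.sub (LinearMap.range u)) = 0 := T.simple.1.range hf.reg u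
  rcases hf.loc _ hr with h1 | h1
  · have h2 := LocL.rad hM hf
    have h3 := h2.1.nt
    have h4 := finrank_pos' h3
    have h5 := finrank_surj hf.surj
    have h6 := LinearMap.finrank_le_finrank_of_surjective (f := u.restrictScalars k) (show Function.Surjective u from LinearMap.range_eq_top.1 h1)
    omega
  · apply hne; ext x
    exact h1 ⟨x, rfl⟩

theorem LocL.hom_soc {h : Aff s t δ} {c : RS s t k δ} {l : ℕ} {M : Obj s t k} (hM : LocL h c (l+1) M) 
    (T : RS s t k δ) : (T = (h.sg)^[l] c → hom T.rep M = T.d) ∧ (T ≠ (h.sg)^[l] c → hom T.rep M = 0) := by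
  induction l generalizing c M with
  | zero =>
    obtain ⟨⟨f, hf⟩, hd⟩ := hM
    have e := LinearEquiv.ofBijective f (LocL.len_one hd hf.surj)
    rw [hom_congr (LinearEquiv.refl _ T.rep) e]
    refine ⟨?_, fun hT => RS.hom_ne hT⟩
    rintro rfl; rfl
  | succ l ih =>
    obtain ⟨⟨f, hf⟩, hd⟩ := hM
    have h2 := LocL.rad hd hf
    have : hom T.rep M = hom T.rep (M.sub (LinearMap.ker f)) := by
      apply le_antisymm
      · refine hom_le_linear (postH T.rep (N := M.sub (LinearMap.ker f)) (N' := M) (LinearMap.ker f).subtype) ?_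
        intro u
        obtain ⟨v, hv⟩ := exact_lift (N' := M.sub (LinearMap.ker f)) (LinearMap.exact_subtype_ker_map f)
          (LinearMap.ker f).subtype_injective u (LocL.soc_in_rad hd hf u)
        exact ⟨v, hv⟩
      · exact hom_le_of_inj T.rep (LinearMap.ker f).subtype_injective
    rw [this]
    exact ih h2

theorem LocL.ext_right {h : Aff s t δ} {c : RS s t k δ} {l : ℕ} {M : Obj s t k} (hM : LocL h c (l+1) M)
    (T : RS s t k δ) : (h.sg T = c → ext T.rep M = T.d) ∧ (h.sg T ≠ c → ext T.rep M = 0) := by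
  classical
  have e1 := euler T.rep M
  have e2 := h.eu_ts_right c T (l+1)
  rw [hM.2] at e1
  have e3 : eu s t (dim T.rep) (h.ts c (l+1)) = eu s t T.dv (h.ts c (l+1)) := rfl
  have e4 := hM.hom_soc T
  rw [e3, e2] at e1
  have e5 : hom T.rep M = T.d * (if h.sg T = (h.sg)^[l+1] c then 1 else 0) := by
    split_ifs with hif
    · rw [Function.iterate_succ_apply', h.sg_inj.eq_iff] at hif
      rw [e4.1 hif, mul_one]
    · rw [Function.iterate_succ_apply', h.sg_inj.eq_iff] at hif
      rw [e4.2 hif, mul_zero]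
  have e6 : ext T.rep M = T.d * (if h.sg T = c then 1 else 0) := by linarith
  refine ⟨fun hc => by rw [e6, if_pos hc, mul_one], fun hc => by rw [e6, if_neg hc, mul_zero]⟩

/-- a nonsplit extension of a simple by a local module is local -/
theorem LocL.extend {h : Aff s t δ} {c T : RS s t k δ} {l : ℕ} {E N : Obj s t k} (hE : LocL h c (l+1) E)
    {f : E →ₗ[PA s t k] N} {g : N →ₗ[PA s t k] T.rep} {ξ : Ext T.rep E} (hc : IsClass f g ξ) (hξ : ξ ≠ 0) :
    h.sg T = c ∧ LocF T N g ∧ LocL h T (l+2) N := by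
  have hT : h.sg T = c := by
    by_contra hT
    exact hξ ((ext_eq_zero_iff _ _).1 ((hE.ext_right T).2 hT) ξ)
  have hN : Reg δ N := Reg.exact hc.inj hc.surj hc.exact hE.1.reg T.simple.1
  have hloc : LocF T N g := by
    refine LocF.of_tops hN hc.surj fun T' u hu => ?_
    have h0 : u ∘ₗ f = 0 := by
      by_contra hne
      have h1 := hE.1.top_ne hne
      subst h1
      have h2 : push T.rep (u ∘ₗ f) ξ = 0 := (hc.ext_iff _ _).2 ⟨u, rfl⟩
      have h3 := push_surj T.rep (T'.simple.surj hE.1.reg hne)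
      have h4 : finrank k (Ext T.rep E) = finrank k (Ext T.rep T'.rep) := by
        have h5 := (hE.ext_right T).1 hT
        have h6 := h.ext_sg T
        rw [hT] at h6
        unfold ext at h5 h6
        exact_mod_cast h5.trans h6.symm
      have h5 := (LinearMap.injective_iff_surjective_of_finrank_eq_finrank h4).2 h3
      exact hξ (h5 (h2.trans (map_zero _).symm))
    obtain ⟨v, hv⟩ := exact_desc hc.exact hc.surj u h0
    have hv0 : v ≠ 0 := by rintro rfl; exact hu (by rw [← hv]; ext; rfl)
    intro x hx
    rw [← hv, LinearMap.mem_ker, LinearMap.comp_apply] at hx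
    exact (T.simple.inj T'.simple.1 hv0) (hx.trans (map_zero v).symm)
  refine ⟨hT, hloc, ⟨g, hloc⟩, ?_⟩
  rw [hc.dim, hE.2, ← hT, h.ts_succ' T]; rfl

theorem LocL.exists (h : Aff s t δ) (c : RS s t k δ) (l : ℕ) : ∃ M, LocL h c (l+1) M := by
  induction l generalizing c with
  | zero => exact ⟨c.rep, Loc.simple c, by rw [h.ts_succ, h.ts_zero, zero_add]; rfl⟩
  | succ l ih =>
    obtain ⟨E, hE⟩ := ih (h.sg c)
    have h1 := (hE.ext_right c).1 rfl
    have h2 : ∃ ξ : Ext c.rep E, ξ ≠ 0 := by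
      by_contra h3
      push Not at h3
      have := (ext_eq_zero_iff _ _).2 h3
      have := c.d_pos
      omega
    obtain ⟨ξ, hξ⟩ := h2
    obtain ⟨N, f, g, hc⟩ := exists_real c.rep E ξ
    exact ⟨N, (hE.extend hc hξ).2.2⟩
end

end KacAff

namespace KacAff
noncomputable section
open Module
set_option linter.all false
variable {V A : Type} [Fintype V] [DecidableEq V] {s t : A → V} {k : Type} [Field k] [Fintype A]
variable {δ : V → ℤ}

theorem exists_max_nat (P : ℕ → Prop) (B : ℕ) (hB : ∀ n, P n → n ≤ B) (h : ∃ n, P n) :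
    ∃ n, P n ∧ ∀ m, P m → m ≤ n := by
  classical
  have h' : ∃ j, ∃ n, P n ∧ B - n = j := by obtain ⟨n, hn⟩ := h; exact ⟨_, n, hn, rfl⟩
  obtain ⟨n, hn, hj⟩ := Nat.find_spec h'
  refine ⟨n, hn, fun m hm => ?_⟩
  by_contra hlt
  have h1 := Nat.find_min' h' ⟨m, hm, rfl⟩
  have h2 := hB m hm
  omega

theorem finrank_sub_lt {M : Obj s t k} {U W : Submodule (PA s t k) M} (h : U < W) :
    finrank k (M.sub U) < finrank k (M.sub W) := by
  have h1 : U.restrictScalars k < W.restrictScalars k := by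
    rw [SetLike.lt_iff_le_and_exists] at h ⊢
    exact ⟨fun x hx => h.1 hx, h.2⟩
  exact Submodule.finrank_lt_finrank_of_lt h1

theorem finrank_inj {M N : Obj s t k} {f : M →ₗ[PA s t k] N} (hf : Function.Injective f) :
    finrank k M ≤ finrank k N :=
  LinearMap.finrank_le_finrank_of_injective (f := f.restrictScalars k) hf
theorem finrank_le_surj {M N : Obj s t k} {f : M →ₗ[PA s t k] N} (hf : Function.Surjective f) :
    finrank k N ≤ finrank k M :=
  LinearMap.finrank_le_finrank_of_surjective (f := f.restrictScalars k) hf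

theorem bij_of_surj {M N : Obj s t k} {f : M →ₗ[PA s t k] N} (hf : Function.Surjective f)
    (h : finrank k M = finrank k N) : Function.Bijective f :=
  ⟨(LinearMap.injective_iff_surjective_of_finrank_eq_finrank (f := f.restrictScalars k) h).2 hf, hf⟩

theorem Loc.len' (h : Aff s t δ) {c : RS s t k δ} {M : Obj s t k} (hM : Loc c M) : ∃ l, LocL h c (l+1) M := by
  obtain ⟨l, hl⟩ := hM.exists_len h; exact ⟨l, hM, hl⟩

theorem Reg.exists_loc_ret (h : Aff s t δ) {M : Obj s t k} (hM : Reg δ M) (hn : Nontrivial M) :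
    ∃ (c : RS s t k δ) (E : Obj s t k), Loc c E ∧ Ret E M := by
  classical
  obtain ⟨n, ⟨c, E, i, hE, hi, hEn⟩, hmax⟩ := exists_max_nat
    (fun n => ∃ (c : RS s t k δ) (E : Obj s t k) (i : E →ₗ[PA s t k] M), Loc c E ∧ Function.Injective i ∧
      finrank k E = n) (finrank k M) (by
      rintro n ⟨c, E, i, hE, hi, rfl⟩; exact finrank_inj hi) (by
      obtain ⟨c, i, hi⟩ := hM.exists_soc hn
      exact ⟨_, c, c.rep, i, Loc.simple c, hi, rfl⟩)
  obtain ⟨n', ⟨C, hC, hCi, hCn⟩, hmax'⟩ := exists_max_nat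
    (fun n => ∃ C : Submodule (PA s t k) M, df δ (M.sub C) = 0 ∧ (∀ x, i x ∈ C → x = 0) ∧
      finrank k (M.sub C) = n) (finrank k M) (by
      rintro n ⟨C, -, -, rfl⟩; exact finrank_inj (M := M.sub C) C.subtype_injective) (by
      refine ⟨_, ⊥, df_bot M, fun x hx => ?_, rfl⟩
      exact hi (((Submodule.mem_bot _).1 hx).trans (map_zero i).symm))
  have hQ := hM.quot hC
  let j : E →ₗ[PA s t k] M.quot C := C.mkQ ∘ₗ i
  have hj : Function.Injective j := by
    rw [← LinearMap.ker_eq_bot, LinearMap.ker_eq_bot']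
    intro x hx
    exact hCi x ((Submodule.Quotient.mk_eq_zero C).1 hx)
  by_cases hjs : Function.Surjective j
  · refine ⟨c, E, hE, i, (LinearEquiv.ofBijective j ⟨hj, hjs⟩).symm.toLinearMap ∘ₗ C.mkQ, fun x => ?_⟩
    exact (LinearEquiv.ofBijective j ⟨hj, hjs⟩).symm_apply_apply x
  exfalso
  have hrj : df δ ((M.quot C).sub (LinearMap.range j)) = 0 := hE.reg.range hQ j
  have hQ1 := hQ.quot hrj
  have hn1 : Nontrivial ((M.quot C).quot (LinearMap.range j)) :=
    Submodule.Quotient.nontrivial_iff.2 fun h => hjs (LinearMap.range_eq_top.1 h)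
  obtain ⟨T, u, hu⟩ := hQ1.exists_soc hn1
  let π := (LinearMap.range j).mkQ
  have hπ : Function.Surjective π := Submodule.mkQ_surjective _
  let F := (LinearMap.range u).comap π
  have hF : Reg δ ((M.quot C).sub F) := hQ.sub (by
    rw [df_comap (B := (M.quot C).quot (LinearMap.range j)) hπ, T.simple.1.range hQ1 u, add_zero, Submodule.ker_mkQ, hrj])
  obtain ⟨g, hg⟩ := exact_lift (X := (M.quot C).sub F) (N' := T.rep) (N := (M.quot C).quot (LinearMap.range j))
    (N'' := ((M.quot C).quot (LinearMap.range j)).quot (LinearMap.range u)) (f := u) (g := (LinearMap.range u).mkQ)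
    (LinearMap.exact_map_mkQ_range u) hu (π ∘ₗ F.subtype) (by
      ext x
      exact (Submodule.Quotient.mk_eq_zero _).2 x.2)
  have hg' : ∀ x : F, u (g x) = π x.1 := fun x => LinearMap.congr_fun hg x
  have hgs : Function.Surjective g := by
    intro y
    obtain ⟨z, hz⟩ := hπ (u y)
    refine ⟨⟨z, ⟨y, hz.symm⟩⟩, hu ?_⟩
    rw [hg']; exact hz
  have hπj : ∀ x, π (j x) = 0 := fun x => (Submodule.Quotient.mk_eq_zero _).2 ⟨x, rfl⟩
  let f0 : E →ₗ[PA s t k] (M.quot C).sub F := j.codRestrict F (fun x => by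
    rw [Submodule.mem_comap, hπj]; exact Submodule.zero_mem _)
  have hf0 : Function.Injective f0 := fun x y hxy => hj (congrArg Subtype.val hxy)
  have hex : Function.Exact f0 g := by
    intro x
    constructor
    · intro hx
      have h1 := hg' x
      rw [hx, map_zero] at h1
      obtain ⟨y, hy⟩ := (Submodule.Quotient.mk_eq_zero _).1 h1.symm
      exact ⟨y, Subtype.ext hy⟩
    · rintro ⟨y, rfl⟩
      apply hu
      rw [hg', map_zero]; exact hπj y
  obtain ⟨ξ, hξ⟩ := exists_class hf0 hgs hex
  have hξ0 : ξ ≠ 0 := by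
    intro h0
    obtain ⟨H, hH⟩ := (hξ.lift_iff T.rep LinearMap.id).1 (by rw [h0, map_zero])
    have hH' : ∀ y, g (H y) = y := fun y => LinearMap.congr_fun hH y
    let v : T.rep →ₗ[PA s t k] M.quot C := F.subtype ∘ₗ H
    have hv : ∀ y, u y = π (v y) := fun y => by
      have := hg' (H y)
      rw [hH'] at this; exact this
    let C' := (LinearMap.range v).comap C.mkQ
    have hC'1 : df δ (M.sub C') = 0 := by
      rw [df_comap (B := M.quot C) (Submodule.mkQ_surjective C), T.simple.1.range hQ v, add_zero, Submodule.ker_mkQ, hC]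
    have hC'2 : ∀ x, i x ∈ C' → x = 0 := by
      rintro x ⟨y, hy⟩
      have h1 := hv y
      have h2 : v y = j x := hy
      rw [h2, hπj] at h1
      have h3 : y = 0 := hu (h1.trans (map_zero u).symm)
      rw [h3, map_zero] at h2
      exact hj (h2.symm.trans (map_zero j).symm)
    have hlt : C < C' := by
      rw [SetLike.lt_iff_le_and_exists]
      constructor
      · intro x hx
        rw [Submodule.mem_comap, Submodule.mkQ_apply, (Submodule.Quotient.mk_eq_zero C).2 hx]
        exact Submodule.zero_mem _
      · have := T.nt
        obtain ⟨y, hy⟩ := exists_ne (0 : T.rep)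
        obtain ⟨x, hx⟩ := C.mkQ_surjective (v y)
        refine ⟨x, ⟨y, hx.symm⟩, fun hxC => hy ?_⟩
        rw [Submodule.mkQ_apply, (Submodule.Quotient.mk_eq_zero C).2 hxC] at hx
        apply hu
        rw [hv, ← hx, map_zero, map_zero]
    have h1 := finrank_sub_lt hlt
    have h2 := hmax' _ ⟨C', hC'1, hC'2, rfl⟩
    omega
  obtain ⟨l, hl⟩ := hE.len' h
  obtain ⟨-, hFl, -⟩ := hl.extend hξ hξ0
  have hexm : ∃ n, ∃ (G : Obj s t k) (a : G →ₗ[PA s t k] M) (q : G →ₗ[PA s t k] (M.quot C).sub F),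
      Function.Injective a ∧ Function.Surjective q ∧ df δ G = 0 ∧ finrank k G = n := by
    refine ⟨_, M.sub (F.comap C.mkQ), (F.comap C.mkQ).subtype,
      (C.mkQ ∘ₗ (F.comap C.mkQ).subtype).codRestrict F (fun x => x.2), Submodule.subtype_injective _, ?_, ?_, rfl⟩
    · rintro ⟨x, hx⟩
      obtain ⟨y, rfl⟩ := C.mkQ_surjective x
      exact ⟨⟨y, hx⟩, rfl⟩
    · rw [df_comap (B := M.quot C) (Submodule.mkQ_surjective C), hF.1, add_zero, Submodule.ker_mkQ, hC]
  obtain ⟨G, a, q, ha, hq, hG0, hGn⟩ := Nat.find_spec hexm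
  have hG : Reg δ G := hM.of_inj ha hG0
  have hGl : LocF T G (g ∘ₗ q) := by
    refine LocF.of_tops hG (hgs.comp hq) fun T' v hv => ?_
    by_contra hnle
    have hK := hG.ker T'.simple.1 v
    have hKr : Reg δ (G.sub (LinearMap.ker v)) := hG.sub hK
    have h1 := hKr.range hF (q ∘ₗ (LinearMap.ker v).subtype)
    rcases hFl.loc _ h1 with h2 | h2
    · have h3 := Nat.find_min' hexm ⟨G.sub (LinearMap.ker v), a ∘ₗ (LinearMap.ker v).subtype,
        q ∘ₗ (LinearMap.ker v).subtype, ha.comp (Submodule.subtype_injective _), LinearMap.range_eq_top.1 h2,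
        hK, rfl⟩
      have h4 := finrank_surj (T'.simple.surj hG hv)
      have h5 := finrank_pos' T'.nt
      omega
    · apply hnle
      intro x hx
      exact h2 ⟨⟨x, hx⟩, rfl⟩
  have h1 := hmax _ ⟨T, G, a, ⟨_, hGl⟩, ha, rfl⟩
  have h2 := finrank_le_surj hq
  have h3 := finrank_surj hgs
  have h4 := finrank_pos' T.nt
  have h5 : finrank k E ≤ finrank k (((M.quot C).sub F).sub (LinearMap.ker g)) := by
    refine finrank_inj (N := ((M.quot C).sub F).sub (LinearMap.ker g))
      (f := f0.codRestrict (LinearMap.ker g) fun x => ?_) fun x y hxy => hf0 (congrArg Subtype.val hxy)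
    exact (hex _).2 ⟨x, rfl⟩
  omega

theorem df_compl {M : Obj s t k} {U W : Submodule (PA s t k) M} (h : IsCompl U W) :
    df δ M = df δ (M.sub U) + df δ (M.sub W) := by
  rw [df_sub_quot M U, df_eqv (M := M.quot U) (N := M.sub W) (Submodule.quotientEquivOfIsCompl U W h)]

theorem Loc.indec {c : RS s t k δ} {M : Obj s t k} (hM : Loc c M) : Indec M := by
  refine ⟨hM.nt, fun U W hUW => ?_⟩
  obtain ⟨f, hf⟩ := hM
  have h1 := df_compl (δ := δ) hUW
  have h2 := hf.reg.2 U
  have h3 := hf.reg.2 W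
  rw [hf.reg.1] at h1
  rcases hf.loc U (by omega) with h4 | h4
  · right; subst h4; exact top_disjoint.1 hUW.disjoint
  rcases hf.loc W (by omega) with h5 | h5
  · left; subst h5; exact disjoint_top.1 hUW.disjoint
  exfalso
  have h6 : LinearMap.ker f = ⊤ := top_le_iff.1 (hUW.sup_eq_top ▸ sup_le h4 h5)
  exact ker_ne_top (surj_ne_zero c.nt hf.surj) h6

theorem Reg.loc_of_indec (h : Aff s t δ) {M : Obj s t k} (hM : Reg δ M) (hi : Indec M) :
    ∃ c : RS s t k δ, Loc c M := by
  obtain ⟨c, E, hE, hr⟩ := hM.exists_loc_ret h hi.1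
  obtain ⟨e⟩ := Indec.ret hi hE.nt hr
  exact ⟨c, hE.congr e⟩

theorem Loc.of_surj {c : RS s t k δ} {M N : Obj s t k} (hM : Loc c M) (hN : Reg δ N) (hn : Nontrivial N)
    {g : M →ₗ[PA s t k] N} (hg : Function.Surjective g) : Loc c N := by
  obtain ⟨c', f', hf'⟩ := hN.exists_top hn
  have h1 : c' = c := hM.top_ne (g := f' ∘ₗ g) (surj_ne_zero c'.nt (hf'.comp hg))
  subst h1
  refine ⟨f', LocF.of_hom hN hf' ?_ ?_⟩
  · rw [← hM.hom_self]; exact hom_le_of_surj _ hg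
  · intro T hT
    exact le_antisymm ((hom_le_of_surj _ hg).trans (hM.hom_ne hT).le) (hom_nonneg _ _)

/-- the quotient by the socle -/
theorem LocL.quot_soc {h : Aff s t δ} {c T : RS s t k δ} {l : ℕ} {M : Obj s t k} (hM : LocL h c (l+2) M)
    (hT : T = (h.sg)^[l+1] c) : ∃ (B : Obj s t k) (Z : T.rep →ₗ[PA s t k] M) (g : M →ₗ[PA s t k] B),
      Function.Injective Z ∧ Function.Surjective g ∧ Function.Exact Z g ∧ LocL h c (l+1) B := by
  have h1 := (hM.hom_soc T).1 hT
  have h2 : ∃ Z : T.rep →ₗ[PA s t k] M, Z ≠ 0 := by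
    by_contra h3
    push Not at h3
    have := (hom_eq_zero_iff _ _).2 h3
    have := T.d_pos
    omega
  obtain ⟨Z, hZ⟩ := h2
  have hZi := T.simple.inj hM.1.reg hZ
  have h3 : dim (M.quot (LinearMap.range Z)) = h.ts c (l+1) := by
    have h4 := dim_exact (L := T.rep) (M := M) (N := M.quot (LinearMap.range Z)) hZi
      (Submodule.mkQ_surjective _) (LinearMap.exact_map_mkQ_range Z)
    rw [hM.2, h.ts_succ, ← hT, add_comm] at h4
    exact (add_left_cancel (a := T.dv) h4).symm
  refine ⟨M.quot (LinearMap.range Z), Z, (LinearMap.range Z).mkQ, hZi, Submodule.mkQ_surjective _,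
    LinearMap.exact_map_mkQ_range Z, ?_, h3⟩
  exact hM.1.of_surj (hM.1.reg.quot (T.simple.1.range hM.1.reg Z)) (ts_sum_pos h c h3) (Submodule.mkQ_surjective _)

theorem LocL.lift {h : Aff s t δ} {c : RS s t k δ} {l : ℕ} {M M' : Obj s t k} (hM : LocL h c (l+1) M)
    (hM' : LocL h c (l+1) M') {f : M →ₗ[PA s t k] c.rep} (hf : LocF c M f)
    {f' : M' →ₗ[PA s t k] c.rep} (hf' : LocF c M' f') (α : c.rep →ₗ[PA s t k] c.rep) :
    ∃ φ : M →ₗ[PA s t k] M', f' ∘ₗ φ = α ∘ₗ f := by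
  induction l generalizing M M' with
  | zero =>
    let e := LinearEquiv.ofBijective f' (LocL.len_one hM'.2 hf'.surj)
    refine ⟨e.symm.toLinearMap ∘ₗ α ∘ₗ f, ?_⟩
    ext x
    exact e.apply_symm_apply _
  | succ l ih =>
    obtain ⟨T, hT⟩ : ∃ T, T = (h.sg)^[l+1] c := ⟨_, rfl⟩
    obtain ⟨B, Z, g, hZ, hgs, hex, hQ⟩ := hM.quot_soc hT
    obtain ⟨B', Z', g', hZ', hgs', hex', hQ'⟩ := hM'.quot_soc hT
    obtain ⟨ξ, hξ⟩ := exists_class hZ hgs hex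
    obtain ⟨ξ', hξ'⟩ := exists_class hZ' hgs' hex'
    obtain ⟨p, hp⟩ := exact_desc hex hgs f (LocL.soc_in_rad hM.2 hf Z)
    obtain ⟨p', hp'⟩ := exact_desc hex' hgs' f' (LocL.soc_in_rad hM'.2 hf' Z')
    have hp0 : LocF c B p := by
      obtain ⟨p1, hp1⟩ := hQ.1
      refine hp1.change ?_
      rintro rfl
      exact surj_ne_zero c.nt hf.surj (by rw [← hp]; ext; rfl)
    have hp0' : LocF c B' p' := by
      obtain ⟨p1, hp1⟩ := hQ'.1
      refine hp1.change ?_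
      rintro rfl
      exact surj_ne_zero c.nt hf'.surj (by rw [← hp']; ext; rfl)
    obtain ⟨φ, hφ⟩ := ih hQ hQ' hp0 hp0'
    have hξ0 : ξ ≠ 0 := by
      intro h0
      obtain ⟨H, hH⟩ := (hξ.ext_iff T.rep LinearMap.id).1 (by rw [h0, map_zero])
      have hHs : Function.Surjective H := fun x => ⟨Z x, LinearMap.congr_fun hH x⟩
      have hH0 := surj_ne_zero T.nt hHs
      have hTc := hf.eq hH0
      subst hTc
      rw [LocL.soc_in_rad hM.2 (hf.change hH0) Z] at hH
      have := T.nt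
      obtain ⟨y, hy⟩ := exists_ne (0 : T.rep)
      exact hy (LinearMap.congr_fun hH y).symm
    have hi := pushL_inj T.simple ξ hξ0
    have hd : finrank k (T.rep →ₗ[PA s t k] T.rep) = finrank k (Ext B T.rep) := by
      have h5 := hQ.ext_left.1
      have h6 := h.d_iter c (l+1)
      rw [← hT] at h5 h6
      have h7 : hom T.rep T.rep = ext B T.rep := h6.trans h5.symm
      unfold hom ext at h7
      exact_mod_cast h7
    obtain ⟨β, hβ⟩ := (LinearMap.injective_iff_surjective_of_finrank_eq_finrank hd).1 hi (pull φ T.rep ξ')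
    have hβ : push B β ξ = pull φ T.rep ξ' := hβ
    have h0 : pull g T.rep ξ = 0 := (hξ.lift_iff M g).2 ⟨LinearMap.id, rfl⟩
    obtain ⟨ψ, hψ⟩ := (hξ'.lift_iff M (φ ∘ₗ g)).1 (by
      rw [pull_comp, ← hβ, ← push_pull, h0, map_zero])
    refine ⟨ψ, ?_⟩
    rw [← hp', LinearMap.comp_assoc, hψ, ← LinearMap.comp_assoc, hφ, LinearMap.comp_assoc, hp]

theorem LocF.surj_of_ne {c : RS s t k δ} {M M' : Obj s t k} (hM : Reg δ M) {f' : M' →ₗ[PA s t k] c.rep}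
    (hf' : LocF c M' f') {φ : M →ₗ[PA s t k] M'} (h : f' ∘ₗ φ ≠ 0) : Function.Surjective φ := by
  rw [← LinearMap.range_eq_top]
  refine (hf'.loc _ (hM.range hf'.reg φ)).resolve_right fun hle => h ?_
  ext x
  exact hle ⟨x, rfl⟩

theorem LocL.iso {h : Aff s t δ} {c : RS s t k δ} {l : ℕ} {M M' : Obj s t k} (hM : LocL h c (l+1) M)
    (hM' : LocL h c (l+1) M') : Nonempty (M ≃ₗ[PA s t k] M') := by
  obtain ⟨f, hf⟩ := hM.1
  obtain ⟨f', hf'⟩ := hM'.1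
  obtain ⟨φ, hφ⟩ := hM.lift hM' hf hf' LinearMap.id
  have h1 : f' ∘ₗ φ ≠ 0 := by rw [hφ]; exact surj_ne_zero c.nt hf.surj
  exact ⟨LinearEquiv.ofBijective φ (bij_of_surj (hf'.surj_of_ne hf.reg h1) (finrank_of_dim (hM.2.trans hM'.2.symm)))⟩

theorem LocL.sub {h : Aff s t δ} {c : RS s t k δ} {l : ℕ} (n : ℕ) {M : Obj s t k} (hM : LocL h c (l+1+n) M) :
    ∃ (N : Obj s t k) (i : N →ₗ[PA s t k] M), LocL h ((h.sg)^[n] c) (l+1) N ∧ Function.Injective i := by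
  induction n generalizing c M with
  | zero => exact ⟨M, LinearMap.id, hM, Function.injective_id⟩
  | succ n ih =>
    obtain ⟨⟨f, hf⟩, hd⟩ := hM
    have h1 : LocL h (h.sg c) (l+1+n) (M.sub (LinearMap.ker f)) := by
      have := LocL.rad (l := l + n) (by rw [hd]; congr 1; omega) hf
      rwa [show l + n + 1 = l + 1 + n by omega] at this
    obtain ⟨N, i, hN, hi⟩ := ih h1
    exact ⟨N, (LinearMap.ker f).subtype ∘ₗ i, hN, (Submodule.subtype_injective _).comp hi⟩

theorem LocL.quot {h : Aff s t δ} {c : RS s t k δ} {l : ℕ} (n : ℕ) {M : Obj s t k} (hM : LocL h c (l+1+n) M) :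
    ∃ (N : Obj s t k) (i : M →ₗ[PA s t k] N), LocL h c (l+1) N ∧ Function.Surjective i := by
  induction n generalizing M with
  | zero => exact ⟨M, LinearMap.id, hM, Function.surjective_id⟩
  | succ n ih =>
    obtain ⟨B, Z, g, -, hg, -, hQ⟩ := LocL.quot_soc (l := l + n) (M := M) (c := c) (h := h) (by rwa [show l + n + 2 = l+1+(n+1) by omega]) rfl
    rw [show l + n + 1 = l + 1 + n by omega] at hQ
    obtain ⟨N, i, hN, hi⟩ := ih hQ
    exact ⟨N, i ∘ₗ g, hN, hi.comp hg⟩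

theorem Aff.ts_add (h : Aff s t δ) (c : RS s t k δ) (n m : ℕ) :
    h.ts c (n + m) = h.ts c n + h.ts ((h.sg)^[n] c) m := by
  induction m with
  | zero => rw [h.ts_zero]; simp
  | succ m ih => rw [← add_assoc, h.ts_succ, h.ts_succ, ih, ← Function.iterate_add_apply, add_comm m n, add_assoc]

/-- long local modules have many endomorphisms -/
theorem LocL.two_le_hom {h : Aff s t δ} {c : RS s t k δ} {l r : ℕ} (hr : 0 < r) (hc : (h.sg)^[r] c = c)
    {M : Obj s t k} (hM : LocL h c (l+1+r) M) : 2 ≤ hom M M := by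
  obtain ⟨N, i, hN, hi⟩ := hM.sub r
  obtain ⟨N', p, hN', hp⟩ := hM.quot r
  rw [hc] at hN
  obtain ⟨e⟩ := hN'.iso hN
  let φ : M →ₗ[PA s t k] M := i ∘ₗ e.toLinearMap ∘ₗ p
  have hφ0 : φ ≠ 0 := by
    have h1 := hN.1.nt
    intro h0
    obtain ⟨x, hx⟩ := exists_ne (0 : N)
    obtain ⟨y, hy⟩ := hp (e.symm x)
    have h2 : i (e (p y)) = 0 := LinearMap.congr_fun h0 y
    rw [hy, e.apply_symm_apply] at h2
    exact hx (hi (h2.trans (map_zero i).symm))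
  have hφs : ¬ Function.Surjective φ := by
    intro hs
    have h1 : Function.Surjective i := Function.Surjective.of_comp (g := fun x => e (p x)) hs
    obtain ⟨f, hf⟩ := hM.1
    have h2 := finrank_of_dim (dim_eqv (LinearEquiv.ofBijective i ⟨hi, h1⟩))
    have h3 := dim_eqv (LinearEquiv.ofBijective i ⟨hi, h1⟩)
    have h4 := hN.ext_left.1
    rw [hN.2, hM.2] at h3
    rw [h.ts_add c (l+1) r] at h3
    have h6 : h.ts ((h.sg)^[l+1] c) r = 0 := by
      have := h3.symm
      rwa [add_eq_left] at this
    obtain ⟨r', rfl⟩ : ∃ r', r = r' + 1 := ⟨r - 1, by omega⟩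
    obtain ⟨X, hX⟩ := LocL.exists h ((h.sg)^[l+1] c) r'
    have h7 := hX.1.nt
    rw [← not_subsingleton_iff_nontrivial, ← dim_eq_zero_iff, hX.2] at h7
    exact h7 h6
  have hli : LinearIndependent k ![(LinearMap.id : M →ₗ[PA s t k] M), φ] := by
    rw [LinearIndependent.pair_iff]
    intro a b hab
    have hb : ∀ x, a • x + b • φ x = 0 := fun x => LinearMap.congr_fun hab x
    have ha : a = 0 := by
      by_contra ha
      apply hφs
      intro x
      have h1 := hb x
      by_cases hb0 : b = 0
      · exfalso
        have h1 := hM.1.nt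
        obtain ⟨y, hy⟩ := exists_ne (0 : M)
        have := hb y
        rw [hb0, zero_smul, add_zero] at this
        exact hy ((smul_eq_zero.1 this).resolve_left ha)
      · refine ⟨(-(a⁻¹ * b)) • x, ?_⟩
        have : φ ((-(a⁻¹ * b)) • x) = (-(a⁻¹ * b)) • φ x := (φ.restrictScalars k).map_smul _ _
        rw [this, neg_smul, mul_smul, eq_neg_of_add_eq_zero_right h1, smul_neg, neg_neg, smul_smul,
          inv_mul_cancel₀ ha, one_smul]
    refine ⟨ha, ?_⟩
    by_contra hb0
    apply hφ0
    ext x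
    have := hb x
    rw [ha, zero_smul, zero_add] at this
    exact (smul_eq_zero.1 this).resolve_left hb0
  have h1 := hli.fintype_card_le_finrank
  simp only [Fintype.card_fin] at h1
  unfold hom
  exact_mod_cast h1
end

end KacAff

namespace KacAff
noncomputable section
open Module
set_option linter.all false
variable {V A : Type} [Fintype V] [DecidableEq V] {s t : A → V} {k : Type} [Field k] [Fintype A]
variable {δ : V → ℤ}

theorem LocL.hom_le {h : Aff s t δ} {c : RS s t k δ} {l : ℕ} {N : Obj s t k} (hN : LocL h c (l+1) N)
    (M : Obj s t k) : hom M N ≤ ∑ n ∈ Finset.range (l+1), hom M ((h.sg)^[n] c).rep := by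
  induction l generalizing N with
  | zero =>
    obtain ⟨⟨f, hf⟩, hd⟩ := hN
    have e := LinearEquiv.ofBijective f (LocL.len_one hd hf.surj)
    rw [Finset.sum_range_one, hom_congr (LinearEquiv.refl _ M) e]; rfl
  | succ l ih =>
    obtain ⟨B, Z, g, hZ, hg, hex, hQ⟩ := hN.quot_soc rfl
    rw [Finset.sum_range_succ]
    have h1 := hom_sub_right M hex hZ
    have h2 := ih hQ
    linarith

theorem LocL.hom_one {h : Aff s t δ} {c : RS s t k δ} {l : ℕ} {E : Obj s t k} (hE : LocL h c (l+1) E)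
    (hd : c.d = 1) (hmin : ∀ n, 0 < n → n < l + 1 → (h.sg)^[n] c ≠ c) : hom E E = 1 := by
  apply le_antisymm
  · refine (hE.hom_le E).trans ?_
    rw [Finset.sum_range_succ']
    rw [Finset.sum_eq_zero]
    · rw [zero_add]; exact (hE.1.hom_self).le.trans hd.le
    · intro n hn
      exact hE.1.hom_ne (hmin _ (Nat.succ_pos n) (by have := Finset.mem_range.1 hn; omega))
  · rcases (hom_nonneg E E).lt_or_eq with h1 | h1
    · exact h1
    · exfalso
      have h1 := (hom_eq_zero_iff _ _).1 h1.symm LinearMap.id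
      have := hE.1.nt
      obtain ⟨x, hx⟩ := exists_ne (0 : E)
      exact hx (LinearMap.congr_fun h1 x)

theorem Loc.inter (h : Aff s t δ) {c : RS s t k δ} {M : Obj s t k} (hM : Loc c M) {U W : Submodule (PA s t k) M}
    (hU : df δ (M.sub U) = 0) (hW : df δ (M.sub W) = 0) (hU0 : U ≠ ⊥) (hW0 : W ≠ ⊥) :
    ∃ x ∈ U, x ∈ W ∧ x ≠ 0 := by
  obtain ⟨l, hl⟩ := hM.len' h
  have key : ∀ U : Submodule (PA s t k) M, df δ (M.sub U) = 0 → U ≠ ⊥ →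
      ∃ Z : ((h.sg)^[l] c).rep →ₗ[PA s t k] M, Function.Injective Z ∧ ∀ x, Z x ∈ U := by
    intro U hU hU0
    obtain ⟨T, Z, hZ⟩ := (hM.reg.sub hU).exists_soc (Submodule.nontrivial_iff_ne_bot.2 hU0)
    have hZ' : Function.Injective (U.subtype ∘ₗ Z) := U.subtype_injective.comp hZ
    have hT : T = (h.sg)^[l] c := by
      by_contra hT
      exact inj_ne_zero (M := M) T.nt hZ' ((hom_eq_zero_iff _ _).1 ((hl.hom_soc T).2 hT) _)
    subst hT
    exact ⟨U.subtype ∘ₗ Z, hZ', fun x => (Z x).2⟩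
  obtain ⟨Z, hZ, hZU⟩ := key U hU hU0
  obtain ⟨Y, hY, hYW⟩ := key W hW hW0
  have hd := (hl.hom_soc _).1 rfl
  generalize (h.sg)^[l] c = T at *
  have hi : Function.Injective (postH T.rep Z) := by
    intro u v huv
    ext x
    exact hZ (LinearMap.congr_fun huv x)
  have hd' : finrank k (T.rep →ₗ[PA s t k] T.rep) = finrank k (T.rep →ₗ[PA s t k] M) := by
    unfold hom RS.d hom at hd; exact_mod_cast hd.symm
  obtain ⟨β, hβ⟩ := (LinearMap.injective_iff_surjective_of_finrank_eq_finrank hd').1 hi Y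
  have := T.nt
  obtain ⟨y, hy⟩ := exists_ne (0 : T.rep)
  refine ⟨Y y, ?_, hYW y, fun h0 => hy (hY (h0.trans (map_zero Y).symm))⟩
  rw [← hβ]; exact hZU _

theorem finrank_ker_range {M N : Obj s t k} (f : M →ₗ[PA s t k] N) :
    finrank k M = finrank k (M.sub (LinearMap.ker f)) + finrank k (N.sub (LinearMap.range f)) := by
  have h1 := finrank_eq_sum M
  rw [dim_ker_range f] at h1
  simp only [Pi.add_apply, Finset.sum_add_distrib] at h1
  rw [← finrank_eq_sum, ← finrank_eq_sum] at h1
  exact_mod_cast h1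

theorem LocF.nil_step (h : Aff s t δ) {c : RS s t k δ} {M : Obj s t k} {f : M →ₗ[PA s t k] c.rep} (hf : LocF c M f)
    {ν : M →ₗ[PA s t k] M} (hν : f ∘ₗ ν = 0) {W : Submodule (PA s t k) M} (hW : df δ (M.sub W) = 0) (hW0 : W ≠ ⊥) :
    finrank k (M.sub (LinearMap.range (ν ∘ₗ W.subtype))) < finrank k (M.sub W) := by
  have hk : LinearMap.ker ν ≠ ⊥ := by
    intro h0
    have hi : Function.Injective ν := LinearMap.ker_eq_bot.1 h0
    have hs : Function.Surjective ν :=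
      (LinearMap.injective_iff_surjective (f := ν.restrictScalars k)).1 hi
    refine surj_ne_zero c.nt (hf.surj.comp hs) (f := f ∘ₗ ν) hν
  obtain ⟨x, hx, hxW, hx0⟩ := Loc.inter h ⟨f, hf⟩ (hf.reg.ker hf.reg ν) hW hk hW0
  have h1 := finrank_ker_range (M := M.sub W) (ν ∘ₗ W.subtype)
  have h2 : Nontrivial ((M.sub W).sub (LinearMap.ker (M := M.sub W) (ν ∘ₗ W.subtype))) := by
    rw [Submodule.nontrivial_iff_ne_bot, Submodule.ne_bot_iff]
    exact ⟨⟨x, hxW⟩, hx, fun h => hx0 (congrArg Subtype.val h)⟩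
  have h3 := finrank_pos' h2
  have h4 : finrank k (M.sub (LinearMap.range (ν ∘ₗ W.subtype))) =
    finrank k (M.sub (LinearMap.range (M := M.sub W) (ν ∘ₗ W.subtype))) := rfl
  omega

theorem LocF.nil (h : Aff s t δ) {c : RS s t k δ} {M : Obj s t k} {f : M →ₗ[PA s t k] c.rep} (hf : LocF c M f)
    (w : List (Module.End (PA s t k) M)) (hw : ∀ ν ∈ w, f ∘ₗ ν = 0) :
    w.prod = 0 ∨ finrank k (M.sub (LinearMap.range w.prod)) + w.length ≤ finrank k M := by
  induction w with
  | nil =>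
    right
    simp only [List.prod_nil, List.length_nil, add_zero]
    exact finrank_inj (M := M.sub _) (Submodule.subtype_injective _)
  | cons ν w ih =>
    rw [List.prod_cons]
    by_cases h0 : w.prod = 0
    · left; rw [h0, mul_zero]
    right
    have h1 := (ih fun μ hμ => hw μ (List.mem_cons_of_mem _ hμ)).resolve_left h0
    have h2 := hf.nil_step h (hw ν List.mem_cons_self) (hf.reg.range hf.reg w.prod)
      (fun hb => h0 (LinearMap.range_eq_bot.1 hb))
    have h3 : LinearMap.range (ν * w.prod) = LinearMap.range (ν ∘ₗ (LinearMap.range w.prod).subtype) := by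
      ext x
      constructor
      · rintro ⟨y, rfl⟩; exact ⟨⟨w.prod y, y, rfl⟩, rfl⟩
      · rintro ⟨⟨_, y, rfl⟩, rfl⟩; exact ⟨y, rfl⟩
    rw [h3, List.length_cons]
    omega

theorem LocF.nil' (h : Aff s t δ) {c : RS s t k δ} {M : Obj s t k} {f : M →ₗ[PA s t k] c.rep} (hf : LocF c M f)
    (w : List (Module.End (PA s t k) M)) (hw : ∀ ν ∈ w, f ∘ₗ ν = 0) (hl : finrank k M ≤ w.length) : w.prod = 0 := by
  rcases hf.nil h w hw with h1 | h1
  · exact h1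
  · have h2 : ¬ Nontrivial (M.sub (LinearMap.range w.prod)) := fun hn => by
      have := finrank_pos' hn; omega
    rw [not_nontrivial_iff_subsingleton] at h2
    exact LinearMap.range_eq_bot.1 (Submodule.subsingleton_iff_eq_bot.1 h2)

theorem RS.end_scalar {c : RS s t k δ} (hd : c.d = 1) (α : c.rep →ₗ[PA s t k] c.rep) :
    ∃ a : k, ∀ x, α x = a • x := by
  have h1 : finrank k (c.rep →ₗ[PA s t k] c.rep) = 1 := by
    unfold RS.d hom at hd; exact_mod_cast hd
  have h2 : (LinearMap.id : c.rep →ₗ[PA s t k] c.rep) ≠ 0 := by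
    intro h0
    have := c.nt
    obtain ⟨x, hx⟩ := exists_ne (0 : c.rep)
    exact hx (LinearMap.congr_fun h0 x)
  obtain ⟨a, ha⟩ := (finrank_eq_one_iff_of_nonzero' _ h2).1 h1 α
  exact ⟨a, fun x => by rw [← ha]; rfl⟩

theorem LocF.end_decomp {c : RS s t k δ} {M : Obj s t k} {f : M →ₗ[PA s t k] c.rep} (hf : LocF c M f)
    (hd : c.d = 1) (φ : M →ₗ[PA s t k] M) : ∃ a : k, f ∘ₗ (φ - a • LinearMap.id) = 0 := by
  obtain ⟨α, hα⟩ := hf.exists_end (f ∘ₗ φ)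
  obtain ⟨a, ha⟩ := RS.end_scalar hd α
  refine ⟨a, ?_⟩
  ext x
  have h1 : α (f x) = f (φ x) := LinearMap.congr_fun hα x
  change f (φ x - a • x) = 0
  have h2 : f (a • x) = a • f x := (f.restrictScalars k).map_smul _ _
  rw [map_sub, ← h1, ha, h2, sub_self]

/-- the period of the tube -/
def Aff.pr (h : Aff s t δ) (c : RS s t k δ) : ℕ := Function.minimalPeriod h.sg c

theorem Aff.pr_pos (h : Aff s t δ) (c : RS s t k δ) : 0 < h.pr c := by
  obtain ⟨r, hr, hc⟩ := h.sg_periodic c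
  exact Function.minimalPeriod_pos_of_mem_periodicPts ⟨r, hr, hc⟩

theorem Aff.sg_pr (h : Aff s t δ) (c : RS s t k δ) : (h.sg)^[h.pr c] c = c :=
  Function.iterate_minimalPeriod

theorem Aff.sg_ne (h : Aff s t δ) (c : RS s t k δ) {n : ℕ} (h0 : 0 < n) (hn : n < h.pr c) : (h.sg)^[n] c ≠ c :=
  fun hc => absurd (Function.IsPeriodicPt.minimalPeriod_le h0 hc) (by unfold Aff.pr at hn; omega)

/-- the tube multiplicity -/
def Aff.hh (h : Aff s t δ) (c : RS s t k δ) : ℤ := Classical.choose (h.ts_period (h.sg_pr c))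

theorem Aff.ts_pr (h : Aff s t δ) (c : RS s t k δ) : h.ts c (h.pr c) = h.hh c • δ :=
  Classical.choose_spec (h.ts_period (h.sg_pr c))

theorem Aff.ts_pos (h : Aff s t δ) (c : RS s t k δ) {l : ℕ} (hl : 0 < l) : h.ts c l ≠ 0 := by
  obtain ⟨l', rfl⟩ : ∃ l', l = l' + 1 := ⟨l - 1, by omega⟩
  obtain ⟨X, hX⟩ := LocL.exists h c l'
  have h7 := hX.1.nt
  rw [← not_subsingleton_iff_nontrivial, ← dim_eq_zero_iff, hX.2] at h7
  exact h7

theorem Aff.ts_nonneg (h : Aff s t δ) (c : RS s t k δ) (l : ℕ) (i : V) : 0 ≤ h.ts c l i := by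
  rw [Aff.ts, Finset.sum_apply]
  exact Finset.sum_nonneg fun n _ => dim_nonneg _ _

theorem Aff.hh_pos (h : Aff s t δ) (c : RS s t k δ) : 0 < h.hh c := by
  have h1 := h.ts_pr c
  have h2 := h.ts_pos c (h.pr_pos c)
  obtain ⟨i⟩ := h.ne
  have h3 := h.ts_nonneg c (h.pr c) i
  rw [h1] at h3 h2
  have h4 := h.pos i
  have h5 : 0 ≤ h.hh c := by
    by_contra hneg
    push Not at hneg
    change 0 ≤ h.hh c * δ i at h3
    nlinarith
  rcases h5.lt_or_eq with h6 | h6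
  · exact h6
  · rw [← h6, zero_smul] at h2; exact absurd rfl h2

theorem Aff.ts_mul (h : Aff s t δ) (c : RS s t k δ) (m : ℕ) :
    h.ts c (m * h.pr c) = ((m : ℤ) * h.hh c) • δ := by
  induction m with
  | zero => simp [h.ts_zero]
  | succ m ih =>
    rw [Nat.succ_mul, h.ts_add, ih]
    have : (h.sg)^[m * h.pr c] c = c := by
      have := (Function.isPeriodicPt_minimalPeriod h.sg c).const_mul m
      exact this
    rw [this, h.ts_pr, ← add_smul]
    congr 1; push_cast; ring

theorem Aff.dvd_of_ts (h : Aff s t δ) (c : RS s t k δ) {l : ℕ} {m : ℤ} (hl : h.ts c l = m • δ) : h.pr c ∣ l := by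
  classical
  have h1 := h.eu_ts_left c c l
  rw [hl, eu_smul_left, c.df, mul_zero] at h1
  have h2 : (h.sg)^[l] c = c := by
    by_contra hne
    rw [if_pos rfl, if_neg hne] at h1
    have := c.d_pos
    linarith
  exact Function.IsPeriodicPt.minimalPeriod_dvd h2

theorem Aff.ts_cond (h : Aff s t δ) (c : RS s t k δ) {l : ℕ} {m : ℤ} (hl : h.ts c l = m • δ) :
    ∃ n : ℕ, l = n * h.pr c ∧ m = n * h.hh c := by
  obtain ⟨n, rfl⟩ := h.dvd_of_ts c hl
  refine ⟨n, mul_comm _ _, ?_⟩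
  rw [mul_comm, h.ts_mul] at hl
  obtain ⟨i⟩ := h.ne
  have := congrFun hl i
  change n * h.hh c * δ i = m * δ i at this
  exact (mul_right_cancel₀ (h.pos i).ne' this).symm

theorem Aff.pr_iter (h : Aff s t δ) (c : RS s t k δ) (n : ℕ) : h.pr ((h.sg)^[n] c) = h.pr c := by
  apply Function.minimalPeriod_apply_iterate
  obtain ⟨r, hr, hc⟩ := h.sg_periodic c
  exact ⟨r, hr, hc⟩

theorem Aff.hh_iter (h : Aff s t δ) (c : RS s t k δ) (n : ℕ) : h.hh ((h.sg)^[n] c) = h.hh c := by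
  have h1 := h.ts_add c n (h.pr c)
  have h2 := h.ts_add c (h.pr c) n
  rw [h.sg_pr, h.ts_pr, add_comm] at h2
  rw [h2] at h1
  have h3 := h.ts_pr ((h.sg)^[n] c)
  rw [h.pr_iter] at h3
  rw [h3, add_comm] at h1
  have h4 := add_left_cancel h1
  obtain ⟨i⟩ := h.ne
  have := congrFun h4 i
  change h.hh c * δ i = _ * δ i at this
  exact (mul_right_cancel₀ (h.pos i).ne' this).symm
end

end KacAff


namespace KacAff

noncomputable section

open Module
set_option linter.all false

variable {V A : Type} [Fintype V] [DecidableEq V] {s t : A → V} {k : Type} [Field k] [Fintype A]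
variable {δ : V → ℤ}

theorem Aff.pa_fin (h : Aff s t δ) (k : Type) [Field k] (j : V) :
    ∃ W : Submodule k (PA s t k), FiniteDimensional k W ∧ pe s t k j ∈ W ∧
      ∀ z, ∀ w ∈ W, z * w ∈ W := by
  classical
  obtain ⟨f, hf⟩ := h.idx
  have key : ∀ n : ℕ, ∀ j : V, Fintype.card V - (f j : ℕ) = n → ∃ W : Submodule k (PA s t k),
      FiniteDimensional k W ∧ pe s t k j ∈ W ∧ ∀ z, ∀ w ∈ W, z * w ∈ W := by
    intro n
    induction n using Nat.strong_induction_on with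
    | _ n ih =>
      intro j hj
      have h1 : ∀ a : A, ∃ W : Submodule k (PA s t k), FiniteDimensional k W ∧
          (s a = j → pe s t k (t a) ∈ W) ∧ ∀ z, ∀ w ∈ W, z * w ∈ W := by
        intro a
        by_cases ha : s a = j
        · have h2 := hf a
          rw [ha] at h2
          have h3 : (f j : ℕ) < f (t a) := h2
          have h4 := (f (t a)).2
          obtain ⟨W, h5, h6, h7⟩ := ih (Fintype.card V - (f (t a) : ℕ)) (by omega) (t a) rfl
          exact ⟨W, h5, fun _ => h6, h7⟩
        · exact ⟨⊥, inferInstance, fun h => absurd h ha, fun z w hw => by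
            rw [Submodule.mem_bot] at hw ⊢; rw [hw, mul_zero]⟩
      choose W hW1 hW2 hW3 using h1
      let W' : Submodule k (PA s t k) := Submodule.span k {pe s t k j} ⊔
        ⨆ a : A, (W a).map (LinearMap.mulRight k (px s t k a))
      have hin : ∀ a, ∀ w ∈ W a, w * px s t k a ∈ W' := by
        intro a w hw
        apply Submodule.mem_sup_right
        exact Submodule.mem_iSup_of_mem a ⟨w, hw, rfl⟩
      have hj' : pe s t k j ∈ W' := Submodule.mem_sup_left (Submodule.mem_span_singleton_self _)
      refine ⟨W', inferInstance, hj', ?_⟩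
      intro z
      induction z using PA_induction with
      | h0 r => intro w hw; rw [← Algebra.smul_def]; exact W'.smul_mem r hw
      | hm a b ha hb => intro w hw; rw [mul_assoc]; exact ha _ (hb _ hw)
      | ha a b ha hb => intro w hw; rw [add_mul]; exact W'.add_mem (ha _ hw) (hb _ hw)
      | he l =>
        have : W' ≤ W'.comap (LinearMap.mulLeft k (pe s t k l)) := by
          refine sup_le ?_ (iSup_le fun a => ?_)
          · rw [Submodule.span_singleton_le_iff_mem, Submodule.mem_comap]
            change pe s t k l * pe s t k j ∈ W'
            by_cases hl : l = j
            · rw [hl, pe_mul_self]; exact hj'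
            · rw [pe_mul_ne hl]; exact W'.zero_mem
          · rintro _ ⟨w, hw, rfl⟩
            change pe s t k l * (w * px s t k a) ∈ W'
            rw [← mul_assoc]; exact hin a _ (hW3 a _ _ hw)
        exact fun w hw => this hw
      | hx b =>
        have : W' ≤ W'.comap (LinearMap.mulLeft k (px s t k b)) := by
          refine sup_le ?_ (iSup_le fun a => ?_)
          · rw [Submodule.span_singleton_le_iff_mem, Submodule.mem_comap]
            change px s t k b * pe s t k j ∈ W'
            by_cases hl : s b = j
            · rw [← hl, px_mul_pe, ← pe_mul_px]; exact hin b _ (hW2 b hl)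
            · rw [← px_mul_pe, mul_assoc, pe_mul_ne hl, mul_zero]; exact W'.zero_mem
          · rintro _ ⟨w, hw, rfl⟩
            change px s t k b * (w * px s t k a) ∈ W'
            rw [← mul_assoc]; exact hin a _ (hW3 a _ _ hw)
        exact fun w hw => this hw
  exact key _ j rfl

/-- projective cover characterization -/
structure IsProj (i : V) (P : Obj s t k) (p : P) : Prop where
  mem : pe s t k i • p = p
  ex : ∀ (M : Obj s t k) (m : M), pe s t k i • m = m → ∃ f : P →ₗ[PA s t k] M, f p = m
  un : ∀ (M : Obj s t k) (f g : P →ₗ[PA s t k] M), f p = g p → f = g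

theorem Aff.exists_proj (h : Aff s t δ) (k : Type) [Field k] (i : V) :
    ∃ (P : Obj s t k) (p : P), IsProj i P p := by
  obtain ⟨W, h1, h2, h3⟩ := h.pa_fin k i
  let U : Submodule (PA s t k) (PA s t k) := Submodule.span _ {pe s t k i}
  have hU : U.restrictScalars k ≤ W := by
    intro x hx
    obtain ⟨z, rfl⟩ := Submodule.mem_span_singleton.1 (show x ∈ U from hx)
    exact h3 z _ h2
  have hfd : FiniteDimensional k (U.restrictScalars k) := Submodule.finiteDimensional_of_le hU
  let P : Obj s t k := 
    { carrier := U
      acg := inferInstanceAs (AddCommGroup (U.restrictScalars k))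
      modp := inferInstanceAs (Module (PA s t k) U)
      modk := inferInstanceAs (Module k (U.restrictScalars k))
      tower := ⟨fun x y z => Subtype.ext (smul_assoc x y (z : PA s t k))⟩
      fd := hfd }
  let p : P := (⟨pe s t k i, Submodule.mem_span_singleton_self _⟩ : U)
  have hgen : ∀ x : P, ∃ z : PA s t k, x = z • p := by
    intro x
    obtain ⟨z, hz⟩ := Submodule.mem_span_singleton.1 (show (x : U).1 ∈ U from (x : U).2)
    exact ⟨z, Subtype.ext hz.symm⟩
  refine ⟨P, p, ?_, ?_, ?_⟩
  · exact Subtype.ext (pe_mul_self i)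
  · intro M m hm
    refine ⟨(LinearMap.toSpanSingleton (PA s t k) M m) ∘ₗ U.subtype, ?_⟩
    exact hm
  · intro M f g hfg
    ext x
    obtain ⟨z, rfl⟩ := hgen x
    rw [map_smul, map_smul, hfg]

theorem IsProj.hom {i : V} {P : Obj s t k} {p : P} (h : IsProj i P p) (M : Obj s t k) :
    hom P M = dim M i := by
  let ev : (P →ₗ[PA s t k] M) →ₗ[k] cmp M i :=
    { toFun := fun f => ⟨f p, mem_cmp.2 (by rw [← map_smul, h.mem])⟩
      map_add' := fun f g => rfl
      map_smul' := fun a f => rfl }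
  have hb : Function.Bijective ev := by
    constructor
    · intro f g hfg
      exact h.un M f g (congrArg Subtype.val hfg)
    · rintro ⟨m, hm⟩
      obtain ⟨f, hf⟩ := h.ex M m (mem_cmp.1 hm)
      exact ⟨f, Subtype.ext hf⟩
  unfold KacAff.hom dim
  rw [(LinearEquiv.ofBijective ev hb).finrank_eq]

theorem IsProj.ext {i : V} {P : Obj s t k} {p : P} (h : IsProj i P p) (M : Obj s t k) :
    ext P M = 0 := by
  rw [ext_eq_zero_iff]
  intro ξ
  obtain ⟨E, f, g, hc⟩ := exists_real P M ξ
  rw [← pull_id (ξ := ξ), hc.lift_iff]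
  obtain ⟨e, he⟩ := hc.surj p
  obtain ⟨H, hH⟩ := h.ex E (pe s t k i • e) (pe_pe i e)
  refine ⟨H, h.un _ _ _ ?_⟩
  rw [LinearMap.comp_apply, hH, map_smul, he, h.mem]; rfl

theorem IsProj.eu_dim {i : V} {P : Obj s t k} {p : P} (h : IsProj i P p) (x : V → ℤ) :
    eu s t (dim P) x = x i := by
  have key : ∀ l, eu s t (dim P) (al l) = (al l : V → ℤ) i := by
    intro l
    obtain ⟨M, hM⟩ := exists_dim (s := s) (t := t) (k := k) (al l) (by
      intro j; unfold al; by_cases hj : j = l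
      · subst hj; simp
      · simp [hj])
    rw [← hM, ← euler, h.hom, h.ext, sub_zero]
  conv_lhs => rw [sum_al x, eu_sum_right]
  conv_rhs => rw [sum_al x]
  rw [Finset.sum_apply]
  refine Finset.sum_congr rfl fun l _ => ?_
  rw [eu_smul_right, key]; rfl

theorem IsProj.df (h : Aff s t δ) {i : V} {P : Obj s t k} {p : P} (hP : IsProj i P p) :
    KacAff.df δ P = - δ i := by
  have := hP.eu_dim δ
  rw [h.eu_delta_right] at this
  unfold KacAff.df; linarith

theorem eu_right_al' (x : V → ℤ) (l : V) :
    eu s t x (al l) = x l - ∑ a, if t a = l then x (s a) else 0 := by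
  unfold eu al
  congr 1
  · simp [Pi.single_apply]
  · refine Finset.sum_congr rfl fun a _ => ?_
    simp [Pi.single_apply]

theorem IsProj.dim_self (h : Aff s t δ) {i : V} {P : Obj s t k} {p : P} (hP : IsProj i P p) :
    dim P i = 1 := by
  obtain ⟨f, hf⟩ := h.idx
  have key : ∀ n : ℕ, ∀ l, (f l : ℕ) = n → f l < f i → dim P l = 0 := by
    intro n
    induction n using Nat.strong_induction_on with
    | _ n ih =>
      intro l hl hlt
      have h1 := hP.eu_dim (al l)
      rw [eu_right_al', Finset.sum_eq_zero] at h1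
      · rw [sub_zero] at h1
        rw [h1]
        unfold al
        rw [Pi.single_apply, if_neg]
        rintro rfl; exact lt_irrefl _ hlt
      · intro a _
        split_ifs with ha
        · have := hf a
          rw [ha] at this
          exact ih _ (by rw [← hl]; exact this) (s a) rfl (this.trans hlt)
        · rfl
  have h1 := hP.eu_dim (al i)
  rw [eu_right_al', Finset.sum_eq_zero] at h1
  · rw [sub_zero] at h1
    rw [h1]; simp [al]
  · intro a _
    split_ifs with ha
    · have := hf a
      rw [ha] at this
      exact key _ (s a) rfl this
    · rfl

end

end KacAff


namespace KacAff

noncomputable section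

open Module
set_option linter.all false

variable {V A : Type} [Fintype V] [DecidableEq V] {s t : A → V} {k : Type} [Field k] [Fintype A]
variable {δ : V → ℤ}

/-- no extensions by regular simples -/
def XProj (δ : V → ℤ) (L : Obj s t k) : Prop := ∀ c : RS s t k δ, ext L c.rep = 0

theorem XProj.reg {L : Obj s t k} (hL : XProj δ L) {Y : Obj s t k} (hY : Reg δ Y) : ext L Y = 0 := by
  induction hn : finrank k Y using Nat.strong_induction_on generalizing Y with
  | _ n ih =>
    rcases subsingleton_or_nontrivial Y with h0 | h0
    · exact ext_zero_right h0
    · obtain ⟨c, f, hf⟩ := hY.exists_top h0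
      have h1 := finrank_surj hf
      have h2 := finrank_pos' c.simple.2.1
      have h3 := ih _ (by omega) (hY.sub (hY.ker c.simple.1 f)) rfl
      have h4 := ext_sub_right (N' := Y.sub (LinearMap.ker f)) L (LinearMap.exact_subtype_ker_map f) hf
      rw [h3, hL c] at h4
      exact le_antisymm (by linarith) (ext_nonneg _ _)

theorem XProj.neg (h : Aff s t δ) {L : Obj s t k} (hL : XProj δ L) (U : Submodule (PA s t k) L)
    (hU : U ≠ ⊥) : df δ (L.sub U) < 0 := by
  obtain ⟨Y, hY1, hY2⟩ := h.exists_reg_delta k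
  have h0 : ∀ (U : Submodule (PA s t k) L) (Z : Obj s t k), Reg δ Z → ext (L.sub U) Z = 0 := by
    intro U Z hZ
    have h1 := ext_le_of_inj (M' := L.sub U) (M := L) Z (g := U.subtype) U.subtype_injective
    rw [hL.reg hZ] at h1
    exact le_antisymm h1 (ext_nonneg _ _)
  have h1 : ∀ U : Submodule (PA s t k) L, df δ (L.sub U) ≤ 0 := by
    intro U
    have h2 := euler (L.sub U) Y
    rw [h0 U Y hY2, hY1, h.eu_delta_right] at h2
    have h3 := hom_nonneg (L.sub U) Y
    unfold df; linarith
  refine lt_of_le_of_ne (h1 U) fun he => ?_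
  have hreg : Reg δ (L.sub U) := by
    refine ⟨he, fun W => ?_⟩
    have e : (L.sub U).sub W ≃ₗ[PA s t k] L.sub (W.map U.subtype) :=
      Submodule.equivMapOfInjective U.subtype U.subtype_injective W
    rw [df_eqv e]; exact h1 _
  have hnt : Nontrivial (L.sub U) := (Submodule.nontrivial_iff_ne_bot).2 hU
  obtain ⟨c, f, hf⟩ := hreg.exists_soc hnt
  have h2 := ext_le_of_inj (h.sg c).rep hf
  rw [h.ext_sg, h0 U _ (h.sg c).simple.1] at h2
  have := c.d_pos
  linarith

theorem XProj.hom_reg (h : Aff s t δ) {L X : Obj s t k} (hL : XProj δ L) (hX : Reg δ X) : hom X L = 0 := by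
  rw [hom_eq_zero_iff]
  intro f
  by_contra hf
  have h1 := hL.neg h (LinearMap.range f) (by rwa [Ne, LinearMap.range_eq_bot])
  have h2 := df_ker_range (δ := δ) f
  have h3 := hX.1
  have h4 := hX.2 (LinearMap.ker f)
  linarith

theorem IsProj.xproj {i : V} {P : Obj s t k} {p : P} (h : IsProj i P p) : XProj δ P := fun c => h.ext _

theorem Reg.hh_one (h : Aff s t δ) {X : Obj s t k} (hX : Reg δ X) (hd : dim X = δ) {c : RS s t k δ}
    {f : X →ₗ[PA s t k] c.rep} (hf : f ≠ 0) : h.hh c = 1 := by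
  classical
  obtain ⟨m, hm, hm'⟩ := hX.factors
  have hmc := hm' c f hf
  rw [hd] at hm
  have hm1 : ∑ c ∈ m.support, (m c : ℤ) • c.dv = δ := hm.symm
  have hg : Good m := ⟨1, by rw [one_smul, hm1]⟩
  have hit : ∀ n, m ((h.sg)^[n] c) = m c := by
    intro n
    induction n with
    | zero => rfl
    | succ n ih => rw [Function.iterate_succ_apply', hg.sg_mult h, ih]
  have hinj : Set.InjOn (fun n => (h.sg)^[n] c) (Finset.range (h.pr c) : Set ℕ) := by
    have := Function.iterate_injOn_Iio_minimalPeriod (f := h.sg) (x := c)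
    intro a ha b hb hab
    exact this (by simpa [Aff.pr] using ha) (by simpa [Aff.pr] using hb) hab
  obtain ⟨j⟩ := h.ne
  have h1 : (h.ts c (h.pr c)) j ≤ δ j := by
    refine le_of_le_of_eq ?_ (congrFun hm1 j)
    rw [Aff.ts, Finset.sum_apply, Finset.sum_apply,
      ← Finset.sum_image (f := fun c' : RS s t k δ => c'.dv j) hinj]
    refine (Finset.sum_le_sum_of_subset_of_nonneg (t := m.support) ?_ ?_).trans ?_
    · intro c' hc'
      obtain ⟨n, _, rfl⟩ := Finset.mem_image.1 hc'
      rw [Finsupp.mem_support_iff]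
      change m ((h.sg)^[n] c) ≠ 0
      rw [hit]; exact hmc
    · intro c' _ _; exact dim_nonneg _ _
    · refine Finset.sum_le_sum fun c' hc' => ?_
      rw [Finsupp.mem_support_iff] at hc'
      change c'.dv j ≤ (m c' : ℤ) * c'.dv j
      have h2 : (1 : ℤ) ≤ m c' := by exact_mod_cast Nat.one_le_iff_ne_zero.2 hc'
      have h3 : 0 ≤ c'.dv j := dim_nonneg _ _
      nlinarith
  rw [h.ts_pr] at h1
  change h.hh c * δ j ≤ δ j at h1
  have h2 := h.pos j
  have h3 := h.hh_pos c
  nlinarith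

theorem RS.d_one (c : RS s t k δ) {i : V} (hi : c.dv i = 1) : c.d = 1 := by
  let φ : (c.rep →ₗ[PA s t k] c.rep) →ₗ[k] (cmp c.rep i →ₗ[k] cmp c.rep i) :=
    { toFun := fun f => cmap f i
      map_add' := fun f g => rfl
      map_smul' := fun a f => rfl }
  have hfr : finrank k (cmp c.rep i) = 1 := by
    have : (finrank k (cmp c.rep i) : ℤ) = 1 := hi
    exact_mod_cast this
  have hφ : Function.Injective φ := by
    rw [injective_iff_map_eq_zero]
    intro f hf
    by_contra hne
    have hb := c.simple.bij c.simple hne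
    have : Nontrivial (cmp c.rep i) := Module.nontrivial_of_finrank_pos (R := k) (by omega)
    obtain ⟨x, hx⟩ := exists_ne (0 : cmp c.rep i)
    apply hx
    apply cmap_inj hb.1 i
    rw [map_zero]
    exact LinearMap.congr_fun hf x
  have h1 := LinearMap.finrank_le_finrank_of_injective hφ
  rw [Module.finrank_linearMap k k (cmp c.rep i) (cmp c.rep i), hfr] at h1
  have h2 := c.d_pos
  have h3 : c.d = (finrank k (c.rep →ₗ[PA s t k] c.rep) : ℤ) := rfl
  omega

theorem Aff.exists_S (h : Aff s t δ) (k : Type) [Field k] {i : V} (hi : δ i = 1) :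
    ∃ S : RS s t k δ, S.dv i = 1 ∧ S.d = 1 ∧ h.hh S = 1 := by
  obtain ⟨Y, hY1, hY2⟩ := h.exists_reg_delta k
  have hnt : Nontrivial Y := by
    by_contra hn
    rw [not_nontrivial_iff_subsingleton, ← dim_eq_zero_iff, hY1] at hn
    rw [hn] at hi; simp at hi
  obtain ⟨c, f, hf⟩ := hY2.exists_top hnt
  have hh := hY2.hh_one h hY1 (surj_ne_zero c.simple.2.1 hf)
  have h1 := congrFun (h.ts_pr c) i
  rw [hh, one_smul, hi, Aff.ts, Finset.sum_apply] at h1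
  have h2 : ∃ n ∈ Finset.range (h.pr c), ((h.sg)^[n] c).dv i ≠ 0 := by
    apply Finset.exists_ne_zero_of_sum_ne_zero; rw [h1]; exact one_ne_zero
  obtain ⟨n, hn, hne⟩ := h2
  have h3 : ((h.sg)^[n] c).dv i ≤ 1 := by
    rw [← h1]
    exact Finset.single_le_sum (f := fun n => ((h.sg)^[n] c).dv i) (fun _ _ => dim_nonneg _ _) hn
  have h4 : 0 ≤ ((h.sg)^[n] c).dv i := dim_nonneg _ _
  have h5 : ((h.sg)^[n] c).dv i = 1 := by omega
  exact ⟨_, h5, RS.d_one _ h5, by rw [h.hh_iter, hh]⟩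

theorem Aff.exists_L (h : Aff s t δ) (k : Type) [Field k] {i : V} (hi : δ i = 1) :
    ∃ (P : Obj s t k) (p : P) (L : Obj s t k), IsProj i P p ∧ dim L = dim P + δ ∧ XProj δ L := by
  obtain ⟨P, p, hP⟩ := h.exists_proj k i
  obtain ⟨S, hS1, hS2, hS3⟩ := h.exists_S k hi
  obtain ⟨r, hr⟩ := Nat.exists_eq_succ_of_ne_zero (h.pr_pos S).ne'
  obtain ⟨X, hX⟩ := LocL.exists h S r
  rw [show r + 1 = h.pr S from hr.symm] at hX
  have hXd : dim X = δ := by rw [hX.2, h.ts_pr, hS3, one_smul]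
  have hXP : ext X P = 1 := by
    have h1 := euler X P
    rw [(hP.xproj (δ := δ)).hom_reg h hX.1.reg, hXd] at h1
    have h2 := hP.df h
    unfold df at h2
    rw [h2, hi] at h1
    linarith
  have hne : ∃ ξ : Ext X P, ξ ≠ 0 := by
    by_contra hall
    push Not at hall
    rw [← ext_eq_zero_iff, hXP] at hall
    exact one_ne_zero hall
  obtain ⟨ξ, hξ⟩ := hne
  obtain ⟨L, f, g, hc⟩ := exists_real X P ξ
  have hLd : dim L = dim P + δ := by rw [dim_exact hc.inj hc.surj hc.exact, hXd]
  refine ⟨P, p, L, hP, hLd, fun R => ?_⟩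
  have hel := hX.ext_left
  rw [h.sg_pr] at hel
  by_cases hR : S = R
  · subst hR
    have hkill : ∀ u : L →ₗ[PA s t k] S.rep, u ∘ₗ f = 0 := by
      intro u
      by_contra hu
      have h1 : ext X (S.rep.quot (LinearMap.range (u ∘ₗ f))) = 0 := by
        refine h.ext_zero hX.1.indec (le_of_eq hX.1.reg.1) _ ?_
        rintro Z hZ ⟨a, b, hab⟩
        let w : S.rep →ₗ[PA s t k] Z := b ∘ₗ (LinearMap.range (u ∘ₗ f)).mkQ
        have hb : Function.Surjective b := fun z => ⟨a z, hab z⟩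
        have hw : Function.Surjective w := hb.comp (Submodule.mkQ_surjective _)
        refine lt_of_le_of_ne (S.simple.1.nonneg_of_surj hw) fun h0 => ?_
        have h2 := df_surj (δ := δ) hw
        rw [S.simple.1.1, ← h0, add_zero] at h2
        rcases S.simple.2.2 _ h2.symm with h3 | h3
        · apply hu
          ext x
          have : (u ∘ₗ f) x ∈ LinearMap.ker w := by
            rw [LinearMap.mem_ker]
            change b ((LinearMap.range (u ∘ₗ f)).mkQ ((u ∘ₗ f) x)) = 0
            have : (LinearMap.range (u ∘ₗ f)).mkQ ((u ∘ₗ f) x) = 0 := by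
              rw [Submodule.mkQ_apply, Submodule.Quotient.mk_eq_zero]; exact ⟨x, rfl⟩
            rw [this, map_zero]
          rw [h3, Submodule.mem_bot] at this
          exact this
        · exact surj_ne_zero hZ.1 hw (LinearMap.ker_eq_top.1 h3)
      have h2 := push_surj_of_coker X (u ∘ₗ f) h1
      have h3 : Function.Injective (push X (u ∘ₗ f)) := by
        have h4 : finrank k (Ext X P) = finrank k (Ext X S.rep) := by
          have h5 := hel.1
          rw [hS2, ← hXP] at h5
          unfold ext at h5; exact_mod_cast h5.symm
        exact (LinearMap.injective_iff_surjective_of_finrank_eq_finrank h4).2 h2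
      apply hξ
      apply h3
      rw [map_zero, hc.ext_iff]
      exact ⟨u, rfl⟩
    have h1 : hom L S.rep ≤ hom X S.rep := by
      refine hom_le_linear (preH g S.rep) fun u => ?_
      exact exact_desc hc.exact hc.surj u (hkill u)
    rw [hX.1.hom_self, hS2] at h1
    have h2 := euler L S.rep
    have h3 : eu s t (dim L) (dim S.rep) = 1 := by
      rw [hLd, eu_add_left, hP.eu_dim]
      have := S.df
      change S.dv i + eu s t δ S.dv = 1
      rw [this, hS1]; rfl
    rw [h3] at h2
    exact le_antisymm (by linarith) (ext_nonneg _ _)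
  · have h1 := ext_sub_left R.rep hc.exact hc.inj hc.surj
    rw [hel.2 R hR, hP.ext] at h1
    exact le_antisymm (by linarith) (ext_nonneg _ _)

/-- the data attached to the vertex `i` -/
structure PL (δ : V → ℤ) (i : V) (P : Obj s t k) (p : P) (L : Obj s t k) : Prop where
  proj : IsProj i P p
  dimL : dim L = dim P + δ
  xp : XProj δ L
  one : δ i = 1

variable {i : V} {P L : Obj s t k} {p : P}

theorem PL.hom (H : PL δ i P p L) (c : RS s t k δ) : hom L c.rep = c.dv i := by
  have h2 := euler L c.rep
  rw [H.xp, H.dimL, eu_add_left, H.proj.eu_dim] at h2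
  have := c.df
  change _ = c.dv i + eu s t δ c.dv at h2
  linarith

theorem PL.dim_i (h : Aff s t δ) (H : PL δ i P p L) : dim L i = 2 := by
  rw [H.dimL]
  change dim P i + δ i = 2
  rw [H.proj.dim_self h, H.one]; rfl

theorem PL.df (h : Aff s t δ) (H : PL δ i P p L) : KacAff.df δ L = -1 := by
  unfold KacAff.df
  rw [H.dimL, eu_add_right, h.eu_delta]
  have := H.proj.df h
  unfold KacAff.df at this
  rw [this, H.one]; rfl

theorem PL.quot (h : Aff s t δ) (H : PL δ i P p L) {θ : L} (hθ : pe s t k i • θ = θ) (h0 : θ ≠ 0) :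
    ∃ (X : Obj s t k) (g : L →ₗ[PA s t k] X), Function.Surjective g ∧ Reg δ X ∧ dim X = δ ∧ g θ = 0 ∧
      ∀ (Y : Obj s t k) (φ : L →ₗ[PA s t k] Y), φ θ = 0 → ∃ v : X →ₗ[PA s t k] Y, v ∘ₗ g = φ := by
  obtain ⟨f, hf⟩ := H.proj.ex L θ hθ
  have hf0 : f ≠ 0 := by rintro rfl; exact h0 hf.symm
  have hinj : Function.Injective f := by
    rw [← LinearMap.ker_eq_bot]
    by_contra hk
    have h1 := (H.proj.xproj (δ := δ)).neg h _ hk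
    have h2 := H.xp.neg h (LinearMap.range f) (by rwa [Ne, LinearMap.range_eq_bot])
    have h3 := df_ker_range (δ := δ) f
    rw [H.proj.df h, H.one] at h3
    linarith
  let X := L.quot (LinearMap.range f)
  let g : L →ₗ[PA s t k] X := (LinearMap.range f).mkQ
  have hg : Function.Surjective g := Submodule.mkQ_surjective _
  have hk : LinearMap.ker g = LinearMap.range f := Submodule.ker_mkQ _
  have hdr : dim (L.sub (LinearMap.range f)) = dim P := (dim_eqv (rangeEqv f hinj)).symm
  have hXd : dim X = δ := by
    have h1 := dim_sub_quot L (LinearMap.range f)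
    rw [hdr, H.dimL] at h1
    exact (add_left_cancel h1).symm
  have hgf : ∀ x, g (f x) = 0 := fun x => by
    rw [← LinearMap.mem_ker, hk]; exact ⟨x, rfl⟩
  refine ⟨X, g, hg, ⟨?_, fun W => ?_⟩, hXd, ?_, ?_⟩
  · unfold KacAff.df; rw [hXd, h.eu_delta]
  · have h1 := df_comap (δ := δ) hg W
    have h2 := H.xp.neg h (W.comap g) (by
      intro hb
      have : θ ∈ W.comap g := by
        rw [Submodule.mem_comap, ← hf, hgf]; exact W.zero_mem
      rw [hb] at this
      exact h0 this)
    have h3 : KacAff.df δ (L.sub (LinearMap.ker g)) = -1 := by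
      rw [hk]; unfold KacAff.df; rw [hdr]
      have := H.proj.df h
      unfold KacAff.df at this
      rw [this, H.one]
    rw [h3] at h1
    omega
  · rw [← hf]; exact hgf p
  · intro Y φ hφ
    apply exists_factor hg
    rw [hk]
    rintro _ ⟨x, rfl⟩
    rw [LinearMap.mem_ker]
    have : φ ∘ₗ f = 0 := H.proj.un _ _ _ (by rw [LinearMap.comp_apply, hf, hφ]; rfl)
    exact LinearMap.congr_fun this x

end

end KacAff


namespace KacAff

noncomputable section

open Module
set_option linter.all false

variable {V A : Type} [Fintype V] [DecidableEq V] {s t : A → V} {k : Type} [Field k] [Fintype A]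
variable {δ : V → ℤ}
variable {i : V} {P L : Obj s t k} {p : P}

theorem Aff.exists_PL (h : Aff s t δ) (k : Type) [Field k] :
    ∃ (i : V) (P : Obj s t k) (p : P) (L : Obj s t k), PL δ i P p L := by
  obtain ⟨i, hi⟩ := h.exists_one
  obtain ⟨P, p, L, h1, h2, h3⟩ := h.exists_L k hi
  exact ⟨i, P, p, L, h1, h2, h3, hi⟩

theorem Aff.exists_iter (h : Aff s t δ) (c : RS s t k δ) (i : V) :
    ∃ n < h.pr c, ((h.sg)^[n] c).dv i ≠ 0 := by
  have h1 := congrFun (h.ts_pr c) i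
  rw [Aff.ts, Finset.sum_apply] at h1
  have h2 : ∃ n ∈ Finset.range (h.pr c), ((h.sg)^[n] c).dv i ≠ 0 := by
    apply Finset.exists_ne_zero_of_sum_ne_zero; rw [h1]
    exact mul_ne_zero (h.hh_pos c).ne' (h.pos i).ne'
  obtain ⟨n, hn, hne⟩ := h2
  exact ⟨n, Finset.mem_range.1 hn, hne⟩

theorem PL.hh_of_kill (h : Aff s t δ) (H : PL δ i P p L) {θ : L} (hθ : pe s t k i • θ = θ) (h0 : θ ≠ 0)
    {c : RS s t k δ} {φ : L →ₗ[PA s t k] c.rep} (hφ : φ ≠ 0) (hk : φ θ = 0) : h.hh c = 1 := by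
  obtain ⟨X, g, hg, hX, hd, _, hfac⟩ := H.quot h hθ h0
  obtain ⟨v, hv⟩ := hfac _ φ hk
  refine hX.hh_one h hd (f := v) ?_
  rintro rfl
  exact hφ (by rw [← hv, LinearMap.zero_comp])

/-- evaluation at θ -/
def evL (L S : Obj s t k) (i : V) (θ : cmp L i) : (L →ₗ[PA s t k] S) →ₗ[k] cmp S i :=
  { toFun := fun φ => cmap φ i θ
    map_add' := fun f g => rfl
    map_smul' := fun a f => rfl }

theorem Aff.hh_alg (h : Aff s t δ) [IsAlgClosed k] (c : RS s t k δ) : h.hh c = 1 := by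
  obtain ⟨i, P, p, L, H⟩ := h.exists_PL k
  obtain ⟨n, _, hn⟩ := h.exists_iter c i
  rw [← h.hh_iter c n]
  set T := (h.sg)^[n] c with hT
  have h2 : finrank k (cmp L i) = 2 := by
    have := H.dim_i h; unfold dim at this; exact_mod_cast this
  have hfr : finrank k (L →ₗ[PA s t k] T.rep) = finrank k (cmp T.rep i) := by
    have := H.hom T
    have h3 : (finrank k (L →ₗ[PA s t k] T.rep) : ℤ) = (finrank k (cmp T.rep i) : ℤ) := this
    exact_mod_cast h3
  have hpos : 0 < finrank k (L →ₗ[PA s t k] T.rep) := by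
    rw [hfr]
    have : (finrank k (cmp T.rep i) : ℤ) ≠ 0 := hn
    exact Nat.pos_of_ne_zero (by exact_mod_cast this)
  have hnt : Nontrivial (L →ₗ[PA s t k] T.rep) := Module.nontrivial_of_finrank_pos (R := k) hpos
  let b := finBasisOfFinrankEq k (cmp L i) h2
  suffices hs : ∃ (θ : cmp L i) (φ : L →ₗ[PA s t k] T.rep), θ ≠ 0 ∧ φ ≠ 0 ∧ φ θ = 0 by
    obtain ⟨θ, φ, h3, h4, h5⟩ := hs
    refine H.hh_of_kill h (mem_cmp.1 θ.2) ?_ h4 h5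
    intro h6; exact h3 (Subtype.ext h6)
  by_cases hinj : Function.Injective (evL L T.rep i (b 0))
  · let e := LinearEquiv.ofInjectiveOfFinrankEq _ hinj hfr
    obtain ⟨μ, hμ⟩ := Module.End.exists_eigenvalue (e.symm.toLinearMap ∘ₗ evL L T.rep i (b 1))
    obtain ⟨φ, hφ⟩ := hμ.exists_hasEigenvector
    refine ⟨b 1 - μ • b 0, φ, ?_, hφ.2, ?_⟩
    · intro h0
      have h3 := congrArg (fun z => b.repr z 1) h0
      simp at h3
    · have h3 := hφ.apply_eq_smul
      rw [LinearMap.comp_apply] at h3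
      have h4 := congrArg e h3
      rw [LinearEquiv.coe_coe, e.apply_symm_apply, map_smul] at h4
      have h5 := congrArg Subtype.val h4
      change φ (b 1) = μ • φ (b 0) at h5
      rw [Submodule.coe_sub, map_sub, h5, Submodule.coe_smul]
      rw [show φ (μ • (b 0 : L)) = μ • φ (b 0) from (φ.restrictScalars k).map_smul _ _, sub_self]
  · rw [injective_iff_map_eq_zero] at hinj
    push Not at hinj
    obtain ⟨φ, h3, h4⟩ := hinj
    exact ⟨b 0, φ, b.ne_zero 0, h4, congrArg Subtype.val h3⟩

/-- the simples seen by `i` -/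
def TP (h : Aff s t δ) (k : Type) [Field k] (i : V) : Type 1 :=
  {c : RS s t k δ // h.hh c = 1 ∧ c.dv i ≠ 0}

theorem Aff.dv_one (h : Aff s t δ) (hi : δ i = 1) {c : RS s t k δ} (hh : h.hh c = 1) (hc : c.dv i ≠ 0) :
    c.dv i = 1 := by
  have h1 := congrFun (h.ts_pr c) i
  rw [hh, one_smul, hi, Aff.ts, Finset.sum_apply] at h1
  have h3 := Finset.single_le_sum (f := fun n => ((h.sg)^[n] c).dv i) (fun _ _ => dim_nonneg _ _)
    (Finset.mem_range.2 (h.pr_pos c))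
  rw [h1] at h3
  have h4 : 0 ≤ c.dv i := dim_nonneg _ _
  change c.dv i ≤ 1 at h3
  omega

theorem PL.exists_kill (h : Aff s t δ) (H : PL δ i P p L) {c : RS s t k δ} (hc : h.hh c = 1 ∧ c.dv i ≠ 0) :
    ∃ (θ : cmp L i) (φ : L →ₗ[PA s t k] c.rep), θ ≠ 0 ∧ φ ≠ 0 ∧ φ θ = 0 := by
  have h1 := h.dv_one H.one hc.1 hc.2
  have h2 := H.hom c
  rw [h1] at h2
  have : ∃ φ : L →ₗ[PA s t k] c.rep, φ ≠ 0 := by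
    by_contra hall
    push Not at hall
    rw [← hom_eq_zero_iff, h2] at hall
    exact one_ne_zero hall
  obtain ⟨φ, hφ⟩ := this
  have hlt : finrank k (cmp c.rep i) < finrank k (cmp L i) := by
    have h3 := H.dim_i h
    unfold dim at h3
    have h4 : (finrank k (cmp c.rep i) : ℤ) = 1 := h1
    omega
  have h5 := LinearMap.ker_ne_bot_of_finrank_lt (f := cmap φ i) hlt
  obtain ⟨θ, hθ, h0⟩ := Submodule.exists_mem_ne_zero_of_ne_bot h5
  exact ⟨θ, φ, h0, hφ, congrArg Subtype.val hθ⟩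

theorem PL.uniq_c (h : Aff s t δ) (H : PL δ i P p L) {c c' : RS s t k δ} (hc : c.dv i ≠ 0) (hc' : c'.dv i ≠ 0)
    {θ : cmp L i} (h0 : θ ≠ 0) {φ : L →ₗ[PA s t k] c.rep} (hφ : φ ≠ 0) (hk : φ θ = 0)
    {φ' : L →ₗ[PA s t k] c'.rep} (hφ' : φ' ≠ 0) (hk' : φ' θ = 0) : c = c' := by
  obtain ⟨X, g, hg, hX, hd, _, hfac⟩ := H.quot h (mem_cmp.1 θ.2) (fun h6 => h0 (Subtype.ext h6))
  obtain ⟨v, hv⟩ := hfac _ φ hk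
  obtain ⟨v', hv'⟩ := hfac _ φ' hk'
  have hv0 : v ≠ 0 := by rintro rfl; exact hφ (by rw [← hv, LinearMap.zero_comp])
  have hv0' : v' ≠ 0 := by rintro rfl; exact hφ' (by rw [← hv', LinearMap.zero_comp])
  by_contra hne
  have hs := c.simple.surj hX hv0
  let K := X.sub (LinearMap.ker v)
  have hK : Reg δ K := hX.sub (hX.ker c.simple.1 v)
  let u : K →ₗ[PA s t k] c'.rep := v' ∘ₗ (LinearMap.ker v).subtype
  have hu : u ≠ 0 := by
    intro hu
    obtain ⟨w, hw⟩ := exists_factor hs v' (fun x hx => LinearMap.congr_fun hu (⟨x, hx⟩ : K))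
    refine hne (RS.eq_of_map (f := w) ?_)
    rintro rfl
    exact hv0' (by rw [← hw, LinearMap.zero_comp])
  have hus := c'.simple.surj hK hu
  have h1 := congrFun (dim_surj hs) i
  have h2 := congrFun (dim_surj hus) i
  rw [hd, H.one] at h1
  change 1 = dim K i + c.dv i at h1
  change dim K i = dim _ i + c'.dv i at h2
  have h3 := dim_nonneg (K.sub (LinearMap.ker u)) i
  have h4 : 0 ≤ c.dv i := dim_nonneg _ _
  have h5 : 0 ≤ c'.dv i := dim_nonneg _ _
  omega

theorem PL.uniq_θ (h : Aff s t δ) (H : PL δ i P p L) {c : RS s t k δ} (hc : h.hh c = 1 ∧ c.dv i ≠ 0)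
    {θ θ' : cmp L i} (h0 : θ ≠ 0) (h0' : θ' ≠ 0) {φ : L →ₗ[PA s t k] c.rep} (hφ : φ ≠ 0) (hk : φ θ = 0)
    {φ' : L →ₗ[PA s t k] c.rep} (hφ' : φ' ≠ 0) (hk' : φ' θ' = 0) : ∃ a : k, θ' = a • θ := by
  have h1 := h.dv_one H.one hc.1 hc.2
  have h2 := H.hom c
  rw [h1] at h2
  have h2' : finrank k (L →ₗ[PA s t k] c.rep) = 1 := by unfold KacAff.hom at h2; exact_mod_cast h2
  obtain ⟨a, ha⟩ := exists_smul_eq_of_finrank_eq_one h2' hφ' φ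
  have hk2 : φ θ' = 0 := by
    rw [← ha]
    change a • φ' θ' = 0
    rw [hk', smul_zero]
  obtain ⟨X, g, hg, hX, hd, _, hfac⟩ := H.quot h (mem_cmp.1 θ.2) (fun h6 => h0 (Subtype.ext h6))
  obtain ⟨v, hv⟩ := hfac _ φ hk
  have hv0 : v ≠ 0 := by rintro rfl; exact hφ (by rw [← hv, LinearMap.zero_comp])
  have hs : Function.Surjective φ := by rw [← hv]; exact (c.simple.surj hX hv0).comp hg
  have h3 := LinearMap.finrank_range_add_finrank_ker (cmap φ i)
  rw [LinearMap.range_eq_top.2 (cmap_surj hs i), finrank_top] at h3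
  have h4 := H.dim_i h
  unfold dim at h4
  have h5 : (finrank k (cmp c.rep i) : ℤ) = 1 := h1
  have h6 : finrank k (LinearMap.ker (cmap φ i)) = 1 := by omega
  obtain ⟨b, hb⟩ := exists_smul_eq_of_finrank_eq_one h6
    (x := (⟨θ, Subtype.ext hk⟩ : LinearMap.ker (cmap φ i))) (fun h7 => h0 (congrArg Subtype.val h7))
    ⟨θ', Subtype.ext hk2⟩
  exact ⟨b, (congrArg Subtype.val hb).symm⟩

theorem PL.card (h : Aff s t δ) (H : PL δ i P p L) [Finite k] :
    Nat.card (TP h k i) = Nat.card k + 1 := by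
  have h2 : finrank k (cmp L i) = 2 := by
    have := H.dim_i h; unfold dim at this; exact_mod_cast this
  rw [← Projectivization.card_of_finrank_two k (cmp L i) h2]
  choose θ φ hθ hφ hk using fun c : TP h k i => H.exists_kill h c.2
  refine Nat.card_congr (Equiv.ofBijective (fun c => Projectivization.mk k (θ c) (hθ c)) ⟨?_, ?_⟩)
  · intro c c' he
    obtain ⟨a, ha⟩ := (Projectivization.mk_eq_mk_iff' k _ _ (hθ c) (hθ c')).1 he
    refine Subtype.ext (H.uniq_c h c.2.2 c'.2.2 (hθ c') (hφ c) ?_ (hφ c') (hk c'))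
    have h3 := hk c
    have ha0 : a ≠ 0 := by rintro rfl; rw [zero_smul] at ha; exact hθ c ha.symm
    have h5 := congrArg Subtype.val ha
    change a • (θ c' : L) = θ c at h5
    rw [← h5, show φ c (a • (θ c' : L)) = a • φ c (θ c') from ((φ c).restrictScalars k).map_smul _ _] at h3
    exact (smul_eq_zero.1 h3).resolve_left ha0
  · intro ℓ
    induction ℓ using Projectivization.ind with
    | h v hv =>
      obtain ⟨X, g, hg, hX, hd, hgv, hfac⟩ := H.quot h (mem_cmp.1 v.2) (fun h6 => hv (Subtype.ext h6))
      have hnt : Nontrivial X := by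
        by_contra hn
        rw [not_nontrivial_iff_subsingleton, ← dim_eq_zero_iff, hd] at hn
        have := H.one
        rw [hn] at this; simp at this
      obtain ⟨c, f, hf⟩ := hX.exists_top hnt
      have hfg : f ∘ₗ g ≠ 0 := surj_ne_zero c.simple.2.1 (hf.comp hg)
      have hkf : (f ∘ₗ g) v = 0 := by rw [LinearMap.comp_apply, hgv, map_zero]
      have hc : h.hh c = 1 ∧ c.dv i ≠ 0 := by
        refine ⟨hX.hh_one h hd (surj_ne_zero c.simple.2.1 hf), fun h0 => hfg ?_⟩
        exact (hom_eq_zero_iff _ _).1 ((H.hom c).trans h0) _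
      refine ⟨⟨c, hc⟩, ?_⟩
      change Projectivization.mk k _ _ = _
      rw [Projectivization.mk_eq_mk_iff']
      obtain ⟨a, ha⟩ := H.uniq_θ h hc hv (hθ ⟨c, hc⟩) hfg hkf (hφ ⟨c, hc⟩) (hk ⟨c, hc⟩)
      exact ⟨a, ha.symm⟩

end

end KacAff


namespace KacAff

noncomputable section

open Module
set_option linter.all false

variable {V A : Type} [Fintype V] [DecidableEq V] {s t : A → V} {k : Type} [Field k]

/-- matrix representations -/
def MR (s t : A → V) (k : Type) (d : V → ℕ) : Type := ∀ a : A, Matrix (Fin (d (t a))) (Fin (d (s a))) k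

variable {d d' : V → ℕ}

/-- module data of a matrix representation -/
def mrData (x : MR s t k d) : ModData s t k (Π i, Fin (d i) → k) where
  E i := LinearMap.single k (fun i => Fin (d i) → k) i ∘ₗ LinearMap.proj i
  X a := LinearMap.single k (fun i => Fin (d i) → k) (t a) ∘ₗ (x a).mulVecLin ∘ₗ LinearMap.proj (s a)
  idem i := by
    refine LinearMap.ext fun x => ?_
    simp only [Module.End.mul_apply, LinearMap.comp_apply, LinearMap.proj_apply, LinearMap.coe_single]
    rw [Pi.single_eq_same]
  orth i j h := by
    refine LinearMap.ext fun x => ?_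
    simp only [Module.End.mul_apply, LinearMap.comp_apply, LinearMap.proj_apply,
      LinearMap.coe_single, LinearMap.zero_apply]
    rw [Pi.single_eq_of_ne h, Pi.single_zero]
  one := by
    refine LinearMap.ext fun x => ?_
    simp only [LinearMap.sum_apply, LinearMap.comp_apply, LinearMap.proj_apply,
      LinearMap.coe_single, Module.End.one_apply]
    exact Finset.univ_sum_single x
  src a := by
    refine LinearMap.ext fun x => ?_
    simp only [Module.End.mul_apply, LinearMap.comp_apply, LinearMap.proj_apply, LinearMap.coe_single]
    rw [Pi.single_eq_same]
  tgt a := by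
    refine LinearMap.ext fun x => ?_
    simp only [Module.End.mul_apply, LinearMap.comp_apply, LinearMap.proj_apply, LinearMap.coe_single]
    rw [Pi.single_eq_same]

/-- object of a matrix representation -/
def mo (x : MR s t k d) : Obj s t k := mkObj (mrData (s := s) (t := t) (k := k) (d := d) x)

/-- underlying space -/
def me (x : MR s t k d) : (Π i, Fin (d i) → k) ≃ₗ[k] mo x := mkEqv (mrData (s := s) (t := t) (k := k) (d := d) x)

theorem pe_me (x : MR s t k d) (i : V) (w : Π i, Fin (d i) → k) :
    pe s t k i • me x w = me x (Pi.single i (w i)) := pe_mkEqv (mrData (s := s) (t := t) (k := k) (d := d) x) i w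
theorem px_me (x : MR s t k d) (a : A) (w : Π i, Fin (d i) → k) :
    px s t k a • me x w = me x (Pi.single (t a) (Matrix.mulVec (x a) (w (s a)))) := px_mkEqv (mrData (s := s) (t := t) (k := k) (d := d) x) a w

/-- component -/
def cme (x : MR s t k d) (i : V) : (Fin (d i) → k) ≃ₗ[k] cmp (mo x) i :=
  LinearEquiv.ofBijective
      ((((me x).toLinearMap ∘ₗ LinearMap.single k (fun i => Fin (d i) → k) i)).codRestrict
      (cmp (mo x) i) (by
      intro w
      rw [mem_cmp]
      change pe s t k i • me x (Pi.single i w) = me x (Pi.single i w)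
      rw [pe_me, Pi.single_eq_same])) ⟨by
      intro v w hxy
      have := congrArg Subtype.val hxy
      have h2 := (me x).injective this
      exact Pi.single_injective i h2, by
      rintro ⟨z, hz⟩
      obtain ⟨w, rfl⟩ := (me x).surjective z
      refine ⟨w i, Subtype.ext ?_⟩
      change me x (Pi.single i (w i)) = me x w
      rw [← mem_cmp.1 hz, pe_me]⟩

theorem cme_coe (x : MR s t k d) (i : V) (w : Fin (d i) → k) : (cme x i w : mo x) = me x (Pi.single i w) := rfl

theorem dim_mo (x : MR s t k d) : dim (mo x) = fun i => (d i : ℤ) := by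
  funext i
  simp only [dim]
  rw [← (cme x i).finrank_eq]; simp

/-- morphisms from matrices -/
def homOf {x : MR s t k d} {y : MR s t k d'} (g : ∀ i, Matrix (Fin (d' i)) (Fin (d i)) k)
    (hg : ∀ a, g (t a) * x a = y a * g (s a)) : mo x →ₗ[PA s t k] mo y :=
  mkHom ((me y).toLinearMap ∘ₗ (LinearMap.pi fun i => (g i).mulVecLin ∘ₗ LinearMap.proj i) ∘ₗ
      (me x).symm.toLinearMap)
    (by
      intro i m
      obtain ⟨w, rfl⟩ := (me x).surjective m
      rw [pe_me]
      simp only [LinearMap.comp_apply, LinearEquiv.coe_coe, LinearEquiv.symm_apply_apply]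
      rw [pe_me]
      congr 1
      funext j
      simp only [LinearMap.pi_apply, LinearMap.comp_apply, LinearMap.proj_apply, Matrix.mulVecLin_apply]
      by_cases hj : j = i
      · subst hj; rw [Pi.single_eq_same, Pi.single_eq_same]
      · rw [Pi.single_eq_of_ne hj, Pi.single_eq_of_ne hj, Matrix.mulVec_zero])
    (by
      intro a m
      obtain ⟨w, rfl⟩ := (me x).surjective m
      rw [px_me]
      simp only [LinearMap.comp_apply, LinearEquiv.coe_coe, LinearEquiv.symm_apply_apply]
      rw [px_me]
      congr 1
      funext j
      simp only [LinearMap.pi_apply, LinearMap.comp_apply, LinearMap.proj_apply, Matrix.mulVecLin_apply]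
      by_cases hj : j = t a
      · subst hj; rw [Pi.single_eq_same, Pi.single_eq_same, Matrix.mulVec_mulVec, Matrix.mulVec_mulVec, hg]
      · rw [Pi.single_eq_of_ne hj, Pi.single_eq_of_ne hj, Matrix.mulVec_zero])

theorem homOf_me {x : MR s t k d} {y : MR s t k d'} (g : ∀ i, Matrix (Fin (d' i)) (Fin (d i)) k)
    (hg : ∀ a, g (t a) * x a = y a * g (s a)) (w : Π i, Fin (d i) → k) :
    homOf g hg (me x w) = me y (fun i => Matrix.mulVec (g i) (w i)) := by
  change me y _ = _
  congr 1
  funext i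
  simp

/-- matrices of a morphism -/
def matOf {x : MR s t k d} {y : MR s t k d'} (φ : mo x →ₗ[PA s t k] mo y) (i : V) :
    Matrix (Fin (d' i)) (Fin (d i)) k :=
  LinearMap.toMatrix' ((cme y i).symm.toLinearMap ∘ₗ cmap φ i ∘ₗ (cme x i).toLinearMap)

theorem matOf_single {x : MR s t k d} {y : MR s t k d'} (φ : mo x →ₗ[PA s t k] mo y) (i : V) (w : Fin (d i) → k) :
    φ (me x (Pi.single i w)) = me y (Pi.single i (Matrix.mulVec (matOf φ i) w)) := by
  rw [← cme_coe, ← cme_coe, matOf, LinearMap.toMatrix'_mulVec]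
  simp

theorem me_sum (x : MR s t k d) (w : Π i, Fin (d i) → k) : me x w = ∑ i, me x (Pi.single i (w i)) := by
  rw [← map_sum, Finset.univ_sum_single]

theorem matOf_me {x : MR s t k d} {y : MR s t k d'} (φ : mo x →ₗ[PA s t k] mo y) (w : Π i, Fin (d i) → k) :
    φ (me x w) = me y (fun i => Matrix.mulVec (matOf φ i) (w i)) := by
  rw [me_sum, map_sum, me_sum y]
  exact Finset.sum_congr rfl fun i _ => matOf_single φ i (w i)

theorem matOf_comm {x : MR s t k d} {y : MR s t k d'} (φ : mo x →ₗ[PA s t k] mo y) (a : A) :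
    matOf φ (t a) * x a = y a * matOf φ (s a) := by
  apply Matrix.mulVec_injective
  funext w
  have h1 := φ.map_smul (px s t k a) (me x (Pi.single (s a) w))
  rw [px_me, Pi.single_eq_same, matOf_single, matOf_single, px_me, Pi.single_eq_same] at h1
  have h2 := Pi.single_injective (t a) ((me y).injective h1)
  rwa [Matrix.mulVec_mulVec, Matrix.mulVec_mulVec] at h2

theorem matOf_ext {x : MR s t k d} {y : MR s t k d'} {φ ψ : mo x →ₗ[PA s t k] mo y}
    (h : matOf φ = matOf ψ) : φ = ψ := by
  ext m
  obtain ⟨w, rfl⟩ := (me x).surjective m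
  rw [matOf_me, matOf_me, h]

theorem matOf_homOf {x : MR s t k d} {y : MR s t k d'} (g : ∀ i, Matrix (Fin (d' i)) (Fin (d i)) k)
    (hg : ∀ a, g (t a) * x a = y a * g (s a)) : matOf (homOf g hg) = g := by
  funext i
  apply Matrix.mulVec_injective
  funext w
  have h1 := matOf_single (homOf g hg) i w
  rw [homOf_me] at h1
  have h2 := congrFun ((me y).injective h1) i
  rw [Pi.single_eq_same, Pi.single_eq_same] at h2
  exact h2.symm

/-- every object comes from matrices -/
theorem exists_mo (M : Obj s t k) (hd : dim M = fun i => (d i : ℤ)) : ∃ x : MR s t k d, Nonempty (mo x ≃ₗ[PA s t k] M) := by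
  have hfr : ∀ i, finrank k (Fin (d i) → k) = finrank k (cmp M i) := by
    intro i
    have := congrFun hd i
    unfold dim at this
    rw [finrank_fin_fun]; exact_mod_cast this.symm
  let e : ∀ i, (Fin (d i) → k) ≃ₗ[k] cmp M i := fun i => LinearEquiv.ofFinrankEq _ _ (hfr i)
  let X : ∀ a, cmp M (s a) →ₗ[k] cmp M (t a) := fun a =>
    ((act M (px s t k a)) ∘ₗ (cmp M (s a)).subtype).codRestrict _ (fun m => px_mem_cmp a _)
  let x : MR s t k d := fun a => LinearMap.toMatrix' ((e (t a)).symm.toLinearMap ∘ₗ X a ∘ₗ (e (s a)).toLinearMap)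
  have hx : ∀ a w, (e (t a) (Matrix.mulVec (x a) w) : M) = px s t k a • (e (s a) w : M) := by
    intro a w
    change (e (t a) (Matrix.mulVec (LinearMap.toMatrix' _) w) : M) = _
    rw [LinearMap.toMatrix'_mulVec]
    simp only [LinearMap.comp_apply, LinearEquiv.coe_coe, LinearEquiv.apply_symm_apply]
    rfl
  let F0 : (Π i, Fin (d i) → k) ≃ₗ[k] M := (LinearEquiv.piCongrRight e).trans (cmpEqv M).symm
  let F : mo x ≃ₗ[k] M := (me x).symm.trans F0
  have hF : ∀ w, F (me x w) = F0 w := fun w => by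
    change F0 ((me x).symm (me x w)) = _
    rw [LinearEquiv.symm_apply_apply]
  have hpe : ∀ w i, pe s t k i • F0 w = (e i (w i) : M) := by
    intro w i
    have : cmpEqv M (F0 w) i = e i (w i) := by
      change cmpEqv M ((cmpEqv M).symm _) i = _
      rw [LinearEquiv.apply_symm_apply]; rfl
    exact congrArg Subtype.val this
  have hmem : ∀ i w, pe s t k i • (e i w : M) = e i w := fun i w => mem_cmp.1 (e i w).2
  have hsing : ∀ i w, F0 (Pi.single i w) = (e i w : M) := by
    intro i w
    apply ext_pe
    intro j
    rw [hpe]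
    by_cases hj : j = i
    · subst hj; rw [Pi.single_eq_same, hmem]
    · rw [Pi.single_eq_of_ne hj, map_zero, ← hmem, pe_pe_ne hj]; rfl
  let G : mo x →ₗ[PA s t k] M := mkHom F.toLinearMap (by
      intro i m
      obtain ⟨w, rfl⟩ := (me x).surjective m
      rw [pe_me, LinearEquiv.coe_coe, hF, hF, hpe, hsing]) (by
      intro a m
      obtain ⟨w, rfl⟩ := (me x).surjective m
      rw [px_me, LinearEquiv.coe_coe, hF, hF, hsing, hx, ← hpe, px_pe])
  exact ⟨x, ⟨LinearEquiv.ofBijective G F.bijective⟩⟩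

end

end KacAff


namespace KacAff

noncomputable section

open Module
set_option linter.all false

variable {V A : Type} [Fintype V] [DecidableEq V] {s t : A → V} {k : Type} [Field k]
variable {d d' : V → ℕ}

theorem matOf_comp {d'' : V → ℕ} {x : MR s t k d} {y : MR s t k d'} {z : MR s t k d''}
    (ψ : mo y →ₗ[PA s t k] mo z) (φ : mo x →ₗ[PA s t k] mo y) (i : V) :
    matOf (ψ ∘ₗ φ) i = matOf ψ i * matOf φ i := by
  apply Matrix.mulVec_injective
  funext w
  have h1 := matOf_single (ψ ∘ₗ φ) i w
  rw [LinearMap.comp_apply, matOf_single, matOf_single] at h1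
  have h2 := Pi.single_injective i ((me z).injective h1)
  rw [← h2, Matrix.mulVec_mulVec]

theorem matOf_id (x : MR s t k d) (i : V) :
    matOf (LinearMap.id : mo x →ₗ[PA s t k] mo x) i = 1 := by
  apply Matrix.mulVec_injective
  funext w
  have h1 := matOf_single (LinearMap.id : mo x →ₗ[PA s t k] mo x) i w
  have h2 := Pi.single_injective i ((me x).injective h1)
  rw [← h2, Matrix.one_mulVec]

theorem matOf_add {x : MR s t k d} {y : MR s t k d'} (φ ψ : mo x →ₗ[PA s t k] mo y) :
    matOf (φ + ψ) = matOf φ + matOf ψ := by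
  funext i
  apply Matrix.mulVec_injective
  funext w
  have h1 := matOf_single (φ + ψ) i w
  rw [LinearMap.add_apply, matOf_single, matOf_single, ← map_add, ← Pi.single_add] at h1
  have h2 := Pi.single_injective i ((me y).injective h1)
  rw [← h2, Pi.add_apply, Matrix.add_mulVec]

theorem matOf_smul {x : MR s t k d} {y : MR s t k d'} (r : k) (φ : mo x →ₗ[PA s t k] mo y) :
    matOf (r • φ) = r • matOf φ := by
  funext i
  apply Matrix.mulVec_injective
  funext w
  have h1 := matOf_single (r • φ) i w
  rw [LinearMap.smul_apply, matOf_single, ← map_smul, ← Pi.single_smul] at h1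
  have h2 := Pi.single_injective i ((me y).injective h1)
  rw [← h2, Pi.smul_apply, Matrix.smul_mulVec]

/-- stable families -/
def msub (x : MR s t k d) (U : ∀ i, Submodule k (Fin (d i) → k)) : Prop :=
  ∀ a : A, ∀ v ∈ U (s a), Matrix.mulVec (x a) v ∈ U (t a)

/-- isomorphism in matrix form -/
def miso (x y : MR s t k d) : Prop :=
  ∃ g : ∀ i, GL (Fin (d i)) k,
    ∀ a : A, y a = ((g (t a) : Matrix (Fin (d (t a))) (Fin (d (t a))) k) * x a) *
      (((g (s a))⁻¹ : GL (Fin (d (s a))) k) : Matrix (Fin (d (s a))) (Fin (d (s a))) k)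

/-- indecomposability in matrix form -/
def mindec (x : MR s t k d) : Prop :=
  (∃ i, 0 < d i) ∧
    ∀ U W : ∀ i, Submodule k (Fin (d i) → k), msub x U → msub x W →
      (∀ i, IsCompl (U i) (W i)) →
        (∀ i, U i = ⊥) ∨ (∀ i, W i = ⊥)

theorem miso_iff (x y : MR s t k d) :
    miso x y ↔ Nonempty (mo x ≃ₗ[PA s t k] mo y) := by
  constructor
  · rintro ⟨g, hg⟩
    have h1 : ∀ a, (g (t a)).1 * x a = y a * (g (s a)).1 := by
      intro a
      rw [hg a, Matrix.mul_assoc, ← Units.val_mul, inv_mul_cancel, Units.val_one, Matrix.mul_one]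
    have h2 : ∀ a, ((g (t a))⁻¹ : GL (Fin (d (t a))) k).1 * y a = x a * ((g (s a))⁻¹ : GL (Fin (d (s a))) k).1 := by
      intro a
      rw [hg a, ← Matrix.mul_assoc, ← Matrix.mul_assoc, ← Units.val_mul, inv_mul_cancel, Units.val_one, Matrix.one_mul]
    refine ⟨LinearEquiv.ofLinear (homOf (fun i => (g i).1) h1)
      (homOf (x := y) (y := x) (fun i => ((g i)⁻¹ : GL (Fin (d i)) k).1) h2) ?_ ?_⟩
    · apply matOf_ext
      funext i
      rw [matOf_comp, matOf_homOf, matOf_homOf, matOf_id, ← Units.val_mul, mul_inv_cancel]; rfl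
    · apply matOf_ext
      funext i
      rw [matOf_comp, matOf_homOf, matOf_homOf, matOf_id, ← Units.val_mul, inv_mul_cancel]; rfl
  · rintro ⟨e⟩
    have h1 : ∀ i, matOf e.toLinearMap i * matOf e.symm.toLinearMap i = 1 := by
      intro i
      rw [← matOf_comp, ← matOf_id]; congr 1; ext m; simp
    have h2 : ∀ i, matOf e.symm.toLinearMap i * matOf e.toLinearMap i = 1 := by
      intro i
      rw [← matOf_comp, ← matOf_id]; congr 1; ext m; simp
    refine ⟨fun i => ⟨matOf e.toLinearMap i, matOf e.symm.toLinearMap i, h1 i, h2 i⟩, fun a => ?_⟩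
    have h3 := matOf_comm e.toLinearMap a
    change y a = (matOf e.toLinearMap (t a) * x a) * matOf e.symm.toLinearMap (s a)
    rw [h3, Matrix.mul_assoc, h1, Matrix.mul_one]

theorem nontrivial_mo (x : MR s t k d) : Nontrivial (mo x) ↔ ∃ i, 0 < d i := by
  rw [← not_subsingleton_iff_nontrivial, ← dim_eq_zero_iff, dim_mo]
  constructor
  · intro h
    by_contra hn
    push Not at hn
    exact h (funext fun i => by have := hn i; simp; omega)
  · rintro ⟨i, hi⟩ h
    have := congrFun h i
    simp at this; omega

theorem mindec_iff (x : MR s t k d) :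
    mindec x ↔ Indec (mo x) := by
  constructor
  · rintro ⟨h0, h1⟩
    refine ⟨(nontrivial_mo _).2 h0, fun U W hUW => ?_⟩
    let F : Submodule (PA s t k) (mo x) → ∀ i, Submodule k (Fin (d i) → k) :=
      fun U i => (U.restrictScalars k).comap ((me x).toLinearMap ∘ₗ
        LinearMap.single k (fun i => Fin (d i) → k) i)
    have hF : ∀ U i w, w ∈ F U i ↔ me x (Pi.single i w) ∈ U := fun U i w => Iff.rfl
    have hsub : ∀ U, msub x (F U) := by
      intro U a v hv
      rw [hF] at hv ⊢
      have := U.smul_mem (px s t k a) hv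
      rwa [px_me, Pi.single_eq_same] at this
    have hbot : ∀ U, (∀ i, F U i = ⊥) → U = ⊥ := by
      intro U hU
      rw [eq_bot_iff]
      intro u hu
      obtain ⟨w, rfl⟩ := (me x).surjective u
      have : w = 0 := by
        funext i
        have h2 := U.smul_mem (pe s t k i) hu
        rw [pe_me, ← hF, hU i] at h2
        exact h2
      rw [this, map_zero]; exact Submodule.zero_mem _
    refine (h1 (F U) (F W) (hsub U) (hsub W) fun i => ⟨?_, ?_⟩).imp (hbot U) (hbot W)
    · rw [Submodule.disjoint_def]
      intro w hw hw'
      have := Submodule.disjoint_def.1 hUW.1 _ hw hw'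
      have h2 := (me x).map_eq_zero_iff.1 this
      exact (Pi.single_eq_zero_iff).1 h2
    · rw [codisjoint_iff, eq_top_iff]
      intro w _
      have h2 : me x (Pi.single i w) ∈ U ⊔ W := by
        rw [codisjoint_iff.1 hUW.2]; trivial
      obtain ⟨u, hu, v, hv, huv⟩ := Submodule.mem_sup.1 h2
      obtain ⟨u, rfl⟩ := (me x).surjective u
      obtain ⟨v, rfl⟩ := (me x).surjective v
      rw [← map_add] at huv
      have h3 := congrFun ((me x).injective huv) i
      rw [Pi.single_eq_same, Pi.add_apply] at h3
      rw [← h3]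
      have h4 := U.smul_mem (pe s t k i) hu
      have h5 := W.smul_mem (pe s t k i) hv
      rw [pe_me] at h4 h5
      exact Submodule.add_mem_sup h4 h5
  · rintro ⟨h0, h1⟩
    refine ⟨(nontrivial_mo x).1 h0, fun U W hU hW hUW => ?_⟩
    let G : ∀ U : ∀ i, Submodule k (Fin (d i) → k), msub x U → Submodule (PA s t k) (mo x) :=
      fun U hU => mkSub ((Submodule.pi Set.univ U).comap (me x).symm.toLinearMap) (by
        intro i m hm
        obtain ⟨w, rfl⟩ := (me x).surjective m
        rw [pe_me]
        simp only [Submodule.mem_comap, LinearEquiv.coe_coe, LinearEquiv.symm_apply_apply, Submodule.mem_pi] at hm ⊢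
        intro j _
        by_cases hj : j = i
        · subst hj; rw [Pi.single_eq_same]; exact hm j trivial
        · rw [Pi.single_eq_of_ne hj]; exact Submodule.zero_mem _) (by
        intro a m hm
        obtain ⟨w, rfl⟩ := (me x).surjective m
        rw [px_me]
        simp only [Submodule.mem_comap, LinearEquiv.coe_coe, LinearEquiv.symm_apply_apply, Submodule.mem_pi] at hm ⊢
        intro j _
        by_cases hj : j = t a
        · subst hj; rw [Pi.single_eq_same]; exact hU a _ (hm _ trivial)
        · rw [Pi.single_eq_of_ne hj]; exact Submodule.zero_mem _)
    have hG : ∀ U hU w, me x w ∈ G U hU ↔ ∀ i, w i ∈ U i := by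
      intro U hU w
      change (me x).symm (me x w) ∈ Submodule.pi Set.univ U ↔ _
      rw [LinearEquiv.symm_apply_apply, Submodule.mem_pi]
      simp
    have hbot : ∀ U hU, G U hU = ⊥ → ∀ i, U i = ⊥ := by
      intro U hU h2 i
      rw [eq_bot_iff]
      intro w hw
      have h3 : me x (Pi.single i w) ∈ G U hU := by
        rw [hG U hU]
        intro j
        by_cases hj : j = i
        · subst hj; rw [Pi.single_eq_same]; exact hw
        · rw [Pi.single_eq_of_ne hj]; exact Submodule.zero_mem _
      rw [h2] at h3
      exact (Pi.single_eq_zero_iff).1 ((me x).map_eq_zero_iff.1 h3)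
    refine (h1 (G U hU) (G W hW) ⟨?_, ?_⟩).imp (hbot U hU) (hbot W hW)
    · rw [Submodule.disjoint_def]
      intro m hm hm'
      obtain ⟨w, rfl⟩ := (me x).surjective m
      rw [hG U hU] at hm
      rw [hG W hW] at hm'
      have : w = 0 := funext fun i => Submodule.disjoint_def.1 (hUW i).1 _ (hm i) (hm' i)
      rw [this, map_zero]
    · rw [codisjoint_iff, eq_top_iff]
      intro m _
      obtain ⟨w, rfl⟩ := (me x).surjective m
      have h2 : ∀ i, ∃ u v, u ∈ U i ∧ v ∈ W i ∧ u + v = w i := by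
        intro i
        have : w i ∈ U i ⊔ W i := by rw [codisjoint_iff.1 (hUW i).2]; trivial
        obtain ⟨u, hu, v, hv, h⟩ := Submodule.mem_sup.1 this
        exact ⟨u, v, hu, hv, h⟩
      choose u v hu hv huv using h2
      have : w = u + v := funext fun i => (huv i).symm
      rw [this, map_add]
      exact Submodule.add_mem_sup ((hG U hU u).2 hu) ((hG W hW v).2 hv)

theorem MIso_iff {Q : FinQuiver} {d : Q.V → ℕ} (x y : MRep Q k d) :
    MIso x y ↔ miso (s := Q.src) (t := Q.tgt) x y := Iff.rfl

theorem MIndec_iff {Q : FinQuiver} {d : Q.V → ℕ} (x : MRep Q k d) :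
    MIndec x ↔ mindec (s := Q.src) (t := Q.tgt) x := Iff.rfl

theorem indec_of_idem {M : Obj s t k} (hM : Nontrivial M)
    (h : ∀ e : M →ₗ[PA s t k] M, e ∘ₗ e = e → e = 0 ∨ e = LinearMap.id) : Indec M := by
  refine ⟨hM, fun U W hUW => ?_⟩
  have h1 := h (U.projection W hUW) (Submodule.isIdempotentElem_projection hUW)
  rcases h1 with h1 | h1
  · left
    have := Submodule.range_projection hUW
    rw [h1, LinearMap.range_zero] at this
    exact this.symm
  · right
    have := Submodule.ker_projection hUW
    rw [h1, LinearMap.ker_id] at this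
    exact this.symm

end

end KacAff


namespace KacAff

noncomputable section

open Module
set_option linter.all false

variable {V A : Type} [Fintype V] [DecidableEq V] {s t : A → V} {k : Type} [Field k]
variable {d : V → ℕ} {K : Type} [Field K] [Algebra k K]

/-- families of matrices -/
abbrev MF (k : Type) [Field k] (d : V → ℕ) := ∀ i : V, Matrix (Fin (d i)) (Fin (d i)) k

/-- base change of matrix families -/
def bc (K : Type) [Field K] [Algebra k K] : MF k d →+* MF K d :=
  Pi.ringHom fun i => ((algebraMap k K).mapMatrix).comp (Pi.evalRingHom _ i)

theorem bc_apply (g : MF k d) (i : V) (p q : Fin (d i)) : bc K g i p q = algebraMap k K (g i p q) := rfl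

theorem bc_inj : Function.Injective (bc K : MF k d →+* MF K d) := by
  intro g g' h
  funext i
  ext p q
  have := congrFun (congrFun (congrFun h i) p) q
  exact (algebraMap k K).injective this

theorem bc_smul (r : k) (g : MF k d) : bc K (r • g) = (algebraMap k K r) • bc K g := by
  funext i
  ext p q
  change algebraMap k K (r * g i p q) = algebraMap k K r * algebraMap k K (g i p q)
  rw [map_mul]

/-- base change of representations -/
def bcr (K : Type) [Field K] [Algebra k K] (x : MR s t k d) : MR s t K d :=
  fun a => Matrix.map (x a) (algebraMap k K)

/-- matrices of endomorphisms as a monoid hom -/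
def matH (x : MR s t k d) : Module.End (PA s t k) (mo x) →* MF k d where
  toFun φ := matOf φ
  map_one' := funext fun i => matOf_id x i
  map_mul' φ ψ := funext fun i => matOf_comp φ ψ i

theorem matH_inj (x : MR s t k d) : Function.Injective (matH x) := fun _ _ h => matOf_ext h

theorem matOf_zero (x : MR s t k d) : matOf (0 : mo x →ₗ[PA s t k] mo x) = 0 := by
  have := matOf_add (0 : mo x →ₗ[PA s t k] mo x) 0
  rw [add_zero] at this
  exact left_eq_add.1 this

theorem matOf_sub {x : MR s t k d} (φ ψ : mo x →ₗ[PA s t k] mo x) : matOf (φ - ψ) = matOf φ - matOf ψ := by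
  have := matOf_add (φ - ψ) ψ
  rw [sub_add_cancel] at this
  rw [this, add_sub_cancel_right]

theorem matOf_one (x : MR s t k d) : matOf (LinearMap.id : mo x →ₗ[PA s t k] mo x) = 1 := funext fun i => matOf_id x i

/-- commuting families descend -/
theorem bc_span (x : MR s t k d) (g : MF K d) (hg : ∀ a, g (t a) * bcr K x a = bcr K x a * g (s a)) :
    g ∈ Submodule.span K (Set.range fun φ : Module.End (PA s t k) (mo x) => bc K (matH x φ)) := by
  classical
  let b := Basis.ofVectorSpace k K
  let γ : ∀ j, MF k d := fun j i => Matrix.of fun p q => b.repr (g i p q) j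
  have hγ : ∀ j a, γ j (t a) * x a = x a * γ j (s a) := by
    intro j a
    ext p q
    have h1 := congrFun (congrFun (hg a) p) q
    rw [Matrix.mul_apply, Matrix.mul_apply] at h1 ⊢
    have h2 := congrArg (fun z => b.repr z j) h1
    simp only [map_sum, Finsupp.coe_finset_sum, Finset.sum_apply] at h2
    have e1 : ∀ r, b.repr (g (t a) p r * bcr K x a r q) j = γ j (t a) p r * x a r q := by
      intro r
      have : g (t a) p r * bcr K x a r q = x a r q • g (t a) p r := by
        rw [Algebra.smul_def, mul_comm]; rfl
      rw [this, map_smul, Finsupp.smul_apply, smul_eq_mul, mul_comm]; rfl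
    have e2 : ∀ r, b.repr (bcr K x a p r * g (s a) r q) j = x a p r * γ j (s a) r q := by
      intro r
      have : bcr K x a p r * g (s a) r q = x a p r • g (s a) r q := by
        rw [Algebra.smul_def]; rfl
      rw [this, map_smul, Finsupp.smul_apply, smul_eq_mul]; rfl
    rw [Finset.sum_congr rfl fun r _ => e1 r, Finset.sum_congr rfl fun r _ => e2 r] at h2
    exact h2
  let F : Finset _ := Finset.univ.biUnion fun i : V => Finset.univ.biUnion fun p : Fin (d i) =>
    Finset.univ.biUnion fun q : Fin (d i) => (b.repr (g i p q)).support
  have hs : g = ∑ j ∈ F, b j • bc K (matH x (homOf (γ j) (hγ j))) := by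
    funext i
    ext p q
    rw [Finset.sum_apply, Matrix.sum_apply]
    have e3 : ∀ j, (b j • bc K (matH x (homOf (γ j) (hγ j)))) i p q = b.repr (g i p q) j • b j := by
      intro j
      change b j * algebraMap k K (matOf (homOf (γ j) (hγ j)) i p q) = _
      rw [matOf_homOf, Algebra.smul_def, mul_comm]; rfl
    rw [Finset.sum_congr rfl fun j _ => e3 j]
    conv_lhs => rw [← b.linearCombination_repr (g i p q), Finsupp.linearCombination_apply]
    refine Finsupp.sum_of_support_subset _ ?_ _ (by simp)
    intro j hj
    simp only [F, Finset.mem_biUnion, Finset.mem_univ, true_and]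
    exact ⟨i, p, q, hj⟩
  rw [hs]
  exact Submodule.sum_mem _ fun j _ => Submodule.smul_mem _ _ (Submodule.subset_span ⟨_, rfl⟩)

theorem bc_end (x : MR s t k d) (N : Set (Module.End (PA s t k) (mo x)))
    (h1 : ∀ φ : Module.End (PA s t k) (mo x), ∃ a : k, φ - a • LinearMap.id ∈ N) (r : ℕ)
    (h2 : ∀ w : List (Module.End (PA s t k) (mo x)), (∀ ν ∈ w, ν ∈ N) → w.length = r → w.prod = 0)
    (Φ : Module.End (PA s t K) (mo (bcr K x))) :
    ∃ a : K, (Φ - a • LinearMap.id) ^ r = 0 := by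
  let S : Set (MF K d) := (fun φ => bc K (matH x φ)) '' N
  have hS : Submodule.span K S ^ r = ⊥ := by
    rw [Submodule.span_pow, eq_bot_iff, Submodule.span_le]
    intro z hz
    obtain ⟨f, hf⟩ := Set.mem_pow.1 hz
    choose ν hν hν' using fun i => (f i).2
    have : (List.ofFn fun i => (f i : MF K d)) = (List.ofFn ν).map ((bc K : MF k d →+* MF K d).toMonoidHom.comp (matH x)) := by
      rw [List.map_ofFn]
      congr 1
      funext i
      exact (hν' i).symm
    rw [this, List.prod_hom, h2 _ (by
      intro n hn
      obtain ⟨i, rfl⟩ := (List.mem_ofFn' _ _).1 hn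
      exact hν i) (List.length_ofFn)] at hf
    rw [← hf]
    change bc K (matOf (0 : mo x →ₗ[PA s t k] mo x)) ∈ (⊥ : Submodule K (MF K d))
    rw [matOf_zero, map_zero]; exact Submodule.zero_mem _
  have key : ∀ z ∈ Submodule.span K (Set.range fun φ : Module.End (PA s t k) (mo x) => bc K (matH x φ)),
      ∃ a : K, z - a • (1 : MF K d) ∈ Submodule.span K S := by
    intro z hz
    induction hz using Submodule.span_induction with
    | mem z hz =>
      obtain ⟨φ, rfl⟩ := hz
      obtain ⟨a, ha⟩ := h1 φ
      refine ⟨algebraMap k K a, ?_⟩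
      have : bc K (matH x φ) - algebraMap k K a • (1 : MF K d) = bc K (matH x (φ - a • LinearMap.id)) := by
        change _ = bc K (matOf (φ - a • LinearMap.id))
        rw [matOf_sub, matOf_smul, matOf_one, map_sub, bc_smul, map_one]; rfl
      simp only [this]
      exact Submodule.subset_span ⟨_, ha, rfl⟩
    | zero => exact ⟨0, by simp⟩
    | add y z _ _ hy hz =>
      obtain ⟨a, ha⟩ := hy
      obtain ⟨b, hb⟩ := hz
      refine ⟨a + b, ?_⟩
      have := Submodule.add_mem _ ha hb
      rw [add_smul]
      convert this using 1
      abel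
    | smul r z _ hz =>
      obtain ⟨a, ha⟩ := hz
      refine ⟨r * a, ?_⟩
      have := Submodule.smul_mem _ r ha
      rwa [smul_sub, smul_smul] at this
  obtain ⟨a, ha⟩ := key _ (bc_span x (matOf Φ) (matOf_comm Φ))
  refine ⟨a, matH_inj _ ?_⟩
  rw [map_pow]
  have e1 : matH (bcr K x) (Φ - a • LinearMap.id) = matOf Φ - a • (1 : MF K d) := by
    change matOf (Φ - a • LinearMap.id) = _
    rw [matOf_sub, matOf_smul, matOf_one]
  have e2 : matH (bcr K x) 0 = 0 := matOf_zero _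
  rw [e1, e2]
  have := Submodule.pow_mem_pow _ ha r
  rw [hS] at this
  exact this

theorem indec_of_local {M : Obj s t k} (hM : Nontrivial M) {r : ℕ}
    (h : ∀ φ : Module.End (PA s t k) M, ∃ a : k, (φ - a • LinearMap.id) ^ r = 0) : Indec M := by
  refine indec_of_idem hM fun e he => ?_
  obtain ⟨a, ha⟩ := h e
  have he' : IsIdempotentElem (M := Module.End (PA s t k) M) e := he
  by_cases h0 : a = 0
  · left
    rw [h0, zero_smul, sub_zero] at ha
    have hr : IsNilpotent (R := Module.End (PA s t k) M) e := ⟨r, ha⟩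
    exact he'.eq_zero_of_isNilpotent hr
  · right
    have hu : IsUnit (M := Module.End (PA s t k) M) e := by
      have h1 : IsUnit (a • (1 : Module.End (PA s t k) M)) := by
        refine ⟨⟨a • 1, a⁻¹ • 1, ?_, ?_⟩, rfl⟩
        · rw [smul_mul_smul_comm, mul_inv_cancel₀ h0, one_mul, one_smul]
        · rw [smul_mul_smul_comm, inv_mul_cancel₀ h0, one_mul, one_smul]
      have h2 : IsNilpotent (R := Module.End (PA s t k) M) (e - a • 1) := ⟨r, ha⟩
      have h3 : Commute (e - a • 1 : Module.End (PA s t k) M) (a • 1) := by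
        apply Commute.smul_right
        exact Commute.one_right _
      have := h2.isUnit_add_right_of_commute h1 h3
      rwa [sub_add_cancel] at this
    have h4 : (e : Module.End (PA s t k) M) * e = e * 1 := by rw [mul_one]; exact he
    exact hu.mul_left_cancel h4

end

end KacAff


namespace KacAff

noncomputable section

open Module
set_option linter.all false

variable {V A : Type} [Fintype V] [DecidableEq V] {s t : A → V} {k : Type} [Field k] [Fintype A]
variable {δ : V → ℤ}

theorem end_scalar_of_one {M : Obj s t k} (h1 : hom M M = 1) (φ : M →ₗ[PA s t k] M) :
    ∃ a : k, φ = a • LinearMap.id := by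
  have h1 : finrank k (M →ₗ[PA s t k] M) = 1 := by unfold hom at h1; exact_mod_cast h1
  have h2 : (LinearMap.id : M →ₗ[PA s t k] M) ≠ 0 := by
    intro h0
    have h3 : ∀ φ : M →ₗ[PA s t k] M, φ = 0 := fun φ => by rw [← LinearMap.comp_id φ, h0]; ext; simp
    have : Subsingleton (M →ₗ[PA s t k] M) := ⟨fun a b => by rw [h3 a, h3 b]⟩
    rw [finrank_zero_of_subsingleton] at h1
    exact absurd h1 (by norm_num)
  obtain ⟨a, ha⟩ := (finrank_eq_one_iff_of_nonzero' _ h2).1 h1 φ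
  exact ⟨a, ha.symm⟩

theorem hom_le_one {M : Obj s t k} (h : ∀ φ : M →ₗ[PA s t k] M, ∃ a : k, φ = a • LinearMap.id) : hom M M ≤ 1 := by
  have : finrank k (M →ₗ[PA s t k] M) ≤ 1 := finrank_le_one LinearMap.id fun φ => by
    obtain ⟨a, ha⟩ := h φ
    exact ⟨a, ha.symm⟩
  unfold hom; exact_mod_cast this

theorem exists_mo' (M : Obj s t k) : ∃ (d : V → ℕ) (x : MR s t k d), dim M = (fun i => (d i : ℤ)) ∧ Nonempty (mo x ≃ₗ[PA s t k] M) := by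
  have h : dim M = fun i => (((dim M i).toNat : ℕ) : ℤ) := funext fun i => (Int.toNat_of_nonneg (dim_nonneg M i)).symm
  obtain ⟨x, hx⟩ := exists_mo (d := fun i => (dim M i).toNat) M h
  exact ⟨_, x, h, hx⟩

theorem nontrivial_bcr {d : V → ℕ} (K : Type) [Field K] [Algebra k K] {x : MR s t k d} (h : Nontrivial (mo x)) :
    Nontrivial (mo (bcr K x)) := (nontrivial_mo _).2 ((nontrivial_mo _).1 h)

theorem Aff.hh_of_d (h : Aff s t δ) (c : RS s t k δ) (hd : c.d = 1) : h.hh c = 1 := by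
  obtain ⟨l, hl⟩ : ∃ l, h.pr c = l + 1 := ⟨h.pr c - 1, by have := h.pr_pos c; omega⟩
  obtain ⟨E, hE⟩ := LocL.exists h c l
  have h1 := hE.hom_one hd (fun n h0 hn => h.sg_ne c h0 (by omega))
  obtain ⟨d, x, hdx, ⟨e⟩⟩ := exists_mo' E
  rw [← hom_congr e e] at h1
  let K := AlgebraicClosure k
  have hsc : ∀ φ : Module.End (PA s t K) (mo (bcr K x)), ∃ a : K, (φ - a • LinearMap.id) ^ 1 = 0 := by
    refine bc_end x {0} ?_ 1 ?_
    · intro φ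
      obtain ⟨a, ha⟩ := end_scalar_of_one h1 φ
      exact ⟨a, by rw [Set.mem_singleton_iff, sub_eq_zero]; exact ha⟩
    · intro w hw hlen
      obtain ⟨ν, rfl⟩ := List.length_eq_one_iff.1 hlen
      rw [List.prod_singleton]
      exact hw ν (by simp)
  have hnt : Nontrivial (mo x) := e.toEquiv.nontrivial_congr.2 hE.1.nt
  have hi := indec_of_local (nontrivial_bcr K hnt) hsc
  have hle : hom (mo (bcr K x)) (mo (bcr K x)) ≤ 1 := hom_le_one fun φ => by
    obtain ⟨a, ha⟩ := hsc φ
    rw [pow_one, sub_eq_zero] at ha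
    exact ⟨a, ha⟩
  have hdim : dim (mo (bcr K x)) = h.hh c • δ := by
    rw [dim_mo, ← hdx, hE.2, ← hl, h.ts_pr]
  have hdf : df δ (mo (bcr K x)) = 0 := by
    unfold df; rw [hdim, eu_smul_right, h.eu_delta, mul_zero]
  obtain ⟨c', hc'⟩ := (h.indec_reg hi hdf).loc_of_indec h hi
  obtain ⟨l', hl'⟩ := hc'.len' h
  have h2 : l' + 1 ≤ h.pr c' := by
    by_contra hlt
    obtain ⟨l'', rfl⟩ : ∃ l'', l' = l'' + h.pr c' := ⟨l' - h.pr c', by omega⟩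
    have h3 : l'' + h.pr c' + 1 = l'' + 1 + h.pr c' := by omega
    rw [h3] at hl'
    have := hl'.two_le_hom (h.pr_pos c') (h.sg_pr c')
    omega
  obtain ⟨n, hn, hn'⟩ := h.ts_cond c' (hl'.2.symm.trans hdim)
  rw [h.hh_alg c', mul_one] at hn'
  have h4 : n ≤ 1 := by
    by_contra hlt
    have : 2 * h.pr c' ≤ n * h.pr c' := Nat.mul_le_mul_right _ (by omega)
    have := h.pr_pos c'
    omega
  have := h.hh_pos c
  omega

theorem RS.d_alg [IsAlgClosed k] (c : RS s t k δ) : c.d = 1 := by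
  apply le_antisymm _ c.d_pos
  refine hom_le_one fun φ => ?_
  have := c.nt
  obtain ⟨μ, hμ⟩ := Module.End.exists_eigenvalue (φ.restrictScalars k)
  obtain ⟨v, hv⟩ := hμ.exists_hasEigenvector
  refine ⟨μ, ?_⟩
  by_contra hne
  have h1 : φ - μ • LinearMap.id ≠ 0 := fun h => hne (sub_eq_zero.1 h)
  have h2 := (c.simple.bij c.simple h1).1
  apply hv.2
  apply h2
  rw [map_zero]
  change φ v - μ • v = 0
  rw [sub_eq_zero]
  exact hv.apply_eq_smul

theorem frob_id {K R : Type*} [Field K] [Ring R] [Algebra K R] (p : ℕ) [Fact p.Prime] [CharP K p] (e : ℕ) (a : K) (Φ : R) :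
    (Φ - a • 1) ^ p ^ e = Φ ^ p ^ e - a ^ p ^ e • 1 := by
  have h := sub_pow_char_pow (R := Polynomial K) (p := p) Polynomial.X (Polynomial.C a) (n := e)
  have h2 := congrArg (Polynomial.aeval Φ) h
  simp only [map_sub, map_pow, Polynomial.aeval_X, Polynomial.aeval_C] at h2
  rwa [Algebra.algebraMap_eq_smul_one, smul_pow, one_pow] at h2

theorem Aff.d_of_abs (h : Aff s t δ) [Finite k] {d : V → ℕ} (x : MR s t k d) (c : RS s t k δ)
    (hc : Loc c (mo x)) (hi : Indec (mo (bcr (AlgebraicClosure k) x))) : c.d = 1 := by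
  let K := AlgebraicClosure k
  have : Fintype k := Fintype.ofFinite k
  obtain ⟨p, hp⟩ := CharP.exists k
  have hprime : Fact p.Prime := ⟨(CharP.char_is_prime_or_zero k p).resolve_right (CharP.char_ne_zero_of_finite k p)⟩
  have hpK : CharP K p := charP_of_injective_algebraMap (algebraMap k K).injective p
  obtain ⟨l, hl⟩ := hc.len' h
  obtain ⟨f, hf⟩ := hc
  have hdf : df δ (mo (bcr K x)) = 0 := by
    have := hf.reg.1
    unfold df at this ⊢
    rw [dim_mo] at this ⊢; exact this
  obtain ⟨c', f', hf'⟩ := (h.indec_reg hi hdf).loc_of_indec h hi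
  obtain ⟨i, hi0⟩ := (nontrivial_mo (bcr K x)).1 hi.1
  apply le_antisymm _ c.d_pos
  refine hom_le_one fun α => ?_
  obtain ⟨φ, hφ⟩ := hl.lift hl hf hf α
  let Φ : Module.End (PA s t K) (mo (bcr K x)) := homOf (bc K (matOf φ)) (fun a => by
    have := congrArg (fun z => Matrix.map z (algebraMap k K)) (matOf_comm φ a)
    simp only [Matrix.map_mul] at this
    exact this)
  have hΦ : matH _ Φ = bc K (matH x φ) := matOf_homOf _ _
  obtain ⟨a, ha⟩ := hf'.end_decomp (c'.d_alg) Φ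
  let r := finrank K (mo (bcr K x))
  have h1 : (Φ - a • LinearMap.id) ^ p ^ r = 0 := by
    rw [← List.prod_replicate]
    refine hf'.nil' h _ ?_ ?_
    · intro ν hν
      rw [(List.mem_replicate.1 hν).2]; exact ha
    · rw [List.length_replicate]
      exact (Nat.lt_pow_self hprime.out.one_lt).le
  have h2 := frob_id p r a Φ
  rw [show (1 : Module.End (PA s t K) (mo (bcr K x))) = LinearMap.id from rfl] at h2
  rw [h1, eq_comm, sub_eq_zero] at h2
  have h3 : bc K (matH x (φ ^ p ^ r)) = a ^ p ^ r • (1 : MF K d) := by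
    rw [map_pow, map_pow, ← hΦ, ← map_pow, h2]
    change matOf (_ • LinearMap.id) = _
    rw [matOf_smul, matOf_one]
  let b := matH x (φ ^ p ^ r) i ⟨0, hi0⟩ ⟨0, hi0⟩
  have hb : algebraMap k K b = a ^ p ^ r := by
    have := congrFun (congrFun (congrFun h3 i) ⟨0, hi0⟩) ⟨0, hi0⟩
    rw [bc_apply] at this
    rw [this, Pi.smul_apply, Matrix.smul_apply, Pi.one_apply, Matrix.one_apply_eq, smul_eq_mul, mul_one]
  have h4 : φ ^ p ^ r = b • LinearMap.id := by
    apply matH_inj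
    apply bc_inj (K := K)
    rw [h3, ← hb]
    change _ = bc K (matOf (b • LinearMap.id))
    rw [matOf_smul, matOf_one, bc_smul, map_one]
  obtain ⟨b', hb'⟩ := (bijective_iterateFrobenius k p r).2 b
  rw [iterateFrobenius_def] at hb'
  have h5 : (φ - b' • LinearMap.id : Module.End (PA s t k) (mo x)) ^ p ^ r = 0 := by
    have := frob_id p r b' (φ : Module.End (PA s t k) (mo x))
    rw [hb', h4, show (1 : Module.End (PA s t k) (mo x)) = LinearMap.id from rfl, sub_self] at this
    exact this
  refine ⟨b', ?_⟩
  by_contra hne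
  have h6 : α - b' • LinearMap.id ≠ 0 := fun h => hne (sub_eq_zero.1 h)
  have h7 := (c.simple.bij c.simple h6).2
  have h8 : ∀ m, f ((φ - b' • LinearMap.id : mo x →ₗ[PA s t k] mo x) m) = (α - b' • LinearMap.id : c.rep →ₗ[PA s t k] c.rep) (f m) := by
    intro m
    have h9 : f (φ m) = α (f m) := LinearMap.congr_fun hφ m
    have h10 : f (b' • m) = b' • f m := (f.restrictScalars k).map_smul _ _
    change f (φ m - b' • m) = α (f m) - b' • f m
    rw [map_sub, h9, h10]
  have h9 : ∀ n, Function.Surjective fun m => f (((φ - b' • LinearMap.id : Module.End (PA s t k) (mo x)) ^ n) m) := by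
    intro n
    induction n with
    | zero => exact hf.surj
    | succ n ih =>
      intro y
      obtain ⟨y', rfl⟩ := h7 y
      obtain ⟨m, rfl⟩ := ih y'
      refine ⟨m, ?_⟩
      beta_reduce
      rw [pow_succ', Module.End.mul_apply]
      exact h8 _
  have h10 := h9 (p ^ r)
  rw [h5] at h10
  have := c.nt
  obtain ⟨y, hy⟩ := exists_ne (0 : c.rep)
  obtain ⟨m, hm⟩ := h10 y
  apply hy
  rw [← hm]
  exact map_zero f

theorem Aff.abs_of_d (h : Aff s t δ) {d : V → ℕ} (x : MR s t k d) (c : RS s t k δ)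
    (hc : Loc c (mo x)) (hd : c.d = 1) (K : Type) [Field K] [Algebra k K] : Indec (mo (bcr K x)) := by
  obtain ⟨f, hf⟩ := hc
  refine indec_of_local (r := finrank k (mo x)) (nontrivial_bcr K (Loc.nt ⟨f, hf⟩)) ?_
  refine bc_end x {ν | f ∘ₗ ν = 0} (fun φ => hf.end_decomp hd φ) _ ?_
  intro w hw hlen
  exact hf.nil' h w hw hlen.ge

theorem RS.d_dvd (c : RS s t k δ) (i : V) : c.d ∣ c.dv i := by
  have hnt := c.nt
  have hu : ∀ φ : Module.End (PA s t k) c.rep, IsUnit φ ∨ φ = 0 := by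
    intro φ
    by_cases h0 : φ = 0
    · exact Or.inr h0
    · exact Or.inl ((Module.End.isUnit_iff φ).2 (c.simple.bij c.simple h0))
  let D := Module.End (PA s t k) c.rep
  have hR : Nontrivial D := inferInstance
  letI iD : DivisionRing D := DivisionRing.ofIsUnitOrEqZero hu
  let W : Submodule D c.rep :=
    { carrier := {m | pe s t k i • m = m}
      add_mem' := fun {a b} ha hb => by
        change pe s t k i • (a + b) = a + b
        rw [smul_add, ha, hb]
      zero_mem' := smul_zero _
      smul_mem' := fun φ m hm => by
        change pe s t k i • φ m = φ m
        rw [← map_smul, hm] }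
  have htow : IsScalarTower k D c.rep := ⟨fun a φ m => rfl⟩
  have h1 := Module.finrank_mul_finrank k D W
  let e : W ≃ₗ[k] cmp c.rep i :=
    { toFun := fun m => ⟨m.1, mem_cmp.2 m.2⟩
      invFun := fun m => ⟨m.1, mem_cmp.1 m.2⟩
      left_inv := fun _ => rfl
      right_inv := fun _ => rfl
      map_add' := fun _ _ => rfl
      map_smul' := fun _ _ => rfl }
  rw [e.finrank_eq] at h1
  refine ⟨finrank D W, ?_⟩
  change (finrank k (cmp c.rep i) : ℤ) = _
  rw [← h1]
  push_cast
  rfl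

theorem Aff.d_of_pr (h : Aff s t δ) (c : RS s t k δ) (hp : h.pr c ≠ 1) : c.d = 1 := by
  have hne : h.sg c ≠ c := by
    intro hc
    apply hp
    have h1 : Function.IsPeriodicPt h.sg 1 c := hc
    exact Nat.le_antisymm (h1.minimalPeriod_le Nat.one_pos) (h.pr_pos c)
  choose x hx using c.d_dvd
  have hdv : c.dv = c.d • x := funext fun i => by rw [hx i]; rfl
  have h1 : eu s t c.dv c.dv = c.d := by
    have h2 := euler c.rep c.rep
    rw [h.ext_ne hne, sub_zero] at h2
    exact h2.symm
  rw [hdv, eu_smul_left, eu_smul_right] at h1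
  have h3 := c.d_pos
  have h4 : c.d * eu s t x x = 1 := by
    apply mul_left_cancel₀ h3.ne'
    rw [h1, mul_one]
  exact Int.eq_one_of_mul_eq_one_right h3.le h4

end

end KacAff


namespace KacAff

noncomputable section

open Module
set_option linter.all false

variable {V A : Type} [Fintype V] [DecidableEq V] {s t : A → V} {k : Type} [Field k] [Fintype A]
variable {δ : V → ℤ}

/-- regular simples vanishing at the extending vertex -/
def T0 (s t : A → V) (k : Type) [Field k] (δ : V → ℤ) (i : V) : Type 1 := {c : RS s t k δ // c.dv i = 0}

/-- the candidate basis -/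
def vb (s t : A → V) (k : Type) [Field k] (δ : V → ℤ) (i : V) : Option (T0 s t k δ i) → V → ℤ
  | none => δ
  | some c => c.1.dv

theorem Aff.dv_of_pr (h : Aff s t δ) (c : RS s t k δ) (hp : h.pr c = 1) : c.dv = h.hh c • δ := by
  rw [← h.ts_pr, hp, Aff.ts, Finset.sum_range_one]; rfl

theorem Aff.mem_vb (h : Aff s t δ) {i : V} (hi : δ i = 1) (c : RS s t k δ) :
    c.dv ∈ Submodule.span ℤ (Set.range (vb s t k δ i)) := by
  have hδ : δ ∈ Submodule.span ℤ (Set.range (vb s t k δ i)) := Submodule.subset_span ⟨none, rfl⟩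
  have h0 : ∀ c : RS s t k δ, c.dv i = 0 → c.dv ∈ Submodule.span ℤ (Set.range (vb s t k δ i)) :=
    fun c hc => Submodule.subset_span ⟨some ⟨c, hc⟩, rfl⟩
  by_cases hp : h.pr c = 1
  · rw [h.dv_of_pr c hp]
    exact Submodule.smul_mem _ _ hδ
  by_cases hc : c.dv i = 0
  · exact h0 c hc
  have h1 := h.ts_pr c
  rw [h.hh_of_d c (h.d_of_pr c hp), one_smul] at h1
  obtain ⟨p, hp'⟩ : ∃ p, h.pr c = p + 1 := ⟨h.pr c - 1, by have := h.pr_pos c; omega⟩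
  rw [hp', Aff.ts, Finset.sum_range_succ'] at h1
  have h2 := congrFun h1 i
  rw [Pi.add_apply, Finset.sum_apply, hi] at h2
  have hnn : ∀ n ∈ Finset.range p, 0 ≤ ((h.sg)^[n+1] c).dv i := fun n _ => dim_nonneg _ _
  have h3 : 0 < c.dv i := lt_of_le_of_ne (dim_nonneg _ _) (Ne.symm hc)
  have h4 := Finset.sum_nonneg hnn
  have h5 : ∑ n ∈ Finset.range p, ((h.sg)^[n+1] c).dv i = 0 := by
    change _ + c.dv i = 1 at h2
    omega
  have h6 : c.dv = δ - ∑ n ∈ Finset.range p, ((h.sg)^[n+1] c).dv := by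
    exact eq_sub_of_add_eq' h1
  rw [h6]
  refine Submodule.sub_mem _ hδ (Submodule.sum_mem _ fun n hn => h0 _ ?_)
  exact (Finset.sum_eq_zero_iff_of_nonneg hnn).1 h5 n hn

/-- the defect functional -/
def dfL (s t : A → V) (δ : V → ℤ) : (V → ℤ) →ₗ[ℤ] ℤ where
  toFun x := eu s t δ x
  map_add' x y := eu_add_right δ x y
  map_smul' r x := by rw [eu_smul_right]; rfl

theorem Aff.vb_span (h : Aff s t δ) {i : V} (hi : δ i = 1) :
    Submodule.span ℤ (Set.range (vb s t k δ i)) = LinearMap.ker (dfL s t δ) := by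
  apply le_antisymm
  · rw [Submodule.span_le]
    rintro _ ⟨o, rfl⟩
    rcases o with _ | c
    · exact h.eu_delta
    · exact c.1.df
  · intro x hx
    obtain ⟨N, hN⟩ := h.exists_reg k x hx
    obtain ⟨M, hM, hR⟩ := hN N le_rfl
    obtain ⟨m, hm, -⟩ := hR.factors
    have : x = dim M - N • δ := by rw [hM]; abel
    rw [this, hm]
    refine Submodule.sub_mem _ (Submodule.sum_mem _ fun c _ => Submodule.smul_mem _ _ (h.mem_vb hi c)) ?_
    exact Submodule.smul_of_tower_mem _ _ (Submodule.subset_span ⟨none, rfl⟩)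

theorem Aff.vb_li (h : Aff s t δ) {i : V} (hi : δ i = 1) : LinearIndependent ℤ (vb s t k δ i) := by
  classical
  set v := vb s t k δ i with hv
  have hnn : ∀ o j, 0 ≤ v o j := by
    intro o j
    rcases o with _ | c
    · exact (h.pos j).le
    · exact dim_nonneg _ _
  have hne : ∀ o, v o ≠ 0 := by
    intro o
    rcases o with _ | c
    · intro h0
      have h1 := congrFun h0 i
      have h2 : δ i = 0 := h1
      omega
    · intro h0
      have := c.1.nt
      rw [← not_subsingleton_iff_nontrivial, ← dim_eq_zero_iff] at this
      exact this h0
  have heu : ∀ o o', o ≠ o' → eu s t (v o) (v o') ≤ 0 := by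
    intro o o' hoo
    rcases o with _ | c <;> rcases o' with _ | c'
    · exact absurd rfl hoo
    · exact c'.1.df.le
    · change eu s t c.1.dv δ ≤ 0
      rw [h.eu_delta_right, c.1.df]; simp
    · change eu s t c.1.dv c'.1.dv ≤ 0
      have hcc : c.1 ≠ c'.1 := fun hc => hoo (by rw [Subtype.ext hc])
      have h1 := euler c.1.rep c'.1.rep
      rw [RS.hom_ne hcc] at h1
      have h2 := ext_nonneg c.1.rep c'.1.rep
      change _ = eu s t c.1.dv c'.1.dv at h1
      omega
  rw [linearIndependent_iff']
  intro S g hg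
  let P := ∑ o ∈ S, (g o)⁺ • v o
  let N := ∑ o ∈ S, (g o)⁻ • v o
  have hPN : P = N := by
    rw [← sub_eq_zero, ← hg, ← Finset.sum_sub_distrib]
    refine Finset.sum_congr rfl fun o _ => ?_
    rw [← sub_smul, posPart_sub_negPart]
  have hq : eu s t P N ≤ 0 := by
    change eu s t (∑ o ∈ S, (g o)⁺ • v o) (∑ o ∈ S, (g o)⁻ • v o) ≤ 0
    rw [eu_sum_left]
    refine Finset.sum_nonpos fun o _ => ?_
    rw [eu_sum_right]
    refine Finset.sum_nonpos fun o' _ => ?_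
    rw [eu_smul_left, eu_smul_right]
    by_cases hoo : o = o'
    · subst hoo
      rcases le_total 0 (g o) with h0 | h0
      · rw [negPart_eq_zero.2 h0, zero_mul, mul_zero]
      · rw [posPart_eq_zero.2 h0, zero_mul]
    · exact mul_nonpos_of_nonneg_of_nonpos (posPart_nonneg _)
        (mul_nonpos_of_nonneg_of_nonpos (negPart_nonneg _) (heu _ _ hoo))
  rw [← hPN] at hq
  obtain ⟨m, hm⟩ := h.isotropic (le_antisymm hq (h.psd P))
  have hPi : P i = 0 := by
    have hvi : ∀ o, o ≠ none → v o i = 0 := by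
      intro o ho
      rcases o with _ | c
      · exact absurd rfl ho
      · exact c.2
    by_cases hg0 : 0 ≤ g none
    · rw [hPN]
      change (∑ o ∈ S, (g o)⁻ • v o) i = 0
      rw [Finset.sum_apply]
      refine Finset.sum_eq_zero fun o _ => ?_
      rw [Pi.smul_apply, smul_eq_mul]
      by_cases ho : o = none
      · rw [ho, negPart_eq_zero.2 hg0, zero_mul]
      · rw [hvi o ho, mul_zero]
    · change (∑ o ∈ S, (g o)⁺ • v o) i = 0
      rw [Finset.sum_apply]
      refine Finset.sum_eq_zero fun o _ => ?_
      rw [Pi.smul_apply, smul_eq_mul]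
      by_cases ho : o = none
      · rw [ho, posPart_eq_zero.2 (not_le.1 hg0).le, zero_mul]
      · rw [hvi o ho, mul_zero]
  have hP0 : P = 0 := by
    rw [hm] at hPi ⊢
    rw [Pi.smul_apply, hi, smul_eq_mul, mul_one] at hPi
    rw [hPi, zero_smul]
  have key : ∀ f : Option (T0 s t k δ i) → ℤ, (∀ o, 0 ≤ f o) → ∑ o ∈ S, f o • v o = 0 → ∀ o ∈ S, f o = 0 := by
    intro f hf hs o ho
    by_contra hfo
    apply hne o
    funext j
    have h1 := congrFun hs j
    rw [Finset.sum_apply] at h1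
    have h2 := (Finset.sum_eq_zero_iff_of_nonneg (fun o _ => mul_nonneg (hf o) (hnn o j))).1 h1 o ho
    exact (mul_eq_zero.1 h2).resolve_left hfo
  intro o ho
  rw [← posPart_sub_negPart (g o), key _ (fun o => posPart_nonneg _) hP0 o ho,
    key _ (fun o => negPart_nonneg _) (hPN.symm.trans hP0) o ho, sub_zero]

theorem Aff.card_T0 (h : Aff s t δ) {i : V} (hi : δ i = 1) :
    Finite (T0 s t k δ i) ∧ Nat.card (T0 s t k δ i) + 2 = Fintype.card V := by
  have hli := h.vb_li (k := k) hi
  have hfin : Finite (Option (T0 s t k δ i)) := hli.finite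
  have hfin' : Finite (T0 s t k δ i) := Finite.of_injective _ (Option.some_injective _)
  refine ⟨hfin', ?_⟩
  have : Fintype (Option (T0 s t k δ i)) := Fintype.ofFinite _
  have h1 := finrank_span_eq_card hli
  rw [h.vb_span hi, ← Nat.card_eq_fintype_card, Finite.card_option] at h1
  have h2 := Submodule.finrank_quotient_add_finrank (LinearMap.ker (dfL s t δ))
  rw [(dfL s t δ).quotKerEquivRange.finrank_eq] at h2
  rw [h1, Module.finrank_fintype_fun_eq_card] at h2
  have h3 : finrank ℤ (LinearMap.range (dfL s t δ)) ≤ 1 := by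
    have := Submodule.finrank_le (LinearMap.range (dfL s t δ))
    rwa [finrank_self] at this
  have h4 : 0 < finrank ℤ (LinearMap.range (dfL s t δ)) := by
    obtain ⟨j, P, p, L, H⟩ := h.exists_PL k
    have hne : dfL s t δ (dim L) ≠ 0 := by
      have := H.df h
      change df δ L ≠ 0
      rw [this]; norm_num
    have : Nontrivial (LinearMap.range (dfL s t δ)) :=
      ⟨⟨⟨_, ⟨dim L, rfl⟩⟩, 0, fun h0 => hne (congrArg Subtype.val h0)⟩⟩
    exact finrank_pos
  omega

end

end KacAff


namespace KacAff

noncomputable section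

open Module
set_option linter.all false

theorem exists_path {V A : Type} (s t : A → V) {i j : V} (h : Relation.TransGen (fun i j => ∃ a, s a = i ∧ t a = j) i j) :
    ∃ (n : ℕ) (g : ℕ → A), s (g 0) = i ∧ t (g n) = j ∧ ∀ m < n, t (g m) = s (g (m + 1)) := by
  induction h with
  | single h =>
    obtain ⟨a, h1, h2⟩ := h
    exact ⟨0, fun _ => a, h1, h2, fun m hm => absurd hm (Nat.not_lt_zero _)⟩
  | tail _ h ih =>
    obtain ⟨n, g, h0, hn, hg⟩ := ih
    obtain ⟨a, h1, h2⟩ := h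
    refine ⟨n + 1, fun m => if m ≤ n then g m else a, ?_, ?_, ?_⟩
    · simpa using h0
    · simpa using h2
    · intro m hm
      have hm' : m ≤ n := by omega
      simp only [if_pos hm']
      by_cases hmn : m + 1 ≤ n
      · rw [if_pos hmn]; exact hg m (by omega)
      · rw [if_neg hmn]
        have : m = n := by omega
        rw [this, hn, h1]

theorem exists_idx (Q : FinQuiver) (hl : Q.NoLoops) (hac : Q.Acyclic) :
    ∃ f : Q.V ≃ Fin (Fintype.card Q.V), ∀ a, f (Q.src a) < f (Q.tgt a) := by
  let r : Q.V → Q.V → Prop := fun i j => ∃ a, Q.src a = i ∧ Q.tgt a = j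
  have hirr : ∀ i, ¬ Relation.TransGen r i i := by
    intro i hi
    obtain ⟨n, g, h0, hn, hg⟩ := exists_path Q.src Q.tgt hi
    apply hac
    refine ⟨n, fun m => g m.1, fun m => ?_⟩
    by_cases hm : m = Fin.last n
    · rw [hm, Fin.last_add_one]
      change Q.tgt (g n) = Q.src (g 0)
      rw [h0, hn]
    · have h1 : m.1 < n := Fin.val_lt_last hm
      have h2 : (m + 1).1 = m.1 + 1 := Fin.val_add_one_of_lt (Fin.lt_last_iff_ne_last.2 hm)
      change Q.tgt (g m.1) = Q.src (g (m + 1).1)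
      rw [h2]
      exact hg m.1 h1
  letI : PartialOrder Q.V :=
    { le := Relation.ReflTransGen r
      le_refl := fun _ => Relation.ReflTransGen.refl
      le_trans := fun _ _ _ => Relation.ReflTransGen.trans
      le_antisymm := by
        intro i j hij hji
        rcases Relation.reflTransGen_iff_eq_or_transGen.1 hij with h | h
        · exact h.symm
        · exact absurd (h.trans_left hji) (hirr i) }
  letI : Fintype (LinearExtension Q.V) := (inferInstance : Fintype Q.V)
  let e := Fintype.orderIsoFinOfCardEq (LinearExtension Q.V) (rfl : Fintype.card (LinearExtension Q.V) = Fintype.card Q.V)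
  refine ⟨e.symm.toEquiv, fun a => ?_⟩
  have h1 : (Q.src a) ≤ (Q.tgt a) := Relation.ReflTransGen.single ⟨a, rfl, rfl⟩
  have h2 : toLinearExtension (Q.src a) ≤ toLinearExtension (Q.tgt a) := toLinearExtension.monotone h1
  have h3 : toLinearExtension (Q.src a) < toLinearExtension (Q.tgt a) := lt_of_le_of_ne h2 (hl a)
  exact e.symm.strictMono h3

theorem aff_of (Q : AffineQuiver) : Aff Q.src Q.tgt Q.δ where
  ne := Q.connected.nonempty
  pos := Q.delta_pos
  psd := Q.posSemidef
  rad := Q.radical_iff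
  idx := exists_idx Q.toFinQuiver Q.noLoops Q.acyclic

variable {V A : Type} [Fintype V] [DecidableEq V] {s t : A → V} {k : Type} [Field k] [Fintype A]
variable {δ : V → ℤ}

theorem Aff.card_d (h : Aff s t δ) [Finite k] :
    Nat.card {c : RS s t k δ // c.d = 1} = Nat.card k + (Fintype.card V - 1) := by
  obtain ⟨i, P, p, L, H⟩ := h.exists_PL k
  have hi := H.one
  obtain ⟨hf, h1⟩ := h.card_T0 (k := k) hi
  have h2 := H.card h
  have hf2 : Finite (TP h k i) := Nat.finite_of_card_ne_zero (by omega)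
  let F : TP h k i ⊕ T0 s t k δ i → {c : RS s t k δ // c.d = 1} := Sum.elim
    (fun c => ⟨c.1, c.1.d_one (h.dv_one hi c.2.1 c.2.2)⟩)
    (fun c => ⟨c.1, h.d_of_pr c.1 (fun hp => by
      have h3 := congrFun (h.dv_of_pr c.1 hp) i
      rw [c.2, Pi.smul_apply, hi, smul_eq_mul, mul_one] at h3
      have := h.hh_pos c.1
      omega)⟩)
  have hF : Function.Bijective F := by
    constructor
    · rintro (c | c) (c' | c') hcc
      · exact congrArg _ (Subtype.ext (congrArg (fun z : {c : RS s t k δ // c.d = 1} => z.1) hcc))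
      · have h3 : c.1 = c'.1 := congrArg (fun z : {c : RS s t k δ // c.d = 1} => z.1) hcc
        exact absurd (h3 ▸ c'.2) c.2.2
      · have h3 : c.1 = c'.1 := congrArg (fun z : {c : RS s t k δ // c.d = 1} => z.1) hcc
        exact absurd (h3 ▸ c.2) c'.2.2
      · exact congrArg _ (Subtype.ext (congrArg (fun z : {c : RS s t k δ // c.d = 1} => z.1) hcc))
    · rintro ⟨c, hc⟩
      by_cases h0 : c.dv i = 0
      · exact ⟨Sum.inr ⟨c, h0⟩, rfl⟩
      · exact ⟨Sum.inl ⟨c, h.hh_of_d c hc, h0⟩, rfl⟩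
  rw [← Nat.card_eq_of_bijective F hF, Nat.card_sum, h2]
  omega

theorem Loc.uniq {c c' : RS s t k δ} {M : Obj s t k} (h : Loc c M) (h' : Loc c' M) : c' = c := by
  obtain ⟨f, hf⟩ := h'
  exact h.top_ne (surj_ne_zero c'.nt hf.surj)

theorem Aff.count (h : Aff s t δ) [Finite k] (m : ℕ) (hm : 1 ≤ m) (d : V → ℕ) (hd : (fun i => (d i : ℤ)) = (m : ℤ) • δ) :
    Nat.card (Quot (fun x y : {x : MR s t k d // mindec x ∧ mindec (bcr (AlgebraicClosure k) x)} =>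
      miso x.1 y.1)) = Nat.card k + (Fintype.card V - 1) := by
  rw [← h.card_d]
  have hex : ∀ x : {x : MR s t k d // mindec x ∧ mindec (bcr (AlgebraicClosure k) x)},
      ∃ c : {c : RS s t k δ // c.d = 1}, Loc c.1 (mo x.1) := by
    rintro ⟨x, h1, h2⟩
    rw [mindec_iff] at h1 h2
    have hdf : df δ (mo x) = 0 := by
      unfold df; rw [dim_mo, hd, eu_smul_right, h.eu_delta, mul_zero]
    obtain ⟨c, hc⟩ := (h.indec_reg h1 hdf).loc_of_indec h h1
    exact ⟨⟨c, h.d_of_abs x c hc h2⟩, hc⟩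
  choose F hF using hex
  let G : Quot (fun x y : {x : MR s t k d // mindec x ∧ mindec (bcr (AlgebraicClosure k) x)} =>
      miso x.1 y.1) → {c : RS s t k δ // c.d = 1} := Quot.lift F (by
    intro x y hxy
    rw [miso_iff] at hxy
    obtain ⟨e⟩ := hxy
    exact Subtype.ext (((hF y).uniq ((hF x).congr e))))
  apply Nat.card_eq_of_bijective G
  constructor
  · intro X Y hXY
    induction X using Quot.ind with | _ x =>
    induction Y using Quot.ind with | _ y =>
    have hXY' : F x = F y := hXY
    apply Quot.sound
    rw [miso_iff]
    have hx := hF x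
    have hy := hF y
    rw [← hXY'] at hy
    obtain ⟨l, hl⟩ := hx.len' h
    obtain ⟨l', hl'⟩ := hy.len' h
    have hhh := h.hh_of_d (F x).1 (F x).2
    obtain ⟨n, hn, hn'⟩ := h.ts_cond (F x).1 (hl.2.symm.trans ((dim_mo _).trans hd))
    obtain ⟨n', hn1, hn1'⟩ := h.ts_cond (F x).1 (hl'.2.symm.trans ((dim_mo _).trans hd))
    rw [hhh, mul_one] at hn' hn1'
    have hnn : n = n' := by omega
    have hll : l = l' := by rw [hnn, ← hn1] at hn; omega
    subst hll
    exact hl.iso hl'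
  · intro c
    have hhh := h.hh_of_d c.1 c.2
    obtain ⟨l, hl⟩ : ∃ l, m * h.pr c.1 = l + 1 :=
      ⟨m * h.pr c.1 - 1, by have := Nat.mul_pos hm (h.pr_pos c.1); omega⟩
    obtain ⟨M, hM⟩ := LocL.exists h c.1 l
    have hdim : dim M = fun i => (d i : ℤ) := by
      rw [hM.2, ← hl, h.ts_mul, hhh, mul_one, hd]
    obtain ⟨x, ⟨e⟩⟩ := exists_mo M hdim
    have hx : Loc c.1 (mo x) := hM.1.congr e.symm
    refine ⟨Quot.mk _ ⟨x, (mindec_iff x).2 hx.indec, (mindec_iff _).2 (h.abs_of_d x c.1 hx c.2 _)⟩, ?_⟩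
    exact Subtype.ext (hx.uniq (hF _))

end

end KacAff

/-- Over a finite field `F_q`, for every `m ≥ 1` the number of isomorphism classes of
absolutely indecomposable representations of an affine quiver with `n + 1` vertices in
dimension vector `mδ` is exactly `q + n`.  In particular
`a_{mδ}(q) = a_δ(q) = q + dim g_{mδ}`, confirming Kac's conjecture in dimension `mδ`. -/
theorem kac_conjecture_dimension_m_delta
    (Q : AffineQuiver) (k : Type) [Field k] [Fintype k] (m : ℕ) (hm : 1 ≤ m) :
    Nat.card (Quot (fun x y :
        {x : MRep Q.toFinQuiver k (fun i => m * (Q.δ i).toNat) // MAbsIndec x} =>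
        MIso x.1 y.1))
      = Fintype.card k + (Fintype.card Q.V - 1) := by
  rw [← Nat.card_eq_fintype_card (α := k)]
  refine (KacAff.aff_of Q).count (k := k) m hm (fun i => m * (Q.δ i).toNat) ?_
  funext i
  have := Q.delta_pos i
  rw [Pi.smul_apply, smul_eq_mul]
  push_cast
  rw [Int.toNat_of_nonneg this.le]
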